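/- Assume ZF, let λ be even, let j be a proper I_{0,λ}-embedding, and let N be a tight extension of 𝓛 (with μ_j ∈ N). Suppose the ultrapower Ult₀(N, μ_j) satisfies Łoś's theorem. Then μ_j is iterable, both in the sense of iterating 𝓛 externally and in the sense of iterating N internally. Moreover, letting (𝓛_α, λ_α, μ_α, j_α) be the iterates of (𝓛, μ_j) with iteration maps j_{αβ} : 𝓛_α → 𝓛_β, and (N_α, μ'_α) the internal iterates of (N, μ_j) with iteration maps j'_{αβ}, we have 𝓛_α = j'_{0α}(𝓛), μ_α = μ'_α, j_{αβ} ⊆ j'_{αβ}, and all iteration maps are elementary. -/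

import Mathlib

set_option autoImplicit false
set_option maxHeartbeats 1000000
namespace ZFI0
inductive Fml : ℕ → Type where
  | mem : {n : ℕ} → Fin n → Fin n → Fml n
  | equ : {n : ℕ} → Fin n → Fin n → Fml n
  | aux : {n : ℕ} → Fin n → Fml n
  | impl : {n : ℕ} → Fml n → Fml n → Fml n
  | neg : {n : ℕ} → Fml n → Fml n
  | all : {n : ℕ} → Fml (n + 1) → Fml n
  | ex : {n : ℕ} → Fml (n + 1) → Fml n
  | allb : {n : ℕ} → Fin n → Fml (n + 1) → Fml n
def IsDelta0 : {n : ℕ} → Fml n → Prop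
  | _, Fml.mem _ _ => True
  | _, Fml.equ _ _ => True
  | _, Fml.aux _ => True
  | _, Fml.impl f g => IsDelta0 f ∧ IsDelta0 g
  | _, Fml.neg f => IsDelta0 f
  | _, Fml.all _ => False
  | _, Fml.ex _ => False
  | _, Fml.allb _ f => IsDelta0 f
inductive IsSigma1 : {n : ℕ} → Fml n → Prop where
  | base : ∀ {n : ℕ} (f : Fml n), IsDelta0 f → IsSigma1 f
  | exI : ∀ {n : ℕ} (f : Fml (n + 1)), IsSigma1 f → IsSigma1 (Fml.ex f)
variable {M : Type}
def Eval (E : M → M → Prop) (P : M → Prop) (C : M → Prop) :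
    {n : ℕ} → Fml n → (Fin n → M) → Prop
  | _, Fml.mem i j, v => E (v i) (v j)
  | _, Fml.equ i j, v => v i = v j
  | _, Fml.aux i, v => P (v i)
  | _, Fml.impl f g, v => Eval E P C f v → Eval E P C g v
  | _, Fml.neg f, v => ¬ Eval E P C f v
  | _, Fml.all f, v => ∀ x : M, C x → Eval E P C f (Fin.cons x v)
  | _, Fml.ex f, v => ∃ x : M, C x ∧ Eval E P C f (Fin.cons x v)
  | _, Fml.allb i f, v => ∀ x : M, C x → E x (v i) → Eval E P C f (Fin.cons x v)
def NoAux : M → Prop := fun _ => False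
def AllSets : M → Prop := fun _ => True
section
variable (E : M → M → Prop)
def SubsetE (x y : M) := ∀ z, E z x → E z y
def TransClass (C : M → Prop) :=
  ∀ x y, C x → E y x → C y
structure SatZF (P : M → Prop) : Prop where
  ext : ∀ x y : M, (∀ z, E z x ↔ E z y) → x = y
  found : ∀ x : M, (∃ y, E y x) → ∃ y, E y x ∧ ∀ z, E z y → ¬ E z x
  pair : ∀ x y : M, ∃ p, ∀ z, E z p ↔ (z = x ∨ z = y)
  union : ∀ x : M, ∃ u, ∀ z, E z u ↔ ∃ y, E y x ∧ E z y
  power : ∀ x : M, ∃ p, ∀ z, E z p ↔ SubsetE E z x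
  infty : ∃ w : M, (∃ z, E z w ∧ ∀ u, ¬ E u z) ∧
    ∀ x, E x w → ∃ s, E s w ∧ ∀ z, E z s ↔ (E z x ∨ z = x)
  sep : ∀ {n : ℕ} (f : Fml (n + 1)) (v : Fin n → M) (a : M),
    ∃ b, ∀ z, E z b ↔ (E z a ∧ Eval E P AllSets f (Fin.cons z v))
  repl : ∀ {n : ℕ} (f : Fml (n + 2)) (v : Fin n → M) (a : M),
    (∀ x, E x a → ∃! y, Eval E P AllSets f (Fin.cons x (Fin.cons y v))) →
    ∃ b, ∀ y, E y b ↔ ∃ x, E x a ∧ Eval E P AllSets f (Fin.cons x (Fin.cons y v))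
def ClassSatZF (P : M → Prop) (C : M → Prop) :=
  SatZF (M := {x : M // C x}) (fun a b ↦ E a.1 b.1) (fun a ↦ P a.1)
def TransSet (x : M) := ∀ y, E y x → SubsetE E y x
def IsOrd (x : M) :=
  TransSet E x ∧ ∀ y z, E y x → E z x → (E y z ∨ y = z ∨ E z y)
def IsZero (x : M) := IsOrd E x ∧ ∀ y, ¬ E y x
def IsSuccOf (x s : M) := ∀ z, E z s ↔ (E z x ∨ z = x)
def IsLimitOrd (x : M) :=
  IsOrd E x ∧ (∃ y, E y x) ∧ ∀ y, E y x → ∃ s, E s x ∧ IsSuccOf E y s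
def OrdIter (E : M → M → Prop) : ℕ → M → M → Prop
  | 0, x, y => x = y
  | n + 1, x, y => ∃ s, IsSuccOf E x s ∧ OrdIter E n s y
def IsEvenOrd (l : M) :=
  ∃ (h : M) (n : ℕ), (IsZero E h ∨ IsLimitOrd E h) ∧ OrdIter E (2 * n) h l
def IsOmegaOrd (w : M) :=
  IsLimitOrd E w ∧ ∀ z, E z w → ¬ IsLimitOrd E z
def IsNextLimit (u w : M) :=
  IsLimitOrd E w ∧ E u w ∧ ∀ z, IsLimitOrd E z → E u z → (w = z ∨ E w z)
def IsUPair (p x y : M) := ∀ z, E z p ↔ (z = x ∨ z = y)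
def IsKPair (p x y : M) :=
  ∃ a b, IsUPair E a x x ∧ IsUPair E b x y ∧ IsUPair E p a b
def IsKTriple (t u v w : M) :=
  ∃ q, IsKPair E q v w ∧ IsKPair E t u q
def PairIn (f x y : M) := ∃ p, E p f ∧ IsKPair E p x y
def IsFunc (f : M) :=
  (∀ p, E p f → ∃ x y, IsKPair E p x y) ∧
  (∀ x y y', PairIn E f x y → PairIn E f x y' → y = y')
def IsFuncOn (f d : M) :=
  IsFunc E f ∧ ∀ x, (∃ y, PairIn E f x y) ↔ E x d
def MapsTo (f a b : M) :=
  IsFuncOn E f a ∧ ∀ x y, PairIn E f x y → E y b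
def SurjOn (f a b : M) :=
  MapsTo E f a b ∧ ∀ y, E y b → ∃ x, PairIn E f x y
def IsRestrOfFn (f d r : M) :=
  IsFuncOn E r d ∧ ∀ x y, PairIn E r x y ↔ (E x d ∧ PairIn E f x y)
def SatAC :=
  ∀ x, (∀ y, E y x → ∃ z, E z y) →
    ∃ f, IsFuncOn E f x ∧ ∀ y z, PairIn E f y z → E z y
def IsVHier (H a : M) :=
  IsOrd E a ∧ IsFunc E H ∧ (∀ b, (∃ y, PairIn E H b y) ↔ (E b a ∨ b = a)) ∧
  ∀ b w, PairIn E H b w →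
    ∀ x, E x w ↔ ∃ c u, E c b ∧ PairIn E H c u ∧ SubsetE E x u
def IsVStage (a v : M) := ∃ H, IsVHier E H a ∧ PairIn E H a v
def VAt (l : M) (n : ℕ) (v : M) :=
  ∃ s, OrdIter E n l s ∧ IsVStage E s v
def IsRankOf (x r : M) :=
  IsOrd E r ∧ (∃ v, IsVStage E r v ∧ SubsetE E x v) ∧
  ∀ r' v', IsOrd E r' → IsVStage E r' v' → SubsetE E x v' → (r = r' ∨ E r r')
def IsGProd (z x y : M) :=
  ∀ w, E w z ↔ ∃ u v, E u x ∧ E v y ∧ IsKPair E w u v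
def IsGMemRel (z x y : M) :=
  ∀ w, E w z ↔ ∃ u v, E u x ∧ E v y ∧ E u v ∧ IsKPair E w u v
def IsGDiff (z x y : M) := ∀ w, E w z ↔ (E w x ∧ ¬ E w y)
def IsGInter (z x y : M) := ∀ w, E w z ↔ (E w x ∧ E w y)
def IsGUnionSet (z x : M) := ∀ w, E w z ↔ ∃ u, E u x ∧ E w u
def IsGDom (z x : M) :=
  ∀ w, E w z ↔ ∃ p u, E p x ∧ IsKPair E p w u
def IsGConv (z x : M) :=
  ∀ w, E w z ↔ ∃ u v p, E p x ∧ IsKPair E p u v ∧ IsKPair E w v u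
def IsGPerm1 (z x : M) :=
  ∀ t, E t z ↔ ∃ u v w t', E t' x ∧ IsKTriple E t' u w v ∧ IsKTriple E t u v w
def IsGPerm2 (z x : M) :=
  ∀ t, E t z ↔ ∃ u v w t', E t' x ∧ IsKTriple E t' v w u ∧ IsKTriple E t u v w
def GClosed (c : M) :=
  (∀ x y z, E x c → E y c →
    (IsUPair E z x y ∨ IsGProd E z x y ∨ IsGMemRel E z x y ∨
      IsGDiff E z x y ∨ IsGInter E z x y) → E z c) ∧
  (∀ x z, E x c →
    (IsGUnionSet E z x ∨ IsGDom E z x ∨ IsGConv E z x ∨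
      IsGPerm1 E z x ∨ IsGPerm2 E z x) → E z c)
def IsGClOf (b c : M) :=
  SubsetE E b c ∧ GClosed E c ∧ ∀ c', SubsetE E b c' → GClosed E c' → SubsetE E c c'
def IsDefSetOf (l d : M) :=
  ∃ lp c, (∀ z, E z lp ↔ (E z l ∨ z = l)) ∧ IsGClOf E lp c ∧
    ∀ y, E y d ↔ (SubsetE E y l ∧ E y c)
def IsTransClOf (x t : M) :=
  SubsetE E x t ∧ TransSet E t ∧ ∀ t', SubsetE E x t' → TransSet E t' → SubsetE E t t'
def IsTCSing (x t : M) :=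
  E x t ∧ TransSet E t ∧ ∀ t', E x t' → TransSet E t' → SubsetE E t t'
def IsLZero (b z : M) :=
  ∃ t, IsTransClOf E b t ∧ ∀ x, E x z ↔ (E x t ∨ x = b)
def IsLHier (b H a : M) :=
  IsOrd E a ∧ IsFunc E H ∧ (∀ c, (∃ y, PairIn E H c y) ↔ (E c a ∨ c = a)) ∧
  (∀ c z, IsZero E c → PairIn E H c z → IsLZero E b z) ∧
  (∀ c s z w, IsSuccOf E c s → PairIn E H c z → PairIn E H s w → IsDefSetOf E z w) ∧
  (∀ c z, IsLimitOrd E c → PairIn E H c z →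
    ∀ x, E x z ↔ ∃ d u, E d c ∧ PairIn E H d u ∧ E x u)
def IsLStage (b a l : M) :=
  ∃ H, IsLHier E b H a ∧ PairIn E H a l
def InL (b x : M) := ∃ a l, IsLStage E b a l ∧ E x l
def IsV2L (v1 w : M) :=
  ∀ x, E x w ↔ (InL E v1 x ∧ SubsetE E x v1)
def ClassFun (C : M → Prop) (J : M → M → Prop) :=
  (∀ x, C x → ∃ y, J x y) ∧ (∀ x y, J x y → C x ∧ C y) ∧
  (∀ x y y', J x y → J x y' → y = y')
def ElemOn (C : M → Prop) (J : M → M → Prop) :=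
  ClassFun C J ∧ ∀ {n : ℕ} (f : Fml n) (v w : Fin n → M),
    (∀ i, J (v i) (w i)) → (Eval E NoAux C f v ↔ Eval E NoAux C f w)
def ElemBetween (C D : M → Prop) (J : M → M → Prop) :=
  (∀ x, C x → ∃ y, J x y) ∧ (∀ x y, J x y → C x ∧ D y) ∧
  (∀ x y y', J x y → J x y' → y = y') ∧
  ∀ {n : ℕ} (f : Fml n) (v w : Fin n → M),
    (∀ i, J (v i) (w i)) → (Eval E NoAux C f v ↔ Eval E NoAux D f w)
def Sigma1ElemOn (C : M → Prop) (J : M → M → Prop) :=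
  ClassFun C J ∧ ∀ {n : ℕ} (f : Fml n), IsSigma1 f → ∀ (v w : Fin n → M),
    (∀ i, J (v i) (w i)) → (Eval E NoAux C f v ↔ Eval E NoAux C f w)
def SetElemEmbOn (a k : M) :=
  MapsTo E k a a ∧ ∀ {n : ℕ} (f : Fml n) (v w : Fin n → M),
    (∀ i, PairIn E k (v i) (w i)) →
    (Eval E NoAux (fun z ↦ E z a) f v ↔ Eval E NoAux (fun z ↦ E z a) f w)
def SetSigma1ElemEmbOn (a k : M) :=
  MapsTo E k a a ∧ ∀ {n : ℕ} (f : Fml n), IsSigma1 f → ∀ (v w : Fin n → M),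
    (∀ i, PairIn E k (v i) (w i)) →
    (Eval E NoAux (fun z ↦ E z a) f v ↔ Eval E NoAux (fun z ↦ E z a) f w)
def NontrivialRel (J : M → M → Prop) := ∃ x y, J x y ∧ x ≠ y
def CritBelow (J : M → M → Prop) (l : M) :=
  ∃ k, IsOrd E k ∧ E k l ∧ ¬ J k k ∧ ∀ b, IsOrd E b → E b k → J b b
def I0Emb (l v1 : M) (J : M → M → Prop) :=
  ElemOn E (InL E v1) J ∧ CritBelow E J l
def JPred (J : M → M → Prop) : M → Prop :=
  fun p ↦ ∃ x y, IsKPair E p x y ∧ J x y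
def CodesRestr (J : M → M → Prop) (a r : M) :=
  IsFuncOn E r a ∧ ∀ x y, PairIn E r x y → J x y
def IsMuSet (J : M → M → Prop) (vl v1 m : M) :=
  ∀ X, E X m ↔ (InL E v1 X ∧ SubsetE E X v1 ∧
    ∃ r Y, CodesRestr E J vl r ∧ J X Y ∧ E r Y)
def RelComp (J1 J0 : M → M → Prop) : M → M → Prop := fun x z ↦ ∃ y, J0 x y ∧ J1 y z
def IncrTuple {n : ℕ} (v : Fin n → M) :=
  ∀ i j : Fin n, i < j → E (v i) (v j)
def IsSilverClass (v1 : M) (I : M → Prop) :=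
  (∀ x, I x → IsOrd E x) ∧
  (∀ a, IsOrd E a → ∃ i, I i ∧ E a i) ∧
  (∀ a, IsLimitOrd E a → (∀ b, E b a → ∃ i, I i ∧ E b i ∧ E i a) → I a) ∧
  (∀ {n m : ℕ} (f : Fml (n + m)) (p : Fin m → M) (s t : Fin n → M),
    (∀ i, E (p i) v1) → (∀ i, I (s i)) → (∀ i, I (t i)) →
    IncrTuple E s → IncrTuple E t →
    (Eval E NoAux (InL E v1) f (Fin.append s p) ↔
      Eval E NoAux (InL E v1) f (Fin.append t p))) ∧
  (∀ x, InL E v1 x → ∃ (n m : ℕ) (f : Fml (n + m + 1)) (p : Fin m → M) (s : Fin n → M),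
    (∀ i, E (p i) v1) ∧ (∀ i, I (s i)) ∧
    ∀ y, InL E v1 y →
      (Eval E NoAux (InL E v1) f (Fin.cons y (Fin.append s p)) ↔ y = x))
def SharpEmb (l v1 : M) (J : M → M → Prop) :=
  ElemOn E (InL E v1) J ∧ NontrivialRel J ∧
  ∀ b, IsOrd E b → (E b l ∨ b = l) → J b b
def DefClassRel (P : M → Prop) (R : M → M → Prop) :=
  ∃ (n : ℕ) (f : Fml (n + 2)) (p : Fin n → M),
    ∀ x y, R x y ↔ Eval E P AllSets f (Fin.cons x (Fin.cons y p))
def DefOverClassRel (W : M → Prop) (R : M → M → Prop) :=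
  ∃ (n : ℕ) (f : Fml (n + 2)) (p : Fin n → M), (∀ i, W (p i)) ∧
    ∀ x y, W x → W y → (R x y ↔ Eval E NoAux W f (Fin.cons x (Fin.cons y p)))
def SharpExists (P : M → Prop) (l v1 : M) :=
  ∃ J, DefClassRel E P J ∧ SharpEmb E l v1 J
def ProperEmb (P : M → Prop) (l v1 : M) (J : M → M → Prop) :=
  ¬ SharpExists E P l v1 ∨
    (SharpExists E P l v1 ∧ ∀ I, IsSilverClass E v1 I → ∀ x, I x → J x x)
def StdDecomp (P : M → Prop) (l v1 : M)
    (J J0 J1 : M → M → Prop) :=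
  ElemOn E (InL E v1) J0 ∧ ElemOn E (InL E v1) J1 ∧
  (∀ x z, InL E v1 x → (J x z ↔ RelComp J1 J0 x z)) ∧
  ProperEmb E P l v1 J0 ∧
  (∀ b, IsOrd E b → E b l → J1 b b) ∧
  (¬ SharpExists E P l v1 → ∀ x, InL E v1 x → J1 x x)
def IsVSharpSet (v1 sh : M) :=
  SubsetE E sh v1 ∧ ¬ InL E v1 sh ∧ ∃ I, IsSilverClass E v1 I
def IsThetaOf (W : M → Prop) (v th : M) :=
  IsOrd E th ∧
  (∀ a, E a th → ∃ b f, (E a b ∨ a = b) ∧ W f ∧ SurjOn E f v b) ∧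
  (∀ a f, IsOrd E a → W f → SurjOn E f v a → E a th)
def RegularIn (W : M → Prop) (th : M) :=
  ¬ ∃ a f, IsOrd E a ∧ E a th ∧ W f ∧ MapsTo E f a th ∧
    ∀ b, E b th → ∃ x y, PairIn E f x y ∧ (E b y ∨ b = y)
def CofinalOmegaSeq (th : M) :=
  ∃ f : ℕ → M, (∀ n, IsOrd E (f n) ∧ E (f n) th) ∧
    ∀ b, E b th → ∃ n, E b (f n) ∨ b = f n
def IsTreeOn (T h X : M) :=
  (∀ f, E f T → ∃ b, IsOrd E b ∧ E b h ∧ MapsTo E f b X) ∧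
  (∀ f d b r, E f T → IsFuncOn E f d → E b d → IsRestrOfFn E f b r → E r T)
def IsMaxBranch (T h X b : M) :=
  ∃ a, IsOrd E a ∧ (E a h ∨ a = h) ∧ MapsTo E b a X ∧
    ((E b T ∧ ¬ ∃ g dg, E g T ∧ IsFuncOn E g dg ∧ E a dg ∧ IsRestrOfFn E g a b) ∨
     ((IsZero E a ∨ IsLimitOrd E a) ∧ ¬ E b T ∧
       ∀ c, E c a → ∃ r, E r T ∧ IsRestrOfFn E b c r))
def DCOn (h : M) (W : M → Prop) :=
  ∀ X T, W X → W T → IsTreeOn E T h X → ∃ b, W b ∧ IsMaxBranch E T h X b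
def DCAt (h : M) := DCOn E h AllSets
def ODIn (C : M → Prop) (Xc : M → Prop) (x : M) :=
  ∃ (n : ℕ) (f : Fml (n + 1)) (p : Fin n → M),
    (∀ i, C (p i)) ∧ (∀ i, IsOrd E (p i) ∨ Xc (p i)) ∧
    ∀ z, C z → (Eval E NoAux C f (Fin.cons z p) ↔ z = x)
def HODIn (C : M → Prop) (Xc : M → Prop) (x : M) :=
  ∀ t, IsTCSing E x t → ∀ y, E y t → ODIn E C Xc y
def InHull (D : M → Prop) (Xp : M → Prop) (y : M) :=
  ∃ (n : ℕ) (f : Fml (n + 1)) (p : Fin n → M), (∀ i, Xp (p i)) ∧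
    ∀ z, D z → (Eval E NoAux D f (Fin.cons z p) ↔ z = y)
def FnInto (C : M → Prop) (v f : M) :=
  C f ∧ IsFuncOn E f v ∧ ∀ x y, PairIn E f x y → C y
def MeasOne (mu : M → Prop) (v : M) (Q : M → Prop) :=
  ∃ X, (∀ z, E z X ↔ (E z v ∧ Q z)) ∧ mu X
def UltSat (E : M → M → Prop) (C : M → Prop) (v : M) (mu : M → Prop) :
    {n : ℕ} → Fml n → (Fin n → M) → Prop
  | _, Fml.mem i j, fs => MeasOne E mu v (fun k ↦
      ∃ y z, PairIn E (fs i) k y ∧ PairIn E (fs j) k z ∧ E y z)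
  | _, Fml.equ i j, fs => MeasOne E mu v (fun k ↦
      ∃ y z, PairIn E (fs i) k y ∧ PairIn E (fs j) k z ∧ y = z)
  | _, Fml.aux _, _ => False
  | _, Fml.impl f g, fs => UltSat E C v mu f fs → UltSat E C v mu g fs
  | _, Fml.neg f, fs => ¬ UltSat E C v mu f fs
  | _, Fml.all f, fs => ∀ g, FnInto E C v g → UltSat E C v mu f (Fin.cons g fs)
  | _, Fml.ex f, fs => ∃ g, FnInto E C v g ∧ UltSat E C v mu f (Fin.cons g fs)
  | _, Fml.allb i f, fs => ∀ g, FnInto E C v g →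
      MeasOne E mu v (fun k ↦ ∃ y z, PairIn E g k y ∧ PairIn E (fs i) k z ∧ E y z) →
      UltSat E C v mu f (Fin.cons g fs)
def LosOK (C : M → Prop) (v : M) (mu : M → Prop) :=
  ∀ {n : ℕ} (f : Fml n) (fs : Fin n → M), (∀ i, FnInto E C v (fs i)) →
    (UltSat E C v mu f fs ↔ MeasOne E mu v (fun k ↦
      ∃ ys : Fin n → M, (∀ i, PairIn E (fs i) k (ys i)) ∧ Eval E NoAux C f ys))
def UltRepOKB (C D : M → Prop) (v : M) (mu : M → Prop)
    (Rep : M → M → Prop) (Jm : M → M → Prop) :=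
  (∀ f, FnInto E C v f → ∃ x, D x ∧ Rep f x) ∧
  (∀ f x, Rep f x → FnInto E C v f ∧ D x) ∧
  (∀ x, D x → ∃ f, Rep f x) ∧
  (∀ {n : ℕ} (f : Fml n) (fs xs : Fin n → M), (∀ i, Rep (fs i) (xs i)) →
    (Eval E NoAux D f xs ↔ MeasOne E mu v (fun k ↦
      ∃ ys : Fin n → M, (∀ i, PairIn E (fs i) k (ys i)) ∧ Eval E NoAux C f ys))) ∧
  (∀ x y, C x → (Jm x y ↔ ∃ f, (∀ p, E p f ↔ ∃ k, E k v ∧ IsKPair E p k x) ∧ Rep f y))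
def UltRepOK (C : M → Prop) (v : M) (mu : M → Prop)
    (Rep : M → M → Prop) (Jm : M → M → Prop) :=
  UltRepOKB E C C v mu Rep Jm
def IsUltPowMap (C : M → Prop) (v : M) (mu : M → Prop)
    (Jm : M → M → Prop) :=
  ∃ Rep, UltRepOK E C v mu Rep Jm
def IsUltPowMapB (C D : M → Prop) (v : M) (mu : M → Prop)
    (Jm : M → M → Prop) :=
  ∃ Rep, UltRepOKB E C D v mu Rep Jm
structure IterData (M : Type) where
  cls : M → M → Prop
  meas : M → M → Prop
  emb : M → M → M → Prop
  imap : M → M → M → M → Prop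
def IterMeasStep (S : IterData M) (z0 v1 v2L a tgt Y : M) :=
  ∃ v1a v2a pi Xr jX, S.imap z0 a v1 v1a ∧ S.imap z0 a v2L v2a ∧
    S.cls a pi ∧ MapsTo E pi v1a v2a ∧
    (∀ z, E z Xr ↔ (S.meas a z ∧ ∃ x, PairIn E pi x z)) ∧
    S.imap a tgt Xr jX ∧ E Y jX
def IsIterSys (C0 : M → Prop) (mu0 : M → Prop)
    (z0 v1 v2L d : M) (S : IterData M) :=
  IsZero E z0 ∧
  (∀ x, S.cls z0 x ↔ C0 x) ∧ (∀ X, S.meas z0 X ↔ mu0 X) ∧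
  (∀ a, IsOrd E a → (E a d ∨ a = d) → ∀ x y, S.imap a a x y ↔ (S.cls a x ∧ x = y)) ∧
  (∀ a b c, IsOrd E a → IsOrd E b → IsOrd E c → (E a b ∨ a = b) → (E b c ∨ b = c) →
    (E c d ∨ c = d) → ∀ x z, S.imap a c x z ↔ ∃ y, S.imap a b x y ∧ S.imap b c y z) ∧
  (∀ a b, IsOrd E a → IsOrd E b → (E a b ∨ a = b) → (E b d ∨ b = d) →
    ElemBetween E (S.cls a) (S.cls b) (S.imap a b)) ∧
  (∀ a s, IsOrd E a → IsSuccOf E a s → (E s d ∨ s = d) →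
    (∀ x, S.cls s x ↔ S.cls a x) ∧
    (∀ x y, S.imap a s x y ↔ S.emb a x y) ∧
    (∀ Y, S.meas s Y ↔ IterMeasStep E S z0 v1 v2L a s Y)) ∧
  (∀ a v1a, IsOrd E a → (E a d ∨ a = d) → S.imap z0 a v1 v1a →
    IsUltPowMap E (S.cls a) v1a (S.meas a) (S.emb a)) ∧
  (∀ h, IsLimitOrd E h → (E h d ∨ h = d) →
    (∀ x, S.cls h x → ∃ a x0, IsOrd E a ∧ E a h ∧ S.imap a h x0 x) ∧
    (∀ Y, S.meas h Y ↔ ∃ a, IsOrd E a ∧ E a h ∧ IterMeasStep E S z0 v1 v2L a h Y))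
def LinMeasAt (S : IterData M) (z0 m a : M) : M → Prop :=
  fun X ↦ ∃ ma, S.imap z0 a m ma ∧ E X ma
def IsLinIterSys (C0 : M → Prop) (z0 v1 m d : M)
    (S : IterData M) :=
  IsZero E z0 ∧ (∀ x, S.cls z0 x ↔ C0 x) ∧
  (∀ a, IsOrd E a → (E a d ∨ a = d) → ∀ x y, S.imap a a x y ↔ (S.cls a x ∧ x = y)) ∧
  (∀ a b c, IsOrd E a → IsOrd E b → IsOrd E c → (E a b ∨ a = b) → (E b c ∨ b = c) →
    (E c d ∨ c = d) → ∀ x z, S.imap a c x z ↔ ∃ y, S.imap a b x y ∧ S.imap b c y z) ∧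
  (∀ a b, IsOrd E a → IsOrd E b → (E a b ∨ a = b) → (E b d ∨ b = d) →
    ElemBetween E (S.cls a) (S.cls b) (S.imap a b)) ∧
  (∀ a s, IsOrd E a → IsSuccOf E a s → (E s d ∨ s = d) →
    (∀ x y, S.imap a s x y ↔ S.emb a x y) ∧
    ∀ v1a, S.imap z0 a v1 v1a →
      IsUltPowMapB E (S.cls a) (S.cls s) v1a (LinMeasAt E S z0 m a) (S.emb a)) ∧
  (∀ h, IsLimitOrd E h → (E h d ∨ h = d) →
    ∀ x, S.cls h x → ∃ a x0, IsOrd E a ∧ E a h ∧ S.imap a h x0 x)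
structure OmegaIterData (M : Type) where
  meas : ℕ → M → Prop
  emb : ℕ → M → M → Prop
  limC : M → Prop
  limMap : ℕ → M → M → Prop
  limMeas : M → Prop
  limEmb : M → M → Prop
def OmegaMeasStep (C0 : M → Prop) (mu : M → Prop)
    (Jn : M → M → Prop) (v1 v2L Y : M) :=
  ∃ pi Xr jX, C0 pi ∧ MapsTo E pi v1 v2L ∧
    (∀ z, E z Xr ↔ (mu z ∧ ∃ x, PairIn E pi x z)) ∧ Jn Xr jX ∧ E Y jX
def IsOmegaIter (v1 v2L : M) (mu0 : M → Prop)
    (S : OmegaIterData M) :=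
  (∀ X, S.meas 0 X ↔ mu0 X) ∧
  (∀ n Y, S.meas (n + 1) Y ↔
    OmegaMeasStep E (InL E v1) (S.meas n) (S.emb n) v1 v2L Y) ∧
  (∀ n, IsUltPowMap E (InL E v1) v1 (S.meas n) (S.emb n)) ∧
  (∀ n x y, S.limMap n x y ↔ ∃ z, S.emb n x z ∧ S.limMap (n + 1) z y) ∧
  (∀ y, S.limC y ↔ ∃ n x, S.limMap n x y) ∧
  (∀ n, ElemBetween E (InL E v1) S.limC (S.limMap n)) ∧
  (∀ Y, S.limMeas Y ↔ ∃ n pi Xr jX, InL E v1 pi ∧ MapsTo E pi v1 v2L ∧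
    (∀ z, E z Xr ↔ (S.meas n z ∧ ∃ x, PairIn E pi x z)) ∧
    S.limMap n Xr jX ∧ E Y jX) ∧
  (∀ v1w, S.limMap 0 v1 v1w → IsUltPowMap E S.limC v1w S.limMeas S.limEmb)
def IsPosetOn (P le : M) :=
  (∀ q, E q le → ∃ x y, IsKPair E q x y ∧ E x P ∧ E y P) ∧
  (∀ p, E p P → PairIn E le p p) ∧
  (∀ p q r, PairIn E le p q → PairIn E le q r → PairIn E le p r) ∧
  (∀ p q, PairIn E le p q → PairIn E le q p → p = q)
def CompatIn (P le p q : M) :=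
  ∃ r, E r P ∧ PairIn E le r p ∧ PairIn E le r q
def IsDenseIn (P le D : M) :=
  SubsetE E D P ∧ ∀ p, E p P → ∃ q, E q D ∧ PairIn E le q p
def IsFilterCl (P le : M) (G : M → Prop) :=
  (∀ p, G p → E p P) ∧ (∃ p, G p) ∧
  (∀ p q, G p → G q → ∃ r, G r ∧ PairIn E le r p ∧ PairIn E le r q) ∧
  (∀ p q, G p → E q P → PairIn E le p q → G q)
def IsGenericOver (W : M → Prop) (P le : M) (G : M → Prop) :=
  IsFilterCl E P le G ∧ ∀ D, W D → IsDenseIn E P le D → ∃ p, G p ∧ E p D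
def IsAntichainIn (P le A : M) :=
  SubsetE E A P ∧ ∀ p q, E p A → E q A → p ≠ q → ¬ CompatIn E P le p q
def ExtEquals (W : M → Prop) (G : M → Prop) (Wx : M → Prop) :=
  (∀ x, W x → Wx x) ∧ TransClass E Wx ∧ ClassSatZF E NoAux Wx ∧
  (∃ g, Wx g ∧ ∀ x, E x g ↔ G x) ∧
  ∀ C : M → Prop, TransClass E C → ClassSatZF E NoAux C → (∀ x, W x → C x) →
    (∀ g, (∀ x, E x g ↔ G x) → C g) → ∀ x, Wx x → C x
def IsSetGenExt (W Wx : M → Prop) :=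
  ∃ P le G, W P ∧ W le ∧ IsPosetOn E P le ∧ IsGenericOver E W P le G ∧
    ExtEquals E W G Wx
def LamAlphaOmega (l a g : M) :=
  ∃ F s, IsSuccOf E a s ∧ IsFuncOn E F s ∧
    (∀ z y, IsZero E z → PairIn E F z y → y = l) ∧
    (∀ c sc u w, IsSuccOf E c sc → E sc s → PairIn E F c u → PairIn E F sc w →
      IsNextLimit E u w) ∧
    (∀ c w, IsLimitOrd E c → PairIn E F c w →
      ∀ x, E x w ↔ ∃ dd u, E dd c ∧ PairIn E F dd u ∧ E x u) ∧
    PairIn E F a g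
def IsTjNode (l v1 th lth j t : M) :=
  ∃ a b ga gb la el,
    IsLimitOrd E a ∧ E a th ∧ IsLimitOrd E b ∧ E b th ∧
    LamAlphaOmega E l a ga ∧ LamAlphaOmega E l b gb ∧
    MapsTo E t ga gb ∧
    IsLStage E v1 a la ∧ IsFuncOn E el la ∧
    (∀ x y, PairIn E j x y → PairIn E el x y) ∧
    (∀ x y, PairIn E t x y → PairIn E el x y) ∧
    (∀ x y, PairIn E el x y → E y lth) ∧
    (∀ {n : ℕ} (f : Fml n), IsSigma1 f → ∀ v w : Fin n → M,
      (∀ i, PairIn E el (v i) (w i)) →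
      (Eval E NoAux (fun z ↦ E z lth) f v ↔ Eval E NoAux (fun z ↦ E z lth) f w))
def IsTjSet (l v1 th lth j T : M) :=
  ∀ t, E t T ↔ IsTjNode E l v1 th lth j t
def NodeExtends (s t : M) :=
  ∃ dt, IsFuncOn E t dt ∧ IsRestrOfFn E s dt t
def IsDerivOf (th T T' : M) :=
  ∀ t, E t T' ↔ (E t T ∧ ∀ b, E b th →
    ∃ s ds, E s T ∧ IsFuncOn E s ds ∧ NodeExtends E s t ∧ (E b ds ∨ b = ds))
def IsDerivHier (th T0 H a : M) :=
  IsOrd E a ∧ IsFunc E H ∧ (∀ c, (∃ y, PairIn E H c y) ↔ (E c a ∨ c = a)) ∧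
  (∀ c z, IsZero E c → PairIn E H c z → z = T0) ∧
  (∀ c s z w, IsSuccOf E c s → PairIn E H c z → PairIn E H s w → IsDerivOf E th z w) ∧
  (∀ c z, IsLimitOrd E c → PairIn E H c z →
    ∀ x, E x z ↔ ∀ dd u, E dd c → PairIn E H dd u → E x u)
def IsTjDerivAt (th T0 a T : M) :=
  ∃ H, IsDerivHier E th T0 H a ∧ PairIn E H a T
def InTjInfty (th T0 t : M) :=
  E t T0 ∧ ∀ a T, IsOrd E a → IsTjDerivAt E th T0 a T → E t T
def IsThBranchCl (th T : M) (B : M → Prop) :=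
  (∀ t, B t → E t T) ∧
  (∀ t s, B t → B s → NodeExtends E s t ∨ NodeExtends E t s) ∧
  (∀ b, E b th → ∃ t ds, B t ∧ IsFuncOn E t ds ∧ (E b ds ∨ b = ds))
def IsThBranchSet (th T Bs : M) :=
  (∀ t, E t Bs → E t T) ∧
  (∀ t s, E t Bs → E s Bs → NodeExtends E s t ∨ NodeExtends E t s) ∧
  (∀ b, E b th → ∃ t ds, E t Bs ∧ IsFuncOn E t ds ∧ (E b ds ∨ b = ds))
end
set_option autoImplicit true
set_option linter.unusedVariables false
set_option linter.unusedSectionVars false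
notation:max x:max "◜" => x.1
notation:max x:max "◝" => x.2
notation "⬚" => ?_
notation "◁" => Or.inl
notation "▷" => Or.inr
notation "⊹" => Fin.cons
notation:max "ℸ" x:min => fun _ => x
notation:max "⊙" X:max => ℕ → X
notation:max f:max "⁰" => f 0
notation:max f:max "¹" => f 1
notation:max f:max "²" => f 2
notation:max f:max "³" => f 3
notation:max f:max "⇡" => fun n => f (n+1)
notation:max "⊠" X:max => ⊙X → X
noncomputable section
open Fml
section
def Fml.ren : {n : ℕ} → Fml n → {m : ℕ} → (Fin n → Fin m) → Fml m
  | _, Fml.mem i j, _, r => Fml.mem (r i) (r j)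
  | _, Fml.equ i j, _, r => Fml.equ (r i) (r j)
  | _, Fml.aux i, _, r => Fml.aux (r i)
  | _, Fml.impl f g, _, r => Fml.impl (f.ren r) (g.ren r)
  | _, Fml.neg f, _, r => Fml.neg (f.ren r)
  | _, Fml.all f, _, r => Fml.all (f.ren (⊹ 0 fun i ↦ (r i).succ))
  | _, Fml.ex f, _, r => Fml.ex (f.ren (⊹ 0 fun i ↦ (r i).succ))
  | _, Fml.allb i f, _, r => Fml.allb (r i) (f.ren (⊹ 0 fun i ↦ (r i).succ))
theorem cons_ren (x : M) (v : Fin m → M) (r : Fin n → Fin m) :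
    (fun i ↦ (⊹ x v : Fin (m+1) → M) ((⊹ 0 (fun i ↦ (r i).succ) : Fin (n+1) → Fin (m+1)) i))
      = (⊹ x (fun i ↦ v (r i)) : Fin (n+1) → M) := by
  funext i; refine Fin.cases ⬚ (fun i ↦ ⬚) i <;> simp
theorem eval_ren (E : M → M → Prop) (P C : M → Prop) (f : Fml n) :
    ∀ {m : ℕ} (r : Fin n → Fin m) (v : Fin m → M),
      Eval E P C (f.ren r) v ↔ Eval E P C f fun i ↦ v (r i) := by
  induction f with
  | mem i j => intros; rfl
  | equ i j => intros; rfl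
  | aux i => intros; rfl
  | impl f g ihf ihg => intro m r v; exact imp_congr (ihf r v) (ihg r v)
  | neg f ih => intro m r v; exact not_congr (ih r v)
  | all f ih => intro m r v; simp only [Fml.ren, Eval, ih, cons_ren]
  | ex f ih => intro m r v; simp only [Fml.ren, Eval, ih, cons_ren]
  | allb i f ih => intro m r v; simp only [Fml.ren, Eval, ih, cons_ren]
theorem val_cons {M : Type} {C : M → Prop} {n : ℕ} (x : M) (h : C x) (v : Fin n → {x // C x}) :
    (⊹ x (fun i ↦ (v i)◜) : Fin (n+1) → M) =
      fun i ↦ ((⊹ (⟨x, h⟩ : {x // C x}) v : Fin (n+1) → {x // C x}) i)◜ := by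
  funext i; refine Fin.cases ⬚ (fun i ↦ ⬚) i <;> simp
theorem eval_sub {M : Type} (E : M → M → Prop) (P C : M → Prop) {n : ℕ} (f : Fml n) :
    ∀ (v : Fin n → {x // C x}), Eval E P C f (fun i ↦ (v i)◜) ↔
      Eval (M := {x // C x}) (fun a b ↦ E a◜ b◜) (fun a ↦ P a◜) AllSets f v := by
  induction f with
  | mem i j => intros; rfl
  | equ i j => intro v; exact Subtype.ext_iff.symm
  | aux i => intros; rfl
  | impl f g ihf ihg => intro v; exact imp_congr (ihf v) (ihg v)
  | neg f ih => intro v; exact not_congr (ih v)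
  | all f ih =>
    intro v
    constructor
    · intro h x _; exact (ih _)◜ (by rw [← val_cons x◜ x◝]; exact h x◜ x◝)
    · intro h x hx; rw [val_cons x hx]; exact (ih _)◝ (h ⟨x, hx⟩ trivial)
  | ex f ih =>
    intro v
    constructor
    · rintro ⟨x, hx, h⟩; rw [val_cons x hx] at h; exact ⟨⟨x, hx⟩, trivial, (ih _)◜ h⟩
    · rintro ⟨x, _, h⟩; exact ⟨x◜, x◝, by rw [val_cons x◜ x◝]; exact (ih _)◝ h⟩
  | allb i f ih =>
    intro v
    constructor
    · intro h x _ hx; exact (ih _)◜ (by rw [← val_cons x◜ x◝]; exact h x◜ x◝ hx)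
    · intro h x hx hi; rw [val_cons x hx]; exact (ih _)◝ (h ⟨x, hx⟩ trivial hi)
class ZFM (X : Type) where
  E : X → X → Prop
  P : X → Prop
  sat : SatZF E P
infix:50 "~" => ZFM.E
notation "∊" => ZFM.E
variable {X : Type} [ZFM X] {x z : X}
def env (σ : ⊙X) (c : ℕ ⊕ X) : X := Sum.elim σ id c
class DF (R : ⊙X → Prop) : Prop where
  ex : ∃ (k : ℕ) (f : Fml k) (c : Fin k → ℕ ⊕ X), ∀ σ, R σ ↔
    Eval ∊ ZFM.P AllSets f fun i ↦ env σ (c i)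
class DT (t : ⊠X) : Prop where
  df : DF fun σ ↦ σ 0 = t σ⇡
abbrev T1 (X : Type) [ZFM X] (F : X → X) : Prop := ∀ {s : ⊠X} [DT s], DT fun σ => F (s σ)
abbrev T2 (X : Type) [ZFM X] (F : X → X → X) : Prop := ∀ {s t : ⊠X} [DT s] [DT t], DT fun σ => F (s σ) (t σ)
abbrev T3 (X : Type) [ZFM X] (F : X → X → X → X) : Prop := ∀ {s t u : ⊠X} [DT s] [DT t] [DT u], DT fun σ => F (s σ) (t σ) (u σ)
abbrev F1 (X : Type) [ZFM X] (F : X → Prop) : Prop := ∀ {s : ⊠X} [DT s], DF fun σ => F (s σ)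
abbrev F2 (X : Type) [ZFM X] (F : X → X → Prop) : Prop := ∀ {s t : ⊠X} [DT s] [DT t], DF fun σ => F (s σ) (t σ)
abbrev F3 (X : Type) [ZFM X] (F : X → X → X → Prop) : Prop := ∀ {s t u : ⊠X} [DT s] [DT t] [DT u], DF fun σ => F (s σ) (t σ) (u σ)
theorem DF.congr {R S : ⊙X → Prop} (h : DF R) (e : ∀ σ, S σ ↔ R σ) : DF S := by
  have : S = R := funext fun σ ↦ propext (e σ)
  rw [this]; exact h
theorem DF.sub (h : DF R) (τ : ℕ → ℕ ⊕ X) :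
    DF fun σ ↦ R fun n ↦ env σ (τ n) := by
  rcases h with ⟨k, f, c, h⟩
  refine ⟨k, f, fun i ↦ Sum.elim τ Sum.inr (c i), fun σ ↦ ⬚⟩
  rw [h]
  have : (fun i ↦ env (fun n ↦ env σ (τ n)) (c i)) = fun i ↦ env σ (Sum.elim τ Sum.inr (c i)) := by
    funext i; cases c i <;> rfl
  rw [this]
instance DF.mem_ (i j : ℕ) : DF fun σ : ⊙X ↦ σ i ~ σ j :=
  ⟨2, Fml.mem 0 1, ![Sum.inl i, Sum.inl j], ℸ Iff.rfl⟩
theorem DF.eq_ (i j : ℕ) : DF fun σ : ⊙X ↦ σ i = σ j :=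
  ⟨2, Fml.equ 0 1, ![Sum.inl i, Sum.inl j], ℸ Iff.rfl⟩
theorem DF.P_ (i : ℕ) : DF fun σ : ⊙X ↦ ZFM.P (σ i) :=
  ⟨1, Fml.aux 0, ![Sum.inl i], ℸ Iff.rfl⟩
instance DF.not_ {R : ⊙X → Prop} [h : DF R] : DF fun σ ↦ ¬ R σ := by
  rcases h with ⟨k, f, c, h⟩
  exact ⟨k, f.neg, c, fun σ ↦ not_congr (h σ)⟩
instance DF.imp_ {R S : ⊙X → Prop} [h : DF R] [h₀ : DF S] : DF fun σ ↦ R σ → S σ := by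
  rcases h with ⟨k, f, c, h⟩
  rcases h₀ with ⟨k₀, f₀, c₀, h₀⟩
  refine ⟨k + k₀, (f.ren (Fin.castAdd k₀)).impl (f₀.ren (Fin.natAdd k)), Fin.append c c₀, fun σ ↦ ⬚⟩
  simp only [Eval, eval_ren, Fin.append_left, Fin.append_right, h, h₀]
instance DF.and_ {R S : ⊙X → Prop} [h : DF R] [h₀ : DF S] : DF fun σ ↦ R σ ∧ S σ :=
  (inferInstance : DF fun σ ↦ ¬ (R σ → ¬ S σ)).congr fun σ ↦ by tauto
instance DF.or_ {R S : ⊙X → Prop} [h : DF R] [h₀ : DF S] : DF fun σ ↦ R σ ∨ S σ :=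
  (inferInstance : DF fun σ ↦ ¬ R σ → S σ).congr fun σ ↦ by tauto
instance DF.iff_ {R S : ⊙X → Prop} [h : DF R] [h₀ : DF S] : DF fun σ ↦ R σ ↔ S σ :=
  (inferInstance : DF fun σ ↦ (R σ → S σ) ∧ (S σ → R σ)).congr fun σ ↦ by tauto
open Classical in
instance DF.ex_ {R : X → ⊙X → Prop} [h : DF fun σ ↦ R σ⁰ σ⇡] :
    DF fun σ ↦ ∃ x, R x σ := by
  rcases h with ⟨k, f, c, h⟩
  refine ⟨k, (f.ren fun i ↦ if c i = Sum.inl 0 then 0 else i.succ).ex,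
    fun i ↦ Sum.elim (fun n ↦ Sum.inl (n - 1)) Sum.inr (c i), fun σ ↦ ⬚⟩
  simp only [Eval, eval_ren, AllSets, true_and]
  refine exists_congr fun x ↦ ⬚
  refine (h fun n ↦ Nat.casesOn n x σ).trans ⬚
  refine iff_of_eq (congrArg _ (funext fun i ↦ ⬚))
  rcases hc : c i with (_ | n) | y <;> simp [env, hc]
instance DF.all_ {R : X → ⊙X → Prop} [h : DF fun σ ↦ R σ⁰ σ⇡] :
    DF fun σ ↦ ∀ x, R x σ :=
  (inferInstance : DF fun σ ↦ ¬ ∃ x, ¬ R x σ).congr fun σ ↦ by simp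
instance DT.var (i : ℕ) : DT fun σ : ⊙X ↦ σ i := ⟨DF.eq_ 0 (i+1)⟩
instance DT.const (a : X) : DT fun _ : ℕ → X ↦ a :=
  ⟨2, Fml.equ 0 1, ![Sum.inl 0, Sum.inr a], ℸ Iff.rfl⟩
theorem DF.subst {R : X → ⊙X → Prop} (h : DF fun σ ↦ R σ⁰ σ⇡)
    (s : ⊠X) [hs : DT s] : DF fun σ ↦ R (s σ) σ :=
  (@DF.ex_ _ _ (fun x σ ↦ x = s σ ∧ R x σ) (@DF.and_ _ _ _ _ hs.df h)).congr fun σ ↦ by simp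
theorem DT.shift (s : ⊠X) [hs : DT s] : DT fun σ ↦ s σ⇡ :=
  ⟨hs.df.sub fun n ↦ if n = 0 then .inl 0 else .inl (n+1)⟩
theorem dfK {R : ⊙X → Prop} (h : DF R) (K : ℕ) : ∀ (τ : ℕ → ⊠X), (∀ n, DT (τ n)) →
    DF fun σ ↦ R fun n ↦ if n < K then τ n σ else σ (n - K) := by
  induction K with
  | zero => intro τ _; simpa using h
  | succ K ih =>
    intro τ hτ
    have h1 := ih (fun n σ ↦ τ n σ⇡) fun n ↦ DT.shift _
    have := hτ K
    refine (DF.subst (R := fun x σ ↦ R fun n ↦ if n < K then τ n σ else if n = K then x else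
      σ (n - (K+1))) (h1.congr fun σ ↦ ⬚) (τ K)).congr fun σ ↦ ⬚
    · refine iff_of_eq (congrArg R (funext fun n ↦ ⬚))
      rcases lt_trichotomy n K with h | h | h
      · simp [h]
      · simp [h]
      · simp [h.not_gt, h.ne']; congr 1; omega
    · refine iff_of_eq (congrArg R (funext fun n ↦ ⬚))
      rcases lt_trichotomy n K with h | h | h
      · simp [h, h.trans (Nat.lt_succ_self K)]
      · simp [h]
      · simp [h.not_gt, h.ne']; intro; omega
theorem df1 (R : X → Prop) [h : DF fun σ ↦ R σ⁰] (s : ⊠X) [hs : DT s] :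
    DF fun σ ↦ R (s σ) := DF.subst (R := fun x _ ↦ R x) h s
theorem df2 (R : X → X → Prop) [h : DF fun σ ↦ R σ⁰ σ¹] (s t : ⊠X)
    [hs : DT s] [ht : DT t] : DF fun σ ↦ R (s σ) (t σ) :=
  (dfK h 2 (fun n ↦ if n = 0 then s else t) fun n ↦ by split <;> assumption).congr
    fun σ ↦ by simp
theorem df3 (R : X → X → X → Prop) [h : DF fun σ ↦ R σ⁰ σ¹ σ²] (s t u : ⊠X)
    [hs : DT s] [ht : DT t] [hu : DT u] : DF fun σ ↦ R (s σ) (t σ) (u σ) :=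
  (dfK h 3 (fun n ↦ if n = 0 then s else if n = 1 then t else u)
    (fun n ↦ by repeat' split <;> try assumption)).congr fun σ ↦ by simp
theorem df4 (R : X → X → X → X → Prop) [h : DF fun σ ↦ R σ⁰ σ¹ σ² σ³]
    (s t u w : ⊠X) [hs : DT s] [ht : DT t] [hu : DT u] [hw : DT w] :
    DF fun σ ↦ R (s σ) (t σ) (u σ) (w σ) :=
  (dfK h 4 (fun n ↦ if n = 0 then s else if n = 1 then t else if n = 2 then u else w)
    (fun n ↦ by repeat' split <;> try assumption)).congr fun σ ↦ by simp
instance DF.mem2 {s t : ⊠X} [DT s] [DT t] : DF fun σ ↦ s σ ~ t σ := df2 ∊ s t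
instance DF.eq2 {s t : ⊠X} [DT s] [DT t] : DF fun σ ↦ s σ = t σ :=
  @df2 _ _ (fun x y ↦ x = y) (DF.eq_ 0 1) s t _ _
instance DF.P2 {s : ⊠X} [DT s] : DF fun σ ↦ ZFM.P (s σ) := @df1 _ _ _ (DF.P_ 0) s _
instance DF.prop (p : Prop) : DF fun _ : ℕ → X ↦ p := by
  by_cases h : p
  · exact (inferInstance : DF fun σ : ⊙X ↦ σ 0 = σ 0).congr fun σ ↦ by simp [h]
  · exact (inferInstance : DF fun σ : ⊙X ↦ ¬ σ 0 = σ 0).congr fun σ ↦ by simp [h]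
theorem dt1 (F : X → X) [h : DT fun σ ↦ F σ⁰] (s : ⊠X) [hs : DT s] :
    DT fun σ ↦ F (s σ) :=
  have := DT.shift s
  ⟨@df2 _ _ (fun x a ↦ x = F a) h.df _ _ _ _⟩
theorem dt2 (F : X → X → X) [h : DT fun σ ↦ F σ⁰ σ¹] (s t : ⊠X) [hs : DT s] [ht : DT t] :
    DT fun σ ↦ F (s σ) (t σ) :=
  have := DT.shift s
  have := DT.shift t
  ⟨@df3 _ _ (fun x a b ↦ x = F a b) h.df _ _ _ _ _ _⟩
theorem dt3 (F : X → X → X → X) [h : DT fun σ ↦ F σ⁰ σ¹ σ²] (s t u : ⊠X)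
    [hs : DT s] [ht : DT t] [hu : DT u] : DT fun σ ↦ F (s σ) (t σ) (u σ) :=
  have := DT.shift s
  have := DT.shift t
  have := DT.shift u
  ⟨@df4 _ _ (fun x a b c ↦ x = F a b c) h.df _ _ _ _ _ _ _ _⟩
theorem ti1 (F : X → X) (h : DT fun σ ↦ F σ⁰) : T1 X F := dt1 F _
theorem ti2 (F : X → X → X) (h : DT fun σ ↦ F σ⁰ σ¹) : T2 X F := dt2 F _ _
theorem ti3 (F : X → X → X → X) (h : DT fun σ ↦ F σ⁰ σ¹ σ²) : T3 X F := dt3 F _ _ _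
theorem fi1 (F : X → Prop) (h : DF fun σ ↦ F σ⁰) : F1 X F := df1 F _
theorem fi2 (F : X → X → Prop) (h : DF fun σ ↦ F σ⁰ σ¹) : F2 X F := df2 F _ _
theorem fi3 (F : X → X → X → Prop) (h : DF fun σ ↦ F σ⁰ σ¹ σ²) : F3 X F := df3 F _ _ _
theorem zext (h : ∀ z, z ~ x ↔ z ~ y) : x = y := ZFM.sat.ext x y h
def IsS (Q : X → Prop) : Prop := ∃ s, ∀ z, z ~ s ↔ Q z
open Classical in
def bld (Q : X → Prop) : X :=
  if h : IsS Q then h.choose else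
    (ZFM.sat.infty (E := ZFM.E (X := X))).choose_spec◜.choose
theorem mem_bld (h : IsS Q) : z ~ bld Q ↔ Q z := by
  unfold bld; rw [dif_pos h]; exact Exists.choose_spec h z
theorem bld_not (h : ¬ IsS Q) : ¬ z ~ bld Q := by
  unfold bld; rw [dif_neg h]
  exact (ZFM.sat.infty (E := ZFM.E (X := X))).choose_spec◜.choose_spec◝ z
theorem eq_bld :
    x = bld Q ↔ (∀ z, z ~ x ↔ Q z) ∨ ((¬ ∃ s, ∀ z, z ~ s ↔ Q z) ∧ ∀ z, ¬ z ~ x) := by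
  constructor
  · rintro rfl
    by_cases h : IsS Q
    · exact ◁ fun z ↦ mem_bld h
    · exact ▷ ⟨h, fun z ↦ bld_not h⟩
  · rintro (h | ⟨h, h₀⟩)
    · exact zext fun z ↦ (h z).trans (mem_bld ⟨x, h⟩).symm
    · exact zext fun z ↦ iff_of_false (h₀ z) (bld_not h)
theorem bld_eq (h : ∀ z, z ~ x ↔ Q z) : bld Q = x := (eq_bld◝ (◁ h)).symm
instance DT.bld_ {Q : ⊙X → X → Prop} [h : DF fun σ ↦ Q σ⇡ σ⁰] :
    DT fun σ ↦ bld (Q σ) := by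
  have h1 : DF fun σ : ⊙X ↦ Q (fun n ↦ σ (n+2)) σ⁰ :=
    h.sub fun n ↦ if n = 0 then .inl 0 else .inl (n+1)
  have h2 : DF fun σ : ⊙X ↦ Q (fun n ↦ σ (n+3)) σ⁰ :=
    h.sub fun n ↦ if n = 0 then .inl 0 else .inl (n+2)
  refine ⟨DF.congr ⬚ fun σ ↦ eq_bld⟩
  refine @DF.or_ _ _ _ _ ⬚ (@DF.and_ _ _ _ _ (@DF.not_ _ _ _ ⬚) inferInstance)
  · exact @DF.all_ _ _ (fun z σ ↦ z ~ σ 0 ↔ Q σ⇡ z) (@DF.iff_ _ _ _ _ inferInstance h1)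
  · exact @DF.ex_ _ _ (fun s σ ↦ ∀ z, z ~ s ↔ Q σ⇡ z)
     (@DF.all_ _ _ (fun z σ ↦ z ~ σ 0 ↔ Q (fun n ↦ σ (n+2)) z) (@DF.iff_ _ _ _ _ inferInstance h2))
theorem isS_sep (a : X) (Q : X → Prop) [h : DF fun σ ↦ Q σ⁰] : IsS fun z ↦ z ~ a ∧ Q z := by
  rcases h with ⟨k, f, c, h⟩
  obtain ⟨b, hb⟩ := ZFM.sat.sep (E := ZFM.E (X := X)) (f.ren fun i ↦ Sum.elim (ℸ 0) (ℸ i.succ) (c i))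
    (fun i ↦ env (ℸ a) (c i)) a
  refine ⟨b, fun z ↦ (hb z).trans (and_congr_right ℸ ⬚)⟩
  rw [eval_ren]; refine ((h ℸ z).trans (iff_of_eq (congrArg _ (funext fun i ↦ ⬚)))).symm
  rcases hc : c i with n | y <;> simp [env, hc]
theorem isS_img (a : X) (t : X → X) [h : DT fun σ ↦ t σ⁰] : IsS fun z ↦ ∃ k, k ~ a ∧ z = t k := by
  rcases h.df with ⟨k, f, c, h⟩
  have key := ZFM.sat.repl (E := ZFM.E (X := X)) (n := k)
    (f.ren fun i ↦ Sum.elim (fun n ↦ if n = 0 then 1 else 0) (ℸ i.succ.succ) (c i))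
    (fun i ↦ env (ℸ a) (c i)) a
  refine Exists.elim (key ⬚) fun b hb ↦ ⬚
  · intro x _
    refine ⟨t x, ⬚, fun y hy ↦ ⬚⟩
    · simp only []
      rw [eval_ren]
      refine ((h fun n ↦ if n = 0 then t x else x).trans (iff_of_eq (congrArg _ (funext fun i ↦ ⬚))))◜ rfl
      rcases hc : c i with (_ | n) | y <;> simp [env, hc]
    · beta_reduce at hy; rw [eval_ren] at hy
      refine ((h fun n ↦ if n = 0 then y else x).trans (iff_of_eq (congrArg _ (funext fun i ↦ ⬚))))◝ hy
      rcases hc : c i with (_ | n) | y <;> simp [env, hc]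
  · refine ⟨b, fun z ↦ (hb z).trans (exists_congr fun x ↦ and_congr_right ℸ ⬚)⟩
    rw [eval_ren]
    refine ((h fun n ↦ if n = 0 then z else x).trans (iff_of_eq (congrArg _ (funext fun i ↦ ⬚)))).symm
    rcases hc : c i with (_ | n) | y <;> simp [env, hc]
end
section
variable {X : Type} [ZFM X] {a z x y f : X}
def emp : X := bld ℸ False
def upr (x y : X) : X := bld fun z ↦ z = x ∨ z = y
def pr (x y : X) : X := upr (upr x x) (upr x y)
def sUn (x : X) : X := bld fun z ↦ ∃ y, y ~ x ∧ z ~ y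
def un (x y : X) : X := bld fun z ↦ z ~ x ∨ z ~ y
def suc (x : X) : X := bld fun z ↦ z ~ x ∨ z = x
def sep (a : X) (Q : X → Prop) : X := bld fun z ↦ z ~ a ∧ Q z
def img (a : X) (t : X → X) : X := bld fun z ↦ ∃ k, k ~ a ∧ z = t k
def lam (a : X) (t : X → X) : X := bld fun z ↦ ∃ k, k ~ a ∧ z = pr k (t k)
def pow (x : X) : X := bld fun z ↦ ∀ w, w ~ z → w ~ x
def app (f x : X) : X := bld fun z ↦ ∃ y, pr x y ~ f ∧ z ~ y
section
variable {s t u w : ⊠X}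
instance : T2 X upr := ti2 upr (by unfold upr; infer_instance)
instance : T2 X pr := ti2 pr (by unfold pr; infer_instance)
instance : T2 X un := ti2 un (by unfold un; infer_instance)
instance : T1 X sUn := ti1 sUn (by unfold sUn; infer_instance)
instance : T1 X suc := ti1 suc (by unfold suc; infer_instance)
instance : T1 X pow := ti1 pow (by unfold pow; infer_instance)
instance : T2 X app := ti2 app (by unfold app; infer_instance)
instance {Q : ⊙X → X → Prop} [DT s] [DF fun σ ↦ Q σ⇡ σ⁰] :
    DT fun σ ↦ sep (s σ) (Q σ) :=
  have := DT.shift s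
  inferInstanceAs (DT fun σ ↦ bld fun z ↦ z ~ s σ ∧ Q σ z)
instance {F : ⊙X → X → X} [DT s] [h : DT fun σ ↦ F σ⇡ σ⁰] :
    DT fun σ ↦ img (s σ) (F σ) := by
  have h1 : DT fun σ ↦ s fun n ↦ σ (n+1+1) := @DT.shift _ _ _ (DT.shift s)
  have h2 : DF fun σ ↦ σ 1 = F (fun n ↦ σ (n+2)) σ⁰ :=
    h.df.sub fun n ↦ if n = 0 then .inl 1 else if n = 1 then .inl 0 else .inl n
  exact @DT.bld_ _ _ (fun σ z ↦ ∃ k, k ~ s σ ∧ z = F σ k) (@DF.ex_ _ _ (fun k σ ↦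
    k ~ s σ⇡ ∧ σ 0 = F σ⇡ k) (@DF.and_ _ _ _ _ inferInstance h2))
instance {F : ⊙X → X → X} [DT s] [h : DT fun σ ↦ F σ⇡ σ⁰] :
    DT fun σ ↦ lam (s σ) (F σ) :=
  inferInstanceAs (DT fun σ ↦ img (s σ) fun k ↦ pr k (F σ k))
instance {Q : ⊙X → X → Prop} [DT s] [DF fun σ ↦ Q σ⇡ σ⁰] :
    DF fun σ ↦ ∀ z, z ~ s σ → Q σ z :=
  have := DT.shift s
  DF.all_
instance {Q : ⊙X → X → Prop} [DT s] [DF fun σ ↦ Q σ⇡ σ⁰] :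
    DF fun σ ↦ ∃ z, z ~ s σ ∧ Q σ z :=
  have := DT.shift s
  DF.ex_
end
theorem isS_of_sub (a : X) [h : DF fun σ ↦ Q σ⁰] (h : ∀ z, Q z → z ~ a) : IsS Q := by
  have := isS_sep a Q
  rwa [show (fun z ↦ z ~ a ∧ Q z) = Q from funext fun z ↦ propext ⟨fun h ↦ h◝, fun h₀ ↦ ⟨h z h₀, h₀⟩⟩] at this
@[simp] theorem mem_sep [h : DF fun σ ↦ Q σ⁰] :
    z ~ sep a Q ↔ z ~ a ∧ Q z := mem_bld (isS_sep a Q)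
@[simp] theorem mem_upr : z ~ upr x y ↔ z = x ∨ z = y := mem_bld (ZFM.sat.pair x y)
@[simp] theorem mem_img [h : DT fun σ ↦ t σ⁰] :
    z ~ img a t ↔ ∃ k, k ~ a ∧ z = t k := mem_bld (isS_img a t)
@[simp] theorem mem_lam [h : DT fun σ ↦ t σ⁰] :
    z ~ lam a t ↔ ∃ k, k ~ a ∧ z = pr k (t k) := mem_bld (isS_img a fun k ↦ pr k (t k))
@[simp] theorem mem_sUn : z ~ sUn x ↔ ∃ y, y ~ x ∧ z ~ y := mem_bld (ZFM.sat.union x)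
@[simp] theorem mem_pow : z ~ pow x ↔ ∀ w, w ~ z → w ~ x := mem_bld (ZFM.sat.power x)
@[simp] theorem mem_un : z ~ un x y ↔ z ~ x ∨ z ~ y :=
  mem_bld ⟨sUn (upr x y), fun z ↦ by simp⟩
@[simp] theorem mem_suc : z ~ suc x ↔ z ~ x ∨ z = x :=
  mem_bld ⟨un x (upr x x), fun z ↦ by simp⟩
@[simp] theorem mem_emp : ¬ z ~ emp := by
  unfold emp; by_cases h : IsS fun _ : X ↦ False
  · rw [mem_bld h]; simp
  · exact bld_not h
@[simp] theorem upr_inj : upr x x = upr y y ↔ x = y := by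
  constructor
  · intro h; have : x ~ upr y y := h ▸ (by simp); simpa using this
  · rintro rfl; rfl
@[simp] theorem pr_inj : pr x y = pr x₀ y₀ ↔ x = x₀ ∧ y = y₀ := by
  constructor
  · intro h
    have h1 : ∀ z, z ~ pr x y ↔ z ~ pr x₀ y₀ := fun z ↦ by rw [h]
    simp only [pr, mem_upr] at h1
    have hx : x = x₀ := by
      rcases (h1 (upr x x))◜ (◁ rfl) with h | h
      · exact upr_inj◜ h
      · have : x₀ ~ upr x x := h ▸ (by simp)
        exact (by simpa using this : x₀ = x).symm
    subst hx
    refine ⟨rfl, ⬚⟩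
    have e1 : y ~ upr x x ∨ y ~ upr x y₀ := by
      rcases (h1 (upr x y))◜ (▷ rfl) with h | h
      · exact ◁ (h ▸ (by simp))
      · exact ▷ (h ▸ (by simp))
    have e2 : y₀ ~ upr x x ∨ y₀ ~ upr x y := by
      rcases (h1 (upr x y₀))◝ (▷ rfl) with h | h
      · exact ◁ (h ▸ (by simp))
      · exact ▷ (h ▸ (by simp))
    simp at e1 e2; grind
  · rintro ⟨rfl, rfl⟩; rfl
theorem kp : IsKPair ∊ p x y ↔ p = pr x y := by
  have e : ∀ q a b : X, IsUPair ∊ q a b ↔ q = upr a b := fun q a b ↦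
    ⟨fun h ↦ zext fun z ↦ by rw [h z]; simp, fun h z ↦ by rw [h]; simp⟩
  simp only [IsKPair, e, pr]
  constructor
  · rintro ⟨_, _, rfl, rfl, rfl⟩; rfl
  · rintro rfl; exact ⟨_, _, rfl, rfl, rfl⟩
theorem pin : PairIn ∊ f x y ↔ pr x y ~ f := by
  simp only [PairIn, kp]
  exact ⟨fun ⟨_, h, e⟩ ↦ e ▸ h, fun h ↦ ⟨_, h, rfl⟩⟩
def Fn (f a : X) : Prop := (∀ p, p ~ f → ∃ x y, x ~ a ∧ p = pr x y) ∧ ∀ x, x ~ a → ∃! y, pr x y ~ f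
theorem fn_iff : IsFuncOn ∊ f a ↔ Fn f a := by
  simp only [IsFuncOn, IsFunc, Fn, kp, pin]
  constructor
  · rintro ⟨⟨h1, h2⟩, h3⟩
    refine ⟨fun p hp ↦ ⬚, fun x hx ↦ ⬚⟩
    · rcases h1 p hp with ⟨x, y, rfl⟩; exact ⟨x, y, (h3 x)◜ ⟨y, hp⟩, rfl⟩
    · rcases (h3 x)◝ hx with ⟨y, hy⟩; exact ⟨y, hy, fun z hz ↦ h2 _ _ _ hz hy⟩
  · rintro ⟨h1, h2⟩
    have h3 : ∀ x y, pr x y ~ f → x ~ a := fun x y h ↦ by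
      rcases h1 _ h with ⟨x₀, y₀, h₀, e⟩; simp at e; rw [e◜]; exact h₀
    refine ⟨⟨fun p hp ↦ ⬚, fun x y y₀ h h₀ ↦ ⬚⟩, fun x ↦ ⟨fun ⟨y, hy⟩ ↦ h3 _ _ hy, fun h ↦ (h2 x h).exists⟩⟩
    · rcases h1 p hp with ⟨x, y, _, rfl⟩; exact ⟨x, y, rfl⟩
    · exact (h2 x (h3 _ _ h)).unique h h₀
theorem app_eq (hf : Fn f a) (h : pr x y ~ f) : app f x = y := by
  rcases hf◜ _ h with ⟨x₀, y₀, hx, e⟩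
  simp at e; obtain ⟨rfl, rfl⟩ := e
  exact bld_eq fun z ↦ ⟨fun hz ↦ ⟨_, h, hz⟩, fun ⟨y₀, h₀, hz⟩ ↦ (hf◝ _ hx).unique h₀ h ▸ hz⟩
theorem Fn.mem (hf : Fn f a) : pr x y ~ f ↔ x ~ a ∧ y = app f x := by
  constructor
  · intro h
    rcases hf◜ _ h with ⟨x₀, y₀, hx, e⟩
    simp at e; obtain ⟨rfl, rfl⟩ := e
    exact ⟨hx, (app_eq hf h).symm⟩
  · rintro ⟨h, rfl⟩
    rcases hf◝ x h with ⟨y, hy, _⟩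
    rwa [app_eq hf hy]
theorem Fn.ext (hf : Fn f a) (hg : Fn g a) (h : ∀ x, x ~ a → app f x = app g x) : f = g := by
  refine zext fun p ↦ ⟨fun hp ↦ ⬚, fun hp ↦ ⬚⟩
  · rcases hf◜ _ hp with ⟨x, y, hx, rfl⟩
    rw [hg.mem, ← h x hx]; exact (hf.mem)◜ hp
  · rcases hg◜ _ hp with ⟨x, y, hx, rfl⟩
    rw [hf.mem, h x hx]; exact (hg.mem)◜ hp
theorem fn_lam [h : DT fun σ ↦ t σ⁰] : Fn (lam a t) a := by
  refine ⟨fun p hp ↦ ⬚, fun x hx ↦ ⟨t x, by simpa using hx, fun y hy ↦ ⬚⟩⟩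
  · simp at hp; rcases hp with ⟨k, hk, rfl⟩; exact ⟨k, _, hk, rfl⟩
  · simp at hy; rcases hy with ⟨k, hk, rfl, rfl⟩; rfl
theorem app_lam [h : DT fun σ ↦ t σ⁰] (hx : x ~ a) : app (lam a t) x = t x :=
  app_eq fn_lam (by simpa using hx)
end
section
variable {X : Type} [ZFM X]
theorem lam_congr {a : X} {t t₀ : X → X} [DT fun σ ↦ t σ⁰] [DT fun σ ↦ t₀ σ⁰]
    (h : ∀ x, x ~ a → t x = t₀ x) : lam a t = lam a t₀ :=
  fn_lam.ext fn_lam fun x hx ↦ by rw [app_lam hx, app_lam hx, h x hx]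
def prd (S : X → X → X → Prop) (p x : X) : X := bld fun z ↦ S p z x
def Att (S : X → X → X → Prop) (G : X → X → X → X) (p A f : X) : Prop :=
  (∀ y, y ~ A → ∀ z, S p z y → z ~ A) ∧ Fn f A ∧
    ∀ y, y ~ A → app f y = G p y (lam (prd S p y) fun z ↦ app f z)
def rec₀ (S : X → X → X → Prop) (G : X → X → X → X) (p x : X) : X :=
  bld fun w ↦ ∃ A f, Att S G p A f ∧ x ~ A ∧ w ~ app f x
section
variable {s t u w : ⊠X}
instance : F2 X Fn := fi2 Fn (by unfold Fn ExistsUnique; infer_instance)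
variable {S : X → X → X → Prop} [hS : DF fun σ ↦ S σ⁰ σ¹ σ²]
  {G : X → X → X → X} [hG : DT fun σ ↦ G σ⁰ σ¹ σ²]
instance prd_dt [DT s] [DT t] : DT fun σ ↦ prd S (s σ) (t σ) := by
  have : ∀ s t u [DT s] [DT t] [DT u], DF fun σ ↦ S (s σ) (t σ) (u σ) := fun s t u ↦ df3 S s t u
  exact @dt2 _ _ (prd S) (by unfold prd; infer_instance) _ _ _ _
instance rec_dt [DT s] [DT t] : DT fun σ ↦ rec₀ S G (s σ) (t σ) := by
  have : ∀ s t u [DT s] [DT t] [DT u], DF fun σ ↦ S (s σ) (t σ) (u σ) := fun s t u ↦ df3 S s t u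
  have : ∀ s t u [DT s] [DT t] [DT u], DT fun σ ↦ G (s σ) (t σ) (u σ) := fun s t u ↦ dt3 G s t u
  exact @dt2 _ _ (rec₀ S G) (by unfold rec₀ Att; infer_instance) _ _ _ _
theorem sind {S : X → X → Prop} [hS : DF fun σ ↦ S σ⁰ σ¹]
    (hc : ∀ x, ∃ A, x ~ A ∧ ∀ y, y ~ A → ∀ z, S z y → z ~ A)
    (hw : ∀ A, (∃ x, x ~ A) → ∃ y, y ~ A ∧ ∀ z, z ~ A → ¬ S z y)
    (Q : X → Prop) [DF fun σ ↦ Q σ⁰] (h : ∀ x, (∀ z, S z x → Q z) → Q x) (x : X) : Q x := by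
  by_contra hx
  rcases hc x with ⟨A, hA, hA₀⟩
  obtain ⟨y, hy, hy₀⟩ := hw (sep A fun z ↦ ¬ Q z) ⟨x, by simp [hA, hx]⟩
  simp at hy hy₀
  refine hy◝ (h y fun z hz ↦ ⬚)
  by_contra hq
  exact hy₀ z (hA₀ _ hy◜ _ hz) hq hz
theorem rec_eq {p : X}
    (hc : ∀ x, ∃ A, x ~ A ∧ ∀ y, y ~ A → ∀ z, S p z y → z ~ A)
    (hw : ∀ A, (∃ x, x ~ A) → ∃ y, y ~ A ∧ ∀ z, z ~ A → ¬ S p z y) (x : X) :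
    rec₀ S G p x = G p x (lam (prd S p x) fun z ↦ rec₀ S G p z) := by
  have i1 : ∀ s t u [DT s] [DT t] [DT u], DF fun σ ↦ S (s σ) (t σ) (u σ) := fun s t u ↦ df3 S s t u
  have i2 : ∀ s t u [DT s] [DT t] [DT u], DT fun σ ↦ G (s σ) (t σ) (u σ) := fun s t u ↦ dt3 G s t u
  have hp : ∀ y z, z ~ prd S p y ↔ S p z y := fun y z ↦ by
    rcases hc y with ⟨A, hA, hA₀⟩
    exact mem_bld (isS_of_sub A fun z hz ↦ hA₀ _ hA _ hz)
  have uniq : ∀ A f A₀ f₀, Att S G p A f → Att S G p A₀ f₀ → ∀ y, y ~ A ∧ y ~ A₀ → app f y = app f₀ y := by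
    intro A f A₀ f₀ h h₀
    refine sind hc hw (fun y ↦ y ~ A ∧ y ~ A₀ → app f y = app f₀ y) fun y ih hy ↦ ⬚
    rw [h◝◝ y hy◜, h₀◝◝ y hy◝]
    refine congrArg _ (lam_congr fun z hz ↦ ⬚)
    rw [hp] at hz
    exact ih z hz ⟨h◜ _ hy◜ _ hz, h₀◜ _ hy◝ _ hz⟩
  have val : ∀ A f y, Att S G p A f → y ~ A → rec₀ S G p y = app f y := fun A f y h hy ↦
    bld_eq fun w ↦ ⟨fun hw ↦ ⟨A, f, h, hy, hw⟩, fun ⟨A₀, f₀, h₀, hy₀, hw⟩ ↦ by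
      rwa [uniq _ _ _ _ h h₀ y ⟨hy, hy₀⟩]⟩
  have L1 : ∀ A f y, Att S G p A f → y ~ A →
      rec₀ S G p y = G p y (lam (prd S p y) fun z ↦ rec₀ S G p z) := fun A f y h hy ↦ by
    rw [val A f y h hy, h◝◝ y hy]
    refine congrArg _ (lam_congr fun z hz ↦ (val A f z h (h◜ _ hy _ ((hp _ _)◜ hz))).symm)
  have dA : ∀ s t [DT s] [DT t], DF fun σ ↦ Att S G p (s σ) (t σ) := fun s t _ _ ↦
    @df2 _ _ (Att S G p) (by unfold Att; infer_instance) _ _ _ _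
  have ex : ∀ x, ∃ A f, Att S G p A f ∧ x ~ A := by
    refine sind hc hw (fun x ↦ ∃ A f, Att S G p A f ∧ x ~ A) fun y ih ↦ ⬚
    rcases hc y with ⟨A0, hA0, hA0₀⟩
    let A2 := sep A0 fun z ↦ z = y ∨ ∃ A f, Att S G p A f ∧ z ~ A
    have hA2 : ∀ z, z ~ A2 ↔ z ~ A0 ∧ (z = y ∨ ∃ A f, Att S G p A f ∧ z ~ A) := fun z ↦ mem_sep
    have key : ∀ v, v ~ A2 → ∀ z, S p z v → z ~ A0 ∧ ∃ A f, Att S G p A f ∧ z ~ A := by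
      intro v hv z hz
      rw [hA2] at hv
      refine ⟨hA0₀ _ hv◜ _ hz, ⬚⟩
      rcases hv◝ with rfl | ⟨A, f, h, hv₀⟩
      · exact ih z hz
      · exact ⟨A, f, h, h◜ _ hv₀ _ hz⟩
    refine ⟨A2, lam A2 fun z ↦ G p z (lam (prd S p z) fun z ↦ rec₀ S G p z),
      ⟨fun v hv z hz ↦ (hA2 z)◝ ⟨(key v hv z hz)◜, ▷ (key v hv z hz)◝⟩, fn_lam, fun v hv ↦ ⬚⟩,
      (hA2 y)◝ ⟨hA0, ◁ rfl⟩⟩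
    rw [app_lam hv]
    refine congrArg _ (lam_congr fun z hz ↦ ⬚)
    rw [hp] at hz
    rcases key v hv z hz with ⟨h1, A, f, h2, h3⟩
    rw [app_lam ((hA2 z)◝ ⟨h1, ▷ ⟨A, f, h2, h3⟩⟩)]
    exact L1 A f z h2 h3
  rcases ex x with ⟨A, f, h, hx⟩
  exact L1 A f x h hx
end
end
section
variable {X : Type} [ZFM X] {x y z a b p : X}
theorem fnd {Q : X} (h : ∃ x, x ~ Q) : ∃ y, y ~ Q ∧ ∀ z, z ~ Q → ¬ z ~ y := by
  rcases ZFM.sat.found Q h with ⟨y, h1, h2⟩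
  exact ⟨y, h1, fun z h3 h4 ↦ h2 z h4 h3⟩
theorem nm3 (h1 : x ~ y) (h2 : y ~ z) (h3 : z ~ x) : False := by
  obtain ⟨w, h, h₀⟩ := fnd (Q := un (upr x y) (upr z z)) ⟨x, by simp⟩
  simp at h h₀
  rcases h with (rfl | rfl) | rfl
  · exact h₀ z (by simp) h3
  · exact h₀ x (by simp) h1
  · exact h₀ y (by simp) h2
theorem nm2 (h1 : x ~ y) (h2 : y ~ x) : False := by
  obtain ⟨w, h, h₀⟩ := fnd (Q := upr x y) ⟨x, by simp⟩
  simp at h h₀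
  rcases h with rfl | rfl
  · exact h₀◝ h2
  · exact h₀◜ h1
@[simp] theorem nm1 : ¬ x ~ x := fun h ↦ nm2 h h
abbrev Od (x : X) : Prop := IsOrd ∊ x
section
variable {s t u w : ⊠X}
instance : F1 X (IsOrd ∊) := fi1 (IsOrd ∊) (by unfold IsOrd TransSet SubsetE; infer_instance)
instance : F2 X (IsSuccOf ∊) := fi2 (IsSuccOf ∊) (by unfold IsSuccOf; infer_instance)
instance : F1 X (IsLimitOrd ∊) := fi1 (IsLimitOrd ∊) (by unfold IsLimitOrd; infer_instance)
end
theorem Od.mem (h : Od a) (hb : b ~ a) : Od b := by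
  refine ⟨fun z hz w hw ↦ ⬚, fun y z hy hz ↦ h◝ y z (h◜ b hb y hy) (h◜ b hb z hz)⟩
  rcases h◝ w b (h◜ z (h◜ b hb z hz) w hw) hb with h | rfl | h
  · exact h
  · exact (nm2 hw hz).elim
  · exact (nm3 h hw hz).elim
theorem Od.tr (h : Od a) (hb : b ~ a) (hc : c ~ b) : c ~ a := h◜ b hb c hc
theorem oind (Q : X → Prop) [DF fun σ ↦ Q σ⁰] (h : ∀ a, Od a → (∀ b, b ~ a → Q b) → Q a)
    (a : X) (ha : Od a) : Q a := by
  by_contra hn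
  obtain ⟨y, hy, hy₀⟩ := fnd (Q := sep (suc a) fun z ↦ ¬ Q z) ⟨a, by simp [hn]⟩
  simp at hy hy₀
  have hyo : Od y := by rcases hy◜ with h | rfl; exacts [ha.mem h, ha]
  refine hy◝ (h y hyo fun b hb ↦ ⬚)
  by_contra hq
  refine hy₀ b (◁ ⬚) hq hb
  rcases hy◜ with h | rfl; exacts [ha.tr h hb, hb]
theorem oleast (Q : X → Prop) [DF fun σ ↦ Q σ⁰] (h : ∃ a, Od a ∧ Q a) :
    ∃ a, Od a ∧ Q a ∧ ∀ b, b ~ a → ¬ Q b := by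
  by_contra hn
  push Not at hn
  rcases h with ⟨a, ha, hq⟩
  refine oind (fun a ↦ ¬ Q a) (fun a ha ih hq ↦ ⬚) a ha hq
  rcases hn a ha hq with ⟨b, hb, hb₀⟩
  exact ih b hb hb₀
theorem Od.tri (ha : Od a) (hb : Od b) : a ~ b ∨ a = b ∨ b ~ a := by
  refine oind (fun a ↦ ∀ b, Od b → a ~ b ∨ a = b ∨ b ~ a) (fun a ha ih ↦ ⬚) a ha b hb
  refine oind (fun b ↦ a ~ b ∨ a = b ∨ b ~ a) fun b hb ih₀ ↦ ⬚
  by_cases h1 : ∃ c, c ~ a ∧ (c = b ∨ b ~ c)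
  · rcases h1 with ⟨c, hc, rfl | h⟩
    · exact ▷ (▷ hc)
    · exact ▷ (▷ (ha.tr hc h))
  by_cases h2 : ∃ c, c ~ b ∧ (a = c ∨ a ~ c)
  · rcases h2 with ⟨c, hc, rfl | h⟩
    · exact ◁ hc
    · exact ◁ (hb.tr hc h)
  push Not at h1 h2
  refine ▷ (◁ (zext fun z ↦ ⟨fun hz ↦ ⬚, fun hz ↦ ⬚⟩))
  · have := ih z hz b hb; have := h1 z hz; tauto
  · have := ih₀ z hz; have := h2 z hz; tauto
theorem Od.sucO (h : Od a) : Od (suc a) := by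
  refine ⟨fun y hy z hz ↦ ⬚, fun y z hy hz ↦ ⬚⟩
  · simp at hy ⊢; rcases hy with hy | rfl; exacts [◁ (h.tr hy hz), ◁ hz]
  · simp at hy hz
    have : Od y := by rcases hy with hy | rfl; exacts [h.mem hy, h]
    have : Od z := by rcases hz with hy | rfl; exacts [h.mem hy, h]
    exact Od.tri ‹_› ‹_›
theorem Od_emp : Od (emp : X) := ⟨fun y hy ↦ by simp at hy, fun y z hy ↦ by simp at hy⟩
theorem Od.sUnO (h : ∀ x, x ~ a → Od x) : Od (sUn a) := by
  refine ⟨fun y hy z hz ↦ ⬚, fun y z hy hz ↦ ⬚⟩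
  · simp at hy ⊢; rcases hy with ⟨w, h1, h2⟩; exact ⟨w, h1, (h w h1).tr h2 hz⟩
  · simp at hy hz
    rcases hy with ⟨w, h1, h2⟩; obtain ⟨w₀, h1₀, h2₀⟩ := hz
    exact ((h w h1).mem h2).tri ((h _ h1₀).mem h2₀)
theorem succ_iff : IsSuccOf ∊ x s ↔ s = suc x :=
  ⟨fun h ↦ zext fun z ↦ by rw [h z]; simp, fun h z ↦ by rw [h]; simp⟩
theorem zero_iff : IsZero ∊ x ↔ x = emp :=
  ⟨fun h ↦ zext fun z ↦ by simp [h◝ z], fun h ↦ h ▸ ⟨Od_emp, fun y ↦ by simp⟩⟩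
theorem lim_iff : IsLimitOrd ∊ x ↔ Od x ∧ (∃ y, y ~ x) ∧ ∀ y, y ~ x → suc y ~ x := by
  simp only [IsLimitOrd, succ_iff]; simp
theorem emp_or : x = emp ∨ ∃ y, y ~ x := by
  by_cases h : ∃ y, y ~ x
  · exact ▷ h
  · exact ◁ (zext fun z ↦ by push Not at h; simp [h])
theorem Od.suc_le (h : Od a) (hb : b ~ a) : suc b ~ a ∨ suc b = a := by
  rcases (h.mem hb).sucO.tri h with h₀ | h₀ | h₀
  · exact ◁ h₀
  · exact ▷ h₀
  · simp at h₀; rcases h₀ with h₀ | rfl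
    · exact (nm2 h₀ hb).elim
    · exact (nm1 hb).elim
theorem Od.cases (h : Od a) : a = emp ∨ (∃ b, Od b ∧ a = suc b) ∨ IsLimitOrd ∊ a := by
  rcases emp_or (x := a) with h0 | h0
  · exact ◁ h0
  refine ▷ ⬚
  by_cases h1 : ∃ b, b ~ a ∧ suc b = a
  · rcases h1 with ⟨b, hb, e⟩; exact ◁ ⟨b, h.mem hb, e.symm⟩
  · push Not at h1
    exact ▷ (lim_iff◝ ⟨h, h0, fun y hy ↦ (h.suc_le hy).resolve_right (h1 y hy)⟩)
theorem Od.le_of (ha : Od a) (hb : Od b) (h : ∀ z, z ~ a → z ~ b) : a ~ b ∨ a = b := by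
  rcases ha.tri hb with h₀ | h₀ | h₀
  · exact ◁ h₀
  · exact ▷ h₀
  · exact (nm1 (h _ h₀)).elim
theorem no_all_ord {w : X} (h : ∀ a, Od a → a ~ w) : False := by
  have : Od (sep w Od) := ⟨fun y hy z hz ↦ by simp at hy ⊢; exact ⟨h _ (hy◝.mem hz), hy◝.mem hz⟩,
    fun y z hy hz ↦ by simp at hy hz; exact hy◝.tri hz◝⟩
  exact nm1 (x := sep w Od) (by rw [mem_sep]; exact ⟨h _ this, this⟩)
def mn (Q : X → Prop) : X :=
  bld fun z ↦ Od z ∧ (∃ a, Od a ∧ Q a) ∧ ∀ a, Od a → Q a → z ~ a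
instance {Q : ⊙X → X → Prop} [h : DF fun σ ↦ Q σ⇡ σ⁰] :
    DT fun σ ↦ mn (Q σ) := by
  have h1 : DF fun σ : ⊙X ↦ Q (fun n ↦ σ (n+1+1)) σ⁰ :=
    h.sub fun n ↦ if n = 0 then .inl 0 else .inl (n+1)
  unfold mn; infer_instance
theorem mn_spec {Q : X → Prop} [DF fun σ ↦ Q σ⁰] (h : ∃ a, Od a ∧ Q a) :
    Od (mn Q) ∧ Q (mn Q) ∧ ∀ a, Od a → Q a → mn Q ~ a ∨ mn Q = a := by
  rcases oleast Q h with ⟨a, ha, hq, hl⟩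
  have hl₀ : ∀ b, Od b → Q b → a ~ b ∨ a = b := fun b hb hb₀ ↦ by
    rcases ha.tri hb with h | h | h
    · exact ◁ h
    · exact ▷ h
    · exact (hl b h hb₀).elim
  have : mn Q = a := bld_eq fun z ↦ ⟨fun hz ↦ ⟨ha.mem hz, h, fun b hb hb₀ ↦ by
    rcases hl₀ b hb hb₀ with h | rfl; exacts [hb.tr h hz, hz]⟩, fun hz ↦ hz◝◝ a ha hq⟩
  rw [this]; exact ⟨ha, hq, hl₀⟩
theorem ex_lim : ∃ w : X, IsLimitOrd ∊ w := by
  by_contra hn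
  rcases ZFM.sat.infty (E := ZFM.E (X := X)) with ⟨w, ⟨z, hz, hz₀⟩, hw⟩
  have e : z = emp := zext fun u ↦ by simp; exact hz₀ u
  subst e
  refine no_all_ord (w := w) (oind (fun a ↦ a ~ w) fun a ha ih ↦ ⬚)
  rcases ha.cases with rfl | ⟨b, hb, rfl⟩ | h
  · exact hz
  · rcases hw b (ih b (by simp)) with ⟨s, h1, h2⟩
    rwa [show suc b = s from (succ_iff◜ h2).symm]
  · exact (hn ⟨a, h⟩).elim
def om : X := mn fun a ↦ IsLimitOrd ∊ a
theorem om_spec : IsLimitOrd ∊ (om : X) ∧ ∀ a : X, IsLimitOrd ∊ a → om ~ a ∨ om = a := by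
  have := mn_spec (Q := fun a : X ↦ IsLimitOrd ∊ a) (ex_lim.imp fun a h ↦ ⟨h◜, h⟩)
  exact ⟨this◝◜, fun a h ↦ this◝◝ a h◜ h⟩
theorem om_lim : Od (om : X) ∧ (∃ y : X, y ~ om) ∧ ∀ y : X, y ~ om → suc y ~ om := lim_iff◜ om_spec◜
theorem emp_om : (emp : X) ~ om := by
  rcases Od_emp.tri (om_lim (X := X))◜ with h | h | h
  · exact h
  · rcases (om_lim (X := X))◝◜ with ⟨y, hy⟩; rw [← h] at hy; simp at hy
  · simp at h
def OS (_p z y : X) : Prop := Od y ∧ z ~ y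
instance : DF fun σ : ⊙X ↦ OS σ⁰ σ¹ σ² := by unfold OS; infer_instance
def orec (G : X → X → X → X) (p x : X) : X := rec₀ OS G p x
instance {G : X → X → X → X} [hG : DT fun σ ↦ G σ⁰ σ¹ σ²] {s t : ⊠X} [DT s] [DT t] :
    DT fun σ ↦ orec G (s σ) (t σ) := by unfold orec; infer_instance
theorem orec_eq [hG : DT fun σ ↦ G σ⁰ σ¹ σ²] (ha : Od a) :
    orec G p a = G p a (lam a fun z ↦ orec G p z) := by
  unfold orec
  rw [rec_eq]
  · congr 2; exact bld_eq fun z ↦ ⟨fun h ↦ ⟨ha, h⟩, fun h ↦ h◝⟩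
  · intro x
    by_cases hx : Od x
    · refine ⟨suc x, by simp, fun y hy z hz ↦ ⬚⟩
      simp at hy ⊢; left
      rcases hy with hy | rfl; exacts [hx.tr hy hz◝, hz◝]
    · refine ⟨upr x x, by simp, fun y hy z hz ↦ ⬚⟩
      simp at hy; subst hy; exact (hx hz◜).elim
  · intro A hA
    rcases fnd hA with ⟨y, h1, h2⟩
    exact ⟨y, h1, fun z hz h ↦ h2 z hz h◝⟩
def tcG (p _a f : X) : X := bld fun z ↦ z ~ p ∨ ∃ n y w, pr n y ~ f ∧ w ~ y ∧ z ~ w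
instance : DT fun σ : ⊙X ↦ tcG σ⁰ σ¹ σ² := by unfold tcG; infer_instance
theorem tc_mem (ha : Od a) : z ~ orec tcG p a ↔
    z ~ p ∨ ∃ n, n ~ a ∧ ∃ w, w ~ orec tcG p n ∧ z ~ w := by
  rw [orec_eq ha, tcG, mem_bld]
  · simp only [mem_lam, pr_inj]; refine or_congr Iff.rfl ⬚
    constructor
    · rintro ⟨n, y, w, ⟨k, hk, rfl, rfl⟩, h⟩; exact ⟨n, hk, w, h⟩
    · rintro ⟨n, hn, w, h⟩; exact ⟨n, _, w, ⟨n, hn, rfl, rfl⟩, h⟩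
  · refine isS_of_sub (un p (sUn (sUn (img a fun n ↦ orec tcG p n)))) fun z hz ↦ ⬚
    simp only [mem_lam, pr_inj, mem_un, mem_sUn, mem_img] at hz ⊢
    refine hz.imp id ⬚
    rintro ⟨n, y, w, ⟨k, hk, rfl, rfl⟩, h⟩; exact ⟨w, ⟨_, ⟨n, hk, rfl⟩, h◜⟩, h◝⟩
def tc (x : X) : X := orec tcG x om
instance : T1 X tc := by unfold tc; infer_instance
theorem tc_sub (h : z ~ x) : z ~ tc x := (tc_mem om_lim◜)◝ (◁ h)
theorem tc_tr (h : y ~ tc x) (hz : z ~ y) : z ~ tc x := by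
  have h₀ := (tc_mem om_lim◜)◜ h
  refine (tc_mem om_lim◜)◝ (▷ ⬚)
  rcases h₀ with h₀ | ⟨n, hn, w, h1, h2⟩
  · exact ⟨emp, emp_om, y, (tc_mem Od_emp)◝ (◁ h₀), hz⟩
  · exact ⟨suc n, om_lim◝◝ n hn, y, (tc_mem (om_lim◜.mem hn).sucO)◝ (▷ ⟨n, by simp, w, h1, h2⟩), hz⟩
theorem tc_least (hx : ∀ z, z ~ x → z ~ t) (ht : ∀ y, y ~ t → ∀ z, z ~ y → z ~ t)
    (hz : z ~ tc x) : z ~ t := by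
  refine oind (fun a ↦ ∀ z, z ~ orec tcG x a → z ~ t) (fun a ha ih z hz ↦ ⬚) om om_lim◜ z hz
  rcases (tc_mem ha)◜ hz with h | ⟨n, hn, w, h1, h2⟩
  · exact hx z h
  · exact ht _ (ih n hn w h1) _ h2
theorem mind (Q : X → Prop) [DF fun σ ↦ Q σ⁰] (h : ∀ x, (∀ z, z ~ x → Q z) → Q x) (x : X) : Q x :=
  sind (S := fun z x ↦ z ~ x) (fun x ↦ ⟨un (tc x) (upr x x), by simp, fun y hy z hz ↦ by
    simp at hy ⊢; left; rcases hy with hy | rfl; exacts [tc_tr hy hz, tc_sub hz]⟩) (fun _ h ↦ fnd h) Q h x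
def VG (_p _a f : X) : X := bld fun z ↦ ∃ n y, pr n y ~ f ∧ ∀ w, w ~ z → w ~ y
instance : DT fun σ : ⊙X ↦ VG σ⁰ σ¹ σ² := by unfold VG; infer_instance
def Vs (a : X) : X := orec VG emp a
instance : T1 X Vs := by unfold Vs; infer_instance
theorem mem_Vs (ha : Od a) : z ~ Vs a ↔ ∃ n, n ~ a ∧ ∀ w, w ~ z → w ~ Vs n := by
  unfold Vs
  rw [orec_eq ha, VG, mem_bld]
  · simp only [mem_lam, pr_inj]
    constructor
    · rintro ⟨n, y, ⟨k, hk, rfl, rfl⟩, h⟩; exact ⟨n, hk, h⟩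
    · rintro ⟨n, hn, h⟩; exact ⟨n, _, ⟨n, hn, rfl, rfl⟩, h⟩
  · refine isS_of_sub (sUn (img a fun n ↦ pow (orec VG emp n))) fun z hz ↦ ⬚
    simp only [mem_lam, pr_inj, mem_sUn, mem_img] at hz ⊢
    rcases hz with ⟨n, y, ⟨k, hk, rfl, rfl⟩, h⟩; exact ⟨_, ⟨n, hk, rfl⟩, mem_pow◝ h⟩
theorem Vs_mono (ha : Od a) (hb : Od b) (h : ∀ z, z ~ a → z ~ b) (hx : x ~ Vs a) : x ~ Vs b := by
  rw [mem_Vs ha] at hx; rw [mem_Vs hb]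
  rcases hx with ⟨n, hn, h₀⟩; exact ⟨n, h n hn, h₀⟩
theorem Vs_tr (ha : Od a) (hx : x ~ Vs a) (hy : y ~ x) : y ~ Vs a := by
  rcases (mem_Vs ha)◜ hx with ⟨n, hn, h⟩
  exact Vs_mono (ha.mem hn) ha (fun z hz ↦ ha.tr hn hz) (h y hy)
theorem Vs_suc (ha : Od a) : x ~ Vs (suc a) ↔ ∀ w, w ~ x → w ~ Vs a := by
  rw [mem_Vs ha.sucO]
  constructor
  · rintro ⟨n, hn, h⟩ w hw
    simp at hn; rcases hn with hn | rfl
    · exact Vs_mono (ha.mem hn) ha (fun z hz ↦ ha.tr hn hz) (h w hw)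
    · exact h w hw
  · exact fun h ↦ ⟨a, by simp, h⟩
def rk (x : X) : X := mn fun a ↦ ∀ w, w ~ x → w ~ Vs a
instance : T1 X rk := ti1 rk (by unfold rk; infer_instance)
theorem rk_spec (x : X) : Od (rk x) ∧ (∀ w, w ~ x → w ~ Vs (rk x)) ∧
    ∀ a, Od a → (∀ w, w ~ x → w ~ Vs a) → rk x ~ a ∨ rk x = a := by
  refine mn_spec (Q := fun a ↦ ∀ w, w ~ x → w ~ Vs a) ⬚
  refine mind (fun x ↦ ∃ a, Od a ∧ ∀ w, w ~ x → w ~ Vs a) (fun x ih ↦ ⬚) x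
  have key : ∀ y, y ~ x → Od (rk y) ∧ ∀ w, w ~ y → w ~ Vs (rk y) := fun y hy ↦
    have := mn_spec (ih y hy); ⟨this◜, this◝◜⟩
  have ho : Od (sUn (img x fun y ↦ suc (rk y))) := Od.sUnO fun z hz ↦ by
    simp at hz; rcases hz with ⟨k, hk, rfl⟩; exact (key k hk)◜.sucO
  refine ⟨_, ho, fun y hy ↦ ⬚⟩
  refine Vs_mono (key y hy)◜.sucO ho (fun z hz ↦ ⬚) ((Vs_suc (key y hy)◜)◝ (key y hy)◝)
  rw [mem_sUn]; exact ⟨_, mem_img◝ ⟨y, hy, rfl⟩, hz⟩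
theorem rk_od (x : X) : Od (rk x) := (rk_spec x)◜
theorem in_V (x : X) : x ~ Vs (suc (rk x)) := (Vs_suc (rk_od x))◝ (rk_spec x)◝◜
theorem rk_lt (h : x ~ y) : rk x ~ rk y := by
  rcases (mem_Vs (rk_od y))◜ ((rk_spec y)◝◜ x h) with ⟨n, hn, h₀⟩
  rcases (rk_spec x)◝◝ n ((rk_od y).mem hn) h₀ with h | h
  · exact (rk_od y).tr hn h
  · rwa [h]
theorem coll (a : X) (R : X → X → Prop) [h : DF fun σ ↦ R σ⁰ σ¹] (ha : ∀ x, x ~ a → ∃ y, R x y) :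
    ∃ b, ∀ x, x ~ a → ∃ y, y ~ b ∧ R x y := by
  have : ∀ s t [DT s] [DT t], DF fun σ ↦ R (s σ) (t σ) := fun s t ↦ df2 R s t
  have key : ∀ x, x ~ a → _ := fun x hx ↦ mn_spec (Q := fun a ↦ ∃ y, y ~ Vs a ∧ R x y) (by
    rcases ha x hx with ⟨y, hy⟩; exact ⟨_, (rk_od y).sucO, y, in_V y, hy⟩)
  let F := img a fun x ↦ Vs (mn fun a ↦ ∃ y, y ~ Vs a ∧ R x y)
  refine ⟨sUn F, fun x hx ↦ ⬚⟩
  rcases (key x hx)◝◜ with ⟨y, h1, h2⟩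
  exact ⟨y, mem_sUn◝ ⟨_, mem_img◝ ⟨x, hx, rfl⟩, h1⟩, h2⟩
end
section
variable {X : Type} [ZFM X] {x y a b Y p c k q s t : X}
def ite₀ (Q : Prop) (x y : X) : X := bld fun z ↦ (Q ∧ z ~ x) ∨ (¬ Q ∧ z ~ y)
theorem ite_pos (h : Q) : ite₀ Q x y = x := bld_eq fun z ↦ by simp [h]
theorem ite_neg (h : ¬ Q) : ite₀ Q x y = y := bld_eq fun z ↦ by simp [h]
instance {Q : ⊙X → Prop} {s t : ⊠X} [h : DF Q] [DT s] [DT t] :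
    DT fun σ ↦ ite₀ (Q σ) (s σ) (t σ) :=
  have : DF fun σ : ⊙X ↦ Q σ⇡ := h.sub fun n ↦ .inl (n+1)
  have := DT.shift s
  have := DT.shift t
  inferInstanceAs (DT fun σ ↦ bld fun z ↦ (Q σ ∧ z ~ s σ) ∨ (¬ Q σ ∧ z ~ t σ))
def fns (a b : X) : X := bld fun f ↦ Fn f a ∧ ∀ x, x ~ a → app f x ~ b
instance : T2 X fns := ti2 fns (by unfold fns; infer_instance)
theorem mem_fns : f ~ fns a b ↔ Fn f a ∧ ∀ x, x ~ a → app f x ~ b := by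
  refine mem_bld (isS_of_sub (pow (sUn (img a fun x ↦ img b fun y ↦ pr x y))) fun f hf ↦ ⬚)
  refine mem_pow◝ fun p hp ↦ ⬚
  rcases hf◜◜ p hp with ⟨x, y, hx, rfl⟩
  refine mem_sUn◝ ⟨_, mem_img◝ ⟨x, hx, rfl⟩, mem_img◝ ⟨y, ⬚, rfl⟩⟩
  rw [(hf◜.mem◜ hp)◝]; exact hf◝ x hx
theorem lam_fns {t : X → X} [h : DT fun σ ↦ t σ⁰] (hh : ∀ x, x ~ a → t x ~ b) :
    lam a t ~ fns a b := mem_fns◝ ⟨fn_lam, fun x hx ↦ by rw [app_lam hx]; exact hh x hx⟩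
theorem sep_congr (h : ∀ x, x ~ a → (Q x ↔ R x)) : sep a Q = sep a R := by
  unfold sep; congr 1; funext z; exact propext (and_congr_right fun hz ↦ h z hz)
theorem sep_eta (h : ∀ z, z ~ Y → z ~ a) : sep a (fun z ↦ z ~ Y) = Y :=
  zext fun z ↦ by simp; exact h z
class UC (X : Type) [ZFM X] where
  v : X
  m : X
  D : X
  hD : Od D
  full : v ~ m
  neg : ∀ Y, (∀ z, z ~ Y → z ~ v) → (sep v (fun z ↦ ¬ z ~ Y) ~ m ↔ ¬ Y ~ m)
  int : ∀ Y Z, (∀ z, z ~ Y → z ~ v) → (∀ z, z ~ Z → z ~ v) →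
    (sep v (fun z ↦ z ~ Y ∧ z ~ Z) ~ m ↔ Y ~ m ∧ Z ~ m)
  ac : ∀ F, Fn F v → sep v (fun k ↦ ∃ y, y ~ app F k) ~ m →
    ∃ g, Fn g v ∧ sep v (fun k ↦ app g k ~ app F k) ~ m
  wf : ∀ A, (∃ f, f ~ A) → (∀ f, f ~ A → Fn f v) →
    ∃ f, f ~ A ∧ ∀ g, g ~ A → ¬ sep v (fun k ↦ app g k ~ app f k) ~ m
open UC
variable [UC X]
def Me (Q : X → Prop) : Prop := sep v Q ~ m
instance {Q : ⊙X → X → Prop} [DF fun σ ↦ Q σ⇡ σ⁰] : DF fun σ ↦ Me (Q σ) :=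
  inferInstanceAs (DF fun σ ↦ sep v (Q σ) ~ m)
theorem me_congr {Q R : X → Prop} (h : ∀ x, x ~ v → (Q x ↔ R x)) : Me Q ↔ Me R := by
  unfold Me; rw [sep_congr h]
theorem me_not {Q : X → Prop} [DF fun σ ↦ Q σ⁰] : (Me fun k ↦ ¬ Q k) ↔ ¬ Me Q := by
  unfold Me; rw [← UC.neg _ fun z hz ↦ by simp at hz; exact hz◜]
  rw [sep_congr]; intro x hx; simp [hx]
theorem me_and {Q R : X → Prop} [DF fun σ ↦ Q σ⁰] [DF fun σ ↦ R σ⁰] :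
    (Me fun k ↦ Q k ∧ R k) ↔ Me Q ∧ Me R := by
  unfold Me; rw [← UC.int _ _ (fun z hz ↦ by simp at hz; exact hz◜) fun z hz ↦ by simp at hz; exact hz◜]
  rw [sep_congr]; intro x hx; simp [hx]
theorem me_true {Q : X → Prop} (h : ∀ x, x ~ v → Q x) : Me Q := by
  rw [me_congr (R := fun k ↦ k ~ v) fun x hx ↦ by simp [h x hx, hx]]
  unfold Me; rw [sep_eta fun z h ↦ h]; exact UC.full
theorem me_mono {Q R : X → Prop} [DF fun σ ↦ Q σ⁰] [DF fun σ ↦ R σ⁰]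
    (h : ∀ x, x ~ v → Q x → R x) (hQ : Me Q) : Me R := by
  have : Me fun k ↦ Q k ∧ R k := (me_congr fun x hx ↦ ⟨fun h₀ ↦ ⟨h₀, h x hx h₀⟩, fun h₀ ↦ h₀◜⟩)◜ hQ
  exact (me_and◜ this)◝
theorem me_const {P : Prop} : (Me fun _ : X ↦ P) ↔ P := by
  by_cases h : P
  · simp only [h, iff_true]; exact me_true fun _ _ ↦ trivial
  · simp only [h, iff_false]; rw [← me_not]; exact me_true fun _ _ ↦ id
theorem v_ne : ∃ k : X, k ~ v := by
  by_contra h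
  push Not at h
  exact me_const (X := X) (P := False) |>.1 (me_true fun x hx ↦ h x hx)
def B : X := fns D v
def upd (p c k : X) : X := lam D fun x ↦ ite₀ (x = c) k (app p x)
def cut (b p q : X) : X := lam D fun x ↦ ite₀ (x ~ b) (app p x) (app q x)
section
variable {s t u : ⊠X}
instance : T3 X upd := ti3 upd (by unfold upd; infer_instance)
instance : T3 X cut := ti3 cut (by unfold cut; infer_instance)
end
theorem upd_B (hp : p ~ B) (hk : k ~ v) : upd p c k ~ B :=
  lam_fns fun x hx ↦ by
    by_cases h : x = c
    · rw [ite_pos h]; exact hk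
    · rw [ite_neg h]; exact (mem_fns◜ hp)◝ x hx
theorem cut_B (hp : p ~ B) (hq : q ~ B) : cut b p q ~ B :=
  lam_fns fun x hx ↦ by
    by_cases h : x ~ b
    · rw [ite_pos h]; exact (mem_fns◜ hp)◝ x hx
    · rw [ite_neg h]; exact (mem_fns◜ hq)◝ x hx
theorem upd_ne (hx : x ~ D) (h : x ≠ c) : app (upd p c k) x = app p x := by
  unfold upd; rw [app_lam hx, ite_neg h]
theorem upd_at (hx : c ~ D) : app (upd p c k) c = k := by
  unfold upd; rw [app_lam hx, ite_pos rfl]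
theorem cut_in (hx : x ~ D) (h : x ~ b) : app (cut b p q) x = app p x := by
  unfold cut; rw [app_lam hx, ite_pos h]
theorem cut_out (hx : x ~ D) (h : ¬ x ~ b) : app (cut b p q) x = app q x := by
  unfold cut; rw [app_lam hx, ite_neg h]
theorem B_ext (hp : p ~ B) (hq : q ~ B) (h : ∀ x, x ~ D → app p x = app q x) : p = q :=
  (mem_fns◜ hp)◜.ext (mem_fns◜ hq)◜ h
theorem B_ne : ∃ p : X, p ~ B := by
  rcases v_ne (X := X) with ⟨k, hk⟩
  exact ⟨lam D ℸ k, lam_fns fun _ _ ↦ hk⟩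
def Ag (s p q : X) : Prop := ∀ x, x ~ s → app p x = app q x
def Sup (Y s : X) : Prop := ∀ p q, p ~ B → q ~ B → Ag s p q → (p ~ Y ↔ q ~ Y)
def SubB (Y : X) : Prop := ∀ p, p ~ Y → p ~ B
def A (c Y : X) : X := sep B fun p ↦ Me fun k ↦ upd p c k ~ Y
section
variable {s t u : ⊠X}
instance : F3 X Ag := fi3 Ag (by unfold Ag; infer_instance)
instance : F2 X Sup := fi2 Sup (by unfold Sup; infer_instance)
instance : F1 X SubB := fi1 SubB (by unfold SubB; infer_instance)
instance : T2 X A := ti2 A (by unfold A; infer_instance)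
end
theorem mem_A : p ~ A c Y ↔ p ~ B ∧ Me fun k ↦ upd p c k ~ Y := mem_sep
def U (Y : X) : Prop := ∀ G, B ~ G →
  (∀ c Z, c ~ D → SubB Z → Sup Z (suc c) → A c Z ~ G → Z ~ G) → Y ~ G
instance : F1 X U := fi1 U (by unfold U; infer_instance)
theorem U_B : U (B : X) := fun _ h _ ↦ h
theorem U_up (hc : c ~ D) (h1 : SubB Z) (h2 : Sup Z (suc c)) (h : U (A c Z)) : U Z :=
  fun G h0 hG ↦ hG c Z hc h1 h2 (h G h0 hG)
theorem A_triv (hY : SubB Y) (h : ∀ p k, p ~ B → k ~ v → (upd p c k ~ Y ↔ p ~ Y)) : A c Y = Y := by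
  refine zext fun p ↦ ⬚
  rw [mem_A]
  constructor
  · rintro ⟨hp, h₀⟩; exact me_const◜ ((me_congr fun k hk ↦ h p k hp hk)◜ h₀)
  · intro hp; exact ⟨hY p hp, (me_congr fun k hk ↦ h p k (hY p hp) hk)◝ (me_const◝ hp)⟩
theorem A_triv₀ (hY : SubB Y) (hs : Sup Y s) (hsD : ∀ x, x ~ s → x ~ D) (h : ¬ c ~ s) : A c Y = Y :=
  A_triv hY fun p k hp hk ↦ hs _ _ (upd_B hp hk) hp fun x hx ↦ upd_ne (hsD x hx) (by rintro rfl; exact h hx)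
theorem sub_A : SubB (A c Y) := fun p hp ↦ (mem_A◜ hp)◜
theorem sub_sep {Q : X → Prop} [DF fun σ ↦ Q σ⁰] : SubB (sep B Q) := fun p hp ↦ (mem_sep◜ hp)◜
theorem U_inv (hc : c ~ D) (hY : SubB Y) (hs : Sup Y (suc c)) : U Y ↔ U (A c Y) := by
  refine ⟨fun h ↦ ⬚, U_up hc hY hs⟩
  by_cases hB : Y = B
  · rw [hB, A_triv fun _ h ↦ h]
    · exact U_B
    · intro p k hp hk; simp [hp, upd_B hp hk]
  by_contra hn
  have := h (sep (pow B) fun Z ↦ U Z ∧ Z ≠ Y) (by simp [U_B, Ne.symm hB]) fun c₀ Z hc₀ hZ hsZ hA ↦ by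
    rw [mem_sep] at hA ⊢
    refine ⟨mem_pow◝ hZ, U_up hc₀ hZ hsZ hA◝◜, ⬚⟩
    rintro rfl
    rcases (UC.hD.mem hc).tri (UC.hD.mem hc₀) with h1 | rfl | h1
    · refine hA◝◝ (A_triv₀ hZ hs (fun x hx ↦ ⬚) ⬚)
      · simp at hx; rcases hx with hx | rfl; exacts [UC.hD.tr hc hx, hc]
      · simp; exact ⟨fun h2 ↦ nm2 h1 h2, fun h2 ↦ nm1 (h2 ▸ h1)⟩
    · exact hn hA◝◜
    · suffices e : A c Z = Z from hn (by rw [e]; exact h)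
      refine A_triv₀ hZ hsZ (fun x hx ↦ ⬚) ⬚
      · simp at hx; rcases hx with hx | rfl; exacts [UC.hD.tr hc₀ hx, hc₀]
      · simp; exact ⟨fun h2 ↦ nm2 h1 h2, fun h2 ↦ nm1 (h2 ▸ h1)⟩
  simp at this
theorem U_ne (h : U Y) : ∃ p, p ~ Y := by
  have := h (sep (pow B) fun Z ↦ ∃ p, p ~ Z) (by simp [B_ne]) fun c Z hc hZ hs hA ↦ by
    simp only [mem_sep, mem_pow] at hA ⊢
    refine ⟨hZ, ⬚⟩
    rcases hA◝ with ⟨p, hp⟩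
    by_contra hn
    push Not at hn
    have h2 := (mem_A◜ hp)◝
    exact me_const◜ ((me_congr (R := ℸ False) fun k _ ↦ by simp [hn])◜ h2)
  exact (mem_sep◜ this)◝
def IsMx (s c : X) : Prop := c ~ s ∧ ∀ x, x ~ s → x ~ c ∨ x = c
def Fi (s : X) : Prop := (∀ x, x ~ s → x ~ D) ∧
  ∀ t, (∀ x, x ~ t → x ~ s) → (∃ x, x ~ t) → ∃ c, IsMx t c
section
variable {s t u : ⊠X}
instance : F2 X IsMx := fi2 IsMx (by unfold IsMx; infer_instance)
instance : F1 X Fi := fi1 Fi (by unfold Fi; infer_instance)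
end
theorem Fi.sub (h : Fi s) (ht : ∀ x, x ~ t → x ~ s) : Fi t :=
  ⟨fun x hx ↦ h◜ x (ht x hx), fun u hu ↦ h◝ u fun x hx ↦ ht x (hu x hx)⟩
theorem Fi_emp : Fi (emp : X) := ⟨fun x hx ↦ by simp at hx, fun t ht ⟨x, hx⟩ ↦ by have := ht x hx; simp at this⟩
theorem Fi_sing (h : c ~ D) : Fi (upr c c) := by
  refine ⟨fun x hx ↦ by simp at hx; rwa [hx], fun t ht ⟨x, hx⟩ ↦ ⟨x, hx, fun y hy ↦ ⬚⟩⟩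
  have h1 := ht x hx; have h2 := ht y hy; simp at h1 h2; simp [h1, h2]
theorem Fi.un (hs : Fi s) (ht : Fi t) : Fi (un s t) := by
  refine ⟨fun x hx ↦ by simp at hx; exact hx.elim (hs◜ x) (ht◜ x), fun u hu hn ↦ ⬚⟩
  by_cases h1 : ∃ x, x ~ sep u fun x ↦ x ~ s
  swap
  · exact ht◝ u (fun x hx ↦ by have := hu x hx; simp at this h1; exact this.resolve_left (h1 x hx)) hn
  by_cases h2 : ∃ x, x ~ sep u fun x ↦ x ~ t
  swap
  · exact hs◝ u (fun x hx ↦ by have := hu x hx; simp at this h2; exact this.resolve_right (h2 x hx)) hn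
  rcases hs◝ _ (fun x hx ↦ by simp at hx; exact hx◝) h1 with ⟨c, hc, hc₀⟩
  rcases ht◝ _ (fun x hx ↦ by simp at hx; exact hx◝) h2 with ⟨e, he, he₀⟩
  simp at hc hc₀ he he₀
  have oc := UC.hD.mem (hs◜ c hc◝)
  have oe := UC.hD.mem (ht◜ e he◝)
  rcases oc.tri oe with h | rfl | h
  · refine ⟨e, he◜, fun x hx ↦ ⬚⟩
    have := hu x hx; simp at this
    rcases this with h₀ | h₀
    · rcases hc₀ x hx h₀ with h3 | rfl
      · exact ◁ (oe.tr h h3)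
      · exact ◁ h
    · exact he₀ x hx h₀
  · refine ⟨c, hc◜, fun x hx ↦ ⬚⟩
    have := hu x hx; simp at this
    exact this.elim (hc₀ x hx) (he₀ x hx)
  · refine ⟨c, hc◜, fun x hx ↦ ⬚⟩
    have := hu x hx; simp at this
    rcases this with h₀ | h₀
    · exact hc₀ x hx h₀
    · rcases he₀ x hx h₀ with h3 | rfl
      · exact ◁ (oc.tr h h3)
      · exact ◁ h
def bel (s c : X) : X := sep s fun x ↦ x ~ c
instance : T2 X bel := ti2 bel (by unfold bel; infer_instance)
@[simp] theorem mem_bel : x ~ bel s c ↔ x ~ s ∧ x ~ c := mem_sep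
theorem fiInd (Q : X → Prop) [DF fun σ ↦ Q σ⁰] (h0 : Q emp)
    (h1 : ∀ s c, Fi s → IsMx s c → Q (bel s c) → Q s) (s : X) (hs : Fi s) : Q s := by
  have := fun s [DT s] ↦ df1 Q s
  have : Q (bel s D) := oind (fun x ↦ Q (bel s x)) (fun x hx ih ↦ ⬚) D UC.hD
  · rwa [show bel s D = s from zext fun x ↦ by simp; exact hs◜ x] at this
  · rcases emp_or (x := bel s x) with h | h
    · rwa [h]
    rcases hs◝ _ (fun x hx ↦ (mem_bel◜ hx)◜) h with ⟨c, hc⟩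
    refine h1 _ c (hs.sub fun x hx ↦ (mem_bel◜ hx)◜) hc ⬚
    have hcx := (mem_bel◜ hc◜)◝
    rw [show bel (bel s x) c = bel s c from zext fun y ↦ by
      simp only [mem_bel]; exact ⟨fun h ↦ ⟨h◜◜, h◝⟩, fun h ↦ ⟨⟨h◜, hx.tr hcx h◝⟩, h◝⟩⟩]
    exact ih c hcx
end
section
variable {X : Type} [ZFM X] [UC X] {s t p q c k Y x f b : X}
open UC
theorem Ag.mono (h : Ag t p q) (hs : ∀ x, x ~ s → x ~ t) : Ag s p q := fun x hx ↦ h x (hs x hx)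
theorem IsMx.sub (h : IsMx s c) (x : X) (hx : x ~ s) : x ~ suc c := by simp; exact h◝ x hx
theorem ag_upd (hs : Fi s) (hm : IsMx s c) (h : Ag (bel s c) p q) :
    Ag s (upd p c k) (upd q c k) := by
  intro x hx
  rcases hm◝ x hx with h1 | rfl
  · have : x ≠ c := by rintro rfl; exact nm1 h1
    rw [upd_ne (hs◜ x hx) this, upd_ne (hs◜ x hx) this]; exact h x (by simp [hx, h1])
  · rw [upd_at (hs◜ x hx), upd_at (hs◜ x hx)]
theorem sup_A (hs : Fi s) (hm : IsMx s c) (h : Sup Y s) : Sup (A c Y) (bel s c) := by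
  intro p q hp hq hag
  rw [mem_A, mem_A, and_iff_right hp, and_iff_right hq]
  exact me_congr fun k hk ↦ h _ _ (upd_B hp hk) (upd_B hq hk) (ag_upd hs hm hag)
theorem Sup.mono (h : Sup Y s) (hs : ∀ x, x ~ s → x ~ t) : Sup Y t :=
  fun p q hp hq ha ↦ h p q hp hq (ha.mono hs)
theorem U_mx (hs : Fi s) (hm : IsMx s c) (h : Sup Y s) (hY : SubB Y) : U Y ↔ U (A c Y) :=
  U_inv (hs◜ c hm◜) hY (h.mono hm.sub)
theorem sup_emp (hY : SubB Y) (h : Sup Y emp) : Y = emp ∨ Y = B := by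
  rcases emp_or (x := Y) with h₀ | ⟨p, hp⟩
  · exact ◁ h₀
  · exact ▷ (zext fun q ↦ ⟨hY q, fun hq ↦ (h p q (hY p hp) hq fun x hx ↦ by simp at hx)◜ hp⟩)
theorem not_U_emp : ¬ U (emp : X) := fun h ↦ by simpa using U_ne h
def cmp (Y : X) : X := sep B fun p ↦ ¬ p ~ Y
def itr (Y Z : X) : X := sep B fun p ↦ p ~ Y ∧ p ~ Z
instance : T1 X cmp := ti1 cmp (by unfold cmp; infer_instance)
instance : T2 X itr := ti2 itr (by unfold itr; infer_instance)
theorem U_cmp (hs : Fi s) (hY : SubB Y) (h : Sup Y s) : U (cmp Y) ↔ ¬ U Y := by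
  refine fiInd (fun s ↦ ∀ Y, SubB Y → Sup Y s → (U (cmp Y) ↔ ¬ U Y)) (fun Y hY h ↦ ⬚)
    (fun s c hs hm ih Y hY h ↦ ⬚) s hs Y hY h
  · rcases sup_emp hY h with rfl | rfl
    · have : cmp (emp : X) = B := zext fun p ↦ by simp [cmp]
      simp [this, U_B, not_U_emp]
    · have : cmp (B : X) = emp := zext fun p ↦ by simp [cmp]
      simp [this, U_B, not_U_emp]
  · rw [U_mx hs hm h hY, ← ih _ sub_A (sup_A hs hm h), U_mx (Y := cmp Y) hs hm _ sub_sep]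
    · have : A c (cmp Y) = cmp (A c Y) := zext fun p ↦ by
        simp only [cmp, mem_A, mem_sep]
        refine and_congr_right fun hp ↦ ⬚
        rw [me_congr (R := fun k ↦ ¬ upd p c k ~ Y) fun k hk ↦ by simp [upd_B hp hk], me_not]
        tauto
      rw [this]
    · intro p q hp hq ha; simp [cmp, hp, hq, h p q hp hq ha]
theorem U_itr (hs : Fi s) (hY : SubB Y) (hZ : SubB Z) (h : Sup Y s) (h₀ : Sup Z s) :
    U (itr Y Z) ↔ U Y ∧ U Z := by
  refine fiInd (fun s ↦ ∀ Y Z, SubB Y → SubB Z → Sup Y s → Sup Z s → (U (itr Y Z) ↔ U Y ∧ U Z))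
    (fun Y Z hY hZ h h₀ ↦ ⬚) (fun s c hs hm ih Y Z hY hZ h h₀ ↦ ⬚) s hs Y Z hY hZ h h₀
  · rcases sup_emp hY h with rfl | rfl
    · have : itr emp Z = emp := zext fun p ↦ by simp [itr]
      simp [this, not_U_emp]
    · have : itr B Z = Z := zext fun p ↦ by simp [itr]; exact hZ p
      simp [this, U_B]
  · rw [U_mx hs hm h hY, U_mx hs hm h₀ hZ, ← ih _ _ sub_A sub_A (sup_A hs hm h) (sup_A hs hm h₀),
      U_mx (Y := itr Y Z) hs hm _ sub_sep]
    · have : A c (itr Y Z) = itr (A c Y) (A c Z) := zext fun p ↦ by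
        simp only [itr, mem_A, mem_sep]
        refine and_congr_right fun hp ↦ ⬚
        rw [me_congr (R := fun k ↦ upd p c k ~ Y ∧ upd p c k ~ Z) fun k hk ↦ by simp [upd_B hp hk], me_and]
        tauto
      rw [this]
    · intro p q hp hq ha; simp [itr, hp, hq, h p q hp hq ha, h₀ p q hp hq ha]
class FSP (Q : X → Prop) : Prop where
  ex : ∃ s, Fi s ∧ ∀ p q, p ~ B → q ~ B → Ag s p q → (Q p ↔ Q q)
class FST (t : X → X) : Prop where
  ex : ∃ s, Fi s ∧ ∀ p q, p ~ B → q ~ B → Ag s p q → t p = t q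
instance (a : X) : FST ℸ a := ⟨emp, Fi_emp, fun _ _ _ _ _ ↦ rfl⟩
instance (P : Prop) : FSP fun _ : X ↦ P := ⟨emp, Fi_emp, fun _ _ _ _ _ ↦ Iff.rfl⟩
theorem fsp1 (R : X → Prop) (t : X → X) [h : FST t] : FSP fun p ↦ R (t p) := by
  rcases h with ⟨s, hs, h⟩; exact ⟨s, hs, fun p q hp hq ha ↦ by rw [h p q hp hq ha]⟩
theorem un_l (h : x ~ s) : x ~ un s t := by simp [h]
theorem un_r (h : x ~ t) : x ~ un s t := by simp [h]
instance fst2 (R : X → X → X) (t u : X → X) [h : FST t] [h₀ : FST u] : FST fun p ↦ R (t p) (u p) := by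
  rcases h with ⟨s, hs, h⟩; obtain ⟨s₀, hs₀, h₀⟩ := h₀
  exact ⟨un s s₀, hs.un hs₀, fun p q hp hq ha ↦ by
    rw [h p q hp hq (ha.mono ℸ un_l), h₀ p q hp hq (ha.mono ℸ un_r)]⟩
theorem fspop (R : Prop → Prop → Prop) (t u : X → Prop) [h : FSP t] [h₀ : FSP u] : FSP fun p ↦ R (t p) (u p) := by
  rcases h with ⟨s, hs, h⟩; obtain ⟨s₀, hs₀, h₀⟩ := h₀
  exact ⟨un s s₀, hs.un hs₀, fun p q hp hq ha ↦ by
    rw [h p q hp hq (ha.mono ℸ un_l), h₀ p q hp hq (ha.mono ℸ un_r)]⟩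
theorem fsp2 (R : X → X → Prop) (t u : X → X) [h : FST t] [h₀ : FST u] : FSP fun p ↦ R (t p) (u p) := by
  rcases h with ⟨s, hs, h⟩; obtain ⟨s₀, hs₀, h₀⟩ := h₀
  exact ⟨un s s₀, hs.un hs₀, fun p q hp hq ha ↦ by
    rw [h p q hp hq (ha.mono ℸ un_l), h₀ p q hp hq (ha.mono ℸ un_r)]⟩
section
variable {Q R : X → Prop} {t u : X → X}
instance [FST t] [FST u] : FSP fun p ↦ t p ~ u p := fsp2 ∊ t u
instance [FST t] [FST u] : FSP fun p ↦ t p = u p := fsp2 Eq t u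
instance [FSP Q] [FSP R] : FSP fun p ↦ Q p ∧ R p := fspop And Q R
instance [FSP Q] [FSP R] : FSP fun p ↦ Q p ∨ R p := fspop Or Q R
instance [FSP Q] [FSP R] : FSP fun p ↦ Q p → R p := fspop (fun a b ↦ a → b) Q R
instance [FSP Q] [FSP R] : FSP fun p ↦ (Q p ↔ R p) := fspop Iff Q R
instance [FSP Q] : FSP fun p ↦ ¬ Q p := fspop (fun a _ ↦ ¬ a) Q Q
end
theorem fspN (R : (Fin n → X) → Prop) (t : Fin n → X → X) (h : ∀ i, FST (t i)) :
    FSP fun p ↦ R fun i ↦ t i p := by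
  have : ∃ s : X, Fi s ∧ ∀ p q, p ~ B → q ~ B → Ag s p q → (fun i ↦ t i p) = fun i ↦ t i q := by
    induction n with
    | zero => exact ⟨emp, Fi_emp, fun _ _ _ _ _ ↦ funext fun i ↦ i.elim0⟩
    | succ n ih =>
      rcases ih (ℸ True) (fun i ↦ t i.succ) fun i ↦ h _ with ⟨s, hs, h1⟩
      rcases (h 0).ex with ⟨s₀, hs₀, h2⟩
      refine ⟨un s s₀, hs.un hs₀, fun p q hp hq ha ↦ funext fun i ↦ ⬚⟩
      refine Fin.cases (h2 p q hp hq (ha.mono ℸ un_r)) (fun i ↦ ⬚) i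
      exact congrFun (h1 p q hp hq (ha.mono ℸ un_l)) i
  rcases this with ⟨s, hs, h⟩
  exact ⟨s, hs, fun p q hp hq ha ↦ by rw [h p q hp hq ha]⟩
def ae (Q : X → Prop) : Prop := U (sep B Q)
instance {Q : ⊙X → X → Prop} [DF fun σ ↦ Q σ⇡ σ⁰] : DF fun σ ↦ ae (Q σ) :=
  inferInstanceAs (DF fun σ ↦ U (sep B (Q σ)))
section
variable {Q R : X → Prop}
theorem ae_congr (h : ∀ p, p ~ B → (Q p ↔ R p)) : ae Q ↔ ae R := by unfold ae; rw [sep_congr h]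
theorem ae_true (h : ∀ p, p ~ B → Q p) : ae Q := by
  rw [ae_congr (R := fun p ↦ p ~ B) fun p hp ↦ by simp [hp, h p hp]]
  unfold ae; rw [sep_eta fun z h ↦ h]; exact U_B
variable [DF fun σ ↦ Q σ⁰] [DF fun σ ↦ R σ⁰]
theorem sup_sep : Sup (sep B Q) s ↔ ∀ p q, p ~ B → q ~ B → Ag s p q → (Q p ↔ Q q) := by
  unfold Sup
  refine forall_congr' fun p ↦ forall_congr' fun q ↦ forall_congr' fun hp ↦ forall_congr' fun hq ↦ ⬚
  simp [hp, hq]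
theorem ae_not [h : FSP Q] : (ae fun p ↦ ¬ Q p) ↔ ¬ ae Q := by
  rcases h with ⟨s, hs, h⟩
  unfold ae; rw [← U_cmp hs sub_sep (sup_sep◝ h), cmp, sep_congr]
  intro p hp; simp [hp]
theorem ae_and [h : FSP Q] [h₀ : FSP R] : (ae fun p ↦ Q p ∧ R p) ↔ ae Q ∧ ae R := by
  rcases h with ⟨s, hs, h⟩; obtain ⟨s₀, hs₀, h₀⟩ := h₀
  unfold ae; rw [← U_itr (hs.un hs₀) sub_sep sub_sep ((sup_sep◝ h).mono ℸ un_l)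
    ((sup_sep◝ h₀).mono ℸ un_r), itr, sep_congr]
  intro p hp; simp [hp]
theorem ae_mono [FSP Q] [FSP R] (h : ∀ p, p ~ B → Q p → R p) (hQ : ae Q) : ae R :=
  (ae_and◜ ((ae_congr fun p hp ↦ ⟨fun h₀ ↦ ⟨h₀, h p hp h₀⟩, fun h₀ ↦ h₀◜⟩ : ae Q ↔ ae fun p ↦ Q p ∧ R p)◜ hQ))◝
theorem ae_imp [FSP Q] [FSP R] : (ae fun p ↦ Q p → R p) ↔ (ae Q → ae R) := by
  rw [ae_congr (R := fun p ↦ ¬ (Q p ∧ ¬ R p)) fun p _ ↦ by tauto, ae_not, ae_and, ae_not]; tauto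
theorem ae_or [FSP Q] [FSP R] : (ae fun p ↦ Q p ∨ R p) ↔ (ae Q ∨ ae R) := by
  rw [ae_congr (R := fun p ↦ ¬ Q p → R p) fun p _ ↦ by tauto, ae_imp, ae_not]; tauto
end
theorem ae_const : (ae fun _ : X ↦ P) ↔ P := by
  by_cases h : P
  · simp only [h, iff_true]; exact ae_true fun _ _ ↦ trivial
  · simp only [h, iff_false]; rw [← ae_not]; exact ae_true fun _ _ ↦ id
theorem ae_ex {Q : X → Prop} [DF fun σ ↦ Q σ⁰] (h : ae Q) : ∃ p, p ~ B ∧ Q p := by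
  rcases U_ne h with ⟨p, hp⟩; exact ⟨p, mem_sep◜ hp⟩
def SF (f s : X) : Prop := ∀ p q, p ~ B → q ~ B → Ag s p q → app f p = app f q
instance : F2 X SF := fi2 SF (by unfold SF; infer_instance)
theorem SF.fst (hs : Fi s) (h : SF f s) : FST (app f) := ⟨s, hs, h⟩
theorem SF.mono (h : SF f s) (hs : ∀ x, x ~ s → x ~ t) : SF f t :=
  fun p q hp hq ha ↦ h p q hp hq (ha.mono hs)
theorem acU {F : X} (hs : Fi s) (h : SF F s) (hne : ae fun p ↦ ∃ y, y ~ app F p) :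
    ∃ g, Fn g B ∧ SF g s ∧ ae fun p ↦ app g p ~ app F p := by
  refine fiInd (fun s ↦ ∀ F, SF F s → (ae fun p ↦ ∃ y, y ~ app F p) →
    ∃ g, Fn g B ∧ SF g s ∧ ae fun p ↦ app g p ~ app F p) (fun F h hne ↦ ⬚)
    (fun s c hs hm ih F h hne ↦ ⬚) s hs F h hne
  · rcases ae_ex hne with ⟨p, hp, y, hy⟩
    refine ⟨lam B ℸ y, fn_lam, fun p q hp hq _ ↦ by rw [app_lam hp, app_lam hq], ae_true fun q hq ↦ ⬚⟩
    rw [app_lam hq, h q p hq hp fun x hx ↦ by simp at hx]; exact hy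
  · have hcD := hs◜ c hm◜
    let R := un (sUn (img B fun p ↦ app F p)) (upr emp emp)
    let F₀ := lam B fun p ↦ sep (fns v R) fun h ↦ Me fun k ↦ app h k ~ app F (upd p c k)
    have F₀d : ∀ p, p ~ B → app F₀ p = sep (fns v R) fun h ↦ Me fun k ↦ app h k ~ app F (upd p c k) :=
      fun p hp ↦ app_lam hp
    have hF₀ : SF F₀ (bel s c) := fun p q hp hq ha ↦ by
      rw [F₀d p hp, F₀d q hq]
      refine sep_congr fun h₀ _ ↦ me_congr fun k hk ↦ ⬚
      rw [h _ _ (upd_B hp hk) (upd_B hq hk) (ag_upd hs hm ha)]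
    have hne₀ : ae fun p ↦ ∃ y, y ~ app F₀ p := by
      have h1 : Sup (sep B fun p ↦ ∃ y, y ~ app F p) s := sup_sep◝ fun p q hp hq ha ↦ by rw [h p q hp hq ha]
      have h2 := (U_mx hs hm h1 sub_sep)◜ hne
      have : A c (sep B fun p ↦ ∃ y, y ~ app F p) = sep B fun p ↦ ∃ y, y ~ app F₀ p := by
        refine zext fun p ↦ ⬚
        rw [mem_A, mem_sep]
        refine and_congr_right fun hp ↦ ⬚
        rw [me_congr (R := fun k ↦ ∃ y, y ~ app F (upd p c k)) fun k hk ↦ by simp [upd_B hp hk], F₀d p hp]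
        constructor
        · intro hme
          obtain ⟨g, hg, hg₀⟩ := UC.ac (lam v fun k ↦ app F (upd p c k)) fn_lam (by
            exact (me_congr fun k hk ↦ by rw [app_lam hk])◜ hme)
          refine ⟨lam v fun k ↦ ite₀ (app g k ~ app F (upd p c k)) (app g k) emp, ⬚⟩
          rw [mem_sep]
          refine ⟨lam_fns fun k hk ↦ ⬚, me_mono (fun k hk hh ↦ ⬚) hg₀⟩
          · by_cases hh : app g k ~ app F (upd p c k)
            · rw [ite_pos hh]; simp only [R, mem_un, mem_sUn, mem_img]
              exact ◁ ⟨_, ⟨_, upd_B hp hk, rfl⟩, hh⟩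
            · rw [ite_neg hh]; simp [R]
          · rw [app_lam hk] at hh; rw [app_lam hk, ite_pos hh]; exact hh
        · rintro ⟨g, hg⟩
          rw [mem_sep] at hg
          exact me_mono (fun k hk h ↦ ⟨_, h⟩) hg◝
      unfold ae; rw [← this]; exact h2
    rcases ih F₀ hF₀ hne₀ with ⟨g₀, hg₀, hs₀, hae⟩
    refine ⟨lam B fun p ↦ app (app g₀ p) (app p c), fn_lam, fun p q hp hq ha ↦ ⬚, ⬚⟩
    · rw [app_lam hp, app_lam hq, ha c hm◜, hs₀ p q hp hq (ha.mono fun x hx ↦ (mem_bel◜ hx)◜)]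
    · have hg : ∀ p k, p ~ B → k ~ v →
          app (lam B fun p ↦ app (app g₀ p) (app p c)) (upd p c k) = app (app g₀ p) k := fun p k hp hk ↦ by
        rw [app_lam (upd_B hp hk), upd_at hcD, hs₀ (upd p c k) p (upd_B hp hk) hp fun x hx ↦ by
          have := mem_bel◜ hx
          exact upd_ne (hs◜ x this◜) (by rintro rfl; exact nm1 this◝)]
      have h1 : Sup (sep B fun p ↦ app (lam B fun p ↦ app (app g₀ p) (app p c)) p ~ app F p) s :=
        sup_sep◝ fun p q hp hq ha ↦ by
          rw [h p q hp hq ha, app_lam hp, app_lam hq, ha c hm◜, hs₀ p q hp hq (ha.mono fun x hx ↦ (mem_bel◜ hx)◜)]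
      refine (U_mx hs hm h1 sub_sep)◝ ⬚
      have e : A c (sep B fun p ↦ app (lam B fun p ↦ app (app g₀ p) (app p c)) p ~ app F p) =
          sep B fun p ↦ Me fun k ↦ app (app g₀ p) k ~ app F (upd p c k) := zext fun p ↦ by
        rw [mem_A, mem_sep]
        refine and_congr_right fun hp ↦ me_congr fun k hk ↦ ⬚
        rw [mem_sep, hg p k hp hk]; simp [upd_B hp hk]
      rw [e]
      have hfs : Fi (bel s c) := hs.sub fun x hx ↦ (mem_bel◜ hx)◜
      have := hs₀.fst hfs; have := hF₀.fst hfs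
      have : FSP fun p ↦ Me fun k ↦ app (app g₀ p) k ~ app F (upd p c k) := ⟨bel s c, hfs, fun p q hp hq ha ↦ by
        rw [hs₀ p q hp hq ha]
        exact me_congr fun k hk ↦ by rw [h _ _ (upd_B hp hk) (upd_B hq hk) (ag_upd hs hm ha)]⟩
      refine ae_mono (fun p hp hh ↦ ⬚) hae
      rw [F₀d p hp, mem_sep] at hh; exact hh◝
theorem cut_upd (hc : ¬ c ~ b) : upd (cut b p q) c k = cut b p (upd q c k) := by
  refine Fn.ext fn_lam fn_lam fun x hx ↦ ⬚
  by_cases h : x = c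
  · subst h; rw [upd_at hx, cut_out hx hc, upd_at hx]
  · rw [upd_ne hx h]
    by_cases hb : x ~ b
    · rw [cut_in hx hb, cut_in hx hb]
    · rw [cut_out hx hb, cut_out hx hb, upd_ne hx h]
theorem fubU (hb : Od b) (hs : Fi s) (hY : SubB Y) (h : Sup Y s) :
    U Y ↔ ae fun p ↦ ae fun q ↦ cut b p q ~ Y := by
  have case1 : ∀ s Y, Fi s → SubB Y → Sup Y s → (∀ x, x ~ s → x ~ b) →
      (U Y ↔ ae fun p ↦ ae fun q ↦ cut b p q ~ Y) := fun s Y hs hY h hsb ↦ by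
    have : (ae fun p ↦ ae fun q ↦ cut b p q ~ Y) ↔ ae fun p ↦ p ~ Y := ae_congr fun p hp ↦ by
      rw [ae_congr (R := ℸ p ~ Y), ae_const]
      exact fun q hq ↦ h _ _ (cut_B hp hq) hp fun x hx ↦ cut_in (hs◜ x hx) (hsb x hx)
    rw [this]; unfold ae; rw [sep_eta hY]
  refine fiInd (fun s ↦ ∀ Y, SubB Y → Sup Y s → (U Y ↔ ae fun p ↦ ae fun q ↦ cut b p q ~ Y))
    (fun Y hY h ↦ case1 _ Y Fi_emp hY h fun x hx ↦ by simp at hx) (fun s c hs hm ih Y hY h ↦ ⬚) s hs Y hY h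
  by_cases hc : c ~ b
  · exact case1 s Y hs hY h fun x hx ↦ by rcases hm◝ x hx with h | rfl; exacts [hb.tr hc h, hc]
  rw [U_mx hs hm h hY, ih _ sub_A (sup_A hs hm h)]
  refine ae_congr fun p hp ↦ ⬚
  have h1 : Sup (sep B fun q ↦ cut b p q ~ Y) s := sup_sep◝ fun q q₀ hq hq₀ ha ↦
    h _ _ (cut_B hp hq) (cut_B hp hq₀) fun x hx ↦ by
      by_cases hb : x ~ b
      · rw [cut_in (hs◜ x hx) hb, cut_in (hs◜ x hx) hb]
      · rw [cut_out (hs◜ x hx) hb, cut_out (hs◜ x hx) hb, ha x hx]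
  refine Iff.trans ⬚ (U_mx hs hm h1 sub_sep).symm
  unfold ae
  refine iff_of_eq (congrArg U (zext fun q ↦ ⬚))
  rw [mem_A, mem_sep]
  refine and_congr_right fun hq ↦ ⬚
  rw [mem_A, and_iff_right (cut_B hp hq)]
  refine me_congr fun k hk ↦ ⬚
  rw [mem_sep, cut_upd hc]; simp [upd_B hq hk]
theorem fub [DF fun σ ↦ Q σ⁰] [h : FSP Q] (hb : Od b) :
    ae Q ↔ ae fun p ↦ ae fun q ↦ Q (cut b p q) := by
  rcases h with ⟨s, hs, h⟩
  have := fun s [DT s] ↦ df1 Q s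
  refine (fubU hb hs sub_sep (sup_sep◝ h)).trans (ae_congr fun p hp ↦ ae_congr fun q hq ↦ ⬚)
  simp [cut_B hp hq]
theorem ae_one [DF fun σ ↦ Q σ⁰] (hc : c ~ D) (hs : ∀ x, x ~ s → x ~ suc c)
    (h : ∀ p q, p ~ B → q ~ B → Ag s p q → (Q p ↔ Q q)) : ae Q ↔ ae fun p ↦ Me fun k ↦ Q (upd p c k) := by
  have := fun s [DT s] ↦ df1 Q s
  refine (U_inv hc sub_sep ((sup_sep◝ h).mono hs)).trans (iff_of_eq (congrArg U (zext fun p ↦ ⬚)))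
  rw [mem_A, mem_sep]
  refine and_congr_right fun hp ↦ me_congr fun k hk ↦ ⬚
  simp [upd_B hp hk]
end
section
variable {X : Type} [ZFM X] {f p b c Z g s b0 : X}
def ran (f : X) : X := bld fun w ↦ ∃ x, pr x w ~ f
instance : T1 X ran := ti1 ran (by unfold ran; infer_instance)
theorem mem_ran : w ~ ran f ↔ ∃ x, pr x w ~ f :=
  mem_bld (isS_of_sub (sUn (sUn f)) fun w ⟨x, hx⟩ ↦ mem_sUn◝ ⟨upr x w, mem_sUn◝ ⟨_, hx, by simp [pr]⟩, by simp⟩)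
def clp (S : X → X → X → Prop) (p x : X) : X := rec₀ S (fun _ _ f ↦ ran f) p x
section
variable {S : X → X → X → Prop} [hS : DF fun σ ↦ S σ⁰ σ¹ σ²]
instance clp_dt {s t : ⊠X} [DT s] [DT t] : DT fun σ ↦ clp S (s σ) (t σ) := by
  unfold clp; infer_instance
theorem clp_mem
    (hc : ∀ x, ∃ A, x ~ A ∧ ∀ y, y ~ A → ∀ z, S p z y → z ~ A)
    (hw : ∀ A, (∃ x, x ~ A) → ∃ y, y ~ A ∧ ∀ z, z ~ A → ¬ S p z y) (x w : X) :
    w ~ clp S p x ↔ ∃ z, S p z x ∧ w = clp S p z := by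
  have i1 : ∀ s t u [DT s] [DT t] [DT u], DF fun σ ↦ S (s σ) (t σ) (u σ) := fun s t u ↦ df3 S s t u
  have hp : ∀ y z, z ~ prd S p y ↔ S p z y := fun y z ↦ by
    rcases hc y with ⟨A, hA, hA₀⟩
    exact mem_bld (isS_of_sub A fun z hz ↦ hA₀ _ hA _ hz)
  unfold clp
  rw [rec_eq hc hw, mem_ran]
  simp only [mem_lam, hp]
  constructor
  · rintro ⟨x, z, hz, h⟩; rcases pr_inj◜ h with ⟨rfl, rfl⟩; exact ⟨_, hz, rfl⟩
  · rintro ⟨z, hz, rfl⟩; exact ⟨z, z, hz, rfl⟩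
end
variable [UC X]
open UC
def FF (b c f : X) : Prop := Fn f B ∧ ∃ s, Fi s ∧ (∀ x, x ~ s → x ~ c ∧ ¬ x ~ b) ∧ SF f s
def WFA (b c : X) : Prop := ∀ A, (∃ f, f ~ A) → (∀ f, f ~ A → FF b c f) →
    ∃ f, f ~ A ∧ ∀ g, g ~ A → ¬ ae fun p ↦ app g p ~ app f p
def WFZ (b c Z : X) : Prop := ∀ A, (∃ f, f ~ A) → (∀ f, f ~ A → FF b c f ∧ ae fun p ↦ app f p ~ Z) →
    ∃ f, f ~ A ∧ ∀ g, g ~ A → ¬ ae fun p ↦ app g p ~ app f p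
section
variable {s t u : ⊠X}
instance : F3 X FF := fi3 FF (by unfold FF; infer_instance)
instance : F3 X WFZ := fi3 WFZ (by unfold WFZ; infer_instance)
instance : F2 X WFA := fi2 WFA (by unfold WFA; infer_instance)
end
theorem FF.fst (h : FF b c f) : FST (app f) := h◝.elim fun s h ↦ h◝◝.fst h◜
theorem WFA.wz (h : WFA b c) : WFZ b c Z := fun A h1 h2 ↦ h A h1 fun f hf ↦ (h2 f hf)◜
theorem WFZ.a (h : ∀ Z, WFZ b c Z) : WFA b c := fun A h1 h2 ↦
  h (sUn (img A fun g ↦ img B fun p ↦ app g p)) A h1 fun f hf ↦ ⟨h2 f hf, ae_true fun p hp ↦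
    mem_sUn◝ ⟨_, mem_img◝ ⟨f, hf, rfl⟩, mem_img◝ ⟨p, hp, rfl⟩⟩⟩
def gp (b g p : X) : X := lam B fun q ↦ app g (cut b p q)
instance : T3 X gp := ti3 gp (by unfold gp; infer_instance)
theorem gp_ag (hs : Fi s) (h : SF g s) (hp : p ~ B) (hp₀ : p₀ ~ B) (ha : Ag (bel s b) p p₀) :
    gp b g p = gp b g p₀ := by
  unfold gp
  refine lam_congr fun q hq ↦ h _ _ (cut_B hp hq) (cut_B hp₀ hq) fun x hx ↦ ⬚
  by_cases hb : x ~ b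
  · rw [cut_in (hs◜ x hx) hb, cut_in (hs◜ x hx) hb]; exact ha x (by simp [hx, hb])
  · rw [cut_out (hs◜ x hx) hb, cut_out (hs◜ x hx) hb]
theorem gp_FF (h : FF b0 c g) (hp : p ~ B) : FF b c (gp b g p) := by
  rcases h with ⟨h1, s, hs, h2, h3⟩
  refine ⟨fn_lam, sep s fun x ↦ ¬ x ~ b, hs.sub fun x hx ↦ (mem_sep◜ hx)◜, fun x hx ↦ ⬚, fun q q₀ hq hq₀ ha ↦ ⬚⟩
  · simp at hx; exact ⟨(h2 x hx◜)◜, hx◝⟩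
  · unfold gp; rw [app_lam hq, app_lam hq₀]
    refine h3 _ _ (cut_B hp hq) (cut_B hp hq₀) fun x hx ↦ ⬚
    by_cases hb : x ~ b
    · rw [cut_in (hs◜ x hx) hb, cut_in (hs◜ x hx) hb]
    · rw [cut_out (hs◜ x hx) hb, cut_out (hs◜ x hx) hb]; exact ha x (by simp [hx, hb])
theorem CUT {η A : X} (hb : Od b) (hW : WFA b0 b) (hη : FF b0 b η)
    (hWZ : ae fun p ↦ WFZ b c (app η p)) (hA : ∃ g, g ~ A)
    (hA₀ : ∀ g, g ~ A → FF b0 c g ∧ ae fun p ↦ app g p ~ app η p) :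
    ∃ f, f ~ A ∧ ∀ g, g ~ A → ¬ ae fun p ↦ app g p ~ app f p := by
  let ZZ := sUn (img A fun g ↦ img B fun p ↦ app g p)
  have hZZ : ∀ g, g ~ A → ∀ p, p ~ B → app g p ~ ZZ := fun g hg p hp ↦
    mem_sUn◝ ⟨_, mem_img◝ ⟨g, hg, rfl⟩, mem_img◝ ⟨p, hp, rfl⟩⟩
  let W : X → X → Prop := fun e h ↦ h ~ fns B ZZ ∧ FF b c h ∧ ae fun q ↦ app h q ~ e
  have iW : ∀ s t : ⊠X, [DT s] → [DT t] → DF fun σ ↦ W (s σ) (t σ) := fun s t _ _ ↦ by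
    show DF fun σ ↦ t σ ~ fns B ZZ ∧ FF b c (t σ) ∧ ae fun q ↦ app (t σ) q ~ s σ
    have := DT.shift s
    have := DT.shift t
    infer_instance
  let S : X → X → X → Prop := fun e h₀ h ↦ W e h₀ ∧ W e h ∧ ae fun q ↦ app h₀ q ~ app h q
  have iS : DF fun σ : ⊙X ↦ S σ⁰ σ¹ σ² := by
    show DF fun σ : ⊙X ↦ W σ⁰ σ¹ ∧ W σ⁰ σ² ∧ ae fun q ↦ app σ¹ q ~ app σ² q
    infer_instance
  have hcl : ∀ e, WFZ b c e → ∀ x w, w ~ clp S e x ↔ ∃ z, S e z x ∧ w = clp S e z := fun e he ↦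
    clp_mem (fun x ↦ ⟨un (upr x x) (fns B ZZ), by simp, fun y _ z hz ↦ un_r hz◜◜⟩) fun A ⟨x, hx⟩ ↦ by
      by_cases h : ∃ y, y ~ A ∧ W e y
      · rcases he (sep A fun y ↦ W e y) (by simpa using h) fun f hf ↦ (mem_sep◜ hf)◝◝ with ⟨y, hy, hm⟩
        exact ⟨y, (mem_sep◜ hy)◜, fun z hz hs ↦ hm z (mem_sep◝ ⟨hz, hs◜⟩) hs◝◝⟩
      · exact ⟨x, hx, fun z hz hs ↦ h ⟨z, hz, hs◜⟩⟩
  let gh : X → X := fun g ↦ lam B fun p ↦ clp S (app η p) (gp b g p)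
  have igh : ∀ s : ⊠X, [DT s] → DT fun σ ↦ gh (s σ) := fun s _ ↦ by
    show DT fun σ ↦ lam B fun p ↦ clp S (app η p) (gp b (s σ) p)
    have := DT.shift s
    infer_instance
  obtain ⟨f, hf, hm⟩ := hW (img A gh) (by rcases hA with ⟨g, hg⟩; exact ⟨_, mem_img◝ ⟨g, hg, rfl⟩⟩) (by
    intro f hf
    rcases mem_img◜ hf with ⟨g, hg, rfl⟩
    rcases (hA₀ g hg)◜ with ⟨_, s, hs, h2, h3⟩
    rcases hη with ⟨_, s₀, hs₀, h2₀, h3₀⟩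
    refine ⟨fn_lam, un (bel s b) s₀, (hs.sub fun x hx ↦ (mem_bel◜ hx)◜).un hs₀, fun x hx ↦ ⬚, fun p q hp hq ha ↦ ⬚⟩
    · simp at hx; rcases hx with hx | hx
      · exact ⟨hx◝, (h2 x hx◜)◝⟩
      · exact h2₀ x hx
    · simp only [gh]; rw [app_lam hp, app_lam hq, h3₀ p q hp hq (ha.mono fun x hx ↦ un_r hx),
        gp_ag hs h3 hp hq (ha.mono fun x hx ↦ un_l hx)])
  rcases mem_img◜ hf with ⟨g, hg, rfl⟩
  refine ⟨g, hg, fun g₀ hg₀ hlt ↦ hm (gh g₀) (mem_img◝ ⟨g₀, hg₀, rfl⟩) ⬚⟩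
  have key : ∀ g, g ~ A → FST (gp b g) := fun g hg ↦ by
    rcases (hA₀ g hg)◜ with ⟨_, s, hs, h2, h3⟩
    exact ⟨bel s b, hs.sub fun x hx ↦ (mem_bel◜ hx)◜, fun p q hp hq ha ↦ gp_ag hs h3 hp hq ha⟩
  have fη := hη.fst
  have f1 := (hA₀ g hg)◜.fst
  have f2 := (hA₀ g₀ hg₀)◜.fst
  have k1 := key g hg
  have k2 := key g₀ hg₀
  have cη : ∀ p q, p ~ B → q ~ B → app η (cut b p q) = app η p := fun p q hp hq ↦ by
    rcases hη with ⟨_, s₀, hs₀, h2₀, h3₀⟩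
    exact h3₀ _ _ (cut_B hp hq) hp fun x hx ↦ cut_in (hs₀◜ x hx) (h2₀ x hx)◜
  have e1 : ∀ g, g ~ A → ae fun p ↦ ae fun q ↦ app (gp b g p) q ~ app η p := fun g hg ↦ by
    have := (hA₀ g hg)◜.fst
    refine (ae_congr fun p hp ↦ ae_congr fun q hq ↦ ⬚)◜ ((fub hb)◜ (hA₀ g hg)◝)
    unfold gp; rw [app_lam hq, cη p q hp hq]
  have e2 : ae fun p ↦ ae fun q ↦ app (gp b g₀ p) q ~ app (gp b g p) q := by
    refine (ae_congr fun p hp ↦ ae_congr fun q hq ↦ ⬚)◜ ((fub hb)◜ hlt)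
    unfold gp; rw [app_lam hq, app_lam hq]
  have i1 : FSP fun p ↦ WFZ b c (app η p) := fsp1 _ _
  have i2 : FSP fun p ↦ ae fun q ↦ app (gp b g p) q ~ app η p := fsp2 (fun h e ↦ ae fun q ↦ app h q ~ e) _ _
  have i3 : FSP fun p ↦ ae fun q ↦ app (gp b g₀ p) q ~ app η p := fsp2 (fun h e ↦ ae fun q ↦ app h q ~ e) _ _
  have i4 : FSP fun p ↦ ae fun q ↦ app (gp b g₀ p) q ~ app (gp b g p) q :=
    fsp2 (fun h e ↦ ae fun q ↦ app h q ~ app e q) _ _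
  have i5 : ∀ g, g ~ A → FST fun p ↦ clp S (app η p) (gp b g p) := fun g hg ↦ by
    have := key g hg
    exact fst2 (clp S) _ _
  have := i5 g hg
  have := i5 g₀ hg₀
  have all := ae_and◝ ⟨hWZ, ae_and◝ ⟨e1 g hg, ae_and◝ ⟨e1 g₀ hg₀, e2⟩⟩⟩
  refine (ae_congr (R := fun p ↦ app (gh g₀) p ~ app (gh g) p) fun p hp ↦ ⬚)◜ (ae_mono (R := fun p ↦ clp S (app η p) (gp b g₀ p) ~ clp S (app η p) (gp b g p)) (fun p hp h ↦ ⬚) all)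
  · simp only [gh]; rw [app_lam hp, app_lam hp]
  · rcases h with ⟨h1, h2, h3, h4⟩
    refine (hcl _ h1 _ _)◝ ⟨_, ⟨⟨⬚, gp_FF (hA₀ g₀ hg₀)◜ hp, h3⟩, ⟨⬚, gp_FF (hA₀ g hg)◜ hp, h2⟩, h4⟩, rfl⟩
    · exact lam_fns fun q hq ↦ hZZ g₀ hg₀ _ (cut_B hp hq)
    · exact lam_fns fun q hq ↦ hZZ g hg _ (cut_B hp hq)
theorem WF0 (h : ∀ x, x ~ c → x ~ b) : WFA b c := by
  intro A ⟨f0, hf0⟩ hA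
  rcases B_ne (X := X) with ⟨p0, hp0⟩
  have cst : ∀ f, f ~ A → ∀ p, p ~ B → app f p = app f p0 := fun f hf p hp ↦ by
    rcases hA f hf with ⟨_, s, hs, h2, h3⟩
    exact h3 _ _ hp hp0 fun x hx ↦ absurd (h x (h2 x hx)◜) (h2 x hx)◝
  rcases fnd (Q := img A fun f ↦ app f p0) ⟨_, mem_img◝ ⟨f0, hf0, rfl⟩⟩ with ⟨y, hy, hm⟩
  rcases mem_img◜ hy with ⟨f, hf, rfl⟩
  refine ⟨f, hf, fun g hg hlt ↦ ⬚⟩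
  rcases ae_ex hlt with ⟨p, hp, hh⟩
  rw [cst f hf p hp, cst g hg p hp] at hh
  exact hm _ (mem_img◝ ⟨g, hg, rfl⟩) hh
theorem WF1 (hc : c ~ D) : WFA c (suc c) := by
  intro A ⟨f0, hf0⟩ hA
  rcases B_ne (X := X) with ⟨p0, hp0⟩
  have sup : ∀ f, f ~ A → ∀ p q, p ~ B → q ~ B → app p c = app q c → app f p = app f q := fun f hf p q hp hq h ↦ by
    rcases hA f hf with ⟨_, s, hs, h2, h3⟩
    refine h3 _ _ hp hq fun x hx ↦ ⬚
    have := h2 x hx; simp at this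
    rcases this with ⟨h1 | h1, h2⟩
    · exact absurd h1 h2
    · rw [h1, h]
  obtain ⟨y, hy, hm⟩ := UC.wf (img A fun f ↦ lam v fun k ↦ app f (upd p0 c k)) ⟨_, mem_img◝ ⟨f0, hf0, rfl⟩⟩
    fun f hf ↦ by rcases mem_img◜ hf with ⟨f, hf, rfl⟩; exact fn_lam
  rcases mem_img◜ hy with ⟨f, hf, rfl⟩
  refine ⟨f, hf, fun g hg hlt ↦ hm _ (mem_img◝ ⟨g, hg, rfl⟩) ⬚⟩
  have := (ae_one (s := suc c) hc (fun x hx ↦ hx) fun p q hp hq ha ↦ by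
    rw [sup f hf p q hp hq (ha c (by simp)), sup g hg p q hp hq (ha c (by simp))])◜ hlt
  rcases ae_ex this with ⟨p, hp, hh⟩
  refine (me_congr fun k hk ↦ ⬚)◜ hh
  have e : app (upd p c k) c = app (upd p0 c k) c := by rw [upd_at hc, upd_at hc]
  rw [app_lam hk, app_lam hk, sup f hf _ _ (upd_B hp hk) (upd_B hp0 hk) e, sup g hg _ _ (upd_B hp hk) (upd_B hp0 hk) e]
theorem WFZ.sub (h : WFZ b c Z₀) (hZ : ∀ x, x ~ Z → x ~ Z₀) : WFZ b c Z := fun A h1 h2 ↦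
  h A h1 fun f hf ↦ ⟨(h2 f hf)◜, by have := (h2 f hf)◜.fst; exact ae_mono (fun p hp h ↦ hZ _ h) (h2 f hf)◝⟩
theorem FF_const : FF b c (lam B ℸ z) :=
  ⟨fn_lam, emp, Fi_emp, fun x hx ↦ by simp at hx, fun p q hp hq _ ↦ by rw [app_lam hp, app_lam hq]⟩
theorem Fi.bd (hs : Fi s) (hc : IsLimitOrd ∊ c) (h : ∀ x, x ~ s → x ~ c) :
    ∃ d, d ~ c ∧ ∀ x, x ~ s → x ~ d := by
  rw [lim_iff] at hc
  rcases emp_or (x := s) with rfl | hne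
  · rcases hc◝◜ with ⟨y, hy⟩; exact ⟨y, hy, fun x hx ↦ by simp at hx⟩
  · rcases hs◝ s (fun _ h ↦ h) hne with ⟨d, hd⟩
    exact ⟨suc d, hc◝◝ d (h d hd◜), hd.sub⟩
theorem WF (c : X) (hc : Od c) : c ~ suc D → ∀ b, Od b → WFA b c := by
  refine oind (fun c ↦ c ~ suc D → ∀ b, Od b → WFA b c) (fun c hc ih hcD b hb ↦ ⬚) c hc
  have hD : Od (suc D : X) := UC.hD.sucO
  rcases hc.cases with rfl | ⟨c₀, hc₀, rfl⟩ | hl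
  · exact WF0 fun x hx ↦ by simp at hx
  · have h1 : c₀ ~ suc D := hD.tr hcD (by simp)
    have h2 : c₀ ~ D := by
      simp at hcD; rcases hcD with h | h
      · exact UC.hD.tr h (by simp)
      · rw [← h]; simp
    refine WFZ.a fun Z A hA hA₀ ↦ CUT hc₀ (ih c₀ (by simp) h1 b hb) FF_const (η := lam B ℸ Z) ⬚ hA fun g hg ↦ ⟨(hA₀ g hg)◜, ⬚⟩
    · exact ae_true fun p hp ↦ (WF1 h2).wz
    · exact (ae_congr fun p hp ↦ by rw [app_lam hp])◜ (hA₀ g hg)◝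
  · by_contra hcon
    have : ∃ Z, ¬ WFZ b c Z := by by_contra h; push Not at h; exact hcon (WFZ.a h)
    rcases this with ⟨Z, hZ⟩
    obtain ⟨ξ, hξ, ⟨b, hb, hbad⟩, hmin⟩ := oleast (fun ξ ↦ ∃ b, Od b ∧ ¬ WFZ b c (Vs ξ))
      ⟨_, rk_od Z, b, hb, fun h ↦ hZ (h.sub (rk_spec Z)◝◜)⟩
    refine hbad fun A ⟨f, hf⟩ hA ↦ ⬚
    rcases hA f hf with ⟨hF, hfV⟩
    have iF := hF.fst
    rcases hF with ⟨h1, s, hs, h2, h3⟩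
    rcases hs.bd hl fun x hx ↦ (h2 x hx)◜ with ⟨d, hd, hsd⟩
    have hod := hc.mem hd
    let η := lam B fun p ↦ Vs (rk (app f p))
    have hη : FF b d η := ⟨fn_lam, s, hs, fun x hx ↦ ⟨hsd x hx, (h2 x hx)◝⟩, fun p q hp hq ha ↦ by
      simp only [η]; rw [app_lam hp, app_lam hq, h3 p q hp hq ha]⟩
    have iη := hη.fst
    have hηe : ∀ p, p ~ B → app η p = Vs (rk (app f p)) := fun p hp ↦ app_lam hp
    have hWZ : ae fun p ↦ WFZ d c (app η p) := by
      have i1 : FSP fun p ↦ WFZ d c (app η p) := fsp1 _ _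
      refine ae_mono (fun p hp h ↦ ⬚) hfV
      rw [hηe p hp]
      rcases (mem_Vs hξ)◜ h with ⟨n, hn, hn₀⟩
      have : rk (app f p) ~ ξ := by
        rcases (rk_spec (app f p))◝◝ n (hξ.mem hn) hn₀ with h | h
        · exact hξ.tr hn h
        · rwa [h]
      by_contra hw
      exact hmin _ this ⟨d, hod, hw⟩
    rcases emp_or (x := sep A fun g ↦ ae fun p ↦ app g p ~ app η p) with hE | hE
    · refine ⟨f, hf, fun g hg hlt ↦ ⬚⟩
      have ig := (hA g hg)◜.fst
      have : g ~ sep A fun g ↦ ae fun p ↦ app g p ~ app η p :=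
        mem_sep◝ ⟨hg, ae_mono (fun p hp h ↦ by rw [hηe p hp]; exact (rk_spec _)◝◜ _ h) hlt⟩
      rw [hE] at this; simp at this
    · obtain ⟨g, hg, hm⟩ := CUT hod (ih d hd (hD.tr hcD hd) b hb) hη hWZ hE fun g hg ↦ by
        rw [mem_sep] at hg; exact ⟨(hA g hg◜)◜, hg◝⟩
      rw [mem_sep] at hg
      refine ⟨g, hg◜, fun g₀ hg₀ hlt ↦ hm g₀ (mem_sep◝ ⟨hg₀, ⬚⟩) hlt⟩
      have ig := (hA g hg◜)◜.fst
      have ig₀ := (hA g₀ hg₀)◜.fst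
      refine ae_mono (fun p hp h ↦ ⬚) (ae_and◝ ⟨hlt, hg◝⟩)
      rw [hηe p hp] at h ⊢
      exact Vs_tr (rk_od _) h◝ h◜
end
section
variable {X : Type} [ZFM X] {a f s g x : X}
theorem dfEval (f : Fml n) : ∀ (C : ⊙X → X → Prop) (hC : DF fun σ ↦ C σ⇡ σ⁰)
    (ts : Fin n → ⊠X) (hts : ∀ i, DT (ts i)),
    DF fun σ ↦ Eval ∊ NoAux (C σ) f fun i ↦ ts i σ := by
  have hcons : ∀ {n} (ts : Fin n → ⊠X) (hts : ∀ i, DT (ts i)) (i : Fin (n+1)),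
      DT ((⊹ (fun σ ↦ σ 0) (fun i σ ↦ ts i σ⇡) : Fin (n+1) → ⊠X) i) := fun ts hts i ↦ by
    refine Fin.cases ⬚ (fun i ↦ ⬚) i
    · exact DT.var 0
    · have := hts i; exact DT.shift (ts i)
  have hce : ∀ {n} (ts : Fin n → ⊠X) (σ : ⊙X), (fun i ↦ (⊹ (fun σ ↦ σ 0) (fun i σ ↦ ts i σ⇡) : Fin (n+1) → ⊠X) i σ) =
      ⊹ σ⁰ fun i ↦ ts i σ⇡ := fun ts σ ↦ by
    funext i; refine Fin.cases ⬚ (fun i ↦ ⬚) i <;> rfl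
  have hsh : ∀ (C : ⊙X → X → Prop) (hC : DF fun σ ↦ C σ⇡ σ⁰),
      DF fun σ ↦ C (fun n ↦ σ (n+1+1)) σ⁰ := fun C hC ↦ hC.sub fun n ↦ if n = 0 then .inl 0 else .inl (n+1)
  induction f with
  | mem i j => intro C hC ts hts; have := hts i; have := hts j; exact DF.mem2
  | equ i j => intro C hC ts hts; have := hts i; have := hts j; exact DF.eq2
  | aux i => intro C hC ts hts; exact DF.prop False
  | impl f g ih1 ih2 => intro C hC ts hts; have := ih1 C hC ts hts; have := ih2 C hC ts hts; exact DF.imp_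
  | neg f ih => intro C hC ts hts; have := ih C hC ts hts; exact DF.not_
  | all f ih =>
    intro C hC ts hts
    have h1 := (ih (fun σ ↦ C σ⇡) (hsh C hC) _ (hcons ts hts)).congr fun σ ↦ by rw [hce]
    exact DF.all_ (R := fun x σ ↦ C σ x → Eval ∊ NoAux (C σ) f (⊹ x fun i ↦ ts i σ))
  | ex f ih =>
    intro C hC ts hts
    have h1 := (ih (fun σ ↦ C σ⇡) (hsh C hC) _ (hcons ts hts)).congr fun σ ↦ by rw [hce]
    exact DF.ex_ (R := fun x σ ↦ C σ x ∧ Eval ∊ NoAux (C σ) f (⊹ x fun i ↦ ts i σ))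
  | allb i f ih =>
    intro C hC ts hts
    have h1 := (ih (fun σ ↦ C σ⇡) (hsh C hC) _ (hcons ts hts)).congr fun σ ↦ by rw [hce]
    have := hts i
    have := DT.shift (ts i)
    exact DF.all_ (R := fun x σ ↦ C σ x → x ~ ts i σ → Eval ∊ NoAux (C σ) f (⊹ x fun i ↦ ts i σ))
instance dfEA {n : ℕ} {f : Fml n} {ts : Fin n → ⊠X} [hts : ∀ i, DT (ts i)] :
    DF fun σ ↦ Eval ∊ NoAux AllSets f fun i ↦ ts i σ := dfEval f (ℸ AllSets) (DF.prop True) ts hts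
variable [UC X]
open UC
abbrev Fa (a f : X) : Prop := FF emp a f
def Sc (a f g : X) : Prop := Fa a f ∧ Fa a g ∧ (ae fun p ↦ app f p ~ app g p) ∧
  ∀ p, p ~ B → app f p = emp ∨ ∃ q, q ~ B ∧ app f p ~ app g q
instance : DF fun σ : ⊙X ↦ Sc σ⁰ σ¹ σ² := by unfold Sc; infer_instance
def pi₀ (a g : X) : X := clp Sc a g
instance : T2 X pi₀ := by unfold pi₀; infer_instance
def adj (f g : X) : X := lam B fun p ↦ ite₀ (app f p ~ app g p) (app f p) emp
def Ok (a : X) : Prop := Od a ∧ a ~ suc D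
theorem Fa.sp (h : Fa a f) : ∃ s, Fi s ∧ (∀ x, x ~ s → x ~ a) ∧ SF f s := by
  rcases h with ⟨_, s, h1, h2, h3⟩; exact ⟨s, h1, fun x hx ↦ (h2 x hx)◜, h3⟩
theorem Fa.mk (h : Fn f B) (h1 : Fi s) (h2 : ∀ x, x ~ s → x ~ a) (h3 : SF f s) : Fa a f :=
  ⟨h, s, h1, fun x hx ↦ ⟨h2 x hx, by simp⟩, h3⟩
theorem Fa.c2 (R : X → X → X) [h : DT fun σ ↦ R σ⁰ σ¹] (hf : Fa a f) (hg : Fa a g) :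
    have := fun s t [DT s] [DT t] ↦ dt2 R s t
    Fa a (lam B fun p ↦ R (app f p) (app g p)) := by
  intro _
  rcases hf.sp with ⟨s, h1, h2, h3⟩
  rcases hg.sp with ⟨s₀, h1₀, h2₀, h3₀⟩
  refine Fa.mk fn_lam (h1.un h1₀) (fun x hx ↦ ⬚) fun p q hp hq ha ↦ ⬚
  · simp at hx; exact hx.elim (h2 x) (h2₀ x)
  · rw [app_lam hp, app_lam hq, h3 p q hp hq (ha.mono fun x hx ↦ un_l hx), h3₀ p q hp hq (ha.mono fun x hx ↦ un_r hx)]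
theorem adj_F (hf : Fa a f) (hg : Fa a g) : Fa a (adj f g) :=
  Fa.c2 (fun x y ↦ ite₀ (x ~ y) x emp) hf hg
theorem adj_eq (hf : Fa a f) (hg : Fa a g) (h : ae fun p ↦ app f p ~ app g p) :
    ae fun p ↦ app (adj f g) p = app f p := by
  have := hf.fst
  have := hg.fst
  have := (adj_F hf hg).fst
  refine ae_mono (fun p hp hh ↦ ⬚) h
  unfold adj; rw [app_lam hp, ite_pos hh]
theorem adj_S (hf : Fa a f) (hg : Fa a g) (h : ae fun p ↦ app f p ~ app g p) : Sc a (adj f g) g := by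
  have := hf.fst
  have := hg.fst
  have := (adj_F hf hg).fst
  refine ⟨adj_F hf hg, hg, ae_mono (fun p hp hh ↦ ⬚) (ae_and◝ ⟨h, adj_eq hf hg h⟩), fun p hp ↦ ⬚⟩
  · rw [hh◝]; exact hh◜
  · unfold adj; rw [app_lam hp]
    by_cases hh : app f p ~ app g p
    · rw [ite_pos hh]; exact ▷ ⟨p, hp, hh⟩
    · rw [ite_neg hh]; exact ◁ rfl
theorem Sc_hc (a x : X) : ∃ A, x ~ A ∧ ∀ y, y ~ A → ∀ z, Sc a z y → z ~ A := by
  let T := tc (un (upr emp emp) (img B fun p ↦ app x p))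
  refine ⟨un (upr x x) (fns B T), by simp, fun y hy z hz ↦ un_r (mem_fns◝ ⟨hz◜◜, fun p hp ↦ ⬚⟩)⟩
  rcases hz◝◝◝ p hp with h | ⟨q, hq, h⟩
  · rw [h]; exact tc_sub (un_l (by simp))
  · simp at hy; rcases hy with rfl | hy
    · exact tc_tr (tc_sub (un_r (mem_img◝ ⟨q, hq, rfl⟩))) h
    · exact tc_tr ((mem_fns◜ hy)◝ q hq) h
theorem Sc_hw (ha : Ok a) (A : X) (hA : ∃ x, x ~ A) : ∃ y, y ~ A ∧ ∀ z, z ~ A → ¬ Sc a z y := by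
  by_cases h : ∃ y, y ~ A ∧ Fa a y
  · rcases WF a ha◜ ha◝ emp Od_emp (sep A fun y ↦ Fa a y) (by simpa using h) fun f hf ↦ (mem_sep◜ hf)◝ with ⟨y, hy, hm⟩
    exact ⟨y, (mem_sep◜ hy)◜, fun z hz hs ↦ hm z (mem_sep◝ ⟨hz, hs◜⟩) hs◝◝◜⟩
  · rcases hA with ⟨x, hx⟩
    exact ⟨x, hx, fun z hz hs ↦ h ⟨z, hz, hs◜⟩⟩
theorem mem_pi (ha : Ok a) : w ~ pi₀ a x ↔ ∃ z, Sc a z x ∧ w = pi₀ a z :=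
  clp_mem (Sc_hc a) (Sc_hw ha) x w
theorem Sind (ha : Ok a) (Q : X → Prop) [DF fun σ ↦ Q σ⁰] (h : ∀ x, (∀ z, Sc a z x → Q z) → Q x) (x : X) : Q x :=
  have : DF fun σ : ⊙X ↦ Sc a σ⁰ σ¹ := by unfold Sc; infer_instance
  sind (S := Sc a) (Sc_hc a) (Sc_hw ha) Q h x
theorem aeq_symm (h : ae fun p ↦ app f p = app g p) : ae fun p ↦ app g p = app f p :=
  (ae_congr fun p hp ↦ eq_comm)◜ h
theorem pi_eq1 (ha : Ok a) (f : X) : ∀ g, Fa a f → Fa a g → (ae fun p ↦ app f p = app g p) → pi₀ a f = pi₀ a g := by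
  refine Sind ha (fun f ↦ ∀ g, Fa a f → Fa a g → (ae fun p ↦ app f p = app g p) → pi₀ a f = pi₀ a g)
    (fun f ih g hf hg h ↦ zext fun w ↦ ⬚) f
  have := hf.fst
  have := hg.fst
  rw [mem_pi ha, mem_pi ha]
  constructor
  · rintro ⟨z, hz, rfl⟩
    have := hz◜.fst
    have h1 : ae fun p ↦ app z p ~ app g p := ae_mono (fun p hp h ↦ by rw [← h◝]; exact h◜) (ae_and◝ ⟨hz◝◝◜, h⟩)
    exact ⟨adj z g, adj_S hz◜ hg h1, ih z hz _ hz◜ (adj_F hz◜ hg) (aeq_symm (adj_eq hz◜ hg h1))⟩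
  · rintro ⟨z, hz, rfl⟩
    have := hz◜.fst
    have h1 : ae fun p ↦ app z p ~ app f p := ae_mono (fun p hp h ↦ by rw [h◝]; exact h◜) (ae_and◝ ⟨hz◝◝◜, h⟩)
    exact ⟨adj z f, adj_S hz◜ hf h1, (ih _ (adj_S hz◜ hf h1) z (adj_F hz◜ hf) hz◜ (adj_eq hz◜ hf h1)).symm⟩
theorem pi_mem1 (ha : Ok a) (hf : Fa a f) (hg : Fa a g) (h : ae fun p ↦ app f p ~ app g p) : pi₀ a f ~ pi₀ a g :=
  (mem_pi ha)◝ ⟨adj f g, adj_S hf hg h, pi_eq1 ha _ _ hf (adj_F hf hg) (aeq_symm (adj_eq hf hg h))⟩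
theorem acF (R : X → X → Prop) [hR : DF fun σ ↦ R σ⁰ σ¹] (hs : Fi s) (hsa : ∀ x, x ~ s → x ~ a)
    (h : ∀ p q, p ~ B → q ~ B → Ag s p q → ∀ y, R p y ↔ R q y) (hne : ae fun p ↦ ∃ y, R p y) :
    ∃ g, Fa a g ∧ ae fun p ↦ R p (app g p) := by
  have : ∀ s t [DT s] [DT t], DF fun σ ↦ R (s σ) (t σ) := fun s t ↦ df2 R s t
  obtain ⟨b, hb⟩ := coll (X := X) B (fun p y ↦ (∃ y, R p y) → R p y) fun p hp ↦ by
    by_cases h : ∃ y, R p y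
    · rcases h with ⟨y, hy⟩; exact ⟨y, ℸ hy⟩
    · exact ⟨p, fun h₀ ↦ absurd h₀ h⟩
  let F := lam B fun p ↦ sep b fun y ↦ R p y
  have hne₀ : ae fun p ↦ ∃ y, y ~ app F p := by
    refine (ae_congr fun p hp ↦ ⟨fun hh ↦ ⬚, fun hh ↦ ⬚⟩)◜ hne
    · simp only [F]; rw [app_lam hp]
      rcases hb p hp with ⟨y, hy, hy₀⟩
      exact ⟨y, mem_sep◝ ⟨hy, hy₀ hh⟩⟩
    · simp only [F] at hh; rw [app_lam hp] at hh; rcases hh with ⟨y, hy⟩; exact ⟨y, (mem_sep◜ hy)◝⟩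
  obtain ⟨g, h1, h2, h3⟩ := acU (F := F) hs (fun p q hp hq ha ↦ by
      simp only [F]; rw [app_lam hp, app_lam hq]; exact sep_congr fun y _ ↦ h p q hp hq ha y) hne₀
  · refine ⟨g, Fa.mk h1 hs hsa h2, ⬚⟩
    have i1 : FST (app g) := h2.fst hs
    have i3 : FSP fun p ↦ app g p ~ app F p := ⟨s, hs, fun p q hp hq ha ↦ by
      simp only [F]; rw [app_lam hp, app_lam hq, h2 p q hp hq ha, sep_congr fun y _ ↦ h p q hp hq ha y]⟩
    have i2 : FSP fun p ↦ R p (app g p) := ⟨s, hs, fun p q hp hq ha ↦ by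
      rw [h2 p q hp hq ha]; exact h p q hp hq ha _⟩
    refine ae_mono (fun p hp hh ↦ ⬚) h3
    simp only [F] at hh; rw [app_lam hp, mem_sep] at hh; exact hh◝
theorem pi_eq2 (ha : Ok a) (f : X) : ∀ g, Fa a f → Fa a g → pi₀ a f = pi₀ a g → (ae fun p ↦ app f p = app g p) := by
  refine Sind ha (fun f ↦ ∀ g, Fa a f → Fa a g → pi₀ a f = pi₀ a g → (ae fun p ↦ app f p = app g p))
    (fun f ih g hf hg h ↦ ⬚) f
  have i1 := hf.fst
  have i2 := hg.fst
  by_contra hne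
  rw [← ae_not] at hne
  rcases hf.sp with ⟨s, h1, h2, h3⟩
  rcases hg.sp with ⟨s₀, h1₀, h2₀, h3₀⟩
  have hU := h1.un h1₀
  have hU₀ : ∀ x, x ~ un s s₀ → x ~ a := fun x hx ↦ by simp at hx; exact hx.elim (h2 x) (h2₀ x)
  have j1 : ∀ p q, p ~ B → q ~ B → Ag (un s s₀) p q → app f p = app f q := fun p q hp hq ha ↦
    h3 p q hp hq (ha.mono fun x hx ↦ un_l hx)
  have j2 : ∀ p q, p ~ B → q ~ B → Ag (un s s₀) p q → app g p = app g q := fun p q hp hq ha ↦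
    h3₀ p q hp hq (ha.mono fun x hx ↦ un_r hx)
  have k1 : FSP fun p ↦ ∃ y, y ~ app f p ∧ ¬ y ~ app g p := fsp2 (fun u w ↦ ∃ y, y ~ u ∧ ¬ y ~ w) _ _
  have k2 : FSP fun p ↦ ∃ y, y ~ app g p ∧ ¬ y ~ app f p := fsp2 (fun u w ↦ ∃ y, y ~ u ∧ ¬ y ~ w) _ _
  have : ae fun p ↦ (∃ y, y ~ app f p ∧ ¬ y ~ app g p) ∨ (∃ y, y ~ app g p ∧ ¬ y ~ app f p) := by
    refine ae_mono (fun p hp hh ↦ ⬚) hne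
    by_contra hc
    push Not at hc
    exact hh (zext fun y ↦ ⟨hc◜ y, hc◝ y⟩)
  rcases ae_or◜ this with hh | hh
  · obtain ⟨k, hk, hk₀⟩ := acF (a := a) (fun p y ↦ y ~ app f p ∧ ¬ y ~ app g p) hU hU₀
      (fun p q hp hq ha y ↦ by rw [j1 p q hp hq ha, j2 p q hp hq ha]) hh
    have i3 := hk.fst
    have hk₀ := ae_and◜ hk₀
    have := pi_mem1 ha hk hf hk₀◜
    rw [h, mem_pi ha] at this
    rcases this with ⟨z, hz, he⟩
    have i4 := hz◜.fst
    have i5 := (adj_F hk hf).fst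
    rw [pi_eq1 ha _ _ hk (adj_F hk hf) (aeq_symm (adj_eq hk hf hk₀◜))] at he
    have e1 := ih _ (adj_S hk hf hk₀◜) z (adj_F hk hf) hz◜ he
    have e2 := adj_eq hk hf hk₀◜
    have : ae fun p ↦ app k p ~ app g p := ae_mono (fun p hp h ↦ by
      rw [← h◜, h◝◜]; exact h◝◝) (ae_and◝ ⟨e2, ae_and◝ ⟨e1, hz◝◝◜⟩⟩)
    exact (ae_not◜ hk₀◝) this
  · obtain ⟨k, hk, hk₀⟩ := acF (a := a) (fun p y ↦ y ~ app g p ∧ ¬ y ~ app f p) hU hU₀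
      (fun p q hp hq ha y ↦ by rw [j1 p q hp hq ha, j2 p q hp hq ha]) hh
    have i3 := hk.fst
    have hk₀ := ae_and◜ hk₀
    have := pi_mem1 ha hk hg hk₀◜
    rw [← h, mem_pi ha] at this
    rcases this with ⟨z, hz, he⟩
    have i4 := hz◜.fst
    have e1 := ih z hz k hz◜ hk he.symm
    have : ae fun p ↦ app k p ~ app f p := ae_mono (fun p hp h ↦ by
      rw [← h◜]; exact h◝) (ae_and◝ ⟨e1, hz◝◝◜⟩)
    exact (ae_not◜ hk₀◝) this
theorem pi_eq (ha : Ok a) (hf : Fa a f) (hg : Fa a g) : pi₀ a f = pi₀ a g ↔ ae fun p ↦ app f p = app g p :=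
  ⟨pi_eq2 ha f g hf hg, pi_eq1 ha f g hf hg⟩
theorem pi_mem (ha : Ok a) (hf : Fa a f) (hg : Fa a g) : pi₀ a f ~ pi₀ a g ↔ ae fun p ↦ app f p ~ app g p := by
  refine ⟨fun h ↦ ⬚, pi_mem1 ha hf hg⟩
  rcases (mem_pi ha)◜ h with ⟨z, hz, he⟩
  have i1 := hf.fst
  have i2 := hg.fst
  have i3 := hz◜.fst
  exact ae_mono (fun p hp h ↦ by rw [h◜]; exact h◝) (ae_and◝ ⟨(pi_eq ha hf hz◜)◜ he, hz◝◝◜⟩)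
def cls (a x : X) : Prop := ∃ f, Fa a f ∧ x = pi₀ a f
instance : F2 X cls := fi2 cls (by unfold cls; infer_instance)
theorem cls_tr (ha : Ok a) (hx : cls a x) (hy : y ~ x) : cls a y := by
  rcases hx with ⟨f, hf, rfl⟩
  rcases (mem_pi ha)◜ hy with ⟨z, hz, rfl⟩
  exact ⟨z, hz◜, rfl⟩
theorem consP (g : X) (fs : Fin n → X) (a : X) : (⊹ (pi₀ a g) (fun i ↦ pi₀ a (fs i)) : Fin (n+1) → X) =
    fun i ↦ pi₀ a ((⊹ g fs : Fin (n+1) → X) i) := by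
  funext i; refine Fin.cases ⬚ (fun i ↦ ⬚) i <;> rfl
theorem consA (g : X) (fs : Fin n → X) (p : X) : (⊹ (app g p) (fun i ↦ app (fs i) p) : Fin (n+1) → X) =
    fun i ↦ app ((⊹ g fs : Fin (n+1) → X) i) p := by
  funext i; refine Fin.cases ⬚ (fun i ↦ ⬚) i <;> rfl
theorem spN (fs : Fin n → X) (h : ∀ i, Fa a (fs i)) :
    ∃ s, Fi s ∧ (∀ x, x ~ s → x ~ a) ∧ ∀ i, SF (fs i) s := by
  induction n with
  | zero => exact ⟨emp, Fi_emp, fun x hx ↦ by simp at hx, fun i ↦ i.elim0⟩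
  | succ n ih =>
    rcases ih (fun i ↦ fs i.succ) fun i ↦ h i.succ with ⟨s, h1, h2, h3⟩
    rcases (h 0).sp with ⟨s₀, h1₀, h2₀, h3₀⟩
    refine ⟨un s s₀, h1.un h1₀, fun x hx ↦ by simp at hx; exact hx.elim (h2 x) (h2₀ x), fun i ↦ ⬚⟩
    refine Fin.cases ⬚ (fun i ↦ ⬚) i
    · exact h3₀.mono fun x hx ↦ un_r hx
    · exact (h3 i).mono fun x hx ↦ un_l hx
theorem Los (ha : Ok a) {n : ℕ} (φ : Fml n) : ∀ (fs : Fin n → X) (h : ∀ i, Fa a (fs i)),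
    Eval ∊ NoAux (cls a) φ (fun i ↦ pi₀ a (fs i)) ↔ ae fun p ↦ Eval ∊ NoAux AllSets φ fun i ↦ app (fs i) p := by
  have FS : ∀ {n} (φ : Fml n) (fs : Fin n → X) (h : ∀ i, Fa a (fs i)),
      FSP fun p ↦ Eval ∊ NoAux AllSets φ fun i ↦ app (fs i) p := fun φ fs h ↦
    fspN (Eval ∊ NoAux AllSets φ) (fun i ↦ app (fs i)) fun i ↦ (h i).fst
  have hcons : ∀ {n} (g : X) (fs : Fin n → X) (hg : Fa a g) (h : ∀ i, Fa a (fs i)) (i), Fa a ((⊹ g fs : Fin (n+1) → X) i) :=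
    fun g fs hg h i ↦ Fin.cases hg h i
  have EX : ∀ {n} (φ : Fml (n+1)) (R : (Fin n → X) → X → Prop) (hR : DF fun σ ↦ R (fun i ↦ σ (i+1)) σ⁰) (ih : ∀ (fs : Fin (n+1) → X) (h : ∀ i, Fa a (fs i)),
      Eval ∊ NoAux (cls a) φ (fun i ↦ pi₀ a (fs i)) ↔ ae fun p ↦ Eval ∊ NoAux AllSets φ fun i ↦ app (fs i) p)
      (fs : Fin n → X) (h : ∀ i, Fa a (fs i)),
      (∃ x, cls a x ∧ Eval ∊ NoAux (cls a) φ (⊹ x fun i ↦ pi₀ a (fs i))) ↔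
      ae fun p ↦ ∃ x, True ∧ Eval ∊ NoAux AllSets φ (⊹ x fun i ↦ app (fs i) p) := by
    intro n φ _ _ ih fs h
    rcases spN fs h with ⟨s, h1, h2, h3⟩
    constructor
    · rintro ⟨_, ⟨g, hg, rfl⟩, hx⟩
      rw [consP, ih _ (hcons g fs hg h)] at hx
      have i1 := FS φ _ (hcons g fs hg h)
      have i2 : FSP fun p ↦ ∃ x, True ∧ Eval ∊ NoAux AllSets φ (⊹ x fun i ↦ app (fs i) p) := FS (Fml.ex φ) fs h
      have i3 : DF fun σ ↦ Eval ∊ NoAux AllSets (Fml.ex φ) fun i ↦ app (fs i) σ⁰ := dfEA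
      have i3 : DF fun σ : ⊙X ↦ ∃ x, True ∧ Eval ∊ NoAux AllSets φ (⊹ x fun i ↦ app (fs i) σ⁰) := i3
      exact ae_mono (fun p hp hh ↦ ⟨_, trivial, by rw [consA]; exact hh⟩) hx
    · intro hh
      have iD : DF fun σ : ⊙X ↦ Eval ∊ NoAux AllSets φ (⊹ σ¹ fun i ↦ app (fs i) σ⁰) := by
        refine (dfEval φ (ℸ AllSets) (DF.prop True) (⊹ (fun σ ↦ σ 1) fun i σ ↦ app (fs i) σ⁰) fun i ↦ ⬚).congr fun σ ↦ ⬚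
        · refine Fin.cases ⬚ (fun i ↦ ⬚) i
          · exact DT.var 1
          · show DT fun σ ↦ app (fs i) σ⁰; infer_instance
        · refine iff_of_eq (congrArg _ (funext fun i ↦ ⬚)); refine Fin.cases ⬚ (fun i ↦ ⬚) i <;> rfl
      obtain ⟨g, hg, hg₀⟩ := acF (a := a) (fun p y ↦ Eval ∊ NoAux AllSets φ (⊹ y fun i ↦ app (fs i) p)) h1 h2
        (fun p q hp hq ha y ↦ by rw [show (fun i ↦ app (fs i) p) = fun i ↦ app (fs i) q from funext fun i ↦ h3 i p q hp hq ha])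
        ((ae_congr fun p hp ↦ exists_congr fun y ↦ (by simp))◜ hh)
      refine ⟨_, ⟨g, hg, rfl⟩, ⬚⟩
      rw [consP, ih _ (hcons g fs hg h)]
      exact (ae_congr fun p hp ↦ by rw [consA])◜ hg₀
  induction φ with
  | mem i j => intro fs h; exact pi_mem ha (h i) (h j)
  | equ i j => intro fs h; exact pi_eq ha (h i) (h j)
  | aux i => intro fs h; exact ae_const.symm
  | impl f g ih1 ih2 =>
    intro fs h
    have := FS f fs h
    have := FS g fs h
    exact (imp_congr (ih1 fs h) (ih2 fs h)).trans ae_imp.symm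
  | neg f ih => intro fs h; have := FS f fs h; exact (not_congr (ih fs h)).trans ae_not.symm
  | all f ih =>
    intro fs h
    have e := not_congr (EX (Fml.neg f) (fun _ _ ↦ True) (DF.prop _) (fun fs h ↦ by
      have := FS f fs h; exact (not_congr (ih fs h)).trans ae_not.symm) fs h)
    have := FS (Fml.ex (Fml.neg f)) fs h
    have i3 : DF fun σ ↦ Eval ∊ NoAux AllSets (Fml.ex (Fml.neg f)) fun i ↦ app (fs i) σ⁰ := dfEA
    have i3 : DF fun σ : ⊙X ↦ ∃ x, True ∧ Eval ∊ NoAux AllSets (Fml.neg f) (⊹ x fun i ↦ app (fs i) σ⁰) := i3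
    have i2 : FSP fun p ↦ ∃ x, True ∧ Eval ∊ NoAux AllSets (Fml.neg f) (⊹ x fun i ↦ app (fs i) p) := this
    rw [← ae_not] at e
    refine Iff.trans ⬚ (e.trans (ae_congr fun p hp ↦ ⬚)) <;>
    simp [Eval, AllSets]
  | ex f ih => intro fs h; exact EX f (fun _ _ ↦ True) (DF.prop _) ih fs h
  | @allb n i f ih =>
    intro fs h
    have e := not_congr (EX (Fml.neg (Fml.impl (Fml.mem 0 i.succ) f)) (fun _ _ ↦ True) (DF.prop _) (fun fs h ↦ by
      have := FS f fs h; have := (h 0).fst; have := (h i.succ).fst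
      have h3 := ((imp_congr (pi_mem ha (h 0) (h i.succ)) (ih fs h)).trans ae_imp.symm)
      have : FSP fun p ↦ app (fs 0) p ~ app (fs i.succ) p → Eval ∊ NoAux AllSets f fun i ↦ app (fs i) p := inferInstance
      exact (not_congr h3).trans ae_not.symm) fs h)
    have := FS (Fml.ex (Fml.neg (Fml.impl (Fml.mem 0 i.succ) f))) fs h
    have i3 : DF fun σ ↦ Eval ∊ NoAux AllSets (Fml.ex (Fml.neg (Fml.impl (Fml.mem 0 i.succ) f))) fun i ↦ app (fs i) σ⁰ := dfEA
    have i3 : DF fun σ : ⊙X ↦ ∃ x, True ∧ Eval ∊ NoAux AllSets (Fml.neg (Fml.impl (Fml.mem 0 i.succ) f)) (⊹ x fun i ↦ app (fs i) σ⁰) := i3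
    have i2 : FSP fun p ↦ ∃ x, True ∧ Eval ∊ NoAux AllSets (Fml.neg (Fml.impl (Fml.mem 0 i.succ) f)) (⊹ x fun i ↦ app (fs i) p) := this
    rw [← ae_not] at e
    refine Iff.trans ⬚ (e.trans (ae_congr fun p hp ↦ ⬚)) <;>
    simp [Eval, AllSets]
end
section
abbrev Pd := ∀ (X : Type) (E : X → X → Prop), ⊙X → Prop
class UD (R : Pd) : Prop where
  ex : ∃ (k : ℕ) (f : Fml k) (c : Fin k → ℕ), ∀ X E σ, R X E σ ↔ Eval E NoAux AllSets f fun i ↦ σ (c i)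
abbrev U1 (F : ∀ {X : Type}, (X → X → Prop) → X → Prop) : Prop := ∀ {i : ℕ}, UD fun X E σ => F E (σ i)
abbrev U2 (F : ∀ {X : Type}, (X → X → Prop) → X → X → Prop) : Prop := ∀ {i j : ℕ}, UD fun X E σ => F E (σ i) (σ j)
abbrev U3 (F : ∀ {X : Type}, (X → X → Prop) → X → X → X → Prop) : Prop := ∀ {i j k : ℕ}, UD fun X E σ => F E (σ i) (σ j) (σ k)
theorem UD.congr (h : UD R) (e : ∀ X E σ, S X E σ ↔ R X E σ) : UD S := by
  have : S = R := funext fun X ↦ funext fun E ↦ funext fun σ ↦ propext (e X E σ)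
  rw [this]; exact h
theorem UD.sub (h : UD R) (τ : ℕ → ℕ) : UD fun X E σ ↦ R X E fun n ↦ σ (τ n) := by
  rcases h with ⟨k, f, c, h⟩
  exact ⟨k, f, fun i ↦ τ (c i), fun X E σ ↦ h _ _ _⟩
instance UD.mem_ (i j : ℕ) : UD fun X E σ ↦ E (σ i) (σ j) := ⟨2, Fml.mem 0 1, ![i, j], fun _ _ _ ↦ Iff.rfl⟩
instance UD.eq_ (i j : ℕ) : UD fun X E σ ↦ σ i = σ j := ⟨2, Fml.equ 0 1, ![i, j], fun _ _ _ ↦ Iff.rfl⟩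
instance UD.false_ : UD fun X E σ ↦ False :=
  ⟨0, (Fml.all (Fml.equ 0 0)).neg, fun i ↦ 0, fun _ _ _ ↦ by simp [Eval]⟩
instance UD.true_ : UD fun X E σ ↦ True :=
  ⟨0, Fml.all (Fml.equ 0 0), fun i ↦ 0, fun _ _ _ ↦ by simp [Eval]⟩
instance UD.not_ [h : UD R] : UD fun X E σ ↦ ¬ R X E σ := by
  rcases h with ⟨k, f, c, h⟩
  exact ⟨k, f.neg, c, fun X E σ ↦ not_congr (h X E σ)⟩
instance UD.imp_ [h : UD R] [h₀ : UD S] : UD fun X E σ ↦ R X E σ → S X E σ := by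
  rcases h with ⟨k, f, c, h⟩
  rcases h₀ with ⟨k₀, f₀, c₀, h₀⟩
  refine ⟨k + k₀, (f.ren (Fin.castAdd k₀)).impl (f₀.ren (Fin.natAdd k)), Fin.append c c₀, fun X E σ ↦ ⬚⟩
  simp only [Eval, eval_ren, Fin.append_left, Fin.append_right, h, h₀]
instance UD.and_ [h : UD R] [h₀ : UD S] : UD fun X E σ ↦ R X E σ ∧ S X E σ :=
  (inferInstance : UD fun X E σ ↦ ¬ (R X E σ → ¬ S X E σ)).congr fun X E σ ↦ by tauto
instance UD.or_ [h : UD R] [h₀ : UD S] : UD fun X E σ ↦ R X E σ ∨ S X E σ :=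
  (inferInstance : UD fun X E σ ↦ ¬ R X E σ → S X E σ).congr fun X E σ ↦ by tauto
instance UD.iff_ [h : UD R] [h₀ : UD S] : UD fun X E σ ↦ (R X E σ ↔ S X E σ) :=
  (inferInstance : UD fun X E σ ↦ (R X E σ → S X E σ) ∧ (S X E σ → R X E σ)).congr fun X E σ ↦ by tauto
instance UD.ex_ {R : ∀ (X : Type) (E : X → X → Prop), X → ⊙X → Prop}
    [h : UD fun X E σ ↦ R X E σ⁰ σ⇡] : UD fun X E σ ↦ ∃ x, R X E x σ := by
  rcases h with ⟨k, f, c, h⟩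
  refine ⟨k, (f.ren fun i ↦ if c i = 0 then 0 else i.succ).ex, fun i ↦ c i - 1, fun X E σ ↦ ⬚⟩
  simp only [Eval, eval_ren, AllSets, true_and]
  refine exists_congr fun x ↦ ⬚
  refine (h X E fun n ↦ Nat.casesOn n x σ).trans ⬚
  refine iff_of_eq (congrArg _ (funext fun i ↦ ⬚))
  rcases hc : c i with _ | n <;> simp [hc]
instance UD.all_ {R : ∀ (X : Type) (E : X → X → Prop), X → ⊙X → Prop}
    [h : UD fun X E σ ↦ R X E σ⁰ σ⇡] : UD fun X E σ ↦ ∀ x, R X E x σ :=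
  (inferInstance : UD fun X E σ ↦ ¬ ∃ x, ¬ R X E x σ).congr fun X E σ ↦ by simp
instance UD.exu_ {R : ∀ (X : Type) (E : X → X → Prop), X → ⊙X → Prop}
    [h : UD fun X E σ ↦ R X E σ⁰ σ⇡] : UD fun X E σ ↦ ∃! x, R X E x σ := by
  have : UD fun X E σ ↦ R X E σ⁰ fun n ↦ σ (n+1+1) := h.sub fun n ↦ Nat.casesOn n 0 fun n ↦ n+2
  exact (inferInstance : UD fun X E σ ↦ ∃ x, R X E x σ ∧ ∀ y, R X E y σ → y = x).congr fun X E σ ↦ Iff.rfl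
def tup : (n : ℕ) → (Fin n → X) → ⊙X → ℕ → X
  | 0, _, σ => σ
  | n+1, v, σ => fun k ↦ Nat.casesOn k v⁰ (tup n (fun i ↦ v i.succ) σ)
theorem tup_lt : ∀ (n : ℕ) (v : Fin n → X) (σ : ⊙X) (i : Fin n), tup n v σ i = v i
  | n+1, v, σ, i => by
    refine Fin.cases rfl (fun i ↦ ⬚) i
    exact tup_lt n (fun i ↦ v i.succ) σ i
theorem tup_ge : ∀ (n : ℕ) (v : Fin n → X) (σ : ⊙X) (i : ℕ), tup n v σ (n + i) = σ i
  | 0, v, σ, i => by simp [tup]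
  | n+1, v, σ, i => by rw [Nat.add_right_comm]; exact tup_ge n (fun i ↦ v i.succ) σ i
theorem UD.allN : ∀ (n : ℕ) {R : Pd} (h : UD R), UD fun X E σ ↦ ∀ v : Fin n → X, R X E (tup n v σ) := by
  intro n
  induction n with
  | zero => exact fun {R} h ↦ h.congr fun X E σ ↦ ⟨fun h ↦ h Fin.elim0, fun h _ ↦ h⟩
  | succ n ih =>
    intro R h
    have h1 : UD fun X E σ ↦ ∀ x, R X E fun k ↦ Nat.casesOn k x σ := by
      have : UD fun X E σ ↦ R X E fun k ↦ Nat.casesOn k σ⁰ σ⇡ :=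
        h.congr fun X E σ ↦ by
          rw [show (fun k ↦ Nat.casesOn k σ⁰ σ⇡) = σ from funext fun k ↦ by cases k <;> rfl]
      exact UD.all_ (R := fun X E x σ ↦ R X E fun k ↦ Nat.casesOn k x σ)
    refine (ih h1).congr fun X E σ ↦ ⟨fun h v x ↦ ⬚, fun h v ↦ ⬚⟩
    · have := h (⊹ x v); simpa [tup] using this
    · exact h (fun i ↦ v i.succ) v⁰
theorem UD.evalC (f : Fml n) : ∀ (C : ∀ (X : Type) (E : X → X → Prop), ⊙X → X → Prop)
    (hC : UD fun X E σ ↦ C X E σ⇡ σ⁰) (c : Fin n → ℕ),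
    UD fun X E σ ↦ Eval E NoAux (C X E σ) f fun i ↦ σ (c i) := by
  have hsh : ∀ (C : ∀ (X : Type) (E : X → X → Prop), ⊙X → X → Prop)
    (hC : UD fun X E σ ↦ C X E σ⇡ σ⁰), UD fun X E σ ↦ C X E (fun n ↦ σ (n+1+1)) σ⁰ :=
    fun C hC ↦ hC.sub fun n ↦ Nat.casesOn n 0 fun n ↦ n+2
  have hsh2 : ∀ (n : ℕ) (f : Fml (n+1)) (ih : ∀ (C : ∀ (X : Type) (E : X → X → Prop), ⊙X → X → Prop)
    (hC : UD fun X E σ ↦ C X E σ⇡ σ⁰) (c : Fin (n+1) → ℕ),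
    UD fun X E σ ↦ Eval E NoAux (C X E σ) f fun i ↦ σ (c i)) (C : ∀ (X : Type) (E : X → X → Prop), ⊙X → X → Prop)
    (hC : UD fun X E σ ↦ C X E σ⇡ σ⁰) (c : Fin n → ℕ), UD fun X E σ ↦
      Eval E NoAux (C X E σ⇡) f (⊹ σ⁰ fun i ↦ σ (c i + 1)) := fun n f ih C hC c ↦ by
    refine (ih (fun X E σ ↦ C X E σ⇡) (hsh C hC) (⊹ 0 fun i ↦ c i + 1)).congr fun X E σ ↦ ⬚
    refine iff_of_eq (congrArg _ (funext fun i ↦ ⬚)); refine Fin.cases ⬚ (fun i ↦ ⬚) i <;> rfl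
  induction f with
  | mem i j => intro C hC c; exact UD.mem_ _ _
  | equ i j => intro C hC c; exact UD.eq_ _ _
  | aux i => intro C hC c; exact UD.false_
  | impl f g ih1 ih2 => intro C hC c; have := ih1 C hC c; have := ih2 C hC c; exact UD.imp_
  | neg f ih => intro C hC c; have := ih C hC c; exact UD.not_
  | all f ih =>
    intro C hC c; have := hsh2 _ f ih C hC c
    exact (UD.all_ : UD fun X E σ ↦ ∀ x, C X E σ x → Eval E NoAux (C X E σ) f (⊹ x fun i ↦ σ (c i)))
  | ex f ih =>
    intro C hC c; have := hsh2 _ f ih C hC c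
    exact (UD.ex_ : UD fun X E σ ↦ ∃ x, C X E σ x ∧ Eval E NoAux (C X E σ) f (⊹ x fun i ↦ σ (c i)))
  | allb j f ih =>
    intro C hC c; have := hsh2 _ f ih C hC c
    exact (UD.all_ : UD fun X E σ ↦ ∀ x, C X E σ x → E x (σ (c j)) → Eval E NoAux (C X E σ) f (⊹ x fun i ↦ σ (c i)))
section
variable (i j k l : ℕ)
instance : U2 SubsetE := by unfold SubsetE; infer_instance
instance : U1 TransSet := by unfold TransSet; infer_instance
instance : U1 IsOrd := by unfold IsOrd; infer_instance
instance : U1 IsZero := by unfold IsZero; infer_instance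
instance : U2 IsSuccOf := by unfold IsSuccOf; infer_instance
instance : U1 IsLimitOrd := by unfold IsLimitOrd; infer_instance
instance : U3 IsUPair := by unfold IsUPair; infer_instance
instance : U3 IsKPair := by unfold IsKPair; infer_instance
instance : UD fun X E σ ↦ IsKTriple E (σ i) (σ j) (σ k) (σ l) := by unfold IsKTriple; infer_instance
instance : U3 PairIn := by unfold PairIn; infer_instance
instance : U1 IsFunc := by unfold IsFunc; infer_instance
instance : U2 IsFuncOn := by unfold IsFuncOn; infer_instance
instance : U3 MapsTo := by unfold MapsTo; infer_instance
instance : U2 IsVHier := by unfold IsVHier; infer_instance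
instance : U2 IsVStage := by unfold IsVStage; infer_instance
instance : U1 GClosed := by
  unfold GClosed IsGProd IsGMemRel IsGDiff IsGInter IsGUnionSet IsGDom IsGConv IsGPerm1 IsGPerm2; infer_instance
instance : U2 IsGClOf := by unfold IsGClOf; infer_instance
instance : U2 IsDefSetOf := by unfold IsDefSetOf; infer_instance
instance : U2 IsTransClOf := by unfold IsTransClOf; infer_instance
instance : U2 IsLZero := by unfold IsLZero; infer_instance
instance : U3 IsLHier := by unfold IsLHier; infer_instance
instance : U3 IsLStage := by unfold IsLStage; infer_instance
instance : U2 InL := by unfold InL; infer_instance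
end
theorem zf_ud {X Y : Type} {E : X → X → Prop} {E₀ : Y → Y → Prop} (σ : ⊙X) (τ : ℕ → Y)
    (e : ∀ R, UD R → R X E σ → R Y E₀ τ) (h : SatZF E NoAux) : SatZF E₀ NoAux where
  ext := e (fun X E σ ↦ ∀ x y, (∀ z, E z x ↔ E z y) → x = y) inferInstance h.ext
  found := e (fun X E σ ↦ ∀ x : X, (∃ y, E y x) → ∃ y, E y x ∧ ∀ z, E z y → ¬ E z x) inferInstance h.found
  pair := e (fun X E σ ↦ ∀ x y : X, ∃ p, ∀ z, E z p ↔ (z = x ∨ z = y)) inferInstance h.pair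
  union := e (fun X E σ ↦ ∀ x : X, ∃ u, ∀ z, E z u ↔ ∃ y, E y x ∧ E z y) inferInstance h.union
  power := e (fun X E σ ↦ ∀ x : X, ∃ p, ∀ z, E z p ↔ SubsetE E z x) inferInstance h.power
  infty := e (fun X E σ ↦ ∃ w : X, (∃ z, E z w ∧ ∀ u, ¬ E u z) ∧
    ∀ x, E x w → ∃ s, E s w ∧ ∀ z, E z s ↔ (E z x ∨ z = x)) inferInstance h.infty
  sep := fun {n} f v a ↦ by
    have i1 : UD fun X E σ ↦ Eval E NoAux AllSets f (⊹ σ⁰ fun i : Fin n ↦ σ (i + 1 + 1 + 1)) :=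
      (UD.evalC f (fun _ _ _ ↦ AllSets) (inferInstanceAs (UD fun X E σ ↦ True)) (⊹ 0 fun i ↦ i + 1 + 1 + 1)).congr
        fun X E σ ↦ iff_of_eq (congrArg _ (funext fun i ↦ Fin.cases rfl (fun i ↦ rfl) i))
    have i2 : UD fun X E σ ↦ ∀ a, ∃ b, ∀ z, E z b ↔ (E z a ∧ Eval E NoAux AllSets f (⊹ z fun i : Fin n ↦ σ i)) :=
      inferInstance
    have := e _ (UD.allN n i2) (fun v ↦ by simp only [tup_lt]; exact h.sep f v) v
    simp only [tup_lt] at this; exact this a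
  repl := fun {n} f v a ↦ by
    have i1 : UD fun X E σ ↦ Eval E NoAux AllSets f (⊹ σ¹ (⊹ σ⁰ fun i : Fin n ↦ σ (i + 1 + 1 + 1))) :=
      (UD.evalC f (fun _ _ _ ↦ AllSets) (inferInstanceAs (UD fun X E σ ↦ True))
        (⊹ 1 (⊹ 0 fun i ↦ i + 1 + 1 + 1))).congr
        fun X E σ ↦ iff_of_eq (congrArg _ (funext fun i ↦ Fin.cases rfl (fun i ↦ Fin.cases rfl (fun i ↦ rfl) i) i))
    have i3 : UD fun X E σ ↦ Eval E NoAux AllSets f (⊹ σ⁰ (⊹ σ¹ fun i : Fin n ↦ σ (i + 1 + 1 + 1 + 1))) :=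
      (UD.evalC f (fun _ _ _ ↦ AllSets) (inferInstanceAs (UD fun X E σ ↦ True))
        (⊹ 0 (⊹ 1 fun i ↦ i + 1 + 1 + 1 + 1))).congr
        fun X E σ ↦ iff_of_eq (congrArg _ (funext fun i ↦ Fin.cases rfl (fun i ↦ Fin.cases rfl (fun i ↦ rfl) i) i))
    have i2 : UD fun X E σ ↦ ∀ a, (∀ x, E x a → ∃! y, Eval E NoAux AllSets f (⊹ x (⊹ y fun i : Fin n ↦ σ i))) →
      ∃ b, ∀ y, E y b ↔ ∃ x, E x a ∧ Eval E NoAux AllSets f (⊹ x (⊹ y fun i : Fin n ↦ σ i)) := inferInstance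
    have := e _ (UD.allN n i2) (fun v ↦ by simp only [tup_lt]; exact h.repl f v) v
    simp only [tup_lt] at this; exact this a
end
section
variable {X : Type} [ZFM X] {u v x y w t z c s a b l : X}
def gpr (x y : X) : X := bld fun w ↦ ∃ u v, u ~ x ∧ v ~ y ∧ w = pr u v
def gme (x y : X) : X := bld fun w ↦ ∃ u v, u ~ x ∧ v ~ y ∧ u ~ v ∧ w = pr u v
def gdf (x y : X) : X := sep x fun w ↦ ¬ w ~ y
def gin (x y : X) : X := sep x fun w ↦ w ~ y
def gdo (x : X) : X := bld fun w ↦ ∃ u, pr w u ~ x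
def gco (x : X) : X := bld fun w ↦ ∃ u v, pr u v ~ x ∧ w = pr v u
def g1 (x : X) : X := bld fun t ↦ ∃ u v w, pr u (pr w v) ~ x ∧ t = pr u (pr v w)
def g2 (x : X) : X := bld fun t ↦ ∃ u v w, pr v (pr w u) ~ x ∧ t = pr u (pr v w)
section
variable {s t : ⊠X} [DT s] [DT t]
instance : T2 X gpr := ti2 gpr (by unfold gpr; infer_instance)
instance : T2 X gme := ti2 gme (by unfold gme; infer_instance)
instance : T2 X gdf := ti2 gdf (by unfold gdf; infer_instance)
instance : T2 X gin := ti2 gin (by unfold gin; infer_instance)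
instance : T1 X gdo := ti1 gdo (by unfold gdo; infer_instance)
instance : T1 X gco := ti1 gco (by unfold gco; infer_instance)
instance : T1 X g1 := ti1 g1 (by unfold g1; infer_instance)
instance : T1 X g2 := ti1 g2 (by unfold g2; infer_instance)
end
theorem in_pr1 (h : pr u v ~ x) : u ~ sUn (sUn x) := by
  simp; exact ⟨upr u u, ⟨_, h, by simp [pr]⟩, by simp⟩
theorem in_pr2 (h : pr u v ~ x) : v ~ sUn (sUn x) := by
  simp; exact ⟨upr u v, ⟨_, h, by simp [pr]⟩, by simp⟩
@[simp] theorem mem_gpr : w ~ gpr x y ↔ ∃ u v, u ~ x ∧ v ~ y ∧ w = pr u v :=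
  mem_bld (isS_of_sub (sUn (img x fun u ↦ img y fun v ↦ pr u v)) (by
    rintro _ ⟨u, v, h1, h2, rfl⟩; simp only [mem_sUn, mem_img]; exact ⟨_, ⟨u, h1, rfl⟩, by simp only [mem_img]; exact ⟨v, h2, rfl⟩⟩))
@[simp] theorem mem_gme : w ~ gme x y ↔ ∃ u v, u ~ x ∧ v ~ y ∧ u ~ v ∧ w = pr u v :=
  mem_bld (isS_of_sub (gpr x y) (by rintro _ ⟨u, v, h1, h2, _, rfl⟩; simp only [mem_gpr]; exact ⟨u, v, h1, h2, rfl⟩))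
@[simp] theorem mem_gdf : w ~ gdf x y ↔ w ~ x ∧ ¬ w ~ y := mem_sep
@[simp] theorem mem_gin : w ~ gin x y ↔ w ~ x ∧ w ~ y := mem_sep
@[simp] theorem mem_gdo : w ~ gdo x ↔ ∃ u, pr w u ~ x :=
  mem_bld (isS_of_sub (sUn (sUn x)) fun w ⟨u, h⟩ ↦ in_pr1 h)
@[simp] theorem mem_gco : w ~ gco x ↔ ∃ u v, pr u v ~ x ∧ w = pr v u :=
  mem_bld (isS_of_sub (gpr (sUn (sUn x)) (sUn (sUn x))) (by
    rintro _ ⟨u, v, h, rfl⟩; rw [mem_gpr]; exact ⟨v, u, in_pr2 h, in_pr1 h, rfl⟩))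
theorem in_pr3 (h : pr u (pr v w) ~ x) : v ~ sUn (sUn (sUn (sUn x))) ∧ w ~ sUn (sUn (sUn (sUn x))) :=
  ⟨in_pr1 (in_pr2 h), in_pr2 (in_pr2 h)⟩
@[simp] theorem mem_g1 : t ~ g1 x ↔ ∃ u v w, pr u (pr w v) ~ x ∧ t = pr u (pr v w) :=
  mem_bld (isS_of_sub (gpr (sUn (sUn x)) (gpr (sUn (sUn (sUn (sUn x)))) (sUn (sUn (sUn (sUn x)))))) (by
    rintro _ ⟨u, v, w, h, rfl⟩; simp only [mem_gpr]
    exact ⟨_, _, in_pr1 h, ⟨_, _, (in_pr3 h)◝, (in_pr3 h)◜, rfl⟩, rfl⟩))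
@[simp] theorem mem_g2 : t ~ g2 x ↔ ∃ u v w, pr v (pr w u) ~ x ∧ t = pr u (pr v w) :=
  mem_bld (isS_of_sub (gpr (sUn (sUn (sUn (sUn x)))) (gpr (sUn (sUn x)) (sUn (sUn (sUn (sUn x)))))) (by
    rintro _ ⟨u, v, w, h, rfl⟩; simp only [mem_gpr]
    exact ⟨_, _, (in_pr3 h)◝, ⟨_, _, in_pr1 h, (in_pr3 h)◜, rfl⟩, rfl⟩))
def Gop (t x y : X) : Prop := (t = upr x y ∨ t = gpr x y ∨ t = gme x y ∨ t = gdf x y ∨ t = gin x y) ∨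
  (t = sUn x ∨ t = gdo x ∨ t = gco x ∨ t = g1 x ∨ t = g2 x)
def GC (c : X) : Prop := ∀ x y t, x ~ c → y ~ c → Gop t x y → t ~ c
instance : F3 X Gop := fi3 Gop (by unfold Gop; infer_instance)
instance : F1 X GC := fi1 GC (by unfold GC; infer_instance)
theorem zeq {Q : X → Prop} (ht : ∀ w, w ~ t ↔ Q w) : (∀ w, ∊ w z ↔ Q w) ↔ z = t :=
  ⟨fun h ↦ zext fun w ↦ (h w).trans (ht w).symm, fun h w ↦ h ▸ ht w⟩
theorem gc_iff : GClosed ∊ c ↔ GC c := by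
  have e1 : ∀ x y z : X, IsUPair ∊ z x y ↔ z = upr x y := fun x y z ↦ zeq fun w ↦ mem_upr
  have e2 : ∀ x y z : X, IsGProd ∊ z x y ↔ z = gpr x y := fun x y z ↦ by
    unfold IsGProd; simp only [kp]; exact zeq fun w ↦ mem_gpr
  have e3 : ∀ x y z : X, IsGMemRel ∊ z x y ↔ z = gme x y := fun x y z ↦ by
    unfold IsGMemRel; simp only [kp]; exact zeq fun w ↦ mem_gme
  have e4 : ∀ x y z : X, IsGDiff ∊ z x y ↔ z = gdf x y := fun x y z ↦ zeq fun w ↦ mem_gdf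
  have e5 : ∀ x y z : X, IsGInter ∊ z x y ↔ z = gin x y := fun x y z ↦ zeq fun w ↦ mem_gin
  have e6 : ∀ x z : X, IsGUnionSet ∊ z x ↔ z = sUn x := fun x z ↦ zeq fun w ↦ mem_sUn
  have e7 : ∀ x z : X, IsGDom ∊ z x ↔ z = gdo x := fun x z ↦ by
    unfold IsGDom; simp only [kp]; exact zeq fun w ↦ mem_gdo.trans ⟨fun ⟨u, h⟩ ↦ ⟨_, u, h, rfl⟩, fun ⟨_, u, h, e⟩ ↦ ⟨u, e ▸ h⟩⟩
  have e8 : ∀ x z : X, IsGConv ∊ z x ↔ z = gco x := fun x z ↦ by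
    unfold IsGConv; simp only [kp]
    exact zeq fun w ↦ mem_gco.trans ⟨fun ⟨u, v, h, e⟩ ↦ ⟨u, v, _, h, rfl, e⟩, fun ⟨u, v, _, h, e, e₀⟩ ↦ ⟨u, v, e ▸ h, e₀⟩⟩
  have e0 : ∀ t u v w : X, IsKTriple ∊ t u v w ↔ t = pr u (pr v w) := fun t u v w ↦ by
    unfold IsKTriple; simp only [kp]; exact ⟨fun ⟨_, h, h₀⟩ ↦ h ▸ h₀, fun h ↦ ⟨_, rfl, h⟩⟩
  have e9 : ∀ x z : X, IsGPerm1 ∊ z x ↔ z = g1 x := fun x z ↦ by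
    unfold IsGPerm1; simp only [e0]
    exact zeq fun w ↦ mem_g1.trans ⟨fun ⟨u, v, w, h, e⟩ ↦ ⟨u, v, w, _, h, rfl, e⟩, fun ⟨u, v, w, _, h, e, e₀⟩ ↦ ⟨u, v, w, e ▸ h, e₀⟩⟩
  have e10 : ∀ x z : X, IsGPerm2 ∊ z x ↔ z = g2 x := fun x z ↦ by
    unfold IsGPerm2; simp only [e0]
    exact zeq fun w ↦ mem_g2.trans ⟨fun ⟨u, v, w, h, e⟩ ↦ ⟨u, v, w, _, h, rfl, e⟩, fun ⟨u, v, w, _, h, e, e₀⟩ ↦ ⟨u, v, w, e ▸ h, e₀⟩⟩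
  simp only [GClosed, e1, e2, e3, e4, e5, e6, e7, e8, e9, e10, GC, Gop]
  exact ⟨fun h x y t hx hy ho ↦ ho.elim (h◜ x y t hx hy) (h◝ x t hx), fun h ↦
    ⟨fun x y z hx hy ho ↦ h x y z hx hy (◁ ho), fun x z hx ho ↦ h x x z hx hx (▷ ho)⟩⟩
def gten (x y : X) : X := un (un (upr (upr x y) (gpr x y)) (un (upr (gme x y) (gdf x y)) (upr (gin x y) (gin x y))))
  (un (upr (sUn x) (gdo x)) (un (upr (gco x) (g1 x)) (upr (g2 x) (g2 x))))
theorem mem_gten : t ~ gten x y ↔ Gop t x y := by simp [gten, Gop, or_assoc]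
instance : T2 X gten := by unfold gten; infer_instance
def gst (s : X) : X := un s (sUn (img s fun x ↦ sUn (img s fun y ↦ gten x y)))
theorem mem_gst : t ~ gst s ↔ t ~ s ∨ ∃ x y, x ~ s ∧ y ~ s ∧ Gop t x y := by
  simp only [gst, mem_un, mem_sUn, mem_img]
  refine or_congr Iff.rfl ⟨⬚, fun ⟨x, y, hx, hy, h⟩ ↦ ⟨_, ⟨x, hx, rfl⟩, ⬚⟩⟩
  · rintro ⟨_, ⟨x, hx, rfl⟩, h⟩
    simp only [mem_sUn, mem_img] at h; obtain ⟨_, ⟨y, hy, rfl⟩, h⟩ := h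
    exact ⟨x, y, hx, hy, mem_gten◜ h⟩
  · simp only [mem_sUn, mem_img]; exact ⟨_, ⟨y, hy, rfl⟩, mem_gten◝ h⟩
instance : T1 X gst := ti1 gst (by unfold gst; infer_instance)
def gG (p _a f : X) : X := bld fun z ↦ z ~ p ∨ ∃ n y, pr n y ~ f ∧ z ~ gst y
instance : DT fun σ : ⊙X ↦ gG σ⁰ σ¹ σ² := by unfold gG; infer_instance
def gsq (s n : X) : X := orec gG s n
instance : T2 X gsq := by unfold gsq; infer_instance
theorem mem_gsq (ha : Od a) : z ~ gsq s a ↔ z ~ s ∨ ∃ n, n ~ a ∧ z ~ gst (gsq s n) := by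
  unfold gsq
  rw [orec_eq ha, gG, mem_bld]
  · simp only [mem_lam, pr_inj]; refine or_congr Iff.rfl ⬚
    constructor
    · rintro ⟨n, y, ⟨k, hk, rfl, rfl⟩, h⟩; exact ⟨n, hk, h⟩
    · rintro ⟨n, hn, h⟩; exact ⟨n, _, ⟨n, hn, rfl, rfl⟩, h⟩
  · refine isS_of_sub (un s (sUn (img a fun n ↦ gst (orec gG s n)))) fun z hz ↦ ⬚
    simp only [mem_lam, pr_inj, mem_un, mem_sUn, mem_img] at hz ⊢
    refine hz.imp id ⬚
    rintro ⟨n, y, ⟨k, hk, rfl, rfl⟩, h⟩; exact ⟨_, ⟨n, hk, rfl⟩, h⟩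
def gcl (s : X) : X := gsq s om
instance : T1 X gcl := by unfold gcl; infer_instance
theorem gcl_sub (h : z ~ s) : z ~ gcl s := (mem_gsq om_lim◜)◝ (◁ h)
theorem gsq_mono (ha : Od a) (hb : Od b) (h : ∀ z, z ~ a → z ~ b) (hz : z ~ gsq s a) : z ~ gsq s b := by
  rw [mem_gsq ha] at hz; rw [mem_gsq hb]; exact hz.imp id fun ⟨n, hn, h₀⟩ ↦ ⟨n, h n hn, h₀⟩
theorem gcl_stage (h : z ~ gcl s) : ∃ n, n ~ om ∧ z ~ gsq s n := by
  rcases (mem_gsq om_lim◜)◜ h with h | ⟨n, hn, h⟩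
  · exact ⟨emp, emp_om, (mem_gsq Od_emp)◝ (◁ h)⟩
  · exact ⟨suc n, om_lim◝◝ n hn, (mem_gsq (om_lim◜.mem hn).sucO)◝ (▷ ⟨n, by simp, h⟩)⟩
theorem gcl_GC : GC (gcl s) := by
  intro x y t hx hy ho
  rcases gcl_stage hx with ⟨n, hn, hx⟩
  rcases gcl_stage hy with ⟨k, hk, hy⟩
  have on := om_lim◜.mem hn
  have ok := om_lim◜.mem hk
  have key : ∀ n, n ~ om → x ~ gsq s n → y ~ gsq s n → t ~ gcl s := fun n hn h1 h2 ↦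
    (mem_gsq om_lim◜)◝ (▷ ⟨n, hn, mem_gst◝ (▷ ⟨x, y, h1, h2, ho⟩)⟩)
  rcases on.tri ok with h | rfl | h
  · exact key k hk (gsq_mono on ok (fun z hz ↦ ok.tr h hz) hx) hy
  · exact key _ hn hx hy
  · exact key n hn hx (gsq_mono ok on (fun z hz ↦ on.tr h hz) hy)
theorem gst_least (h : ∀ z, z ~ s → z ~ c) (hc : GC c) (hz : z ~ gst s) : z ~ c := by
  rcases mem_gst◜ hz with hz | ⟨x, y, hx, hy, ho⟩
  exacts [h z hz, hc x y z (h x hx) (h y hy) ho]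
theorem gcl_least (h : ∀ z, z ~ s → z ~ c) (hc : GC c) (hz : z ~ gcl s) : z ~ c := by
  refine oind (fun a ↦ ∀ z, z ~ gsq s a → z ~ c) (fun a ha ih z hz ↦ ⬚) om om_lim◜ z hz
  rcases (mem_gsq ha)◜ hz with hz | ⟨n, hn, hz⟩
  exacts [h z hz, gst_least (ih n hn) hc hz]
theorem gcl_iff : IsGClOf ∊ b c ↔ c = gcl b := by
  simp only [IsGClOf, gc_iff, SubsetE]
  constructor
  · rintro ⟨h1, h2, h3⟩
    exact zext fun z ↦ ⟨h3 _ (fun z ↦ gcl_sub) gcl_GC z, gcl_least h1 h2⟩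
  · rintro rfl; exact ⟨fun z ↦ gcl_sub, gcl_GC, fun c₀ h1 h2 z ↦ gcl_least h1 h2⟩
def Df (l : X) : X := sep (gcl (suc l)) fun y ↦ ∀ w, w ~ y → w ~ l
instance : T1 X Df := ti1 Df (by unfold Df; infer_instance)
theorem mem_Df : y ~ Df l ↔ y ~ gcl (suc l) ∧ ∀ w, w ~ y → w ~ l := mem_sep
theorem df_iff : IsDefSetOf ∊ l d ↔ d = Df l := by
  unfold IsDefSetOf
  have e : ∀ lp : X, (∀ z, ∊ z lp ↔ (∊ z l ∨ z = l)) ↔ lp = suc l := fun lp ↦ succ_iff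
  simp only [e, gcl_iff, SubsetE]
  constructor
  · rintro ⟨_, _, rfl, rfl, h⟩; exact zext fun y ↦ by rw [h, mem_Df]; tauto
  · rintro rfl; exact ⟨_, _, rfl, rfl, fun y ↦ by rw [mem_Df]; tauto⟩
def LG (b a f : X) : X := bld fun z ↦ (a = emp ∧ (z ~ tc b ∨ z = b)) ∨ (∃ c, a = suc c ∧ z ~ Df (app f c)) ∨
  (IsLimitOrd ∊ a ∧ ∃ c, c ~ a ∧ z ~ app f c)
instance : DT fun σ : ⊙X ↦ LG σ⁰ σ¹ σ² := by unfold LG; infer_instance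
def Ls (b a : X) : X := orec LG b a
instance : T2 X Ls := by unfold Ls; infer_instance
theorem suc_inj (h : suc a = suc b) : a = b := by
  have h1 : a ~ suc b := h ▸ by simp
  have h2 : b ~ suc a := h ▸ by simp
  simp at h1 h2
  rcases h1 with h1 | h1
  · rcases h2 with h2 | h2
    · exact absurd h1 (fun h ↦ by
        obtain ⟨y, hy, h₀⟩ := fnd (Q := upr a b) ⟨a, by simp⟩
        simp at hy; rcases hy with rfl | rfl
        · exact h₀ b (by simp) h2
        · exact h₀ a (by simp) h1)
    · exact h2.symm
  · exact h1
theorem suc_ne : suc a ≠ emp := fun h ↦ by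
  have : a ~ emp := h ▸ by simp
  simp at this
theorem lim_ne (h : IsLimitOrd ∊ a) : a ≠ emp := fun e ↦ by
  rcases h◝◜ with ⟨y, hy⟩; rw [e] at hy; simp at hy
theorem lim_suc (h : IsLimitOrd ∊ (suc a)) : False :=
  nm1 ((lim_iff◜ h)◝◝ a (by simp))
theorem mem_Ls (ha : Od a) : z ~ Ls b a ↔ (a = emp ∧ (z ~ tc b ∨ z = b)) ∨ (∃ c, a = suc c ∧ z ~ Df (Ls b c)) ∨
    (IsLimitOrd ∊ a ∧ ∃ c, c ~ a ∧ z ~ Ls b c) := by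
  unfold Ls
  rw [orec_eq ha, LG, mem_bld]
  · refine or_congr Iff.rfl (or_congr (exists_congr fun c ↦ and_congr_right fun e ↦ ⬚) (and_congr_right ℸ exists_congr fun c ↦ and_congr_right fun hc ↦ ⬚))
    · rw [app_lam (e ▸ by simp)]
    · rw [app_lam hc]
  · rcases ha.cases with rfl | ⟨c, hc, rfl⟩ | hl
    · refine isS_of_sub (un (tc b) (upr b b)) fun z hz ↦ ⬚
      rcases hz with hz | ⟨c, h, _⟩ | ⟨h, _⟩
      · simpa using hz◝
      · exact absurd h.symm suc_ne
      · exact absurd rfl (lim_ne h)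
    · refine isS_of_sub (Df (app (lam (suc c) fun z ↦ orec LG b z) c)) fun z hz ↦ ⬚
      rcases hz with hz | ⟨c₀, h, h₀⟩ | ⟨h, _⟩
      · exact absurd hz◜ suc_ne
      · rw [suc_inj h]; rw [← h]; exact h₀
      · exact (lim_suc h).elim
    · refine isS_of_sub (sUn (img a fun c ↦ app (lam a fun z ↦ orec LG b z) c)) fun z hz ↦ ⬚
      rcases hz with hz | ⟨c₀, h, h₀⟩ | ⟨h, c, hc, h₀⟩
      · exact absurd hz◜ (lim_ne hl)
      · rw [h] at hl; exact (lim_suc hl).elim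
      · simp only [mem_sUn, mem_img]; exact ⟨_, ⟨c, hc, rfl⟩, h₀⟩
theorem mem_L0 : z ~ Ls b emp ↔ z ~ tc b ∨ z = b := by
  rw [mem_Ls Od_emp]
  refine ⟨⬚, fun h ↦ ◁ ⟨rfl, h⟩⟩
  rintro (h | ⟨c, h, _⟩ | ⟨h, _⟩)
  · exact h◝
  · exact absurd h.symm suc_ne
  · exact absurd rfl (lim_ne h)
theorem Ls_suc (hc : Od c) : Ls b (suc c) = Df (Ls b c) := zext fun z ↦ by
  rw [mem_Ls hc.sucO]
  refine ⟨⬚, fun h ↦ ▷ (◁ ⟨c, rfl, h⟩)⟩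
  rintro (⟨h, _⟩ | ⟨c₀, h, h₀⟩ | ⟨h, _⟩)
  exacts [absurd h suc_ne, suc_inj h ▸ h₀, (lim_suc h).elim]
theorem mem_Ll (ha : IsLimitOrd ∊ a) : z ~ Ls b a ↔ ∃ c, c ~ a ∧ z ~ Ls b c := by
  rw [mem_Ls ha◜]
  refine ⟨⬚, fun h ↦ ▷ (▷ ⟨ha, h⟩)⟩
  rintro (⟨h, _⟩ | ⟨c₀, h, h₀⟩ | ⟨_, h⟩)
  exacts [absurd h (lim_ne ha), (lim_suc (h ▸ ha)).elim, h]
theorem tc_iff : IsTransClOf ∊ b t ↔ t = tc b := by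
  constructor
  · rintro ⟨h1, h2, h3⟩
    exact zext fun z ↦ ⟨h3 _ (fun z ↦ tc_sub) (fun y hy z hz ↦ tc_tr hy hz) z, tc_least h1 h2⟩
  · rintro rfl; exact ⟨fun z ↦ tc_sub, fun y hy z hz ↦ tc_tr hy hz, fun c₀ h1 h2 z ↦ tc_least h1 h2⟩
theorem l0_iff : IsLZero ∊ b z ↔ z = Ls b emp := by
  simp only [IsLZero, tc_iff]
  constructor
  · rintro ⟨_, rfl, h⟩; exact zext fun x ↦ by rw [mem_L0]; exact h x
  · rintro rfl; exact ⟨_, rfl, fun x ↦ mem_L0⟩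
theorem lst_iff : IsLStage ∊ b a l ↔ Od a ∧ l = Ls b a := by
  simp only [IsLStage, IsLHier, pin, zero_iff, succ_iff, l0_iff, df_iff, IsFunc]
  constructor
  · rintro ⟨H, ⟨(ha : Od a), ⟨-, hf⟩, hd, h0, h1, h2⟩, hl⟩
    refine ⟨ha, oind (fun c ↦ (c ~ a ∨ c = a) → ∀ z, pr c z ~ H → z = Ls b c) (fun c hc ih hca z hz ↦ ⬚) a ha (▷ rfl) l hl⟩
    have hdn : ∀ d, d ~ c → d ~ a ∨ d = a := fun d hd ↦ ◁ (hca.elim (fun h ↦ ha.tr h hd) fun h ↦ h ▸ hd)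
    rcases hc.cases with rfl | ⟨c, hc₀, rfl⟩ | hl
    · exact h0 _ z rfl hz
    · rcases (hd c)◝ (hdn c (by simp)) with ⟨y, hy⟩
      rw [Ls_suc hc₀, ← ih c (by simp) (hdn c (by simp)) y hy]
      exact h1 c _ y z rfl hy hz
    · refine zext fun x ↦ (h2 c z hl hz x).trans ((mem_Ll hl).trans ⬚).symm
      constructor
      · rintro ⟨d, hd₀, hx⟩
        rcases (hd d)◝ (hdn d hd₀) with ⟨y, hy⟩
        exact ⟨d, y, hd₀, hy, ih d hd₀ (hdn d hd₀) y hy ▸ hx⟩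
      · rintro ⟨d, y, hd₀, hy, hx⟩
        exact ⟨d, hd₀, ih d hd₀ (hdn d hd₀) y hy ▸ hx⟩
  · rintro ⟨ha, rfl⟩
    have hm : ∀ c z, pr c z ~ lam (suc a) (fun d ↦ Ls b d) ↔ c ~ suc a ∧ z = Ls b c := fun c z ↦ by
      simp only [mem_lam, pr_inj]; exact ⟨fun ⟨k, hk, h1, h2⟩ ↦ h1 ▸ ⟨hk, h2⟩, fun h ↦ ⟨c, h◜, rfl, h◝⟩⟩
    refine ⟨lam (suc a) fun d ↦ Ls b d, ⟨ha, ⟨fun p hp ↦ ⬚, fun x y y₀ h h₀ ↦ ⬚⟩, fun c ↦ ⬚, ⬚, ⬚, ⬚⟩, (hm _ _)◝ ⟨by simp, rfl⟩⟩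
    · rcases mem_lam◜ hp with ⟨k, hk, h⟩; exact ⟨_, _, kp◝ h⟩
    · rw [hm] at h h₀; exact h◝.trans h₀◝.symm
    · simp only [hm]; simp
    · rintro _ z rfl h; exact ((hm _ _)◜ h)◝
    · rintro c _ z w rfl h h₀; rw [hm] at h h₀; rw [h◝, h₀◝, Ls_suc (ha.sucO.mem h◜)]
    · rintro c z hl h x
      rw [hm] at h; rw [h◝]
      refine (mem_Ll hl).trans ⬚
      simp only [hm]
      exact ⟨fun ⟨d, hd, hx⟩ ↦ ⟨d, _, hd, ⟨ha.sucO.tr h◜ hd, rfl⟩, hx⟩, fun ⟨d, u, hd, ⟨_, e⟩, hx⟩ ↦ ⟨d, hd, e ▸ hx⟩⟩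
theorem inL_iff : InL ∊ b x ↔ ∃ a, Od a ∧ x ~ Ls b a := by
  simp only [InL, lst_iff]
  exact ⟨fun ⟨a, l, ⟨h, e⟩, hx⟩ ↦ ⟨a, h, e ▸ hx⟩, fun ⟨a, h, hx⟩ ↦ ⟨a, _, ⟨h, rfl⟩, hx⟩⟩
instance {s t : ⊠X} [DT s] [DT t] : DF fun σ ↦ InL ∊ (s σ) (t σ) := by
  simp only [inL_iff]; have := DT.shift s; have := DT.shift t; infer_instance
end
section
variable {X : Type} [ZFM X] {x y : X}
theorem DF.exN : ∀ (n : ℕ) {R : ⊙X → Prop} (h : DF R), DF fun σ ↦ ∃ v : Fin n → X, R (tup n v σ) := by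
  intro n
  induction n with
  | zero => exact fun {R} h ↦ h.congr fun σ ↦ ⟨fun ⟨_, h⟩ ↦ h, fun h ↦ ⟨Fin.elim0, h⟩⟩
  | succ n ih =>
    intro R h
    have h1 : DF fun σ ↦ ∃ x, R fun k ↦ Nat.casesOn k x σ := by
      have : DF fun σ ↦ R fun k ↦ Nat.casesOn k σ⁰ σ⇡ :=
        h.congr fun σ ↦ by
          rw [show (fun k ↦ Nat.casesOn k σ⁰ σ⇡) = σ from funext fun k ↦ by cases k <;> rfl]
      exact DF.ex_ (R := fun x σ ↦ R fun k ↦ Nat.casesOn k x σ)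
    refine (ih h1).congr fun σ ↦ ⟨fun ⟨v, h⟩ ↦ ⟨fun i ↦ v i.succ, v 0, h⟩, fun ⟨v, x, h⟩ ↦ ⟨⊹ x v, ⬚⟩⟩
    simpa [tup] using h
def tp : (n : ℕ) → (Fin n → X) → X
  | 0, _ => emp
  | n+1, v => pr v⁰ (tp n fun i ↦ v i.succ)
theorem tp_inj : ∀ {n : ℕ} {v w : Fin n → X}, tp n v = tp n w → v = w
  | 0, v, w, _ => funext fun i ↦ i.elim0
  | n+1, v, w, h => by
    simp only [tp, pr_inj] at h
    have := tp_inj h◝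
    funext i; refine Fin.cases h◜ (fun i ↦ congrFun this i) i
theorem tp_dt : ∀ (n : ℕ) (ts : Fin n → ⊠X) (h : ∀ i, DT (ts i)), DT fun σ ↦ tp n fun i ↦ ts i σ
  | 0, ts, h => DT.const emp
  | n+1, ts, h => by
    have := h 0
    have := tp_dt n (fun i ↦ ts i.succ) fun i ↦ h i.succ
    unfold tp; infer_instance
theorem tp_cons (x : X) (v : Fin n → X) : tp (n+1) (⊹ x v) = pr x (tp n v) := by
  simp [tp]
structure JC (K : X → Prop) : Prop where
  df : DF fun σ ↦ K σ⁰
  tr {x y : X} : K x → y ~ x → K y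
  op : ∀ x y t, K x → K y → Gop t x y → K t
  au : ∀ s, (∀ x, x ~ s → K x) → ∃ w, K w ∧ ∀ x, x ~ s → x ~ w
section
variable {K : X → Prop} (hK : JC K)
include hK
theorem JC.upr (hx : K x) (hy : K y) : K (upr x y) := hK.op x y _ hx hy (by simp [Gop])
theorem JC.pr (hx : K x) (hy : K y) : K (pr x y) := hK.upr (hK.upr hx hx) (hK.upr hx hy)
theorem JC.gpr (hx : K x) (hy : K y) : K (gpr x y) := hK.op x y _ hx hy (by simp [Gop])
theorem JC.gme (hx : K x) (hy : K y) : K (gme x y) := hK.op x y _ hx hy (by simp [Gop])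
theorem JC.gdf (hx : K x) (hy : K y) : K (gdf x y) := hK.op x y _ hx hy (by simp [Gop])
theorem JC.gin (hx : K x) (hy : K y) : K (gin x y) := hK.op x y _ hx hy (by simp [Gop])
theorem JC.sUn (hx : K x) : K (sUn x) := hK.op x x _ hx hx (by simp [Gop])
theorem JC.gdo (hx : K x) : K (gdo x) := hK.op x x _ hx hx (by simp [Gop])
theorem JC.gco (hx : K x) : K (gco x) := hK.op x x _ hx hx (by simp [Gop])
theorem JC.g1 (hx : K x) : K (g1 x) := hK.op x x _ hx hx (by simp [Gop])
theorem JC.g2 (hx : K x) : K (g2 x) := hK.op x x _ hx hx (by simp [Gop])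
theorem JC.emp : K emp := by
  rcases hK.au ZFI0.emp (by simp) with ⟨w, hw, -⟩
  have : ZFI0.gdf w w = ZFI0.emp := zext fun z ↦ by simp
  exact this ▸ hK.gdf hw hw
theorem JC.un (hx : K x) (hy : K y) : K (un x y) := by
  have : ZFI0.un x y = ZFI0.sUn (ZFI0.upr x y) := zext fun z ↦ by simp
  rw [this]; exact hK.sUn (hK.upr hx hy)
theorem JC.tp : ∀ {n : ℕ} {v : Fin n → X}, (∀ i, K (v i)) → K (tp n v)
  | 0, v, _ => hK.emp
  | n+1, v, h => hK.pr (h 0) (JC.tp fun i ↦ h i.succ)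
omit hK in
def Rl (K : X → Prop) (n : ℕ) (Q : (Fin n → X) → Prop) : Prop :=
  ∀ w, K w → ∃ D, K D ∧ ∀ t, t ~ D ↔ ∃ v : Fin n → X, (∀ i, v i ~ w) ∧ t = ZFI0.tp n v ∧ Q v
theorem Rl.congr (h : Rl K n Q) (e : ∀ v, (∀ i, K (v i)) → (Q v ↔ R v)) : Rl K n R :=
  fun w hw ↦ (h w hw).imp fun D ⟨h1, h2⟩ ↦ ⟨h1, fun t ↦ (h2 t).trans (exists_congr fun v ↦
    and_congr_right fun hv ↦ and_congr_right ℸ e v fun i ↦ hK.tr hw (hv i))⟩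
theorem Rl.all (n : ℕ) : Rl K n ℸ True := by
  intro w hw
  induction n with
  | zero => exact ⟨_, hK.upr hK.emp hK.emp, fun t ↦ by simp [ZFI0.tp]⟩
  | succ n ih =>
    rcases ih with ⟨D, h1, h2⟩
    refine ⟨_, hK.gpr hw h1, fun t ↦ ⬚⟩
    simp only [mem_gpr, h2]
    constructor
    · rintro ⟨u, _, hu, ⟨v, hv, rfl, -⟩, rfl⟩
      exact ⟨⊹ u v, fun i ↦ Fin.cases hu hv i, (tp_cons u v).symm, trivial⟩
    · rintro ⟨v, hv, rfl, -⟩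
      exact ⟨_, _, hv 0, ⟨_, fun i ↦ hv i.succ, rfl, trivial⟩, rfl⟩
theorem Rl.neg (h : Rl K n Q) : Rl K n fun v ↦ ¬ Q v := by
  intro w hw
  rcases h w hw with ⟨D, h1, h2⟩
  rcases Rl.all hK n w hw with ⟨A, a1, a2⟩
  refine ⟨_, hK.gdf a1 h1, fun t ↦ ⬚⟩
  simp only [mem_gdf, a2, h2]
  constructor
  · rintro ⟨⟨v, hv, rfl, -⟩, h⟩; exact ⟨v, hv, rfl, fun hq ↦ h ⟨v, hv, rfl, hq⟩⟩
  · rintro ⟨v, hv, rfl, h⟩; exact ⟨⟨v, hv, rfl, trivial⟩, fun ⟨v₀, _, e, h₀⟩ ↦ h (tp_inj e ▸ h₀)⟩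
theorem Rl.and (h : Rl K n Q) (h₀ : Rl K n R) : Rl K n fun v ↦ Q v ∧ R v := by
  intro w hw
  rcases h w hw with ⟨D, h1, h2⟩
  rcases h₀ w hw with ⟨A, a1, a2⟩
  refine ⟨_, hK.gin h1 a1, fun t ↦ ⬚⟩
  simp only [mem_gin, a2, h2]
  constructor
  · rintro ⟨⟨v, hv, rfl, h⟩, ⟨v₀, _, e, h₀⟩⟩; exact ⟨v, hv, rfl, h, tp_inj e ▸ h₀⟩
  · rintro ⟨v, hv, rfl, h, h₀⟩; exact ⟨⟨v, hv, rfl, h⟩, ⟨v, hv, rfl, h₀⟩⟩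
theorem Rl.imp (h : Rl K n Q) (h₀ : Rl K n R) : Rl K n fun v ↦ Q v → R v :=
  Rl.congr hK (Rl.neg hK (Rl.and hK h (Rl.neg hK h₀))) fun v _ ↦ by tauto
theorem Rl.shift (h : Rl K n Q) : Rl K (n+1) fun v ↦ Q fun i ↦ v i.succ := by
  intro w hw
  rcases h w hw with ⟨D, h1, h2⟩
  refine ⟨_, hK.gpr hw h1, fun t ↦ ⬚⟩
  simp only [mem_gpr, h2]
  constructor
  · rintro ⟨u, _, hu, ⟨v, hv, rfl, h⟩, rfl⟩
    exact ⟨⊹ u v, fun i ↦ Fin.cases hu hv i, (tp_cons u v).symm, h⟩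
  · rintro ⟨v, hv, rfl, h⟩
    exact ⟨_, _, hv 0, ⟨_, fun i ↦ hv i.succ, rfl, h⟩, rfl⟩
theorem Rl.ex {n : ℕ} {Q : (Fin (n+1) → X) → Prop} (hd : DF fun σ ↦ Q fun i ↦ σ i) (h : Rl K (n+1) Q) :
    Rl K n fun v ↦ ∃ x, K x ∧ Q (⊹ x v) := by
  intro w hw
  rcases Rl.all hK n w hw with ⟨A, a1, a2⟩
  have hkd := hK.df
  have i0 : DT fun σ : ⊙X ↦ ZFI0.tp n fun i ↦ σ i := tp_dt n (fun i σ ↦ σ i) fun i ↦ DT.var _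
  have i1 : DF fun σ : ⊙X ↦ σ n = ZFI0.tp n (fun i ↦ σ i) ∧ Q (⊹ (σ (n+1)) fun i ↦ σ i) := by
    have : DF fun σ : ⊙X ↦ Q (⊹ (σ (n+1)) fun i ↦ σ i) := by
      refine (hd.sub fun k ↦ Sum.inl (Nat.casesOn k (n+1) fun k ↦ k)).congr fun σ ↦ ⬚
      refine iff_of_eq (congrArg _ (funext fun i ↦ Fin.cases rfl (fun i ↦ rfl) i))
    infer_instance
  have i2 : DF fun σ : ⊙X ↦ ∃ v : Fin n → X, σ 0 = ZFI0.tp n v ∧ Q (⊹ σ¹ v) :=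
    (DF.exN n i1).congr fun σ ↦ exists_congr fun v ↦ by
      rw [show tup n v σ n = σ 0 from tup_ge n v σ 0, show tup n v σ (n+1) = σ 1 from tup_ge n v σ 1]
      simp only [tup_lt]
  have i3 : DF fun σ ↦ K σ¹ := df1 K _
  obtain ⟨b, hb⟩ := coll (sep A fun t ↦ ∃ x, K x ∧ ∃ v : Fin n → X, t = ZFI0.tp n v ∧ Q (⊹ x v))
    (fun t x ↦ K x ∧ ∃ v : Fin n → X, t = ZFI0.tp n v ∧ Q (⊹ x v)) fun t ht ↦ by
      have i3 : DF fun σ ↦ K σ⁰ := hkd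
      have i4 : DF fun σ : ⊙X ↦ ∃ v : Fin n → X, σ 1 = ZFI0.tp n v ∧ Q (⊹ σ⁰ v) :=
        (i2.sub fun k ↦ Sum.inl (1 - k)).congr fun σ ↦ Iff.rfl
      exact (mem_sep◜ ht)◝
  rcases hK.au (sep b K) fun x hx ↦ (mem_sep◜ hx)◝ with ⟨b₀, hb₀, hbb⟩
  rcases h (un w b₀) (hK.un hw hb₀) with ⟨D, h1, h2⟩
  refine ⟨_, hK.gin a1 (hK.gdo (hK.gco h1)), fun t ↦ ⬚⟩
  simp only [mem_gin, mem_gdo, mem_gco, a2, h2, pr_inj]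
  constructor
  · rintro ⟨⟨v, hv, rfl, -⟩, u, x, _, ⟨v₀, hv₀, e, hq⟩, rfl, rfl⟩
    rw [ZFI0.tp, pr_inj] at e
    refine ⟨v, hv, rfl, u, hK.tr (hK.un hw hb₀) (e◜ ▸ hv₀ 0), ⬚⟩
    have := tp_inj e◝
    rwa [show (⊹ u v : Fin (n+1) → X) = v₀ from funext fun i ↦ Fin.cases e◜ (fun i ↦ congrFun this i) i]
  · rintro ⟨v, hv, rfl, x, hx, hq⟩
    refine ⟨⟨v, hv, rfl, trivial⟩, ⬚⟩
    have i3 : DF fun σ ↦ K σ⁰ := hkd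
    have i4 : DF fun σ : ⊙X ↦ ∃ v : Fin n → X, σ 1 = ZFI0.tp n v ∧ Q (⊹ σ⁰ v) :=
        (i2.sub fun k ↦ Sum.inl (1 - k)).congr fun σ ↦ Iff.rfl
    rcases hb (ZFI0.tp n v) (mem_sep◝ ⟨(a2 _)◝ ⟨v, hv, rfl, trivial⟩, x, hx, v, rfl, hq⟩) with ⟨y, hy, hyK, v₀, e, hq₀⟩
    rw [← tp_inj e] at hq₀
    exact ⟨y, y, _, ⟨⊹ y v, fun i ↦ by
      refine Fin.cases ⬚ (fun i ↦ ⬚) i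
      · simpa using ▷ (hbb _ (mem_sep◝ ⟨hy, hyK⟩))
      · simpa using ◁ (hv i), (tp_cons _ _).symm, hq₀⟩, rfl, rfl⟩
theorem Rl.bin {S : X → X → Prop} (hS : ∀ w, K w → ∃ D, K D ∧ ∀ t, t ~ D ↔ ∃ x y, x ~ w ∧ y ~ w ∧ S x y ∧ t = ZFI0.pr x y) :
    ∀ (n : ℕ) (k : Fin n), Rl K (n+1) fun v ↦ S v⁰ (v k.succ) := by
  intro n
  induction n with
  | zero => exact fun k ↦ k.elim0
  | succ n ih =>
    refine fun k ↦ Fin.cases ⬚ (fun k ↦ ⬚) k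
    · intro w hw
      rcases Rl.all hK n w hw with ⟨A, a1, a2⟩
      rcases hS w hw with ⟨D, h1, h2⟩
      refine ⟨_, hK.g2 (hK.g2 (hK.gpr a1 h1)), fun t ↦ ⬚⟩
      simp only [mem_g2, mem_gpr, a2, h2, pr_inj]
      constructor
      · rintro ⟨_, _, _, ⟨_, _, _, ⟨_, _, ⟨v, hv, rfl, -⟩, ⟨x, y, hx, hy, hs, rfl⟩, rfl, e⟩, rfl, rfl, rfl⟩, rfl⟩
        rcases pr_inj◜ e with ⟨rfl, rfl⟩
        refine ⟨⊹ _ (⊹ _ v), fun i ↦ Fin.cases hx (fun i ↦ Fin.cases hy hv i) i, ⬚, hs⟩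
        rw [tp_cons, tp_cons]
      · rintro ⟨v, hv, rfl, hs⟩
        exact ⟨_, _, _, ⟨_, _, _, ⟨_, _, ⟨_, fun i ↦ hv i.succ.succ, rfl, trivial⟩, ⟨_, _, hv 0, hv 1, hs, rfl⟩, rfl, rfl⟩, rfl, rfl, rfl⟩, rfl⟩
    · intro w hw
      rcases ih k w hw with ⟨D, h1, h2⟩
      refine ⟨_, hK.g2 (hK.g1 (hK.gpr hw h1)), fun t ↦ ⬚⟩
      simp only [mem_g2, mem_g1, mem_gpr, h2, pr_inj]
      constructor
      · rintro ⟨_, _, _, ⟨_, _, _, ⟨x, _, hx, ⟨v, hv, rfl, hs⟩, rfl, e⟩, rfl, rfl, rfl⟩, rfl⟩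
        rcases pr_inj◜ e with ⟨rfl, rfl⟩
        refine ⟨⊹ v⁰ (⊹ _ fun i ↦ v i.succ), fun i ↦ Fin.cases (hv 0) (fun i ↦ Fin.cases hx (fun i ↦ hv i.succ) i) i,
          ⬚, hs⟩
        rw [tp_cons, tp_cons]
      · rintro ⟨v, hv, rfl, hs⟩
        exact ⟨_, _, _, ⟨_, _, _, ⟨_, _, hv 1, ⟨⊹ v⁰ fun i ↦ v i.succ.succ, fun i ↦ Fin.cases (hv 0) (fun i ↦ hv i.succ.succ) i, rfl, hs⟩, rfl, rfl⟩, rfl, rfl, rfl⟩, rfl⟩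
theorem Rl.mem (i j : Fin n) : Rl K n fun v ↦ v i ~ v j := by
  induction n with
  | zero => exact i.elim0
  | succ n ih =>
    refine Fin.cases ⬚ (fun i ↦ ⬚) i <;> refine Fin.cases ⬚ (fun j ↦ ⬚) j
    · exact Rl.congr hK (Rl.neg hK (Rl.all hK _)) fun v _ ↦ by simp
    · exact Rl.bin hK (S := fun x y ↦ x ~ y) (fun w hw ↦ ⟨_, hK.gme hw hw, fun t ↦ by simp only [mem_gme]⟩) n j
    · exact Rl.bin hK (S := fun x y ↦ y ~ x) (fun w hw ↦ ⟨_, hK.gco (hK.gme hw hw), fun t ↦ by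
        simp only [mem_gco, mem_gme, pr_inj]
        constructor
        · rintro ⟨_, _, ⟨u, v, hu, hv, h, rfl, rfl⟩, rfl⟩; exact ⟨_, _, hv, hu, h, rfl⟩
        · rintro ⟨x, y, hx, hy, h, rfl⟩; exact ⟨_, _, ⟨_, _, hy, hx, h, rfl, rfl⟩, rfl⟩⟩) n i
    · exact Rl.shift hK (ih i j)
theorem Rl.eval (φ : Fml n) : Rl K n fun v ↦ Eval ∊ NoAux K φ v := by
  have hd : ∀ {n : ℕ} (φ : Fml n), DF fun σ : ⊙X ↦ Eval ∊ NoAux K φ fun i ↦ σ i := fun φ ↦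
    dfEval φ (ℸ K) hK.df (fun i σ ↦ σ i) fun i ↦ DT.var _
  have all : ∀ {n : ℕ} {Q : (Fin (n+1) → X) → Prop} (hd : DF fun σ ↦ Q fun i ↦ σ i) (h : Rl K (n+1) Q),
    Rl K n fun v ↦ ∀ x, K x → Q (⊹ x v) := fun {n Q} hd h ↦ by
      refine Rl.congr hK (Rl.neg hK (Rl.ex hK (Q := fun v ↦ ¬ Q v) DF.not_ (Rl.neg hK h))) fun v _ ↦ ⬚
      simp
  induction φ with
  | mem i j => exact Rl.mem hK i j
  | equ i j =>
    refine Rl.congr hK (all (Q := fun v ↦ (v 0 ~ v i.succ → v 0 ~ v j.succ) ∧ (v 0 ~ v j.succ → v 0 ~ v i.succ)) inferInstance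
      (Rl.and hK (Rl.imp hK (Rl.mem hK _ _) (Rl.mem hK _ _)) (Rl.imp hK (Rl.mem hK _ _) (Rl.mem hK _ _)))) fun v hv ↦ ⬚
    simp only [Fin.cons_zero, Fin.cons_succ]
    show _ ↔ v i = v j
    exact ⟨fun h ↦ zext fun z ↦ ⟨fun hz ↦ (h z (hK.tr (hv i) hz))◜ hz, fun hz ↦ (h z (hK.tr (hv j) hz))◝ hz⟩,
      fun h x hx ↦ by rw [h]; tauto⟩
  | aux i => exact Rl.congr hK (Rl.neg hK (Rl.all hK _)) fun v _ ↦ by simp [Eval, NoAux]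
  | impl f g ih1 ih2 => exact Rl.imp hK ih1 ih2
  | neg f ih => exact Rl.neg hK ih
  | all f ih => exact all (hd f) ih
  | ex f ih => exact Rl.ex hK (hd f) ih
  | allb i f ih =>
    have := hd f
    exact all (Q := fun v ↦ v 0 ~ v i.succ → Eval ∊ NoAux K f v) DF.imp_ (Rl.imp hK (Rl.mem hK _ _) ih)
theorem JC.sep (φ : Fml (n+1)) (v : Fin n → X) (hv : ∀ i, K (v i)) (a : X) (ha : K a) :
    ∃ b, K b ∧ ∀ z, z ~ b ↔ z ~ a ∧ Eval ∊ NoAux K φ (⊹ z v) := by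
  have fin : ∀ (n : ℕ) (v : Fin n → X), (∀ i, K (v i)) → ∃ w, K w ∧ ∀ i, v i ~ w := by
    intro n; induction n with
    | zero => exact fun v hv ↦ ⟨_, hK.emp, fun i ↦ i.elim0⟩
    | succ n ih =>
      intro v hv; obtain ⟨w, h1, h2⟩ := ih (fun i ↦ v i.succ) fun i ↦ hv i.succ
      exact ⟨_, hK.un (hK.upr (hv 0) (hv 0)) h1, fun i ↦ by
        refine Fin.cases ⬚ (fun i ↦ ⬚) i
        · simp
        · simpa using ▷ (h2 i)⟩
  rcases fin n v hv with ⟨w, h1, h2⟩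
  rcases Rl.eval hK φ (ZFI0.un a w) (hK.un ha h1) with ⟨D, d1, d2⟩
  have ht := hK.tp hv
  refine ⟨_, hK.gin ha (hK.gdo (hK.gin d1 (hK.gpr ha (hK.upr ht ht)))), fun z ↦ ⬚⟩
  simp only [mem_gin, mem_gdo, mem_gpr, d2, mem_upr, or_self, pr_inj]
  refine and_congr_right fun hz ↦ ⟨⬚, fun h ↦ ⬚⟩
  · rintro ⟨_, ⟨v₀, hv₀, e, h⟩, _, _, hu, rfl, rfl, rfl⟩
    rw [← tp_cons] at e
    rwa [tp_inj e]
  · exact ⟨_, ⟨⊹ z v, fun i ↦ by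
      refine Fin.cases ⬚ (fun i ↦ ⬚) i
      · simpa using ◁ hz
      · simpa using ▷ (h2 i), (tp_cons _ _).symm, h⟩, _, _, hz, rfl, rfl, rfl⟩
theorem JC.ord (a : X) (ha : Od a) : K a := by
  have hkd := hK.df
  by_contra hn
  rcases oleast (fun a ↦ ¬ K a) ⟨a, ha, hn⟩ with ⟨g, hg, hgn, hgl⟩
  have hle : ∀ c, Od c → K c → c ~ g := fun c hc hcK ↦ by
    rcases hc.tri hg with h | rfl | h
    · exact h
    · exact absurd hcK hgn
    · exact absurd (hK.tr hcK h) hgn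
  rcases hK.au g fun x hx ↦ not_not◜ (hgl x hx) with ⟨w, hw, hgw⟩
  rcases (inferInstance : UD fun X E σ ↦ IsOrd E σ⁰) with ⟨k, f, c, hf⟩
  rcases hK.sep (n := 0) (f.ren ℸ 0) Fin.elim0 (fun i ↦ i.elim0) w hw with ⟨b, hb, hb₀⟩
  have : b = g := zext fun z ↦ by
    rw [hb₀, eval_ren]
    have e : z ~ w → (Eval ∊ NoAux K f (fun i ↦ (⊹ z Fin.elim0 : Fin 1 → X) 0) ↔ Od z) := fun hz ↦ by
      have hzK := hK.tr hw hz
      have := eval_sub ∊ NoAux K f fun i ↦ ⟨z, hzK⟩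
      refine this.trans ((hf {x // K x} (fun a b ↦ a◜ ~ b◜) ℸ ⟨z, hzK⟩).symm.trans ⬚)
      constructor
      · rintro ⟨h1, h2⟩
        have tK := fun {y} (hy : y ~ z) ↦ hK.tr hzK hy
        exact ⟨fun y hy u hu ↦ h1 ⟨y, tK hy⟩ hy ⟨u, hK.tr (tK hy) hu⟩ hu, fun y u hy hu ↦ by
          have := h2 ⟨y, tK hy⟩ ⟨u, tK hu⟩ hy hu
          simpa using this⟩
      · rintro ⟨h1, h2⟩
        exact ⟨fun y hy u hu ↦ h1 y◜ hy u◜ hu, fun y u hy hu ↦ by have := h2 y◜ u◜ hy hu; simpa [Subtype.ext_iff] using this⟩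
    constructor
    · rintro ⟨hz, h⟩; exact hle z ((e hz)◜ h) (hK.tr hw hz)
    · intro hz; exact ⟨hgw z hz, (e (hgw z hz))◝ (hg.mem hz)⟩
  exact hgn (this ▸ hb)
theorem JC.zf : ClassSatZF ∊ NoAux K where
  ext := fun x y h ↦ Subtype.ext (zext fun z ↦ ⟨fun hz ↦ (h ⟨z, hK.tr x◝ hz⟩)◜ hz, fun hz ↦ (h ⟨z, hK.tr y◝ hz⟩)◝ hz⟩)
  found := fun x ⟨y, hy⟩ ↦ by
    rcases fnd (Q := x◜) ⟨_, hy⟩ with ⟨y, h1, h2⟩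
    exact ⟨⟨y, hK.tr x◝ h1⟩, h1, fun z hz hz₀ ↦ h2 _ hz₀ hz⟩
  pair := fun x y ↦ ⟨⟨_, hK.upr x◝ y◝⟩, fun z ↦ by simp [Subtype.ext_iff]⟩
  union := fun x ↦ ⟨⟨_, hK.sUn x◝⟩, fun z ↦ by
    simp only [mem_sUn]
    exact ⟨fun ⟨y, h, h₀⟩ ↦ ⟨⟨y, hK.tr x◝ h⟩, h, h₀⟩, fun ⟨y, h, h₀⟩ ↦ ⟨y◜, h, h₀⟩⟩⟩
  power := fun x ↦ by
    have hkd := hK.df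
    rcases hK.au (ZFI0.sep (pow x◜) K) fun z hz ↦ (mem_sep◜ hz)◝ with ⟨w, hw, hw₀⟩
    rcases hK.sep (n := 1) (Fml.allb 0 (Fml.mem 0 2)) (ℸ x◜) (fun i ↦ x◝) w hw with ⟨b, hb, hb₀⟩
    refine ⟨⟨b, hb⟩, fun z ↦ (hb₀ z◜).trans ⟨fun h u hu ↦ ⬚, fun h ↦ ⟨hw₀ _ (mem_sep◝ ⟨mem_pow◝ fun u hu ↦ ⬚, z◝⟩), fun u huK hu ↦ ⬚⟩⟩⟩
    · exact h◝ u◜ u◝ hu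
    · exact h ⟨u, hK.tr z◝ hu⟩ hu
    · exact h ⟨u, huK⟩ hu
  infty := by
    have ho := om_lim (X := X)
    refine ⟨⟨om, hK.ord _ ho◜⟩, ⟨⟨_, hK.emp⟩, emp_om, fun u ↦ by simp⟩, fun x hx ↦ ⟨⟨_, hK.ord _ (ho◜.mem (ho◝◝ _ hx))⟩, ho◝◝ _ hx, fun z ↦ ⬚⟩⟩
    simp [Subtype.ext_iff]
  sep := fun {n} f v a ↦ by
    rcases hK.sep f (fun i ↦ (v i)◜) (fun i ↦ (v i)◝) a◜ a◝ with ⟨b, hb, hb₀⟩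
    refine ⟨⟨b, hb⟩, fun z ↦ (hb₀ z◜).trans (and_congr_right fun hz ↦ ⬚)⟩
    rw [val_cons z◜ z◝ v]; exact eval_sub ∊ NoAux K f _
  repl := fun {n} f v a h ↦ by
    have hkd := hK.df
    have e : ∀ (x y : {x // K x}), Eval (fun a b : {x // K x} ↦ a◜ ~ b◜) NoAux AllSets f (⊹ x (⊹ y v)) ↔
        Eval ∊ NoAux K f (⊹ x◜ (⊹ y◜ fun i ↦ (v i)◜)) := fun x y ↦ by
      rw [val_cons y◜ y◝ v, val_cons x◜ x◝]; exact (eval_sub ∊ NoAux K f _).symm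
    have i1 : DF fun σ : ⊙X ↦ Eval ∊ NoAux K f (⊹ σ⁰ (⊹ σ¹ fun i ↦ (v i)◜)) := by
      refine (dfEval f (ℸ K) hK.df (⊹ (fun σ ↦ σ 0) (⊹ (fun σ ↦ σ 1) fun i _ ↦ (v i)◜)) fun i ↦ ⬚).congr fun σ ↦ ⬚
      · exact Fin.cases (DT.var 0) (fun i ↦ Fin.cases (DT.var 1) (fun i ↦ DT.const _) i) i
      · exact iff_of_eq (congrArg _ (funext fun i ↦ Fin.cases rfl (fun i ↦ Fin.cases rfl (fun i ↦ rfl) i) i))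
    have i3 : DF fun σ ↦ K σ¹ := df1 K _
    obtain ⟨b, hb⟩ := coll a◜ (fun x y ↦ K y ∧ Eval ∊ NoAux K f (⊹ x (⊹ y fun i ↦ (v i)◜))) fun x hx ↦ by
      rcases h ⟨x, hK.tr a◝ hx⟩ hx with ⟨y, hy, -⟩
      exact ⟨y◜, y◝, (e _ _)◜ hy⟩
    rcases hK.au (ZFI0.sep b K) fun x hx ↦ (mem_sep◜ hx)◝ with ⟨w, hw, hbw⟩
    obtain ⟨c, hc, hc₀⟩ := hK.sep (n := n+1) (Fml.ex ((Fml.impl (Fml.mem 0 2) (Fml.neg (f.ren (⊹ 0 (⊹ 1 fun i ↦ i.succ.succ.succ))))).neg))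
      (⊹ a◜ fun i ↦ (v i)◜) (fun i ↦ by refine Fin.cases ⬚ (fun i ↦ ⬚) i; exacts [a◝, (v i)◝]) w hw
    refine ⟨⟨c, hc⟩, fun y ↦ (hc₀ y◜).trans ⬚⟩
    simp only [Eval, eval_ren]
    have e2 : ∀ x, (fun i ↦ (⊹ x (⊹ y◜ (⊹ a◜ fun i ↦ (v i)◜)) : Fin (n+3) → X)
        ((⊹ 0 (⊹ 1 fun i ↦ i.succ.succ.succ) : Fin (n+2) → Fin (n+3)) i)) = ⊹ x (⊹ y◜ fun i ↦ (v i)◜) :=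
      fun x ↦ funext fun i ↦ by refine Fin.cases ⬚ (fun i ↦ Fin.cases ⬚ (fun i ↦ ⬚) i) i <;> rfl
    simp only [e2, Classical.not_imp, not_not]
    constructor
    · rintro ⟨-, x, hx, hxa, h⟩; exact ⟨⟨x, hx⟩, hxa, (e _ _)◝ h⟩
    · rintro ⟨x, hx, h₀⟩
      refine ⟨⬚, x◜, x◝, hx, (e _ _)◜ h₀⟩
      rcases hb x◜ hx with ⟨y₀, h1, h2, h3⟩
      have := (h x hx).unique h₀ ((e x ⟨y₀, h2⟩)◝ h3)
      rw [this]; exact hbw _ (mem_sep◝ ⟨h1, h2⟩)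
end
end
section
variable {X : Type} [ZFM X] {b a c z x y : X}
theorem Ls_up {l w : X} (hl : ∀ z w, z ~ l → w ~ z → w ~ l) (h : w ~ l) : w ~ Df l :=
  mem_Df◝ ⟨gcl_sub (by simp [h]), fun z hz ↦ hl _ _ h hz⟩
theorem Ls_tr (ha : Od a) : ∀ z w, z ~ Ls b a → w ~ z → w ~ Ls b a := by
  refine oind (fun a ↦ ∀ z w, z ~ Ls b a → w ~ z → w ~ Ls b a) (fun a ha ih z w hz hw ↦ ⬚) a ha
  rcases ha.cases with rfl | ⟨c, hc, rfl⟩ | hl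
  · rw [mem_L0] at *
    rcases hz with hz | rfl
    · exact ◁ (tc_tr hz hw)
    · exact ◁ (tc_sub hw)
  · rw [Ls_suc hc] at *
    exact Ls_up (ih c (by simp)) ((mem_Df◜ hz)◝ _ hw)
  · rw [mem_Ll hl] at *
    rcases hz with ⟨c, hc, hz⟩
    exact ⟨c, hc, ih c hc _ _ hz hw⟩
theorem Ls_le (hc : Od c) (h : z ~ Ls b c) : z ~ Ls b (suc c) := by
  rw [Ls_suc hc]; exact Ls_up (Ls_tr hc) h
theorem Ls_in (hc : Od c) : Ls b c ~ Ls b (suc c) := by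
  rw [Ls_suc hc]; exact mem_Df◝ ⟨gcl_sub (by simp), fun z hz ↦ hz⟩
theorem Ls_mono (ha : Od a) (hca : c ~ a) (hz : z ~ Ls b c) : z ~ Ls b a := by
  refine oind (fun a ↦ ∀ c, c ~ a → ∀ z, z ~ Ls b c → z ~ Ls b a) (fun a ha ih c hca z hz ↦ ⬚) a ha c hca z hz
  rcases ha.cases with rfl | ⟨e, he, rfl⟩ | hl
  · simp at hca
  · apply Ls_le he
    rcases mem_suc◜ hca with h | rfl
    · exact ih e (by simp) c h z hz
    · exact hz
  · exact (mem_Ll hl)◝ ⟨c, hca, hz⟩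
theorem Ls_bd (h : ∀ x, x ~ s → InL ∊ b x) : ∃ a, Od a ∧ ∀ x, x ~ s → x ~ Ls b a := by
  rcases coll s (fun x a ↦ Od a ∧ x ~ Ls b a) fun x hx ↦ inL_iff◜ (h x hx) with ⟨w, hw⟩
  have ho : Od (sUn (sep w Od)) := Od.sUnO fun x hx ↦ (mem_sep◜ hx)◝
  refine ⟨suc (sUn (sep w Od)), ho.sucO, fun x hx ↦ ⬚⟩
  rcases hw x hx with ⟨c, hc, hco, h⟩
  refine Ls_mono ho.sucO (mem_suc◝ (hco.le_of ho fun z hz ↦ mem_sUn◝ ⟨c, mem_sep◝ ⟨hc, hco⟩, hz⟩)) h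
theorem L_tr (h : InL ∊ b x) (hy : y ~ x) : InL ∊ b y := by
  rcases inL_iff◜ h with ⟨a, ha, h⟩
  exact inL_iff◝ ⟨a, ha, Ls_tr ha _ _ h hy⟩
theorem L_op (hx : InL ∊ b x) (hy : InL ∊ b y) (ho : Gop t x y) (ht : ∀ z, z ~ t → InL ∊ b z) :
    InL ∊ b t := by
  obtain ⟨a, ha, h⟩ := Ls_bd (b := b) (s := un t (upr x y)) fun z hz ↦ by
    simp only [mem_un, mem_upr] at hz
    rcases hz with hz | rfl | rfl
    exacts [ht _ hz, hx, hy]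
  refine inL_iff◝ ⟨suc a, ha.sucO, ⬚⟩
  rw [Ls_suc ha]
  refine mem_Df◝ ⟨gcl_GC x y t (gcl_sub ⬚) (gcl_sub ⬚) ho, fun z hz ↦ h _ (by simp [hz])⟩
  · exact mem_suc◝ (◁ (h x (by simp)))
  · exact mem_suc◝ (◁ (h y (by simp)))
theorem L_jc (b : X) : JC (InL ∊ b) := by
  have up : ∀ {x y : X}, InL ∊ b x → InL ∊ b y → InL ∊ b (upr x y) := fun {x y} hx hy ↦
    L_op hx hy (by simp [Gop]) fun z hz ↦ by rcases mem_upr◜ hz with rfl | rfl <;> assumption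
  have pp : ∀ {x y : X}, InL ∊ b x → InL ∊ b y → InL ∊ b (pr x y) := fun hx hy ↦ up (up hx hx) (up hx hy)
  have q : ∀ {x u v : X}, InL ∊ b x → pr u v ~ x → InL ∊ b u ∧ InL ∊ b v := fun {x u v} hx h ↦ by
    have : InL ∊ b (upr u v) := L_tr (L_tr hx h) (mem_upr◝ (▷ rfl))
    exact ⟨L_tr this (by simp), L_tr this (by simp)⟩
  have q3 : ∀ {x u v w : X}, InL ∊ b x → pr u (pr v w) ~ x → InL ∊ b u ∧ InL ∊ b v ∧ InL ∊ b w := fun {x u v w} hx h ↦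
    ⟨(q hx h)◜, q (up (q hx h)◝ (q hx h)◝) (mem_upr◝ (◁ rfl))⟩
  refine ⟨inferInstance, fun h hy ↦ L_tr h hy, fun x y t hx hy ho ↦ L_op hx hy ho fun z hz ↦ ⬚, fun s hs ↦ ⬚⟩
  · rcases ho with (rfl | rfl | rfl | rfl | rfl) | (rfl | rfl | rfl | rfl | rfl)
    · rcases mem_upr◜ hz with rfl | rfl <;> assumption
    · rcases mem_gpr◜ hz with ⟨u, v, hu, hv, rfl⟩; exact pp (L_tr hx hu) (L_tr hy hv)
    · rcases mem_gme◜ hz with ⟨u, v, hu, hv, -, rfl⟩; exact pp (L_tr hx hu) (L_tr hy hv)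
    · exact L_tr hx (mem_gdf◜ hz)◜
    · exact L_tr hx (mem_gin◜ hz)◜
    · rcases mem_sUn◜ hz with ⟨u, hu, hv⟩; exact L_tr (L_tr hx hu) hv
    · rcases mem_gdo◜ hz with ⟨u, hu⟩; exact (q hx hu)◜
    · rcases mem_gco◜ hz with ⟨u, v, hu, rfl⟩; exact pp (q hx hu)◝ (q hx hu)◜
    · rcases mem_g1◜ hz with ⟨u, v, w, h, rfl⟩; have := q3 hx h; exact pp this◜ (pp this◝◝ this◝◜)
    · rcases mem_g2◜ hz with ⟨u, v, w, h, rfl⟩; have := q3 hx h; exact pp this◝◝ (pp this◜ this◝◜)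
  · rcases Ls_bd hs with ⟨a, ha, h⟩
    exact ⟨_, inL_iff◝ ⟨_, ha.sucO, Ls_in ha⟩, h⟩
theorem L_self (b : X) : InL ∊ b b := inL_iff◝ ⟨emp, Od_emp, mem_L0◝ (▷ rfl)⟩
end
section
structure TE {Y X : Type} [ZFM Y] [ZFM X] (i : Y → X) : Prop where
  mem {a b : Y} : i a ~ i b ↔ a ~ b
  tr {x : X} {b : Y} : x ~ i b → ∃ a, x = i a
section
variable {Y X : Type} [ZFM Y] [ZFM X] {i : Y → X} (h : TE i) {a b x y f s : Y}
include h
theorem TE.inj : i a = i b ↔ a = b :=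
  ⟨fun e ↦ zext fun z ↦ by rw [← h.mem, e, h.mem], fun e ↦ e ▸ rfl⟩
theorem TE.ex {Q : X → Prop} : (∃ x, x ~ i b ∧ Q x) ↔ ∃ a, a ~ b ∧ Q (i a) :=
  ⟨fun ⟨x, hx, hq⟩ ↦ by rcases h.tr hx with ⟨a, rfl⟩; exact ⟨a, h.mem◜ hx, hq⟩, fun ⟨a, ha, hq⟩ ↦ ⟨_, h.mem◝ ha, hq⟩⟩
theorem TE.all {Q : X → Prop} : (∀ x, x ~ i b → Q x) ↔ ∀ a, a ~ b → Q (i a) :=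
  ⟨fun H a ha ↦ H _ (h.mem◝ ha), fun H x hx ↦ by rcases h.tr hx with ⟨a, rfl⟩; exact H a (h.mem◜ hx)⟩
theorem TE.eq {x : X} (h1 : ∀ z, z ~ b → i z ~ x) (h2 : ∀ z, z ~ x → ∃ a, z = i a ∧ a ~ b) : i b = x :=
  zext fun z ↦ ⟨fun hz ↦ by rcases h.tr hz with ⟨a, rfl⟩; exact h1 a (h.mem◜ hz), fun hz ↦ by
    rcases h2 z hz with ⟨a, rfl, ha⟩; exact h.mem◝ ha⟩
theorem TE.emp : i emp = emp := h.eq (by simp) (by simp)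
theorem TE.upr : i (upr x y) = upr (i x) (i y) :=
  h.eq (by simp) fun z hz ↦ by rcases mem_upr◜ hz with rfl | rfl <;> exact ⟨_, rfl, by simp⟩
theorem TE.pr : i (pr x y) = pr (i x) (i y) := by unfold ZFI0.pr; simp only [h.upr]
theorem TE.prin : ZFI0.pr (i x) (i y) ~ i f ↔ ZFI0.pr x y ~ f := by rw [← h.pr, h.mem]
theorem TE.prtr {x y : X} (e : ZFI0.pr x y ~ i f) : ∃ a b, x = i a ∧ y = i b ∧ ZFI0.pr a b ~ f := by
  rcases h.tr e with ⟨p, hp⟩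
  obtain ⟨q, hq⟩ := h.tr (by rw [← hp]; exact mem_upr◝ (▷ rfl))
  rcases h.tr (x := x) (b := q) (by rw [← hq]; simp) with ⟨a, rfl⟩
  rcases h.tr (x := y) (b := q) (by rw [← hq]; simp) with ⟨b, rfl⟩
  exact ⟨a, b, rfl, rfl, h.prin◜ e⟩
theorem TE.pre {x y : X} {q : Y} (e : i q = ZFI0.pr x y) : ∃ a b, x = i a ∧ y = i b ∧ q = ZFI0.pr a b := by
  rcases h.prtr (f := ZFI0.upr q q) (x := x) (y := y) (by rw [h.upr, e]; simp) with ⟨a, b, rfl, rfl, h₀⟩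
  rw [← h.pr, h.inj] at e
  exact ⟨a, b, rfl, rfl, e⟩
theorem TE.sUn : i (sUn x) = sUn (i x) :=
  h.eq (fun z hz ↦ by rcases mem_sUn◜ hz with ⟨y, h1, h2⟩; exact mem_sUn◝ ⟨_, h.mem◝ h1, h.mem◝ h2⟩) fun z hz ↦ by
    rcases mem_sUn◜ hz with ⟨y, h1, h2⟩
    rcases h.tr h1 with ⟨y, rfl⟩; obtain ⟨z, rfl⟩ := h.tr h2
    exact ⟨z, rfl, mem_sUn◝ ⟨y, h.mem◜ h1, h.mem◜ h2⟩⟩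
theorem TE.un : i (un x y) = un (i x) (i y) := zext fun z ↦ by
  have e : ∀ x y : Y, ZFI0.un x y = ZFI0.sUn (ZFI0.upr x y) := fun x y ↦ zext fun z ↦ by simp
  rw [e, h.sUn, h.upr]; simp
theorem TE.suc : i (suc x) = suc (i x) := zext fun z ↦ by
  have e : ∀ x : Y, ZFI0.suc x = ZFI0.un x (ZFI0.upr x x) := fun x ↦ zext fun z ↦ by simp
  rw [e, h.un, h.upr]; simp
theorem TE.gdf : i (gdf x y) = gdf (i x) (i y) :=
  h.eq (fun z hz ↦ by simpa [h.mem] using hz) fun z hz ↦ by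
    rw [mem_gdf] at hz; rcases h.tr hz◜ with ⟨z, rfl⟩; exact ⟨z, rfl, by simpa [h.mem] using hz⟩
theorem TE.gin : i (gin x y) = gin (i x) (i y) :=
  h.eq (fun z hz ↦ by simpa [h.mem] using hz) fun z hz ↦ by
    rw [mem_gin] at hz; rcases h.tr hz◜ with ⟨z, rfl⟩; exact ⟨z, rfl, by simpa [h.mem] using hz⟩
theorem TE.gpr : i (gpr x y) = gpr (i x) (i y) :=
  h.eq (fun z hz ↦ by
    rcases mem_gpr◜ hz with ⟨u, v, hu, hv, rfl⟩; exact mem_gpr◝ ⟨i u, i v, h.mem◝ hu, h.mem◝ hv, h.pr⟩) fun z hz ↦ by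
    rcases mem_gpr◜ hz with ⟨u, v, hu, hv, rfl⟩
    rcases h.tr hu with ⟨u, rfl⟩; obtain ⟨v, rfl⟩ := h.tr hv
    exact ⟨_, h.pr.symm, mem_gpr◝ ⟨u, v, h.mem◜ hu, h.mem◜ hv, rfl⟩⟩
theorem TE.gme : i (gme x y) = gme (i x) (i y) :=
  h.eq (fun z hz ↦ by
    rcases mem_gme◜ hz with ⟨u, v, hu, hv, hh, rfl⟩; exact mem_gme◝ ⟨i u, i v, h.mem◝ hu, h.mem◝ hv, h.mem◝ hh, h.pr⟩) fun z hz ↦ by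
    rcases mem_gme◜ hz with ⟨u, v, hu, hv, hh, rfl⟩
    rcases h.tr hu with ⟨u, rfl⟩; obtain ⟨v, rfl⟩ := h.tr hv
    exact ⟨_, h.pr.symm, mem_gme◝ ⟨u, v, h.mem◜ hu, h.mem◜ hv, h.mem◜ hh, rfl⟩⟩
theorem TE.gdo : i (gdo x) = gdo (i x) :=
  h.eq (fun z hz ↦ by rcases mem_gdo◜ hz with ⟨u, hu⟩; exact mem_gdo◝ ⟨i u, h.prin◝ hu⟩) fun z hz ↦ by
    rcases mem_gdo◜ hz with ⟨u, hu⟩; rcases h.prtr hu with ⟨a, b, rfl, rfl, hu₀⟩; exact ⟨a, rfl, mem_gdo◝ ⟨b, hu₀⟩⟩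
theorem TE.gco : i (gco x) = gco (i x) :=
  h.eq (fun z hz ↦ by rcases mem_gco◜ hz with ⟨u, v, hu, rfl⟩; exact mem_gco◝ ⟨i u, i v, h.prin◝ hu, h.pr⟩) fun z hz ↦ by
    rcases mem_gco◜ hz with ⟨u, v, hu, rfl⟩; rcases h.prtr hu with ⟨a, b, rfl, rfl, hu₀⟩; exact ⟨_, h.pr.symm, mem_gco◝ ⟨a, b, hu₀, rfl⟩⟩
theorem TE.prtr3 {x y z : X} (e : ZFI0.pr x (ZFI0.pr y z) ~ i f) :
    ∃ a b c, x = i a ∧ y = i b ∧ z = i c ∧ ZFI0.pr a (ZFI0.pr b c) ~ f := by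
  rcases h.prtr e with ⟨a, q, rfl, e, hu⟩
  rcases h.pre e.symm with ⟨b, c, rfl, rfl, rfl⟩
  exact ⟨a, b, c, rfl, rfl, rfl, hu⟩
theorem TE.g1 : i (g1 x) = g1 (i x) :=
  h.eq (fun z hz ↦ by rcases mem_g1◜ hz with ⟨u, v, w, hu, rfl⟩; exact mem_g1◝ ⟨i u, i v, i w, by rwa [← h.pr, h.prin], by rw [h.pr, h.pr]⟩) fun z hz ↦ by
    rcases mem_g1◜ hz with ⟨u, v, w, hu, rfl⟩; obtain ⟨a, b, c, rfl, rfl, rfl, hu₀⟩ := h.prtr3 hu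
    exact ⟨_, by rw [← h.pr, ← h.pr], mem_g1◝ ⟨a, c, b, hu₀, rfl⟩⟩
theorem TE.g2 : i (g2 x) = g2 (i x) :=
  h.eq (fun z hz ↦ by rcases mem_g2◜ hz with ⟨u, v, w, hu, rfl⟩; exact mem_g2◝ ⟨i u, i v, i w, by rwa [← h.pr, h.prin], by rw [h.pr, h.pr]⟩) fun z hz ↦ by
    rcases mem_g2◜ hz with ⟨u, v, w, hu, rfl⟩; obtain ⟨a, b, c, rfl, rfl, rfl, hu₀⟩ := h.prtr3 hu
    exact ⟨_, by rw [← h.pr, ← h.pr], mem_g2◝ ⟨c, a, b, hu₀, rfl⟩⟩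
theorem TE.gten : i (gten x y) = gten (i x) (i y) := by
  unfold ZFI0.gten; simp only [h.un, h.upr, h.gpr, h.gme, h.gdf, h.gin, h.sUn, h.gdo, h.gco, h.g1, h.g2]
theorem TE.gop : Gop t (i x) (i y) ↔ ∃ s, t = i s ∧ Gop s x y := by
  rw [← mem_gten, ← h.gten]
  constructor
  · intro e; rcases h.tr e with ⟨s, rfl⟩; exact ⟨s, rfl, mem_gten◜ (h.mem◜ e)⟩
  · rintro ⟨s, rfl, e⟩; exact h.mem◝ (mem_gten◝ e)
theorem TE.od : Od (i a) ↔ Od a := by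
  constructor
  · rintro ⟨h1, h2⟩
    exact ⟨fun y hy z hz ↦ h.mem◜ (h1 _ (h.mem◝ hy) _ (h.mem◝ hz)), fun y z hy hz ↦ by
      have := h2 (i y) (i z) (h.mem◝ hy) (h.mem◝ hz)
      rwa [h.inj, h.mem, h.mem] at this⟩
  · rintro ⟨h1, h2⟩
    refine ⟨fun y hy z hz ↦ ⬚, fun y z hy hz ↦ ⬚⟩
    · rcases h.tr hy with ⟨y, rfl⟩; obtain ⟨z, rfl⟩ := h.tr hz
      rw [h.mem] at *; exact h1 _ hy _ hz
    · rcases h.tr hy with ⟨y, rfl⟩; obtain ⟨z, rfl⟩ := h.tr hz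
      rw [h.inj, h.mem, h.mem]; rw [h.mem] at *; exact h2 _ _ hy hz
theorem TE.lim : IsLimitOrd ∊ (i a) ↔ IsLimitOrd ∊ a := by
  rw [lim_iff, lim_iff, h.od]
  refine and_congr_right ℸ and_congr ⬚ ⬚
  · have := h.ex (b := a) (Q := ℸ True); simpa using this
  · rw [h.all]; simp only [← h.suc, h.mem]
theorem TE.sub : SubsetE ∊ (i a) (i b) ↔ SubsetE ∊ a b := by
  unfold SubsetE; have := h.all (b := a) (Q := fun x ↦ x ~ i b); simp only [h.mem] at this; exact this
theorem TE.fn : Fn (i f) (i a) ↔ Fn f a := by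
  rw [← fn_iff, ← fn_iff]
  unfold IsFuncOn IsFunc
  simp only [kp, pin]
  constructor
  · rintro ⟨⟨h1, h2⟩, h3⟩
    refine ⟨⟨fun p hp ↦ ⬚, fun x y z hx hy ↦ ⬚⟩, fun x ↦ ⬚⟩
    · rcases h1 _ (h.mem◝ hp) with ⟨x, y, e⟩
      rcases h.pre e with ⟨a, b, rfl, rfl, e₀⟩; exact ⟨a, b, e₀⟩
    · exact h.inj◜ (h2 _ _ _ (h.prin◝ hx) (h.prin◝ hy))
    · rw [← h.mem, ← h3]; symm
      exact ⟨fun ⟨y, hy⟩ ↦ by rcases h.prtr hy with ⟨a, b, e, rfl, hh⟩; rw [h.inj] at e; exact ⟨b, e ▸ hh⟩, fun ⟨y, hy⟩ ↦ ⟨_, h.prin◝ hy⟩⟩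
  · rintro ⟨⟨h1, h2⟩, h3⟩
    refine ⟨⟨fun p hp ↦ ⬚, fun x y z hx hy ↦ ⬚⟩, fun x ↦ (⬚ : (i a |> fun b ↦ x ~ b) ↔ _).symm⟩
    · rcases h.tr hp with ⟨p, rfl⟩
      rcases h1 _ (h.mem◜ hp) with ⟨x, y, rfl⟩; exact ⟨_, _, h.pr⟩
    · rcases h.prtr hx with ⟨x, y, rfl, rfl, hx₀⟩; obtain ⟨x₀, z, e, rfl, hy₀⟩ := h.prtr hy
      rw [h.inj] at e; subst e; rw [h2 _ _ _ hx₀ hy₀]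
    · refine ⟨fun hx ↦ ⬚, fun ⟨y, hy⟩ ↦ ⬚⟩
      · rcases h.tr hx with ⟨x, rfl⟩; rcases (h3 x)◝ (h.mem◜ hx) with ⟨y, hy⟩; exact ⟨_, h.prin◝ hy⟩
      · rcases h.prtr hy with ⟨x, y, rfl, rfl, hy₀⟩; exact h.mem◝ ((h3 x)◜ ⟨y, hy₀⟩)
theorem TE.app (hf : Fn f a) (hx : x ~ a) : i (app f x) = app (i f) (i x) := by
  have := (Fn.mem hf)◝ ⟨hx, rfl⟩
  exact ((h.fn◝ hf).mem◜ (h.prin◝ this))◝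
theorem TE.gcl : i (gcl s) = gcl (i s) := by
  have h1 : ∀ n y, n ~ om → Od n → y = gsq s n → ∀ z, z ~ i y → z ~ ZFI0.gcl (i s) := by
    by_contra hn
    push Not at hn
    rcases hn with ⟨n, _, hn, hno, rfl, z, hz, hzn⟩
    obtain ⟨n, hn, hmin⟩ := fnd (Q := ZFI0.sep (i om) fun n ↦ ∃ y, ZFI0.pr n y ~ i (lam om (gsq s)) ∧ ∃ z, z ~ y ∧ ¬ z ~ ZFI0.gcl (i s))
      ⟨i n, mem_sep◝ ⟨h.mem◝ hn, _, h.prin◝ (mem_lam◝ ⟨_, hn, rfl⟩), z, hz, hzn⟩⟩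
    rw [mem_sep] at hn
    rcases hn with ⟨hn, y, hy, z, hz, hzn⟩
    rcases h.prtr hy with ⟨n, y, rfl, rfl, hy₀⟩
    rcases mem_lam◜ hy₀ with ⟨n₀, hn₀, e⟩
    rcases pr_inj◜ e with ⟨rfl, rfl⟩
    have hno := om_lim◜.mem hn₀
    rcases h.tr hz with ⟨z, rfl⟩
    have key : ∀ k, k ~ n → ∀ z, z ~ gsq s k → i z ~ ZFI0.gcl (i s) := fun k hk z hz ↦ by
      by_contra hc
      have hko := om_lim◜.tr hn₀ hk
      exact hmin (i k) (mem_sep◝ ⟨h.mem◝ hko, _, h.prin◝ (mem_lam◝ ⟨_, hko, rfl⟩), i z, h.mem◝ hz, hc⟩) (h.mem◝ hk)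
    rw [h.mem, mem_gsq hno] at hz
    rcases hz with hz | ⟨k, hk, hz⟩
    · exact hzn (gcl_sub (h.mem◝ hz))
    · rcases mem_gst◜ hz with hz | ⟨x, y, hx, hy, ho⟩
      · exact hzn (key k hk z hz)
      · exact hzn (gcl_GC _ _ _ (key k hk x hx) (key k hk y hy) (h.gop◝ ⟨z, rfl, ho⟩))
  refine zext fun z ↦ ⟨fun hz ↦ ⬚, fun hz ↦ gcl_least (c := i (ZFI0.gcl s)) (fun z hz ↦ ⬚) (fun x y t hx hy ho ↦ ⬚) hz⟩
  · rcases h.tr hz with ⟨z, rfl⟩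
    rcases gcl_stage (h.mem◜ hz) with ⟨n, hn, hz⟩
    exact h1 n _ hn (om_lim◜.mem hn) rfl _ (h.mem◝ hz)
  · rcases h.tr hz with ⟨z, rfl⟩; rw [h.mem] at *; exact gcl_sub hz
  · rcases h.tr hx with ⟨x, rfl⟩; obtain ⟨y, rfl⟩ := h.tr hy
    rcases h.gop◜ ho with ⟨t, rfl, ho₀⟩
    rw [h.mem] at *; exact gcl_GC _ _ _ hx hy ho₀
theorem TE.Df : i (Df s) = Df (i s) := h.eq
  (fun z hz ↦ by
    rw [mem_Df] at *
    rw [← h.suc, ← h.gcl, h.mem]; refine ⟨hz◜, fun w hw ↦ ⬚⟩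
    rcases h.tr hw with ⟨w, rfl⟩; rw [h.mem] at *; exact hz◝ w hw)
  fun z hz ↦ by
    rw [mem_Df, ← h.suc, ← h.gcl] at hz
    rcases h.tr hz◜ with ⟨z, rfl⟩
    refine ⟨z, rfl, mem_Df◝ ⟨h.mem◜ hz◜, fun w hw ↦ ⬚⟩⟩
    have := hz◝ (i w) (h.mem◝ hw); rwa [h.mem] at this
omit h in
theorem tc_self (hb : TransSet ∊ b) : tc b = b :=
  zext fun z ↦ ⟨fun hz ↦ tc_least (fun z hz ↦ hz) (fun y hy z hz ↦ hb y hy z hz) hz, tc_sub⟩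
theorem TE.trs : TransSet ∊ (i b) ↔ TransSet ∊ b := by
  constructor
  · exact fun hb y hy z hz ↦ h.mem◜ (hb _ (h.mem◝ hy) _ (h.mem◝ hz))
  · intro hb y hy z hz
    rcases h.tr hy with ⟨y, rfl⟩; obtain ⟨z, rfl⟩ := h.tr hz
    rw [h.mem] at *; exact hb _ hy _ hz
theorem TE.Ls (hb : TransSet ∊ b) (ha : Od a) : i (Ls b a) = Ls (i b) (i a) := by
  by_contra hn
  obtain ⟨c, hc, hmin⟩ := fnd (Q := ZFI0.sep (i (ZFI0.suc a)) fun c ↦ ∃ l, ZFI0.pr c l ~ i (lam (ZFI0.suc a) (ZFI0.Ls b)) ∧ l ≠ ZFI0.Ls (i b) c)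
      ⟨i a, mem_sep◝ ⟨h.mem◝ (by simp), _, h.prin◝ (mem_lam◝ ⟨a, by simp, rfl⟩), hn⟩⟩
  rw [mem_sep] at hc
  rcases hc with ⟨hc, l, hl, hne⟩
  rcases h.prtr hl with ⟨c, l, rfl, rfl, hl₀⟩
  rcases mem_lam◜ hl₀ with ⟨c₀, hc₀, e⟩
  rcases pr_inj◜ e with ⟨rfl, rfl⟩
  have hco := ha.sucO.mem hc₀
  have key : ∀ k, k ~ c → i (ZFI0.Ls b k) = ZFI0.Ls (i b) (i k) := fun k hk ↦ by
    by_contra hh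
    have hko := ha.sucO.tr hc₀ hk
    exact hmin (i k) (mem_sep◝ ⟨h.mem◝ hko, _, h.prin◝ (mem_lam◝ ⟨_, hko, rfl⟩), hh⟩) (h.mem◝ hk)
  apply hne
  rcases hco.cases with rfl | ⟨e2, he, rfl⟩ | hli
  · refine zext fun z ↦ ⬚
    rw [h.emp, mem_L0, tc_self (h.trs◝ hb)]
    constructor
    · intro hz; obtain ⟨z, rfl⟩ := h.tr hz
      rwa [h.mem, mem_L0, tc_self hb, ← h.mem, ← h.inj] at hz
    · rintro (hz | rfl)
      · rcases h.tr hz with ⟨z, rfl⟩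
        rw [h.mem, mem_L0, tc_self hb]; exact ◁ (h.mem◜ hz)
      · rw [h.mem, mem_L0]; exact ▷ rfl
  · rw [Ls_suc he, h.Df, key e2 (by simp), h.suc, Ls_suc (h.od◝ he)]
  · refine zext fun z ↦ ⬚
    rw [mem_Ll (h.lim◝ hli), h.ex]
    constructor
    · intro hz; obtain ⟨z, rfl⟩ := h.tr hz
      rw [h.mem, mem_Ll hli] at hz; obtain ⟨k, hk, hz⟩ := hz
      exact ⟨k, hk, by rw [← key k hk, h.mem]; exact hz⟩
    · rintro ⟨k, hk, hz⟩
      rw [← key k hk] at hz; obtain ⟨z, rfl⟩ := h.tr hz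
      rw [h.mem] at *; exact (mem_Ll hli)◝ ⟨k, hk, hz⟩
theorem TE.inL (ho : ∀ a, Od a → ∃ c, a = i c) (hb : TransSet ∊ b) {x : X} :
    InL ∊ (i b) x ↔ ∃ y, x = i y ∧ InL ∊ b y := by
  simp only [inL_iff]
  constructor
  · rintro ⟨a, ha, hx⟩
    rcases ho a ha with ⟨a, rfl⟩; rw [h.od] at ha; rw [← h.Ls hb ha] at hx
    rcases h.tr hx with ⟨x, rfl⟩
    exact ⟨x, rfl, a, ha, h.mem◜ hx⟩
  · rintro ⟨y, rfl, a, ha, hy⟩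
    exact ⟨i a, h.od◝ ha, by rwa [← h.Ls hb ha, h.mem]⟩
theorem TE.ev (φ : Fml n) (hC : ∀ x, C x → ∃ y, x = i y) (v : Fin n → Y) :
    Eval ∊ NoAux C φ (fun k ↦ i (v k)) ↔ Eval ∊ NoAux (fun y ↦ C (i y)) φ v := by
  have cs : ∀ {n : ℕ} (x : Y) (v : Fin n → Y), (⊹ (i x) (fun k ↦ i (v k)) : Fin (n+1) → X) = fun k ↦ i ((⊹ x v : Fin (n+1) → Y) k) :=
    fun x v ↦ funext fun k ↦ by refine Fin.cases ⬚ (fun k ↦ ⬚) k <;> simp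
  induction φ with
  | mem a b => exact h.mem
  | equ a b => exact h.inj
  | aux a => exact Iff.rfl
  | impl f g h1 h2 => exact imp_congr (h1 v) (h2 v)
  | neg f h1 => exact not_congr (h1 v)
  | all f h1 =>
    constructor
    · intro H x hx; have := H (i x) hx; rw [cs] at this; exact (h1 _)◜ this
    · intro H x hx; rcases hC x hx with ⟨x, rfl⟩; rw [cs]; exact (h1 _)◝ (H x hx)
  | ex f h1 =>
    constructor
    · rintro ⟨x, hx, H⟩; rcases hC x hx with ⟨x, rfl⟩; rw [cs] at H; exact ⟨x, hx, (h1 _)◜ H⟩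
    · rintro ⟨x, hx, H⟩; exact ⟨i x, hx, by rw [cs]; exact (h1 _)◝ H⟩
  | allb a f h1 =>
    constructor
    · intro H x hx hm; have := H (i x) hx (h.mem◝ hm); rw [cs] at this; exact (h1 _)◜ this
    · intro H x hx hm; rcases hC x hx with ⟨x, rfl⟩; rw [cs]; exact (h1 _)◝ (H x hx (h.mem◜ hm))
end
end
section
variable {X : Type} [ZFM X] {a : X}
class NA (X : Type) [ZFM X] : Prop where
  na : SatZF ∊ (NoAux : X → Prop)
section
variable [UC X]
open UC
def O (X : Type) [ZFM X] [UC X] := {a : X // Ok a}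
def Yc (a : O X) := {x : X // cls a◜ x}
def mk (a : O X) (f : {f // Fa a◜ f}) : Yc a := ⟨pi₀ a◜ f◜, f◜, f◝, rfl⟩
theorem mk_ex {a : O X} (x : Yc a) : ∃ f, x = mk a f := let ⟨f, hf, e⟩ := x◝; ⟨⟨f, hf⟩, Subtype.ext e⟩
theorem mk_eq {a : O X} {f g : {f // Fa a◜ f}} : mk a f = mk a g ↔ ae fun p ↦ app f◜ p = app g◜ p :=
  Subtype.ext_iff.trans (pi_eq a◝ f◝ g◝)
def cn (x : X) : X := lam B ℸ x
instance : T1 X cn := ti1 cn (by unfold cn; infer_instance)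
def cF (a : O X) (x : X) : {f // Fa a◜ f} := ⟨cn x, FF_const⟩
theorem app_cn {x p : X} (hp : p ~ B) : app (cn x) p = x := app_lam hp
def YE (a : O X) (x y : Yc a) : Prop := x◜ ~ y◜
theorem losY {a : O X} {n : ℕ} (φ : Fml n) (fs : Fin n → {f // Fa a◜ f}) :
    Eval (YE a) NoAux AllSets φ (fun i ↦ mk a (fs i)) ↔ ae fun p ↦ Eval ∊ NoAux AllSets φ fun i ↦ app (fs i)◜ p :=
  (eval_sub ∊ NoAux (cls a◜) φ fun i ↦ mk a (fs i)).symm.trans (Los a◝ φ (fun i ↦ (fs i)◜) fun i ↦ (fs i)◝)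
theorem losU {a : O X} {R : Pd} (h : UD R) (fs : ℕ → {f // Fa a◜ f}) :
    R (Yc a) (YE a) (fun n ↦ mk a (fs n)) ↔ ae fun p ↦ R X ∊ (fun n ↦ app (fs n)◜ p) := by
  rcases h with ⟨k, f, c, h⟩
  simp only [h]; exact losY f fun i ↦ fs (c i)
theorem losC {a : O X} {R : Pd} (h : UD R) (σ : ⊙X) :
    R (Yc a) (YE a) (fun n ↦ mk a (cF a (σ n))) ↔ R X ∊ σ :=
  (losU h _).trans ((ae_congr fun p hp ↦ by simp only [cF, app_cn hp]).trans ae_const)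
instance [NA X] (a : O X) : ZFM (Yc a) :=
  ⟨YE a, NoAux, zf_ud (ℸ (emp : X)) _ (fun R hR h ↦ (losC (a := a) hR _)◝ h) NA.na⟩
instance [NA X] (a : O X) : NA (Yc a) := ⟨ZFM.sat⟩
theorem teY [NA X] (a : O X) : TE fun x : Yc a ↦ x◜ := ⟨Iff.rfl, fun {_ b} h ↦ ⟨⟨_, cls_tr a◝ b◝ h⟩, rfl⟩⟩
instance : LE (O X) := ⟨fun a c ↦ ∀ z, z ~ a◜ → z ~ c◜⟩
theorem Fa.le (h : ∀ z, z ~ a → z ~ c) (hf : Fa a f) : Fa c f :=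
  let ⟨s, h1, h2, h3⟩ := hf.sp; Fa.mk hf◜ h1 (fun x hx ↦ h _ (h2 x hx)) h3
def jF {a c : O X} (h : a ≤ c) (f : {f // Fa a◜ f}) : {f // Fa c◜ f} := ⟨f◜, f◝.le h⟩
def jm {a c : O X} (h : a ≤ c) (x : Yc a) : Yc c := mk c (jF h (mk_ex x).choose)
theorem jm_mk {a c : O X} (h : a ≤ c) (f : {f // Fa a◜ f}) : jm h (mk a f) = mk c (jF h f) :=
  mk_eq◝ ((mk_eq (a := a))◜ (mk_ex (mk a f)).choose_spec.symm)
theorem jmU {a c : O X} (h : a ≤ c) {R : Pd} (hR : UD R) (σ : ℕ → Yc a) :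
    R (Yc c) (YE c) (fun n ↦ jm h (σ n)) ↔ R (Yc a) (YE a) σ := by
  choose f hf using fun n ↦ mk_ex (σ n)
  obtain rfl : σ = fun n ↦ mk a (f n) := funext hf
  simp only [jm_mk]; rw [losU hR, losU hR]; exact Iff.rfl
theorem jm_id {a : O X} (h : a ≤ a) (x : Yc a) : jm h x = x := by rcases mk_ex x with ⟨f, rfl⟩; exact jm_mk h f
theorem jm_cp {a b c : O X} (h : a ≤ b) (h₀ : b ≤ c) (h₀₀ : a ≤ c) (x : Yc a) : jm h₀ (jm h x) = jm h₀₀ x := by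
  rcases mk_ex x with ⟨f, rfl⟩; simp only [jm_mk]; rfl
def up (a : O X) (x : X) : Yc a := mk a (cF a x)
theorem jm_up {a c : O X} (h : a ≤ c) (x : X) : jm h (up a x) = up c x := jm_mk h _
def O.mem {c : O X} (h : a ~ c◜) : O X :=
  ⟨a, c◝◜.mem h, by
    have := c◝◝; simp only [mem_suc] at this ⊢
    rcases this with h₀ | h₀
    · exact ◁ ((hD (X := X)).tr h₀ h)
    · exact ◁ (h₀ ▸ h)⟩
theorem O.mem_le (h : a ~ c◜) : O.mem h ≤ c := fun z hz ↦ c◝◜.tr h hz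
theorem jm_lim {c : O X} (hc : IsLimitOrd ∊ c◜) (x : Yc c) : ∃ (a : X) (h : a ~ c◜) (y : Yc (O.mem h)), x = jm (O.mem_le h) y := by
  rcases mk_ex x with ⟨f, rfl⟩
  rcases f◝.sp with ⟨s, h1, h2, h3⟩
  rcases h1.bd hc h2 with ⟨d, hd, h4⟩
  exact ⟨d, hd, mk (O.mem hd) ⟨f◜, Fa.mk f◝◜ h1 h4 h3⟩, (jm_mk (a := O.mem hd) (O.mem_le hd) ⟨f◜, Fa.mk f◝◜ h1 h4 h3⟩).symm⟩
theorem pi0 (h0 : Ok (emp : X)) (x : X) : pi₀ emp (cn x) = x := by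
  refine mind (fun x ↦ pi₀ emp (cn x) = x) (fun x ih ↦ zext fun w ↦ ⬚) x
  rw [mem_pi h0]
  constructor
  · rintro ⟨z, hz, rfl⟩
    rcases hz◜.sp with ⟨s, h1, h2, h3⟩
    rcases ae_ex hz◝◝◜ with ⟨p, hp, hpx⟩
    rw [app_cn hp] at hpx
    have : pi₀ emp z = pi₀ emp (cn (app z p)) := (pi_eq h0 hz◜ FF_const)◝ (ae_true fun q hq ↦ by
      rw [app_lam hq]; exact h3 _ _ hq hp fun x hx ↦ by have := h2 x hx; simp at this)
    rw [this, ih _ hpx]; exact hpx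
  · intro hw
    have := (pi_mem h0 (f := cn w) (g := cn x) FF_const FF_const)◝ (ae_true fun q hq ↦ by rw [app_cn hq, app_cn hq]; exact hw)
    rw [ih w hw] at this; exact (mem_pi h0)◜ this
theorem up0 {a : O X} (h : a◜ = emp) (x : X) : (up a x)◜ = x := by
  rcases a with ⟨a, h0⟩; subst h; exact pi0 h0 x
theorem upU {a : O X} {R : Pd} (h : UD R) (σ : ⊙X) : R (Yc a) (YE a) (fun n ↦ up a (σ n)) ↔ R X ∊ σ := losC h σ
theorem ordY [NA X] (a : O X) (x : X) (hx : Od x) : ∃ y : Yc a, x = y◜ := by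
  have h1 : ∀ x, Od x → Od (up a x)◜ := fun x hx ↦
    (teY a).od◝ ((upU (R := fun X E σ ↦ IsOrd E σ⁰) inferInstance ℸ x)◝ hx)
  have h : ∀ z, z ~ x → z ~ (up a x)◜ := by
    refine oind (fun x ↦ ∀ z, z ~ x → z ~ pi₀ a◜ (cn x)) (fun x hx ih z hz ↦ ⬚) x hx
    have h2 : (up a z)◜ ~ (up a x)◜ := (upU (R := fun X E σ ↦ E σ⁰ σ¹) inferInstance fun n ↦ if n = 0 then z else x)◝ hz
    exact ((hx.mem hz).le_of (h1 z (hx.mem hz)) (ih z hz)).elim (fun h ↦ (h1 x hx).tr h2 h) fun h ↦ h ▸ h2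
  rcases hx.tri (h1 x hx) with h₀ | h₀ | h₀
  · exact ⟨⟨x, cls_tr a◝ (up a x)◝ h₀⟩, rfl⟩
  · exact ⟨up a x, h₀⟩
  · exact absurd (h _ h₀) nm1
end
end
section
structure UR {Y Y₀ : Type} [ZFM Y] [ZFM Y₀] (v : Y) (mu : Y → Prop) (Rp : Y → Y₀ → Prop) (J : Y → Y₀) : Prop where
  tot : ∀ f, Fn f v → ∃ x, Rp f x
  fn : ∀ f x, Rp f x → Fn f v
  sur : ∀ x, ∃ f, Rp f x
  los : ∀ {n} (φ : Fml n) (fs : Fin n → Y) (xs : Fin n → Y₀), (∀ i, Rp (fs i) (xs i)) →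
    (Eval ∊ NoAux AllSets φ xs ↔ mu (sep v fun z ↦ Eval ∊ NoAux AllSets φ fun i ↦ app (fs i) z))
  con : ∀ x, Rp (lam v ℸ x) (J x)
  el : ∀ {R : Pd}, UD R → ∀ σ : ℕ → Y, R Y₀ ∊ (fun n ↦ J (σ n)) ↔ R Y ∊ σ
variable {X : Type} [ZFM X] [UC X] [NA X]
open UC
theorem app_mk {a : O X} {f h : {f // Fa a◜ f}} (hf : Fn (mk a f) (up a v)) (hh : mk a h ~ up a v)
    (H : Fa a◜ (lam B fun p ↦ app (app f◜ p) (app h◜ p))) : app (mk a f) (mk a h) = mk a ⟨_, H⟩ := by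
  refine app_eq hf (pin◜ ((losU (R := fun X E σ ↦ PairIn E σ⁰ σ¹ σ²) inferInstance
    fun n ↦ if n = 0 then f else if n = 1 then h else ⟨_, H⟩)◝ ⬚))
  have h1 : ae fun p ↦ Fn (app f◜ p) v := (ae_congr fun p hp ↦ by simp [cF, app_cn hp, fn_iff])◜ ((losU (R := fun X E σ ↦ IsFuncOn E σ⁰ σ¹) inferInstance
    fun n ↦ if n = 0 then f else cF a v)◜ (fn_iff◝ hf))
  have h2 : ae fun p ↦ app h◜ p ~ v := (ae_congr fun p hp ↦ by simp only [cF, app_cn hp])◜ ((pi_mem a◝ h◝ (cF a v)◝)◜ hh)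
  have := f◝.fst; have := h◝.fst
  have := fsp1 (fun x ↦ Fn x v) (app f◜)
  have i2 := fsp2 (fun x y ↦ pr y (app x y) ~ x) (app f◜) (app h◜)
  refine (ae_congr fun p hp ↦ ⬚)◜ (ae_mono (R := fun p ↦ pr (app h◜ p) (app (app f◜ p) (app h◜ p)) ~ app f◜ p) (fun p hp hh ↦ ⬚) (ae_and◝ ⟨h1, h2⟩))
  · simp only [pin, if_true, if_false, one_ne_zero]
    rw [if_neg (by decide), if_neg (by decide), app_lam hp]
  · rw [hh◜.mem]; exact ⟨hh◝, rfl⟩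
theorem ap2 {a : O X} (f h : {f // Fa a◜ f}) : Fa a◜ (lam B fun p ↦ app (app f◜ p) (app h◜ p)) :=
  Fa.c2 (fun x y ↦ app x y) f◝ h◝
def sc (a : O X) (h : a◜ ~ D) : O X := ⟨suc a◜, a◝◜.sucO, by
  have := (hD (X := X)).suc_le h; rw [mem_suc]; exact this⟩
theorem sc_le {a : O X} (h : a◜ ~ D) : a ≤ sc a h := fun z hz ↦ by simp [sc, hz]
def ev (a : O X) (f : X) : X := lam B fun p ↦ app (app f p) (app p a◜)
theorem ev_F {a : O X} (h : a◜ ~ D) (f : {f // Fa a◜ f}) : Fa (sc a h)◜ (ev a f◜) := by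
  rcases f◝.sp with ⟨s, h1, h2, h3⟩
  refine Fa.mk fn_lam (h1.un (Fi_sing h)) (fun x hx ↦ ⬚) fun p q hp hq ha ↦ ⬚
  · simp [sc] at hx ⊢; exact hx.imp_left (h2 x)
  · unfold ev; rw [app_lam hp, app_lam hq, h3 p q hp hq (ha.mono fun x hx ↦ un_l hx), ha a◜ (by simp)]
def Rp (a : O X) (h : a◜ ~ D) (F : Yc a) (x : Yc (sc a h)) : Prop :=
  Fn F (up a v) ∧ ∃ f, F = mk a f ∧ x = mk _ ⟨_, ev_F h f⟩
theorem stepUR (a : O X) (h : a◜ ~ D) : UR (up a v) (fun S ↦ S ~ up a m) (Rp a h) (jm (sc_le h)) where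
  tot f hf := by rcases mk_ex f with ⟨f, rfl⟩; exact ⟨_, hf, f, rfl, rfl⟩
  fn f x hf := hf◜
  sur x := by
    rcases mk_ex x with ⟨g, rfl⟩
    rcases g◝.sp with ⟨s, h1, h2, h3⟩
    have hf : Fa a◜ (lam B fun p ↦ lam v fun k ↦ app g◜ (upd p a◜ k)) := by
      refine Fa.mk (s := sep s fun x ↦ x ~ a◜) fn_lam (h1.sub fun x hx ↦ (mem_sep◜ hx)◜) (fun x hx ↦ (mem_sep◜ hx)◝) fun p q hp hq ha ↦ ⬚
      rw [app_lam hp, app_lam hq]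
      refine lam_congr fun k hk ↦ h3 _ _ (upd_B hp hk) (upd_B hq hk) fun x hx ↦ ⬚
      have := h2 x hx; simp only [sc, mem_suc] at this
      rcases this with h₀ | rfl
      · have hD := (hD (X := X)).tr h h₀
        have hn : x ≠ a◜ := by rintro rfl; exact nm1 h₀
        rw [upd_ne hD hn, upd_ne hD hn]; exact ha x (mem_sep◝ ⟨hx, h₀⟩)
      · rw [upd_at h, upd_at h]
    refine ⟨mk a ⟨_, hf⟩, ⬚, ⟨_, hf⟩, rfl, mk_eq◝ (ae_true fun p hp ↦ ⬚)⟩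
    · refine fn_iff◜ ((losU (R := fun X E σ ↦ IsFuncOn E σ⁰ σ¹) inferInstance fun n ↦ if n = 0 then ⟨_, hf⟩ else cF a v)◝
        (ae_true fun p hp ↦ ⬚))
      simp only [cF, app_cn hp, fn_iff, if_true, if_false, one_ne_zero, app_lam hp]; exact fn_lam
    · have hk : app p a◜ ~ v := ((mem_fns◜ hp)◝ _ h)
      simp only [ev]
      rw [app_lam hp, app_lam hp, app_lam hk]
      congr 1
      refine B_ext hp (upd_B hp hk) fun x hx ↦ ⬚
      by_cases e : x = a◜
      · subst e; rw [upd_at h]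
      · rw [upd_ne hx e]
  los {n} φ fs xs hr := by
    choose hF f e1 e2 using hr
    obtain rfl : xs = fun i ↦ mk _ ⟨_, ev_F h (f i)⟩ := funext e2
    obtain rfl : fs = fun i ↦ mk a (f i) := funext e1
    rcases spN (fun i ↦ (f i)◜) fun i ↦ (f i)◝ with ⟨s, h1, h2, h3⟩
    have hS : Fa a◜ (lam B fun p ↦ sep v fun k ↦ Eval ∊ NoAux AllSets φ fun i ↦ app (app (f i)◜ p) k) :=
      Fa.mk fn_lam h1 h2 fun p q hp hq ha ↦ by
        rw [app_lam hp, app_lam hq]; simp only [fun i ↦ h3 i p q hp hq ha]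
    have e3 : (sep (up a v) fun z ↦ Eval ∊ NoAux AllSets φ fun i ↦ app (mk a (f i)) z) = mk a ⟨_, hS⟩ := zext fun z ↦ by
      rw [mem_sep]
      rcases mk_ex z with ⟨g, rfl⟩
      have e4 : (mk a g ~ up a v ↔ ae fun p ↦ app g◜ p ~ v) :=
        (pi_mem a◝ g◝ (cF a v)◝).trans (ae_congr fun p hp ↦ by simp only [cF, app_cn hp])
      have e5 : mk a g ~ up a v → ((Eval ∊ NoAux AllSets φ fun i ↦ app (mk a (f i)) (mk a g)) ↔
          ae fun p ↦ Eval ∊ NoAux AllSets φ fun i ↦ app (app (f i)◜ p) (app g◜ p)) := fun hg ↦ by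
        simp only [fun i ↦ app_mk (hF i) hg (ap2 (f i) g)]
        exact (losY φ fun i ↦ ⟨_, ap2 (f i) g⟩).trans (ae_congr fun p hp ↦ by simp only [app_lam hp])
      have := g◝.fst; have := fun i ↦ (f i)◝.fst
      have i1 : FSP fun p ↦ Eval ∊ NoAux AllSets φ fun i ↦ app (app (f i)◜ p) (app g◜ p) :=
        fspN (Eval ∊ NoAux AllSets φ) (fun i p ↦ app (app (f i)◜ p) (app g◜ p)) fun i ↦ inferInstance
      rw [and_congr_right e5, e4, ← ae_and]
      refine Iff.trans ⬚ (pi_mem a◝ g◝ hS).symm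
      exact ae_congr fun p hp ↦ by rw [app_lam hp, mem_sep]
    rw [e3]
    refine ((losY φ _).trans ⬚).trans (pi_mem a◝ hS (cF a m)◝).symm
    refine (ae_congr (R := fun p ↦ Eval ∊ NoAux AllSets φ fun i ↦ app (app (f i)◜ p) (app p a◜)) fun p hp ↦ by
      simp only [ev, app_lam hp]).trans ((ae_one (s := un s (upr a◜ a◜)) h (fun x hx ↦ ⬚) fun p q hp hq ha ↦ ⬚).trans (ae_congr fun p hp ↦ ⬚))
    · simp at hx ⊢; exact hx.imp_left (h2 x)
    · simp only [ha a◜ (by simp), fun i ↦ h3 i p q hp hq (ha.mono fun x hx ↦ un_l hx)]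
    · rw [app_lam hp]; simp only [cF, app_cn hp]
      refine me_congr fun k hk ↦ ⬚
      simp only [upd_at h, fun i ↦ h3 i _ _ (upd_B hp hk) hp fun x hx ↦ upd_ne ((hD (X := X)).tr h (h2 x hx)) (by rintro rfl; exact nm1 (h2 _ hx))]
  el hR σ := jmU (sc_le h) hR σ
  con x := by
    rcases mk_ex x with ⟨g, rfl⟩
    have hf : Fa a◜ (lam B fun p ↦ lam v ℸ app g◜ p) := Fa.c2 (fun x _ ↦ lam v ℸ x) g◝ g◝
    refine ⟨fn_lam, ⟨_, hf⟩, ⬚, ⬚⟩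
    · have := (losU (a := a) (R := fun X E σ ↦ ∀ p, E p σ⁰ ↔ ∃ k, E k σ¹ ∧ IsKPair E p k σ²) inferInstance
        fun n ↦ if n = 0 then ⟨_, hf⟩ else if n = 1 then cF a v else g)◝ (ae_true fun p hp ↦ by
          simp only [cF, app_cn hp, if_true, if_false, one_ne_zero, app_lam hp, kp, mem_lam]
          simp)
      refine zext fun p ↦ (mem_lam.trans ⬚).trans (this p).symm
      exact exists_congr fun k ↦ and_congr_right ℸ kp.symm
    · rw [jm_mk]; refine mk_eq◝ (ae_true fun p hp ↦ ⬚)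
      have hk : app p a◜ ~ v := ((mem_fns◜ hp)◝ _ h)
      simp only [ev, jF]; rw [app_lam hp, app_lam hp, app_lam hk]
end
section
def LHd (X : Type) (E : X → X → Prop) (v m w : X) : Prop :=
  TransSet E v ∧ (∀ x, SubsetE E x v → InL E v x) ∧ E v m ∧ (∀ x, E x m → SubsetE E x v) ∧
  (∀ a b c, E a m → E b m → SubsetE E c v → (∀ z, E z a → E z b → E z c) → E c m) ∧
  (∀ f, IsFuncOn E f v → (∀ x y, PairIn E f x y → InL E v y) → ∃ g, InL E v g ∧ IsFuncOn E g v ∧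
    ∃ s, E s m ∧ ∀ z, E z s → ∃ y, PairIn E f z y ∧ PairIn E g z y) ∧
  IsV2L E v w ∧ InL E v w ∧
  ∃ b r, TransSet E b ∧ (∀ x, InL E b x ↔ InL E v x) ∧
    (∀ f x, PairIn E r f x → MapsTo E f v b) ∧
    (∀ f, MapsTo E f v b → ∃ x, E x b ∧ PairIn E r f x) ∧ (∀ x, E x b → ∃ f, PairIn E r f x) ∧
    ∀ f g x y, PairIn E r f x → PairIn E r g y →
      (E x y ↔ ∃ s, E s m ∧ ∀ k, E k s → ∃ u u₀, PairIn E f k u ∧ PairIn E g k u₀ ∧ E u u₀)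
instance (i j k : ℕ) : UD fun X E σ ↦ LHd X E (σ i) (σ j) (σ k) := by unfold LHd IsV2L; infer_instance
variable {Y Y₀ : Type} [ZFM Y] [ZFM Y₀] {v m w f g : Y} {x y : Y₀}
abbrev LL (v : Y) := {x // InL ∊ v x}
instance (v : Y) : ZFM (LL v) := ⟨fun x y ↦ x◜ ~ y◜, NoAux, (L_jc v).zf⟩
instance (v : Y) : NA (LL v) := ⟨ZFM.sat⟩
theorem teL (v : Y) : TE fun x : LL v ↦ x◜ := ⟨Iff.rfl, fun {_ b} h ↦ ⟨⟨_, L_tr b◝ h⟩, rfl⟩⟩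
def vL (v : Y) : LL v := ⟨v, L_self v⟩
theorem evL (φ : Fml n) (x : Fin n → LL v) :
    Eval ∊ NoAux AllSets φ x ↔ Eval ∊ NoAux (InL ∊ v) φ fun i ↦ (x i)◜ := (eval_sub ∊ NoAux _ φ x).symm
abbrev LH (v m w : Y) := LHd Y ∊ v m w
theorem LHd.mo (h : LH v m w) [DF fun σ ↦ P σ⁰] [DF fun σ ↦ Q σ⁰] [DF fun σ ↦ R σ⁰]
    (h1 : sep v P ~ m) (h2 : sep v Q ~ m) (h3 : ∀ z, z ~ v → P z → Q z → R z) : sep v R ~ m :=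
  h◝◝◝◝◜ _ _ _ h1 h2 (fun z hz ↦ (mem_sep◜ hz)◜) fun z hz hz₀ ↦
    mem_sep◝ ⟨(mem_sep◜ hz)◜, h3 _ (mem_sep◜ hz)◜ (mem_sep◜ hz)◝ (mem_sep◜ hz₀)◝⟩
theorem LHd.fu (h : LH v m w) [DF fun σ ↦ R σ⁰] (h3 : ∀ z, z ~ v → R z) : sep v R ~ m :=
  h◝◝◝◝◜ _ _ _ h◝◝◜ h◝◝◜ (fun z hz ↦ (mem_sep◜ hz)◜) fun z hz hz₀ ↦ mem_sep◝ ⟨hz, h3 z hz⟩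
theorem LHd.tg (h : LH v m w) (hf : Fn f v) (hl : ∀ x, x ~ v → InL ∊ v (app f x)) :
    ∃ g, InL ∊ v g ∧ Fn g v ∧ sep v (fun z ↦ app f z = app g z) ~ m := by
  obtain ⟨g, h1, h2, s, h3, h4⟩ := h◝◝◝◝◝◜ f (fn_iff◝ hf) fun x y hp ↦ by
    rw [pin, hf.mem] at hp; rw [hp◝]; exact hl x hp◜
  rw [fn_iff] at h2
  refine ⟨g, h1, h2, h◝◝◝◝◜ _ _ _ h3 h3 (fun z hz ↦ (mem_sep◜ hz)◜) fun z hz _ ↦ ⬚⟩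
  rcases h4 z hz with ⟨y, h5, h6⟩
  rw [pin, hf.mem] at h5; rw [pin, h2.mem] at h6
  exact mem_sep◝ ⟨h5◜, h5◝ ▸ h6◝⟩
variable {v m w : Y} {Rp : Y → Y₀ → Prop} {J : Y → Y₀}
theorem UR.ud (h : UR v (· ~ m) Rp J) (hR : UD R) (fs : ℕ → Y) (xs : ℕ → Y₀) (hr : ∀ n, Rp (fs n) (xs n)) :
    R Y₀ ∊ xs ↔ sep v (fun z ↦ R Y ∊ fun n ↦ app (fs n) z) ~ m := by
  rcases hR with ⟨k, f, c, e⟩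
  simp only [e]; exact h.los f _ _ fun i ↦ hr (c i)
theorem UR.mem (h : UR v (· ~ m) Rp J) (h1 : Rp f x) (h2 : Rp g y) :
    x ~ y ↔ sep v (fun z ↦ app f z ~ app g z) ~ m :=
  h.ud (R := fun X E σ ↦ E σ⁰ σ¹) inferInstance (fun n ↦ if n = 0 then f else g) (fun n ↦ if n = 0 then x else y)
    fun n ↦ by by_cases e : n = 0 <;> simpa [e]
theorem UR.eq (h : UR v (· ~ m) Rp J) (h1 : Rp f x) (h2 : Rp g y) :
    x = y ↔ sep v (fun z ↦ app f z = app g z) ~ m :=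
  h.ud (R := fun X E σ ↦ σ 0 = σ 1) inferInstance (fun n ↦ if n = 0 then f else g) (fun n ↦ if n = 0 then x else y)
    fun n ↦ by by_cases e : n = 0 <;> simpa [e]
theorem UR.fx (h : UR v (· ~ m) Rp J) (h1 : Rp f x) (hg : Fn g v)
    (e : sep v (fun z ↦ app f z = app g z) ~ m) : Rp g x := by
  rcases h.tot g hg with ⟨y, hy⟩
  rwa [(h.eq h1 hy)◝ e]
theorem UR.mJ (h : UR v (· ~ m) Rp J) {y : Y} (h1 : Rp f x) :
    x ~ J y ↔ sep v (fun z ↦ app f z ~ y) ~ m :=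
  (h.mem h1 (h.con y)).trans (by rw [sep_congr fun z hz ↦ by rw [app_lam hz]])
theorem UR.lJ (h : UR v (· ~ m) Rp J) (h1 : Rp f x) :
    InL ∊ (J v) x ↔ sep v (fun z ↦ InL ∊ v (app f z)) ~ m :=
  (h.ud (R := fun X E σ ↦ InL E σ⁰ σ¹) inferInstance (fun n ↦ if n = 0 then lam v ℸ v else f)
    (fun n ↦ if n = 0 then J v else x) fun n ↦ by by_cases e : n = 0 <;> simp [e, h1, h.con v]).trans
    (by rw [sep_congr (R := fun z ↦ InL ∊ v (app f z)) fun z hz ↦ by simp only [if_true, one_ne_zero, if_false, app_lam hz]])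
theorem UR.Jin (h : UR v (· ~ m) Rp J) (x : LL v) : InL ∊ (J v) (J x◜) :=
  (h.el (R := fun X E σ ↦ InL E σ⁰ σ¹) inferInstance fun n ↦ if n = 0 then v else x◜)◝ x◝
theorem udL (φ : Fml n) : UD fun X E σ ↦ Eval E NoAux (InL E (σ n)) φ fun i ↦ σ i :=
  UD.evalC φ (fun X E σ ↦ InL E (σ n)) (inferInstanceAs (UD fun X E σ ↦ InL E (σ (n+1)) σ⁰)) _
theorem tup_n (x : Fin n → Y) (σ : ℕ → Y) : tup n x σ n = σ 0 := tup_ge n x σ 0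
theorem UR.L (h : UR v (· ~ m) Rp J) (hl : LH v m w) :
    UR (vL v) (fun S ↦ S◜ ~ m) (fun f (x : LL (J v)) ↦ Rp f◜ x◜) (fun x ↦ ⟨J x◜, h.Jin x⟩) where
  tot f hf := by
    have hf₀ := (teL v).fn◝ hf
    rcases h.tot f◜ hf₀ with ⟨x, hx⟩
    refine ⟨⟨x, (h.lJ hx)◝ (hl.fu fun z hz ↦ ⬚)⟩, hx⟩
    rcases (teL v).tr (b := vL v) hz with ⟨z, rfl⟩
    have := (teL v).app hf hz
    rw [← this]; exact Subtype.prop _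
  fn f x hx := (teL v).fn◜ (h.fn _ _ hx)
  sur x := by
    rcases h.sur x◜ with ⟨f, hf⟩
    have hx := (h.lJ hf)◜ x◝
    obtain ⟨g, h1, h2, h3⟩ := hl.tg (f := lam v fun z ↦ ite₀ (InL ∊ v (app f z)) (app f z) v) fn_lam fun z hz ↦ by
      rw [app_lam hz]
      by_cases e : InL ∊ v (app f z)
      · rwa [ite_pos e]
      · rw [ite_neg e]; exact L_self v
    refine ⟨⟨g, h1⟩, h.fx hf h2 (hl.mo hx h3 fun z hz a b ↦ ⬚)⟩
    rw [← b, app_lam hz, ite_pos a]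
  los {n} φ fs xs hr := by
    rw [evL]
    have e := h.ud (udL φ) (tup n (fun i ↦ (fs i)◜) ℸ lam v ℸ v) (tup n (fun i ↦ (xs i)◜) ℸ J v) fun k ↦ by
      rcases Nat.lt_or_ge k n with hk | hk
      · have := hr ⟨k, hk⟩; rwa [← tup_lt n (fun i ↦ (fs i)◜) (ℸ lam v ℸ v) ⟨k, hk⟩, ← tup_lt n (fun i ↦ (xs i)◜) (ℸ J v) ⟨k, hk⟩] at this
      · rcases Nat.exists_eq_add_of_le hk with ⟨k, rfl⟩; rw [tup_ge, tup_ge]; exact h.con v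
    simp only [tup_lt, tup_n] at e
    rw [e]
    have e2 : (sep (vL v) fun z ↦ Eval ∊ NoAux AllSets φ fun i ↦ app (fs i) z)◜ =
        sep v fun z ↦ Eval ∊ NoAux (InL ∊ (app (lam v ℸ v) z)) φ fun i ↦ app (fs i)◜ z := by
      have hd : DF fun σ : ℕ → Y ↦ Eval ∊ NoAux (InL ∊ (app (lam v ℸ v) σ⁰)) φ fun i ↦ app (fs i)◜ σ⁰ :=
        dfEval φ (fun σ ↦ InL ∊ (app (lam v ℸ v) σ⁰)) inferInstance (fun i σ ↦ app (fs i)◜ σ⁰) inferInstance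
      have e3 : ∀ z : LL v, z ~ vL v → ((Eval ∊ NoAux AllSets φ fun i ↦ app (fs i) z) ↔
          Eval ∊ NoAux (InL ∊ (app (lam v ℸ v) z◜)) φ fun i ↦ app (fs i)◜ z◜) := fun z hz ↦ by
        have hz₀ : z◜ ~ v := hz
        rw [evL, app_lam hz₀]; simp only [fun i ↦ (teL v).app ((teL v).fn◜ (h.fn _ _ (hr i)) : Fn (fs i) (vL v)) hz]
      refine (teL v).eq (fun z hz ↦ ⬚) fun z hz ↦ ⬚
      · rw [mem_sep] at hz ⊢; exact ⟨hz◜, (e3 z hz◜)◜ hz◝⟩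
      · rw [mem_sep] at hz
        exact ⟨⟨z, L_tr (L_self v) hz◜⟩, rfl, mem_sep◝ ⟨hz◜, (e3 ⟨z, L_tr (L_self v) hz◜⟩ hz◜)◝ hz◝⟩⟩
    rw [e2]
  con x := by
    have : (lam (vL v) ℸ x)◜ = lam v ℸ x◜ := by
      refine (teL v).eq (fun z hz ↦ ⬚) fun z hz ↦ ⬚
      · rcases mem_lam◜ hz with ⟨k, hk, rfl⟩
        exact mem_lam◝ ⟨k◜, hk, (teL v).pr⟩
      · rcases mem_lam◜ hz with ⟨k, hk, rfl⟩
        exact ⟨pr ⟨k, L_tr (L_self v) hk⟩ x, ((teL v).pr (x := ⟨k, L_tr (L_self v) hk⟩)).symm, mem_lam◝ ⟨_, hk, rfl⟩⟩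
    show Rp (lam (vL v) ℸ x)◜ (J x◜)
    rw [this]; exact h.con x◜
  el {R} hR σ := by
    rcases hR with ⟨k, f, c, e⟩
    refine (e _ _ _).trans (Iff.trans ⬚ (e _ _ _).symm)
    rw [evL, evL]
    have := h.el (udL f) (tup k (fun i ↦ (σ (c i))◜) ℸ v)
    simp only [tup_lt, tup_n] at this; exact this
def MS (v m w : Y) (J : Y → Y₀) (S : Y₀) : Prop := ∃ pi, InL ∊ v pi ∧ MapsTo ∊ pi v w ∧ ∃ x, InL ∊ v x ∧
  (∀ z, z ~ x ↔ z ~ m ∧ ∃ k, PairIn ∊ pi k z) ∧ S ~ J x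
theorem MS.sub (el : ∀ {R : Pd}, UD R → ∀ σ : ℕ → Y, R Y₀ ∊ (fun n ↦ J (σ n)) ↔ R Y ∊ σ) (h : MS v m w J S) : S ~ J m := by
  rcases h with ⟨_, _, _, x, _, h1, h2⟩
  exact (el (R := fun X E σ ↦ SubsetE E σ⁰ σ¹) inferInstance fun n ↦ if n = 0 then x else m)◝ (fun z hz ↦ ((h1 z)◜ hz)◜) _ h2
theorem MS.amen (hl : LH v m w) {f : LL v} (hf : Fn f (vL v)) (hw : ∀ z, z ~ vL v → app f◜ z◜ ~ w) : ∃ x, InL ∊ v x ∧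
    (∀ z, z ~ x ↔ z ~ m ∧ ∃ k, k ~ v ∧ z = app f◜ k) ∧ ∀ S : Y₀, S ~ J x → MS v m w J S := by
  have hf₀ := (teL v).fn◝ hf
  have hb := hl◝◜ (sep v fun z ↦ app f◜ z ~ m) fun z hz ↦ (mem_sep◜ hz)◜
  have key : ∀ z, z ~ (img (⟨_, hb⟩ : LL v) fun k ↦ app f k)◜ ↔ z ~ m ∧ ∃ k, k ~ v ∧ z = app f◜ k := fun z ↦ by
    constructor
    · intro hz
      rcases (teL v).tr hz with ⟨z, rfl⟩
      have hz : z ~ img (⟨_, hb⟩ : LL v) fun k ↦ app f k := hz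
      rcases mem_img◜ hz with ⟨k, hk, rfl⟩
      have hk := mem_sep◜ hk
      have e := (teL v).app hf (x := k) hk◜
      exact ⟨by rw [e]; exact hk◝, k◜, hk◜, e⟩
    · rintro ⟨hz, k, hk, rfl⟩
      have e := (teL v).app hf (x := ⟨k, L_tr (L_self v) hk⟩) hk
      have : app f ⟨k, L_tr (L_self v) hk⟩ ~ img (⟨_, hb⟩ : LL v) fun k ↦ app f k := mem_img◝ ⟨_, mem_sep◝ ⟨hk, hz⟩, rfl⟩
      rw [← e]; exact this
  refine ⟨_, Subtype.prop _, key, fun S hS ↦ ⟨f◜, f◝, ⟨fn_iff◝ hf₀, fun x y hp ↦ ⬚⟩, _, Subtype.prop _, fun z ↦ (key z).trans ⬚, hS⟩⟩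
  · rw [pin, hf₀.mem] at hp; rw [hp◝]; exact hw ⟨x, L_tr (L_self v) hp◜⟩ hp◜
  · simp only [pin, hf₀.mem]; exact Iff.rfl
instance [ZFM X] : F2 X (SubsetE ∊) := fi2 (SubsetE ∊) (by unfold SubsetE; infer_instance)
theorem UR.ms (h : UR v (· ~ m) Rp J) (hl : LH v m w) (S : Y₀) : S ~ J m ↔ MS v m w J S := by
  refine ⟨fun hS ↦ ⬚, MS.sub h.el⟩
  rcases h.sur S with ⟨f, hf⟩
  rw [h.mJ hf] at hS
  obtain ⟨g, h1, h2, h3⟩ := hl.tg (f := lam v fun z ↦ ite₀ (app f z ~ m) (app f z) v) fn_lam fun z hz ↦ by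
    rw [app_lam hz]
    by_cases e : app f z ~ m
    · rw [ite_pos e]; exact hl◝◜ _ (hl◝◝◝◜ _ e)
    · rw [ite_neg e]; exact L_self v
  have h2₀ : Fn (⟨g, h1⟩ : LL v) (vL v) := (teL v).fn◜ h2
  obtain ⟨G, hG⟩ : ∃ G : LL v, G = lam (vL v) fun z ↦ ite₀ (SubsetE ∊ (app ⟨g, h1⟩ z) (vL v)) (app ⟨g, h1⟩ z) (vL v) := ⟨_, rfl⟩
  have hGf : Fn G (vL v) := by rw [hG]; exact fn_lam
  have hGv : ∀ z : LL v, z ~ vL v → SubsetE ∊ (app G z) (vL v) ∧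
      (SubsetE ∊ (app ⟨g, h1⟩ z) (vL v) → app G z = app ⟨g, h1⟩ z) := fun z hz ↦ by
    rw [hG, app_lam hz]
    by_cases e : SubsetE ∊ (app ⟨g, h1⟩ z) (vL v)
    · rw [ite_pos e]; exact ⟨e, ℸ rfl⟩
    · rw [ite_neg e]; exact ⟨fun _ h ↦ h, fun h ↦ absurd h e⟩
  obtain ⟨x, hx, h4, h5⟩ := MS.amen (J := J) hl hGf fun z hz ↦ by
    rw [← (teL v).app hGf hz]
    exact (hl◝◝◝◝◝◝◜ _)◝ ⟨Subtype.prop _, (teL v).sub◝ (hGv z hz)◜⟩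
  have h6 : sep v (fun z ↦ app f z = app G◜ z ∧ app G◜ z ~ m) ~ m := hl.mo hS h3 fun z hz a b ↦ by
    rw [app_lam hz, ite_pos a] at b
    have hz₀ : (⟨z, L_tr (L_self v) hz⟩ : LL v) ~ vL v := hz
    have e1 := (teL v).app h2₀ hz₀
    have e2 := (teL v).app hGf hz₀
    have e3 := (hGv _ hz₀)◝ ((teL v).sub◜ (by rw [e1]; show SubsetE ∊ (app g z) v; rw [← b]; exact hl◝◝◝◜ _ a))
    rw [e3, e1] at e2
    rw [← e2]; show app f z = app g z ∧ app g z ~ m; rw [← b]; exact ⟨rfl, a⟩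
  have h7 := h.fx hf ((teL v).fn◝ hGf) (hl.mo h6 h6 fun z _ a _ ↦ a◜)
  exact h5 S ((h.mJ h7)◝ (hl.mo h6 h6 fun z hz a _ ↦ (h4 _)◝ ⟨a◝, z, hz, rfl⟩))
theorem MS.lim (el : ∀ {R : Pd}, UD R → ∀ σ : ℕ → Y, R Y₀ ∊ (fun n ↦ J (σ n)) ↔ R Y ∊ σ) (hl : LH v m w) {y : Y}
    (hy : y ~ m) (hn : ∃ k, k ~ v) : MS v m w J (J y) := by
  have hs := hl◝◝◝◜ y hy
  have hyL := hl◝◜ y hs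
  have hf : Fn (lam (vL v) ℸ (⟨y, hyL⟩ : LL v)) (vL v) := fn_lam
  have e : ∀ z, z ~ vL v → y = app (lam (vL v) ℸ (⟨y, hyL⟩ : LL v))◜ z◜ := fun z hz ↦ by
    rw [← (teL v).app hf hz, app_lam hz]
  obtain ⟨x, hx, h4, h5⟩ := MS.amen (J := J) hl hf fun z hz ↦ by
    rw [← e z hz]; exact (hl◝◝◝◝◝◝◜ _)◝ ⟨hyL, hs⟩
  refine h5 _ ((el (R := fun X E σ ↦ E σ⁰ σ¹) inferInstance fun n ↦ if n = 0 then y else x)◝ ((h4 y)◝ ⟨hy, ⬚⟩))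
  exact hn.elim fun k hk ↦ ⟨k, hk, e ⟨k, L_tr (L_self v) hk⟩ hk⟩
end
section
section
variable {X Y Y₀ : Type} [ZFM X] [ZFM Y] [ZFM Y₀] {v m w : Y} {Rp : Y → Y₀ → Prop} {J : Y → Y₀} {i : Y → X} {i₀ : Y₀ → X}
theorem UR.ne (h : UR v (· ~ m) Rp J) [DF fun σ ↦ Q σ⁰] (hq : sep v Q ~ m) : ∃ k, Q k := by
  by_contra hn
  rcases h.sur (J v) with ⟨f, hf⟩
  have := (h.mem hf hf)◝ (by rwa [sep_congr (R := Q) fun z hz ↦ ⟨fun h ↦ absurd h nm1, fun h ↦ absurd ⟨z, h⟩ hn⟩])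
  exact nm1 this
theorem UR.fix (h : UR v (· ~ m) Rp J) (hl : LH v m w) (hi : TE i) (hi₀ : TE i₀) (Q : X → X → Prop) [DF fun σ ↦ Q σ⁰ σ¹]
    (hQ : ∀ F y, Q (i F) (i₀ y) ↔ Rp F y) (hQi : ∀ F y, Q F y → ∃ z, y = i₀ z) (ho : ∀ a, Od a → ∃ c, a = i c) (ho₀ : ∀ a, Od a → ∃ c, a = i₀ c) (x : X) :
    InL ∊ (i v) x ↔ InL ∊ (i₀ (J v)) x := by
  have l2 := hl
  rcases l2 with ⟨hvt, _, _, hms, _, _, _, _, b, r, hb, hbL, r1, r2, r3, r4⟩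
  simp only [pin] at r1 r2 r3 r4
  have r4₀ : ∀ {f g x y}, pr f x ~ r → pr g y ~ r → (x ~ y ↔ sep v (fun z ↦ app f z ~ app g z) ~ m) := fun {f g x y} hf hg ↦ by
    have Hf := (r1 _ _ hf)◜; have Hg := (r1 _ _ hg)◜
    rw [fn_iff] at Hf Hg
    rw [r4 f g x y hf hg]
    constructor
    · rintro ⟨s, hs, hk⟩
      refine hl◝◝◝◝◜ _ _ _ hs hs (fun z hz ↦ (mem_sep◜ hz)◜) fun z hz _ ↦ ⬚
      rcases hk z hz with ⟨u, u₀, h1, h2, h3⟩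
      rw [Hf.mem] at h1; rw [Hg.mem] at h2
      exact mem_sep◝ ⟨h1◜, h1◝ ▸ h2◝ ▸ h3⟩
    · intro hs
      refine ⟨_, hs, fun k hk ↦ ⬚⟩
      rcases mem_sep◜ hk with ⟨h1, h2⟩
      exact ⟨_, _, Hf.mem◝ ⟨h1, rfl⟩, Hg.mem◝ ⟨h1, rfl⟩, h2⟩
  have mp : ∀ {f}, MapsTo ∊ f v b → Fn f v ∧ ∀ k, k ~ v → app f k ~ b := fun {f} hf ↦ by
    have := fn_iff◜ hf◜
    exact ⟨this, fun k hk ↦ hf◝ k _ (pin◝ (this.mem◝ ⟨hk, rfl⟩))⟩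
  have mp₀ : ∀ {f}, Fn f v → (∀ k, k ~ v → app f k ~ b) → MapsTo ∊ f v b := fun {f} hf h ↦ ⟨fn_iff◝ hf, fun k y hp ↦ by
    rw [pin, hf.mem] at hp; rw [hp◝]; exact h k hp◜⟩
  have cor : ∀ {G x u}, Rp G x → u ~ b → sep v (fun z ↦ app G z ~ b) ~ m → ∃ G₀, Rp G₀ x ∧ MapsTo ∊ G₀ v b ∧
      sep v (fun z ↦ app G z = app G₀ z) ~ m := fun {G x u} hG hu hs ↦ by
    have e : ∀ k, k ~ v → app G k ~ b → app G k = app (lam v fun k ↦ ite₀ (app G k ~ b) (app G k) u) k := fun k hk h ↦ by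
      rw [app_lam hk, ite_pos h]
    have hs2 := hl.mo (R := fun z ↦ app G z = app (lam v fun k ↦ ite₀ (app G k ~ b) (app G k) u) z) hs hs fun k hk h _ ↦ e k hk h
    refine ⟨_, h.fx hG fn_lam hs2, mp₀ fn_lam fun k hk ↦ ⬚, hs2⟩
    by_cases h₀ : app G k ~ b
    · rwa [← e k hk h₀]
    · rwa [app_lam hk, ite_neg h₀]
  have := fun s t [DT s] [DT t] ↦ df2 Q s t
  have key := mind (fun w ↦ w ~ i b → ∀ F y, pr F w ~ i r → Q F y → y = w) fun w ih hw F y hF hQy ↦ by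
    rcases hi.prtr hF with ⟨F, w, rfl, rfl, hF₀⟩
    rcases hQi _ _ hQy with ⟨y, rfl⟩
    rw [hQ] at hQy
    rw [hi.mem] at hw
    have hFm := mp (r1 _ _ hF₀)
    refine zext fun z ↦ ⟨fun hz ↦ ⬚, fun hz ↦ ⬚⟩
    · rcases hi₀.tr hz with ⟨z, rfl⟩
      rw [hi₀.mem] at hz
      rcases h.sur z with ⟨G, hG⟩
      have h1 := (h.mem hG hQy)◜ hz
      rcases cor hG hw (hl.mo h1 h1 fun k hk a _ ↦ hb _ (hFm◝ k hk) _ a) with ⟨G₀, h2, h3, h4⟩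
      rcases r2 _ h3 with ⟨x, hx, hx₀⟩
      have hxw : x ~ w := (r4₀ hx₀ hF₀)◝ (hl.mo h1 h4 fun k hk a e ↦ e ▸ a)
      rw [ih (i x) (hi.mem◝ hxw) (hi.mem◝ hx) _ _ (hi.prin◝ hx₀) ((hQ _ _)◝ h2)]
      exact hi.mem◝ hxw
    · rcases hi.tr hz with ⟨z, rfl⟩
      have hz₀ := hi.mem◜ hz
      rcases r3 z (hb _ hw _ hz₀) with ⟨G, hG⟩
      rcases h.tot G (mp (r1 _ _ hG))◜ with ⟨u, hu⟩
      have e := ih (i z) hz (hi.mem◝ (hb _ hw _ hz₀)) _ _ (hi.prin◝ hG) ((hQ _ _)◝ hu)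
      rw [← e, hi₀.mem, h.mem hu hQy]; exact (r4₀ hG hF₀)◜ hz₀
  have eb : i b = i₀ (J b) := zext fun z ↦ by
    constructor
    · intro hz
      rcases hi.tr hz with ⟨z, rfl⟩
      rcases r3 z (hi.mem◜ hz) with ⟨G, hG⟩
      have hm := mp (r1 _ _ hG)
      rcases h.tot G hm◜ with ⟨u, hu⟩
      rw [← key (i z) hz _ _ (hi.prin◝ hG) ((hQ _ _)◝ hu), hi₀.mem, h.mJ hu]
      exact hl.fu hm◝
    · intro hz
      rcases hi₀.tr hz with ⟨z, rfl⟩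
      rcases h.sur z with ⟨G, hG⟩
      have h1 := (h.mJ hG)◜ (hi₀.mem◜ hz)
      rcases h.ne h1 with ⟨k, hk⟩
      rcases cor hG hk h1 with ⟨G₀, h2, h3, h4⟩
      rcases r2 _ h3 with ⟨x, hx, hx₀⟩
      rw [key (i x) (hi.mem◝ hx) _ _ (hi.prin◝ hx₀) ((hQ _ _)◝ h2)]; exact hi.mem◝ hx
  have hb₀ : TransSet ∊ (J b) := (h.el (R := fun X E σ ↦ TransSet E σ⁰) inferInstance ℸ b)◝ hb
  have hv₀ : TransSet ∊ (J v) := (h.el (R := fun X E σ ↦ TransSet E σ⁰) inferInstance ℸ v)◝ hvt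
  have hbL₀ : ∀ x, InL ∊ (J b) x ↔ InL ∊ (J v) x :=
    (h.el (R := fun X E σ ↦ ∀ x, InL E σ⁰ x ↔ InL E σ¹ x) inferInstance fun n ↦ if n = 0 then b else v)◝ hbL
  rw [hi.inL ho hvt, hi₀.inL ho₀ hv₀]
  simp only [← hbL, ← hbL₀]
  rw [← hi.inL ho hb, ← hi₀.inL ho₀ hb₀, eb]
end
section
variable {X : Type} [ZFM X] [UC X] [NA X] {w : X}
open UC
theorem upLH (hl : LH v m w) (a : O X) : LH (up a v) (up a m) (up a w) :=
  (upU (R := fun X E σ ↦ LHd X E σ⁰ σ¹ σ²) inferInstance fun n ↦ if n = 0 then v else if n = 1 then m else w)◝ hl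
theorem fixY (hl : LH v m w) (a : O X) (h : a◜ ~ D) (x : X) :
    InL ∊ (up a v)◜ x ↔ InL ∊ (up (sc a h) v)◜ x := by
  have := (stepUR a h).fix (upLH hl a) (teY a) (teY (sc a h))
    (fun F y ↦ Fn F (up a v)◜ ∧ ∃ f, Fa a◜ f ∧ F = pi₀ a◜ f ∧ y = pi₀ (suc a◜) (lam B fun p ↦ app (app f p) (app p a◜)))
    (fun F y ↦ and_congr (teY a).fn ⟨fun ⟨f, h1, h2, h3⟩ ↦ ⟨⟨f, h1⟩, Subtype.ext h2, Subtype.ext h3⟩, fun ⟨f, h2, h3⟩ ↦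
      ⟨f◜, f◝, congrArg _ h2, congrArg _ h3⟩⟩) (fun F y ⟨_, f, h1, h2, h3⟩ ↦ ⟨mk _ ⟨_, ev_F h ⟨f, h1⟩⟩, h3⟩) (ordY a) (ordY _) x
  rwa [jm_up] at this
end
end
section
section
variable {M Y Y₀ : Type} [ZFM M] [ZFM Y] [ZFM Y₀] {k : Y → M} {k₀ : Y₀ → M} {C D : M → Prop}
theorem TE.comp {X : Type} [ZFM X] {i : X → M} {k : Y → X} (hi : TE i) (hk : TE k) : TE fun y ↦ i (k y) :=
  ⟨hi.mem.trans hk.mem, fun h ↦ by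
    rcases hi.tr h with ⟨y, rfl⟩
    rcases hk.tr (hi.mem◜ h) with ⟨z, rfl⟩; exact ⟨z, rfl⟩⟩
theorem TE.evr (h : TE k) (hC : ∀ x, C x ↔ ∃ y, x = k y) (φ : Fml n) (v : Fin n → Y) :
    Eval ∊ NoAux C φ (fun j ↦ k (v j)) ↔ Eval ∊ NoAux AllSets φ v := by
  rw [h.ev φ (C := C) (fun x hx ↦ (hC x)◜ hx) v, show (fun y ↦ C (k y)) = AllSets from funext fun y ↦ propext ⟨ℸ trivial, ℸ (hC _)◝ ⟨y, rfl⟩⟩]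
theorem TE.elem (h : TE k) (h₀ : TE k₀) (hC : ∀ x, C x ↔ ∃ y, x = k y) (hD : ∀ x, D x ↔ ∃ y, x = k₀ y) {J : Y → Y₀}
    (el : ∀ {R : Pd}, UD R → ∀ σ : ℕ → Y, R Y₀ ∊ (fun n ↦ J (σ n)) ↔ R Y ∊ σ) {j : M → M → Prop}
    (hj : ∀ x y, j x y ↔ ∃ z, x = k z ∧ y = k₀ (J z)) : ElemBetween ∊ C D j := by
  simp only [ElemBetween, hj]
  refine ⟨fun x hx ↦ ⬚, ⬚, ⬚, ⬚⟩
  · rcases (hC x)◜ hx with ⟨y, rfl⟩; exact ⟨_, y, rfl, rfl⟩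
  · rintro x y ⟨z, rfl, rfl⟩; exact ⟨(hC _)◝ ⟨_, rfl⟩, (hD _)◝ ⟨_, rfl⟩⟩
  · rintro x y y₀ ⟨z, rfl, rfl⟩ ⟨z₀, e, rfl⟩; rw [h.inj◜ e]
  · intro n f v w hvw
    choose z h1 h2 using hvw
    obtain rfl : v = fun i ↦ k (z i) := funext h1
    obtain rfl : w = fun i ↦ k₀ (J (z i)) := funext h2
    rw [h.evr hC, h₀.evr hD f fun i ↦ J (z i)]
    have := el (R := fun X E σ ↦ Eval E NoAux AllSets f fun i ↦ σ i) ⟨_, f, fun i ↦ i, fun _ _ _ ↦ Iff.rfl⟩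
      fun j ↦ if h : j < n then z ⟨j, h⟩ else ZFI0.emp
    simpa using this.symm
theorem UR.ult {v : Y} {mu : Y → Prop} {Rp : Y → Y₀ → Prop} {J : Y → Y₀} (h : UR v mu Rp J) (hk : TE k) (hk₀ : TE k₀)
    (hC : ∀ x, C x ↔ ∃ y, x = k y) (hD : ∀ x, D x ↔ ∃ y, x = k₀ y) {mu₀ : M → Prop} (hm : ∀ S, mu₀ S ↔ ∃ s, mu s ∧ S = k s)
    {j : M → M → Prop} (hj : ∀ x y, j x y ↔ ∃ z, x = k z ∧ y = k₀ (J z)) : IsUltPowMapB ∊ C D (k v) mu₀ j := by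
  have fin : ∀ {f}, Fn f v → FnInto ∊ C (k v) (k f) := fun {f} hf ↦ ⟨(hC _)◝ ⟨_, rfl⟩, fn_iff◝ (hk.fn◝ hf), fun x y hp ↦ by
    rw [pin] at hp; rcases hk.prtr hp with ⟨a, b, rfl, rfl, _⟩; exact (hC _)◝ ⟨_, rfl⟩⟩
  refine ⟨fun f x ↦ ∃ f₀ x₀, Rp f₀ x₀ ∧ f = k f₀ ∧ x = k₀ x₀, ⬚, ⬚, ⬚, ⬚, ⬚⟩
  · rintro f ⟨h1, h2, h3⟩
    rcases (hC f)◜ h1 with ⟨f, rfl⟩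
    rcases h.tot f (hk.fn◜ (fn_iff◜ h2)) with ⟨x, hx⟩
    exact ⟨k₀ x, (hD _)◝ ⟨_, rfl⟩, f, x, hx, rfl, rfl⟩
  · rintro f x ⟨f, x, h1, rfl, rfl⟩
    exact ⟨fin (h.fn _ _ h1), (hD _)◝ ⟨_, rfl⟩⟩
  · intro x hx
    rcases (hD x)◜ hx with ⟨x, rfl⟩
    rcases h.sur x with ⟨f, hf⟩
    exact ⟨k f, f, x, hf, rfl, rfl⟩
  · intro n φ fs xs hr
    choose f x hr e1 e2 using hr
    obtain rfl : fs = fun i ↦ k (f i) := funext e1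
    obtain rfl : xs = fun i ↦ k₀ (x i) := funext e2
    rw [hk₀.evr hD, h.los φ f x hr]
    have e : ∀ z, z ~ v → ((∃ ys : Fin n → M, (∀ i, PairIn ∊ (k (f i)) (k z) (ys i)) ∧ Eval ∊ NoAux C φ ys) ↔
        Eval ∊ NoAux AllSets φ fun i ↦ app (f i) z) := fun z hz ↦ by
      rw [← hk.evr hC]
      have hp : ∀ i y, PairIn ∊ (k (f i)) (k z) y ↔ y = k (app (f i) z) := fun i y ↦ by
        rw [pin, (hk.fn◝ (h.fn _ _ (hr i))).mem, hk.mem, ← hk.app (h.fn _ _ (hr i)) hz]; exact and_iff_right hz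
      constructor
      · rintro ⟨ys, h1, h2⟩
        obtain rfl : ys = _ := funext fun i ↦ (hp i _)◜ (h1 i)
        exact h2
      · exact fun h2 ↦ ⟨_, fun i ↦ (hp i _)◝ rfl, h2⟩
    have e2 : ∀ z, z ~ k (sep v fun z ↦ Eval ∊ NoAux AllSets φ fun i ↦ app (f i) z) ↔ z ~ k v ∧
        ∃ ys : Fin n → M, (∀ i, PairIn ∊ (k (f i)) z (ys i)) ∧ Eval ∊ NoAux C φ ys := fun z ↦ by
      constructor
      · intro hz
        rcases hk.tr hz with ⟨z, rfl⟩
        rw [hk.mem, mem_sep] at hz; exact ⟨hk.mem◝ hz◜, (e z hz◜)◝ hz◝⟩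
      · rintro ⟨hz, hh⟩
        rcases hk.tr hz with ⟨z, rfl⟩
        rw [hk.mem] at hz ⊢; exact mem_sep◝ ⟨hz, (e z hz)◜ hh⟩
    constructor
    · exact fun hs ↦ ⟨_, e2, (hm _)◝ ⟨_, hs, rfl⟩⟩
    · rintro ⟨S, h1, h2⟩
      rcases (hm S)◜ h2 with ⟨s, h3, rfl⟩
      rwa [hk.inj◜ (zext fun z ↦ (e2 z).trans (h1 z).symm)]
  · intro x y hx
    rcases (hC x)◜ hx with ⟨x, rfl⟩
    have el : ∀ p, p ~ k (lam v ℸ x) ↔ ∃ z, z ~ k v ∧ IsKPair ∊ p z (k x) := fun p ↦ by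
      simp only [kp, hk.ex, ← hk.pr]
      constructor
      · intro hp
        rcases hk.tr hp with ⟨p, rfl⟩
        rcases mem_lam◜ (hk.mem◜ hp) with ⟨z, hz, rfl⟩; exact ⟨z, hz, rfl⟩
      · rintro ⟨z, hz, rfl⟩; exact hk.mem◝ (mem_lam◝ ⟨z, hz, rfl⟩)
    rw [hj]
    constructor
    · rintro ⟨z, e, rfl⟩
      rcases hk.inj◜ e with rfl
      exact ⟨_, el, _, _, h.con _, rfl, rfl⟩
    · rintro ⟨f, hf, f₀, x₀, h1, rfl, rfl⟩
      have : f₀ = lam v ℸ x := hk.inj◜ (zext fun p ↦ (hf p).trans (el p).symm)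
      subst this
      have hc := h.con x
      refine ⟨x, rfl, ⬚⟩
      have := (h.los (n := 2) (Fml.equ 0 1) (ℸ lam v ℸ x) (fun i ↦ if i = 0 then x₀ else J x) fun i ↦ by
        by_cases e : i = 0 <;> simp [e, h1, hc])
      have t := (h.los (n := 2) (Fml.equ 0 1) (ℸ lam v ℸ x) (fun i ↦ x₀) fun i ↦ h1)◜ rfl
      have := this◝ t
      exact congrArg k₀ this
end
end
section
theorem UR.L₀ {Y Y₀ : Type} [ZFM Y] [ZFM Y₀] {v m w : Y} {Rp : Y → Y₀ → Prop} {J : Y → Y₀} (h : UR v (· ~ m) Rp J) (hl : LH v m w)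
    {v₀ : Y₀} (e : J v = v₀) (hin : ∀ x : LL v, InL ∊ v₀ (J x◜)) :
    UR (vL v) (fun S ↦ S◜ ~ m) (fun f (x : LL v₀) ↦ Rp f◜ x◜) fun x ↦ ⟨J x◜, hin x⟩ := by subst e; exact h.L hl
theorem TE.maps {Y M : Type} [ZFM M] [ZFM Y] {k : Y → M} (h : TE k) {f a b : Y} : MapsTo ∊ (k f) (k a) (k b) ↔ MapsTo ∊ f a b := by
  unfold MapsTo; rw [fn_iff, fn_iff, h.fn]; simp only [pin]
  refine and_congr_right ℸ ⟨fun H x y hp ↦ h.mem◜ (H _ _ (h.prin◝ hp)), fun H x y hp ↦ ⬚⟩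
  rcases h.prtr hp with ⟨x, y, rfl, rfl, hp₀⟩; exact h.mem◝ (H _ _ hp₀)
section
variable {M X : Type} [ZFM M] [ZFM X] [UC X] [NA X] {a s c b : M}
open UC
def SN (i : X → M) : IterData M where
  cls a x := ∃ (p : O X) (y : Yc p), a = i p◜ ∧ x = i y◜
  meas _ _ := False
  emb a x y := ∃ (p : O X) (h : p◜ ~ D) (z : Yc p), a = i p◜ ∧ x = i z◜ ∧ y = i (jm (sc_le h) z)◜
  imap a c x y := ∃ (p q : O X) (h : p ≤ q) (z : Yc p), a = i p◜ ∧ c = i q◜ ∧ x = i z◜ ∧ y = i (jm h z)◜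
def SL (i : X → M) : IterData M where
  cls a x := ∃ (p : O X) (y : LL (up p v)), a = i p◜ ∧ x = i y◜◜
  meas a S := ∃ (p : O X) (s : Yc p), s ~ up p m ∧ a = i p◜ ∧ S = i s◜
  emb a x y := ∃ (p : O X) (h : p◜ ~ D) (z : LL (up p v)), a = i p◜ ∧ x = i z◜◜ ∧ y = i (jm (sc_le h) z◜)◜
  imap a c x y := ∃ (p q : O X) (h : p ≤ q) (z : LL (up p v)), a = i p◜ ∧ c = i q◜ ∧ x = i z◜◜ ∧ y = i (jm h z◜)◜
structure SY (i : X → M) (w d : X) : Prop where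
  te : TE i
  ho : ∀ a, Od a → ∃ c, a = i c
  hl : LH (v : X) m w
  hD : (D : X) = suc d
variable {i : X → M} {w d : X} (h : SY i w d)
include h
theorem SY.ie {p q : O X} (e : i p◜ = i q◜) : p = q := Subtype.ext (h.te.inj◜ e)
theorem SY.ix (ha : Od a) (hd : a ~ i d ∨ a = i d) : ∃ p : O X, a = i p◜ ∧ p◜ ~ D := by
  rcases h.ho a ha with ⟨c, rfl⟩
  rw [h.te.mem, h.te.inj] at hd
  have : c ~ D := by rw [h.hD, mem_suc]; exact hd
  exact ⟨⟨c, h.te.od◜ ha, by rw [mem_suc]; exact ◁ this⟩, rfl, this⟩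
theorem SY.le {p q : O X} (e : i p◜ ~ i q◜ ∨ i p◜ = i q◜) : p ≤ q := by
  rw [h.te.mem, h.te.inj] at e
  rcases e with e | e
  · exact fun z hz ↦ q◝◜.tr e hz
  · exact fun z hz ↦ e ▸ hz
theorem SY.ky (p : O X) : TE fun y : Yc p ↦ i y◜ := h.te.comp (teY p)
theorem SY.kl (p : O X) : TE fun y : LL (up p v) ↦ i y◜◜ := (h.ky p).comp (teL _)
theorem SY.nc (p : O X) (x : M) : (SN i).cls (i p◜) x ↔ ∃ y : Yc p, x = i y◜ :=
  ⟨fun ⟨q, y, e, e₀⟩ ↦ by rcases h.ie e with rfl; exact ⟨y, e₀⟩, fun ⟨y, e⟩ ↦ ⟨p, y, rfl, e⟩⟩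
theorem SY.lc (p : O X) (x : M) : (SL i).cls (i p◜) x ↔ ∃ y : LL (up p v), x = i y◜◜ :=
  ⟨fun ⟨q, y, e, e₀⟩ ↦ by rcases h.ie e with rfl; exact ⟨y, e₀⟩, fun ⟨y, e⟩ ↦ ⟨p, y, rfl, e⟩⟩
theorem SY.lm (p : O X) (x : M) : (SL i).meas (i p◜) x ↔ ∃ s : Yc p, s ~ up p m ∧ x = i s◜ :=
  ⟨fun ⟨q, y, hy, e, e₀⟩ ↦ by rcases h.ie e with rfl; exact ⟨y, hy, e₀⟩, fun ⟨y, hy, e⟩ ↦ ⟨p, y, hy, rfl, e⟩⟩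
theorem SY.ni (hp : p ≤ q) (x y : M) : (SN i).imap (i p◜) (i q◜) x y ↔ ∃ z : Yc p, x = i z◜ ∧ y = i (jm hp z)◜ :=
  ⟨fun ⟨p₀, q₀, _, z, e, e₀, e₀₀⟩ ↦ by rcases h.ie e with rfl; rcases h.ie e₀ with rfl; exact ⟨z, e₀₀⟩, fun ⟨z, e⟩ ↦ ⟨p, q, hp, z, rfl, rfl, e⟩⟩
theorem SY.li (hp : p ≤ q) (x y : M) : (SL i).imap (i p◜) (i q◜) x y ↔ ∃ z : LL (up p v), x = i z◜◜ ∧ y = i (jm hp z◜)◜ :=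
  ⟨fun ⟨p₀, q₀, _, z, e, e₀, e₀₀⟩ ↦ by rcases h.ie e with rfl; rcases h.ie e₀ with rfl; exact ⟨z, e₀₀⟩, fun ⟨z, e⟩ ↦ ⟨p, q, hp, z, rfl, rfl, e⟩⟩
theorem SY.ne (hp : p◜ ~ D) (x y : M) : (SN i).emb (i p◜) x y ↔ ∃ z : Yc p, x = i z◜ ∧ y = i (jm (sc_le hp) z)◜ :=
  ⟨fun ⟨p₀, _, z, e, e₀₀⟩ ↦ by rcases h.ie e with rfl; exact ⟨z, e₀₀⟩, fun ⟨z, e⟩ ↦ ⟨p, hp, z, rfl, e⟩⟩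
theorem SY.le₀ (hp : p◜ ~ D) (x y : M) : (SL i).emb (i p◜) x y ↔ ∃ z : LL (up p v), x = i z◜◜ ∧ y = i (jm (sc_le hp) z◜)◜ :=
  ⟨fun ⟨p₀, _, z, e, e₀₀⟩ ↦ by rcases h.ie e with rfl; exact ⟨z, e₀₀⟩, fun ⟨z, e⟩ ↦ ⟨p, hp, z, rfl, e⟩⟩
omit h in
theorem jmL (hp : p ≤ q) (z : LL (up p (v : X))) : InL ∊ (up q v) (jm hp z◜) := by
  rw [← jm_up hp]
  exact (jmU hp (R := fun X E σ ↦ InL E σ⁰ σ¹) inferInstance fun n ↦ if n = 0 then up p v else z◜)◝ z◝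
theorem SY.nel {p q : O X} (hp : p ≤ q) : ElemBetween ∊ ((SN i).cls (i p◜)) ((SN i).cls (i q◜)) ((SN i).imap (i p◜) (i q◜)) :=
  (h.ky p).elem (h.ky q) (h.nc p) (h.nc q) (J := jm hp) (jmU hp) (h.ni hp)
theorem SY.lel {p q : O X} (hp : p ≤ q) : ElemBetween ∊ ((SL i).cls (i p◜)) ((SL i).cls (i q◜)) ((SL i).imap (i p◜) (i q◜)) := by
  refine (h.kl p).elem (h.kl q) (h.lc p) (h.lc q) (J := fun z ↦ ⟨jm hp z◜, jmL hp z⟩) (fun {R} hR σ ↦ ⬚) (h.li hp)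
  rcases hR with ⟨k, f, c, e⟩
  refine (e _ _ _).trans (Iff.trans ⬚ (e _ _ _).symm)
  rw [evL, evL]
  have := jmU hp (udL f) (tup k (fun i ↦ (σ (c i))◜) ℸ up p v)
  simp only [tup_lt, tup_n] at this
  rw [jm_up] at this; exact this
theorem SY.nu (hp : p◜ ~ D) (hm : ∀ S, mu S ↔ ∃ s, s ~ up p m ∧ S = i s◜) :
    IsUltPowMapB ∊ ((SN i).cls (i p◜)) ((SN i).cls (i (sc p hp)◜)) (i (up p v)◜) mu ((SN i).emb (i p◜)) :=
  (stepUR p hp).ult (h.ky p) (h.ky _) (h.nc p) (h.nc _) hm (h.ne hp)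
theorem SY.lX (p : O X) (x : X) : InL ∊ (up p v)◜ x ↔ ∃ y : LL (up p v), x = y◜◜ := by
  rw [(teY p).inL (ordY p) (upLH h.hl p)◜]
  exact ⟨fun ⟨y, e, hy⟩ ↦ ⟨⟨y, hy⟩, e⟩, fun ⟨y, e⟩ ↦ ⟨y◜, e, y◝⟩⟩
theorem SY.lM (p : O X) (x : M) : (SL i).cls (i p◜) x ↔ InL ∊ (i (up p v)◜) x := by
  rw [(h.ky p).inL (fun a ha ↦ ⬚) (upLH h.hl p)◜, h.lc]
  · exact ⟨fun ⟨y, e⟩ ↦ ⟨y◜, e, y◝⟩, fun ⟨y, e, hy⟩ ↦ ⟨⟨y, hy⟩, e⟩⟩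
  · rcases h.ho a ha with ⟨c, rfl⟩
    rcases ordY p c (h.te.od◜ ha) with ⟨y, rfl⟩; exact ⟨y, rfl⟩
theorem SY.ls (hp : p◜ ~ D) (x : M) : (SL i).cls (i (sc p hp)◜) x ↔ (SL i).cls (i p◜) x := by
  have : ∀ q : O X, (SL i).cls (i q◜) x ↔ ∃ y, x = i y ∧ InL ∊ (up q v)◜ y := fun q ↦ by
    rw [h.lc]; simp only [h.lX]
    exact ⟨fun ⟨y, e⟩ ↦ ⟨_, e, y, rfl⟩, fun ⟨_, e, y, e₀⟩ ↦ ⟨y, e₀ ▸ e⟩⟩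
  rw [this, this]; simp only [fixY h.hl p hp]
theorem SY.lu (hp : p◜ ~ D) :
    IsUltPowMap ∊ ((SL i).cls (i p◜)) (i (up p v)◜) ((SL i).meas (i p◜)) ((SL i).emb (i p◜)) := by
  have hl := upLH h.hl p
  refine ((stepUR p hp).L₀ hl (jm_up _ _) (jmL _)).ult (h.kl p) (h.kl _) (h.lc p) (fun x ↦ (h.ls hp x).symm.trans (h.lc _ x)) (fun S ↦ ⬚) (h.le₀ hp)
  rw [h.lm]
  exact ⟨fun ⟨s, hs, e⟩ ↦ ⟨⟨s, hl◝◜ s (hl◝◝◝◜ s hs)⟩, hs, e⟩, fun ⟨s, hs, e⟩ ↦ ⟨s◜, hs, e⟩⟩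
theorem SY.n0 (hp : p◜ = emp) (hq : p ≤ q) (x : X) (y : M) : (SN i).imap (i p◜) (i q◜) (i x) y ↔ y = i (up q x)◜ := by
  rw [h.ni hq]
  constructor
  · rintro ⟨z, e, rfl⟩
    rw [h.te.inj] at e
    rw [show z = up p x from Subtype.ext (e.symm.trans (up0 hp x).symm), jm_up]
  · rintro rfl; exact ⟨up p x, by rw [up0 hp], by rw [jm_up]⟩
theorem SY.l0 (hp : p◜ = emp) (hq : p ≤ q) (x : X) (hx : InL ∊ v x) (y : M) : (SL i).imap (i p◜) (i q◜) (i x) y ↔ y = i (up q x)◜ := by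
  rw [← h.n0 hp hq, h.ni hq, h.li hq]
  refine ⟨fun ⟨z, e⟩ ↦ ⟨z◜, e⟩, fun ⟨z, e, e₀⟩ ↦ ⟨⟨z, ⬚⟩, e, e₀⟩⟩
  rw [h.te.inj] at e
  rw [show z = up p x from Subtype.ext (e.symm.trans (up0 hp x).symm)]
  exact (upU (R := fun X E σ ↦ InL E σ⁰ σ¹) inferInstance fun n ↦ if n = 0 then v else x)◝ hx
theorem SY.st (hp : o◜ = emp) (ho : o ≤ p) (hq : p ≤ q) (S : M) :
    IterMeasStep ∊ (SL i) (i o◜) (i v) (i w) (i p◜) (i q◜) S ↔ ∃ s : Yc q, S = i s◜ ∧ MS (up p v) (up p m) (up p w) (jm hq) s := by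
  unfold IterMeasStep
  simp only [h.l0 hp ho _ (L_self v), h.l0 hp ho _ h.hl◝◝◝◝◝◝◝◜, h.lc, h.li hq, h.lm]
  have T := h.ky p
  constructor
  · rintro ⟨_, _, _, _, _, rfl, rfl, ⟨f, rfl⟩, h1, h2, ⟨x, rfl, rfl⟩, h3⟩
    rcases (h.ky q).tr h3 with ⟨s, rfl⟩
    refine ⟨s, rfl, f◜, f◝, T.maps◜ h1, x◜, x◝, fun z ↦ ⬚, ((h.ky q).mem)◜ h3⟩
    rw [← T.mem, h2]
    simp only [pin]
    refine and_congr ⟨fun ⟨s, hs, e⟩ ↦ by rwa [T.inj◜ e], fun hs ↦ ⟨z, hs, rfl⟩⟩ ⟨fun ⟨k, hk⟩ ↦ ⬚, fun ⟨k, hk⟩ ↦ ⟨_, T.prin◝ hk⟩⟩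
    rcases T.prtr hk with ⟨a, b, rfl, e, hk₀⟩
    exact ⟨a, by rwa [T.inj◜ e]⟩
  · rintro ⟨s, rfl, f, hf, h1, x, hx, h2, h3⟩
    refine ⟨_, _, _, _, _, rfl, rfl, ⟨⟨f, hf⟩, rfl⟩, T.maps◝ h1, fun z ↦ ⬚, ⟨⟨x, hx⟩, rfl, rfl⟩, ((h.ky q).mem)◝ h3⟩
    simp only [pin] at h2 ⊢
    constructor
    · intro hz
      rcases T.tr hz with ⟨z, rfl⟩
      rcases (h2 z)◜ (T.mem◜ hz) with ⟨h4, k, hk⟩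
      exact ⟨⟨z, h4, rfl⟩, _, T.prin◝ hk⟩
    · rintro ⟨⟨z, h4, rfl⟩, k, hk⟩
      rcases T.prtr hk with ⟨a, b, rfl, e, hk₀⟩
      exact T.mem◝ ((h2 z)◝ ⟨h4, a, by rwa [T.inj◜ e]⟩)
theorem SY.cp {p q r : O X} (h1 : p ≤ q) (h2 : q ≤ r) (x z : M) :
    ((SN i).imap (i p◜) (i r◜) x z ↔ ∃ y, (SN i).imap (i p◜) (i q◜) x y ∧ (SN i).imap (i q◜) (i r◜) y z) ∧
    ((SL i).imap (i p◜) (i r◜) x z ↔ ∃ y, (SL i).imap (i p◜) (i q◜) x y ∧ (SL i).imap (i q◜) (i r◜) y z) := by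
  have h3 : p ≤ r := fun z hz ↦ h2 z (h1 z hz)
  simp only [h.ni h1, h.ni h2, h.ni h3, h.li h1, h.li h2, h.li h3]
  refine ⟨⟨⬚, ⬚⟩, ⟨⬚, ⬚⟩⟩
  · rintro ⟨u, rfl, rfl⟩; exact ⟨_, ⟨u, rfl, rfl⟩, _, rfl, by rw [jm_cp]⟩
  · rintro ⟨_, ⟨u, rfl, rfl⟩, u₀, e, rfl⟩
    rw [← (h.ky q).inj◜ e]; exact ⟨u, rfl, by rw [jm_cp]⟩
  · rintro ⟨u, rfl, rfl⟩; exact ⟨_, ⟨u, rfl, rfl⟩, ⟨_, jmL h1 u⟩, rfl, by rw [jm_cp]⟩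
  · rintro ⟨_, ⟨u, rfl, rfl⟩, u₀, e, rfl⟩
    rw [← (h.ky q).inj◜ e]; exact ⟨u, rfl, by rw [jm_cp]⟩
theorem SY.id {p : O X} (x y : M) : ((SN i).imap (i p◜) (i p◜) x y ↔ (SN i).cls (i p◜) x ∧ x = y) ∧
    ((SL i).imap (i p◜) (i p◜) x y ↔ (SL i).cls (i p◜) x ∧ x = y) := by
  have h1 : p ≤ p := fun z hz ↦ hz
  simp only [h.ni h1, h.li h1, h.nc, h.lc, jm_id]
  exact ⟨⟨fun ⟨z, e, e₀⟩ ↦ ⟨⟨z, e⟩, e.trans e₀.symm⟩, fun ⟨⟨z, e⟩, e₀⟩ ↦ ⟨z, e, e₀ ▸ e⟩⟩,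
    fun ⟨z, e, e₀⟩ ↦ ⟨⟨z, e⟩, e.trans e₀.symm⟩, fun ⟨⟨z, e⟩, e₀⟩ ↦ ⟨z, e, e₀ ▸ e⟩⟩
theorem SY.zr : ∃ o : O X, o◜ = emp ∧ ∀ p : O X, o ≤ p :=
  ⟨⟨(emp : X), Od_emp, by
    have hD : Od (UC.D : X) := UC.hD
    rcases (Od_emp : Od (emp : X)).tri hD.sucO with h₀ | h₀ | h₀
    · exact h₀
    · have : (D : X) ~ emp := by rw [h₀]; simp
      simp at this
    · simp at h₀⟩, rfl, fun p z hz ↦ by simp at hz⟩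
theorem SY.sx (hs : IsSuccOf ∊ a s) (e : a = i p◜) (hp : p◜ ~ D) : s = i (sc p hp)◜ := by
  rw [succ_iff◜ hs, e, ← h.te.suc]; rfl
theorem SY.td (hac : a ~ c ∨ a = c) (hd : c ~ i d ∨ c = i d) : a ~ i d ∨ a = i d := by
  have od : Od (i d) := (h.te.od (a := d))◝ (by have := UC.hD (X := X); rw [h.hD] at this; exact this.mem (by simp))
  rcases hac with h1 | rfl
  · left
    rcases hd with hd | rfl
    · exact od.tr hd h1
    · exact h1
  · exact hd
theorem SY.sd (ha : Od a) (hs : IsSuccOf ∊ a s) (hd : s ~ i d ∨ s = i d) : a ~ i d ∨ a = i d :=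
  h.td (◁ (by rw [succ_iff◜ hs]; simp)) hd
theorem SY.tw (ha : Od a) (hb : Od b) (hab : a ~ b ∨ a = b) (hd : b ~ i d ∨ b = i d) : ∃ p q : O X, a = i p◜ ∧ b = i q◜ ∧ p ≤ q := by
  rcases h.ix ha (h.td hab hd) with ⟨p, rfl, _⟩
  rcases h.ix hb hd with ⟨q, rfl, _⟩
  exact ⟨p, q, rfl, rfl, h.le hab⟩
theorem SY.th (ha : Od a) (hb : Od b) (hc : Od c) (hab : a ~ b ∨ a = b) (hbc : b ~ c ∨ b = c) (hd : c ~ i d ∨ c = i d) :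
    ∃ p q r : O X, a = i p◜ ∧ b = i q◜ ∧ c = i r◜ ∧ p ≤ q ∧ q ≤ r := by
  rcases h.tw hb hc hbc hd with ⟨q, r, rfl, rfl, h1⟩
  rcases h.ix ha (h.td hab (h.td hbc hd)) with ⟨p, rfl, _⟩
  exact ⟨p, q, r, rfl, rfl, rfl, h.le hab, h1⟩
theorem SY.lx (hc : IsLimitOrd ∊ c) (hd : c ~ i d ∨ c = i d) : ∃ q : O X, c = i q◜ ∧ IsLimitOrd ∊ q◜ := by
  rcases h.ix (lim_iff◜ hc)◜ hd with ⟨q, rfl, hq⟩; exact ⟨q, rfl, h.te.lim◜ hc⟩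
theorem SY.lin : IsLinIterSys ∊ (fun x ↦ ∃ y, x = i y) emp (i v) (i m) (i d) (SN i) := by
  rcases h.zr with ⟨o, ho, hop⟩
  have ez : (emp : M) = i o◜ := by rw [ho, h.te.emp]
  refine ⟨zero_iff◝ rfl, fun x ↦ ⬚, ⬚, ⬚, ⬚, ⬚, ⬚⟩
  · rw [ez, h.nc]
    exact ⟨fun ⟨y, e⟩ ↦ ⟨_, e⟩, fun ⟨y, e⟩ ↦ ⟨up o y, by rw [e, up0 ho]⟩⟩
  · intro a ha hd x y
    rcases h.ix ha hd with ⟨p, rfl, hp⟩; exact (h.id x y)◜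
  · intro a b c ha hb hc hab hbc hcd x z
    rcases h.th ha hb hc hab hbc hcd with ⟨p, q, r, rfl, rfl, rfl, h1, h2⟩
    exact (h.cp h1 h2 x z)◜
  · intro a b ha hb hab hd
    rcases h.tw ha hb hab hd with ⟨p, q, rfl, rfl, h1⟩; exact h.nel h1
  · intro a s ha hs hd
    rcases h.ix ha (h.sd ha hs hd) with ⟨p, e, hp⟩
    rcases h.sx hs e hp with rfl
    subst e
    refine ⟨fun x y ↦ (h.ni _ x y).trans (h.ne hp x y).symm, fun v1a hv ↦ ⬚⟩
    rw [ez, h.n0 ho (hop p)] at hv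
    subst hv
    refine h.nu hp fun S ↦ ⬚
    unfold LinMeasAt
    rw [ez]; simp only [h.n0 ho (hop p)]
    constructor
    · rintro ⟨_, rfl, hS⟩
      rcases (h.ky p).tr hS with ⟨s, rfl⟩; exact ⟨s, ((h.ky p).mem)◜ hS, rfl⟩
    · rintro ⟨s, hs, rfl⟩; exact ⟨_, rfl, ((h.ky p).mem)◝ hs⟩
  · intro c hc hd x hx
    rcases h.lx hc hd with ⟨q, rfl, hq⟩
    rw [h.nc] at hx
    rcases hx with ⟨x, rfl⟩
    rcases jm_lim hq x with ⟨a, ha, y, rfl⟩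
    exact ⟨i a, i y◜, h.te.od◝ (q◝◜.mem ha), h.te.mem◝ ha, (h.ni (p := O.mem ha) (O.mem_le ha) _ _)◝ ⟨y, rfl, rfl⟩⟩
theorem SY.it : IsIterSys ∊ (InL ∊ (i v)) (fun S ↦ S ~ i m) emp (i v) (i w) (i d) (SL i) := by
  rcases h.zr with ⟨o, ho, hop⟩
  have ez : (emp : M) = i o◜ := by rw [ho, h.te.emp]
  refine ⟨zero_iff◝ rfl, fun x ↦ ⬚, fun S ↦ ⬚, ⬚, ⬚, ⬚, ⬚, ⬚, ⬚⟩
  · rw [ez, h.lM, up0 ho]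
  · rw [ez, h.lm]
    constructor
    · rintro ⟨s, hs, rfl⟩; have := h.te.mem◝ ((teY o).mem |>.2 hs); rwa [up0 ho] at this
    · intro hS
      rw [← up0 ho m] at hS
      rcases (h.ky o).tr hS with ⟨s, rfl⟩; exact ⟨s, ((h.ky o).mem)◜ hS, rfl⟩
  · intro a ha hd x y
    rcases h.ix ha hd with ⟨p, rfl, hp⟩; exact (h.id x y)◝
  · intro a b c ha hb hc hab hbc hcd x z
    rcases h.th ha hb hc hab hbc hcd with ⟨p, q, r, rfl, rfl, rfl, h1, h2⟩
    exact (h.cp h1 h2 x z)◝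
  · intro a b ha hb hab hd
    rcases h.tw ha hb hab hd with ⟨p, q, rfl, rfl, h1⟩; exact h.lel h1
  · intro a s ha hs hd
    rcases h.ix ha (h.sd ha hs hd) with ⟨p, e, hp⟩
    rcases h.sx hs e hp with rfl
    subst e
    refine ⟨h.ls hp, fun x y ↦ (h.li _ x y).trans (h.le₀ hp x y).symm, fun S ↦ ⬚⟩
    rw [ez, h.st ho (hop p) (sc_le hp), h.lm]
    refine exists_congr fun s ↦ and_comm.trans (and_congr_right ℸ ⬚)
    rw [← jm_up (sc_le hp)]; exact (stepUR p hp).ms (upLH h.hl p) s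
  · intro a va ha hd hv
    rcases h.ix ha hd with ⟨p, rfl, hp⟩
    rw [ez, h.l0 ho (hop p) _ (L_self v)] at hv
    subst hv; exact h.lu hp
  · intro c hc hd
    rcases h.lx hc hd with ⟨q, rfl, hq⟩
    refine ⟨fun x hx ↦ ⬚, fun S ↦ ⬚⟩
    · rw [h.lc] at hx
      rcases hx with ⟨x, rfl⟩
      rcases jm_lim hq x◜ with ⟨a, ha, y, e⟩
      have hy : InL ∊ (up (O.mem ha) v) y := by
        have := x◝; rw [e, ← jm_up (O.mem_le ha)] at this
        exact (jmU (O.mem_le ha) (R := fun X E σ ↦ InL E σ⁰ σ¹) inferInstance fun n ↦ if n = 0 then up (O.mem ha) v else y)◜ this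
      exact ⟨i a, i y◜, h.te.od◝ (q◝◜.mem ha), h.te.mem◝ ha, (h.li (p := O.mem ha) (O.mem_le ha) _ _)◝ ⟨⟨y, hy⟩, rfl, by rw [e]⟩⟩
    · rw [h.lm]
      constructor
      · rintro ⟨s, hs, rfl⟩
        rcases jm_lim hq s with ⟨a, ha, y, rfl⟩
        rw [← jm_up (O.mem_le ha)] at hs
        have hy : y ~ up (O.mem ha) m :=
          (jmU (O.mem_le ha) (R := fun X E σ ↦ E σ⁰ σ¹) inferInstance fun n ↦ if n = 0 then y else up (O.mem ha) m)◜ hs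
        refine ⟨i a, h.te.od◝ (q◝◜.mem ha), h.te.mem◝ ha, ⬚⟩
        rw [ez]
        refine (h.st (p := O.mem ha) ho (hop _) (O.mem_le ha) _)◝ ⟨_, rfl, MS.lim (jmU _) (upLH h.hl _) hy ⬚⟩
        rcases v_ne (X := X) with ⟨k, hk⟩
        exact ⟨up _ k, (upU (R := fun X E σ ↦ E σ⁰ σ¹) inferInstance fun n ↦ if n = 0 then k else v)◝ hk⟩
      · rintro ⟨a, ha, haq, hS⟩
        rcases h.te.tr haq with ⟨a, rfl⟩
        have haq₀ := h.te.mem◜ haq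
        rw [ez] at hS
        rcases (h.st (p := O.mem haq₀) ho (hop _) (O.mem_le haq₀) _)◜ hS with ⟨s, e, hs⟩
        have := hs.sub (jmU _)
        rw [jm_up] at this; exact ⟨s, this, e⟩
theorem SY.main : ∃ SL SN : IterData M, IsIterSys ∊ (InL ∊ (i v)) (fun S ↦ S ~ i m) emp (i v) (i w) (i d) SL ∧
      IsLinIterSys ∊ (fun x ↦ ∃ y, x = i y) emp (i v) (i m) (i d) SN ∧
      (∀ a, IsOrd ∊ a → (a ~ i d ∨ a = i d) →
        (∀ x, SL.cls a x ↔ ∃ v1a, SN.imap emp a (i v) v1a ∧ InL ∊ v1a x) ∧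
        (∀ X, SL.meas a X ↔ ∃ ma, SN.imap emp a (i m) ma ∧ X ~ ma)) ∧
      (∀ a c, IsOrd ∊ a → IsOrd ∊ c → (a ~ c ∨ a = c) → (c ~ i d ∨ c = i d) →
        (∀ x y, SL.imap a c x y → SN.imap a c x y) ∧
        ElemBetween ∊ (SL.cls a) (SL.cls c) (SL.imap a c) ∧
        ElemBetween ∊ (SN.cls a) (SN.cls c) (SN.imap a c)) := by
  rcases h.zr with ⟨o, ho, hop⟩
  have ez : (emp : M) = i o◜ := by rw [ho, h.te.emp]
  refine ⟨SL i, SN i, h.it, h.lin, fun a ha hd ↦ ⬚, fun a c ha hc hac hd ↦ ⬚⟩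
  · rcases h.ix ha hd with ⟨p, rfl, hp⟩
    rw [ez]; simp only [h.n0 ho (hop p), exists_eq_left]
    refine ⟨h.lM p, fun S ↦ (h.lm p S).trans ⟨⬚, fun hS ↦ ⬚⟩⟩
    · rintro ⟨s, hs, rfl⟩; exact ((h.ky p).mem)◝ hs
    · rcases (h.ky p).tr hS with ⟨s, rfl⟩; exact ⟨s, ((h.ky p).mem)◜ hS, rfl⟩
  · rcases h.tw ha hc hac hd with ⟨p, q, rfl, rfl, h1⟩
    refine ⟨fun x y ↦ ⬚, h.lel h1, h.nel h1⟩
    rw [h.li h1, h.ni h1]; exact fun ⟨z, e⟩ ↦ ⟨z◜, e⟩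
end
end
section
section
variable {X Y : Type} [ZFM X] [ZFM Y]
theorem vst {a v : X} : IsVStage ∊ a v ↔ Od a ∧ v = Vs a := by
  unfold IsVStage IsVHier; simp only [pin]
  constructor
  · rintro ⟨H, ⟨(ha : Od a), -, h1, h2⟩, h3⟩
    refine ⟨ha, ⬚⟩
    have key := oind (fun b ↦ b ~ suc a → ∀ w, pr b w ~ H → w = Vs b) (fun b hb ih hba w hw ↦ zext fun x ↦ ⬚) a ha (by simp) v h3
    · exact key
    rw [h2 b w hw, mem_Vs hb]
    constructor
    · rintro ⟨c, u, hc, hu, hx⟩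
      rw [ih c hc (ha.sucO.tr hba hc) u hu] at hx; exact ⟨c, hc, hx⟩
    · rintro ⟨c, hc, hx⟩
      have hca := ha.sucO.tr hba hc
      rcases (h1 c)◝ (by simpa using hca) with ⟨u, hu⟩
      refine ⟨c, u, hc, hu, ⬚⟩
      rw [ih c hc hca u hu]; exact hx
  · rintro ⟨ha, rfl⟩
    have hp : ∀ {b w : X}, pr b w ~ lam (suc a) Vs ↔ b ~ suc a ∧ w = Vs b := fun {b w} ↦ by
      rw [mem_lam]; exact ⟨fun ⟨k, hk, e⟩ ↦ by rcases pr_inj◜ e with ⟨rfl, rfl⟩; exact ⟨hk, rfl⟩, fun ⟨h, e⟩ ↦ ⟨b, h, e ▸ rfl⟩⟩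
    refine ⟨lam (suc a) Vs, ⟨ha, ⟨fun p hp ↦ ⬚, fun x y y₀ ↦ ⬚⟩, fun b ↦ ⬚, fun b w hw x ↦ ⬚⟩, hp◝ ⟨by simp, rfl⟩⟩
    · rcases mem_lam◜ hp with ⟨k, hk, e⟩; exact ⟨_, _, kp◝ e⟩
    · simp only [pin, hp]; rintro ⟨-, rfl⟩ ⟨-, rfl⟩; rfl
    · simp [hp]
    · rcases hp◜ hw with ⟨hb, rfl⟩
      rw [mem_Vs (ha.sucO.mem hb)]
      exact ⟨fun ⟨c, hc, hx⟩ ↦ ⟨c, _, hc, hp◝ ⟨ha.sucO.tr hb hc, rfl⟩, hx⟩, fun ⟨c, u, hc, hu, hx⟩ ↦ ⟨c, hc, (hp◜ hu)◝ ▸ hx⟩⟩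
theorem TE.Vs {i : Y → X} (h : TE i) {a x : Y} (ha : Od a) : i x ~ Vs (i a) ↔ x ~ Vs a := by
  let W := tc (ZFI0.upr x x)
  have hx : x ~ W := tc_sub (by simp)
  have key := oind (X := X) (fun b ↦ b ~ i (ZFI0.suc a) → ∀ x, x ~ i W → ∀ w, ZFI0.pr b w ~ i (lam (ZFI0.suc a) ZFI0.Vs) → (x ~ w ↔ x ~ ZFI0.Vs b))
    (fun b hb ih hba x hx w hw ↦ ⬚) (i a) (h.od◝ ha) (h.mem◝ (by simp)) (i x) (h.mem◝ hx) _ (h.prin◝ (mem_lam◝ ⟨a, by simp, rfl⟩))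
  · rw [← key, h.mem]
  rcases h.prtr hw with ⟨b, w, rfl, rfl, hw₀⟩
  rcases h.tr hx with ⟨x, rfl⟩
  rcases mem_lam◜ hw₀ with ⟨b₀, hb₀, e⟩
  rcases pr_inj◜ e with ⟨rfl, rfl⟩
  rw [h.mem, mem_Vs (h.od◜ hb), mem_Vs hb, h.ex]
  refine exists_congr fun n ↦ and_congr_right fun hn ↦ ⬚
  rw [h.all]
  refine forall₂_congr fun z hz ↦ ⬚
  have hn₀ := ha.sucO.tr hb₀ hn
  rw [← ih (i n) (h.mem◝ hn) (h.mem◝ hn₀) (i z) (h.mem◝ (tc_tr (h.mem◜ hx) hz)) _ (h.prin◝ (mem_lam◝ ⟨n, hn₀, rfl⟩)), h.mem]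
end
end
section
def cs (x : X) (p : ℕ → X) (n : ℕ) : X := Nat.casesOn n x p
section
variable {X M : Type} [ZFM X] [ZFM M]
structure KX {V : M} (J : M → M → Prop) (i : X → M) (k : LL V → X) (j : LL V → LL V) (r l : LL V) (m : X) : Prop where
  ti : TE i
  tk : TE k
  ik : ∀ x, i (k x) = x◜
  ho : ∀ a : M, Od a → ∃ c : LL V, a = c◜
  el : ∀ {R : Pd}, UD R → ∀ σ : ℕ → LL V, R (LL V) ∊ (fun n ↦ j (σ n)) ↔ R (LL V) ∊ σ
  hm : ∀ S, S ~ m ↔ ∃ S₀, S = k S₀ ∧ SubsetE ∊ S₀ (vL V) ∧ r ~ j S₀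
  full : r ~ j (vL V)
  sb : ∀ x, SubsetE ∊ x (k (vL V)) → ∃ y, x = k y
  hr : ∀ z y, pr z y ~ r ↔ z ~ Vs l ∧ y = j z
  hl : Od l
  hV : vL V = Vs (suc l)
  tg : ∀ f, Fn f (k (vL V)) → (∀ x, x ~ k (vL V) → ∃ y, app f x = k y) →
    ∃ g, Fn g (vL V) ∧ sep (k (vL V)) (fun z ↦ app f z = app (k g) z) ~ m
  hJ : DF fun σ : ℕ → M ↦ J σ⁰ σ¹
  jJ : ∀ x y, J x y ↔ ∃ z : LL V, x = z◜ ∧ y = (j z)◜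
variable {V : M} {J : M → M → Prop} {i : X → M} {k : LL V → X} {j : LL V → LL V} {r l : LL V} {m : X}
  (h : KX J i k j r l m)
include h
theorem KX.kk (hR : UD R) (p : ℕ → LL V) [DF fun σ ↦ Q σ⁰]
    (hQ : ∀ z, z ~ vL V → (Q (k z) ↔ R (LL V) ∊ (cs z p))) :
    sep (k (vL V)) Q ~ m ↔ R (LL V) ∊ (cs r fun n ↦ j (p n)) := by
  rcases h.sb (sep (k (vL V)) Q) fun z hz ↦ (mem_sep◜ hz)◜ with ⟨S, hS⟩
  have hS₀ : ∀ z, z ~ S ↔ z ~ vL V ∧ R (LL V) ∊ (cs z p) := fun z ↦ by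
    rw [← h.tk.mem, ← hS, mem_sep, h.tk.mem]; exact and_congr_right (hQ z)
  have u1 : UD fun X E σ ↦ R X E (cs σ⁰ fun n ↦ σ (n+3)) :=
    (hR.sub fun n ↦ Nat.casesOn n 0 fun n ↦ n+3).congr fun X E σ ↦ by
      rw [show (cs σ⁰ fun n ↦ σ (n+3)) = fun n ↦ σ (Nat.casesOn n 0 fun n ↦ n+3) from funext fun n ↦ by cases n <;> rfl]
  have u2 : UD fun X E σ ↦ ∀ z, E z σ⁰ ↔ E z σ¹ ∧ R X E (cs z fun n ↦ σ (n+2)) :=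
    UD.all_ (R := fun X E z σ ↦ E z σ⁰ ↔ E z σ¹ ∧ R X E (cs z fun n ↦ σ (n+2)))
      (h := inferInstanceAs (UD fun X E σ ↦ E σ⁰ σ¹ ↔ E σ⁰ σ² ∧ R X E (cs σ⁰ fun n ↦ σ (n+3))))
  have := (h.el u2 (cs S (cs (vL V) p)))◝ hS₀ r
  rw [hS, h.hm]
  refine Iff.trans ⟨⬚, fun hh ↦ ⟨S, rfl, fun z hz ↦ ((hS₀ z)◜ hz)◜, hh⟩⟩ (this.trans (and_iff_right h.full))
  rintro ⟨S₀, e, h1, h2⟩; rwa [h.tk.inj◜ e]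
theorem KX.up (a b c : X) (ha : a ~ m) (hb : b ~ m) (hc : SubsetE ∊ c (k (vL V))) (H : ∀ z, z ~ a → z ~ b → z ~ c) : c ~ m := by
  rcases h.sb c hc with ⟨c, rfl⟩
  rcases (h.hm a)◜ ha with ⟨a, rfl, h1, h2⟩
  rcases (h.hm b)◜ hb with ⟨b, rfl, h3, h4⟩
  refine (h.hm _)◝ ⟨c, rfl, h.tk.sub◜ hc, ⬚⟩
  refine (h.el (R := fun X E σ ↦ ∀ z, E z σ⁰ → E z σ¹ → E z σ²) inferInstance (cs a (cs b ℸ c)))◝ (fun z ↦ ⬚) r h2 h4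
  have := H (k z); rwa [h.tk.mem, h.tk.mem, h.tk.mem] at this
theorem KX.mo [DF fun σ ↦ P σ⁰] [DF fun σ ↦ Q σ⁰] [DF fun σ ↦ R σ⁰]
    (h1 : sep (k (vL V)) P ~ m) (h2 : sep (k (vL V)) Q ~ m) (h3 : ∀ z, z ~ k (vL V) → P z → Q z → R z) : sep (k (vL V)) R ~ m :=
  h.up _ _ _ h1 h2 (fun z hz ↦ (mem_sep◜ hz)◜) fun z hz hz₀ ↦
    mem_sep◝ ⟨(mem_sep◜ hz)◜, h3 _ (mem_sep◜ hz)◜ (mem_sep◜ hz)◝ (mem_sep◜ hz₀)◝⟩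
theorem KX.jfn (hg : Fn g (vL V)) : Fn (j g) (j (vL V)) := by
  have := (h.el (R := fun X E σ ↦ IsFuncOn E σ⁰ σ¹) inferInstance (cs g ℸ vL V))◝ (fn_iff◝ hg)
  exact fn_iff◜ this
theorem KX.k2 (hR : UD R) (p q : LL V) (hf : Fn f (vL V)) (hg : Fn g (vL V)) [DF fun σ ↦ Q σ⁰]
    (hQ : ∀ z, z ~ vL V → (Q (k z) ↔ R (LL V) ∊ (cs (app f z) (cs (app g z) (cs z (cs p ℸ q)))))) :
    sep (k (vL V)) Q ~ m ↔ R (LL V) ∊ (cs (app (j f) r) (cs (app (j g) r) (cs r (cs (j p) ℸ j q)))) := by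
  have u1 : UD fun X E σ ↦ R X E (cs σ¹ (cs σ⁰ (cs σ² (cs σ³ ℸ σ 4)))) :=
    (hR.sub (cs 1 (cs 0 (cs 2 (cs 3 ℸ 4))))).congr fun X E σ ↦ by
      rw [show (cs σ¹ (cs σ⁰ (cs σ² (cs σ³ ℸ σ 4)))) = fun n ↦ σ (cs 1 (cs 0 (cs 2 (cs 3 ℸ 4))) n) from
        funext fun n ↦ by rcases n with _ | _ | _ | _ | n <;> rfl]
  have u2 : UD fun X E σ ↦ ∃ x y, PairIn E σ³ σ⁰ x ∧ PairIn E (σ 4) σ⁰ y ∧ R X E (cs x (cs y (cs σ⁰ (cs σ¹ ℸ σ 2)))) := by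
    refine UD.ex_ (R := fun X E x σ ↦ ∃ y, PairIn E σ³ σ⁰ x ∧ PairIn E (σ 4) σ⁰ y ∧ R X E (cs x (cs y (cs σ⁰ (cs σ¹ ℸ σ 2)))))
      (h := UD.ex_ (R := fun X E y σ ↦ PairIn E (σ 4) σ¹ σ⁰ ∧ PairIn E (σ 5) σ¹ y ∧ R X E (cs σ⁰ (cs y (cs σ¹ (cs σ² ℸ σ 3)))))
        (h := ⬚))
    exact inferInstanceAs (UD fun X E σ ↦ PairIn E (σ 5) σ² σ¹ ∧ PairIn E (σ 6) σ² σ⁰ ∧ R X E (cs σ¹ (cs σ⁰ (cs σ² (cs σ³ ℸ σ 4)))))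
  have ev : ∀ {f g z p q v : LL V}, Fn f v → Fn g v → z ~ v → ((∃ x y, PairIn ∊ f z x ∧ PairIn ∊ g z y ∧ R _ ∊ (cs x (cs y (cs z (cs p ℸ q))))) ↔
      R _ ∊ (cs (app f z) (cs (app g z) (cs z (cs p ℸ q))))) := fun {f g z p q v} hf hg hz ↦ by
    simp only [pin, hf.mem, hg.mem]
    exact ⟨fun ⟨x, y, e, e₀, H⟩ ↦ e◝ ▸ e₀◝ ▸ H, fun H ↦ ⟨_, _, ⟨hz, rfl⟩, ⟨hz, rfl⟩, H⟩⟩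
  refine (h.kk u2 (cs p (cs q (cs f ℸ g))) fun z hz ↦ (hQ z hz).trans (ev hf hg hz).symm).trans (ev (h.jfn hf) (h.jfn hg) h.full)
theorem KX.od (hf : Fn f (vL V)) (H : sep (k (vL V)) (fun z ↦ Od (app (k f) z)) ~ m) : Od (app (j f) r) :=
  (h.k2 (R := fun X E σ ↦ IsOrd E σ⁰) inferInstance r r hf hf fun z hz ↦ by rw [← h.tk.app hf hz]; exact h.tk.od)◜ H
theorem KX.lt (hf : Fn f (vL V)) (hg : Fn g (vL V)) : sep (k (vL V)) (fun z ↦ app (k f) z ~ app (k g) z) ~ m ↔ app (j f) r ~ app (j g) r :=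
  (h.k2 (R := fun X E σ ↦ E σ⁰ σ¹) inferInstance r r hf hg fun z hz ↦ by rw [← h.tk.app hf hz, ← h.tk.app hg hz]; exact h.tk.mem)
end
end
section
section
variable {X M : Type} [ZFM X] [ZFM M]
theorem TE.sep {i : X → M} (h : TE i) {a : X} {Q : X → Prop} {Q₀ : M → Prop} [DF fun σ ↦ Q σ⁰] [DF fun σ ↦ Q₀ σ⁰]
    (e : ∀ z, z ~ a → (Q z ↔ Q₀ (i z))) : i (sep a Q) = sep (i a) Q₀ :=
  h.eq (fun z hz ↦ by rw [mem_sep] at hz ⊢; exact ⟨h.mem◝ hz◜, (e z hz◜)◜ hz◝⟩) fun z hz ↦ by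
    rw [mem_sep] at hz; obtain ⟨z, rfl⟩ := h.tr hz◜
    have := h.mem◜ hz◜
    exact ⟨z, rfl, mem_sep◝ ⟨this, (e z this)◝ hz◝⟩⟩
section
variable {V : M} {J : M → M → Prop} {i : X → M} {k : LL V → X} {j : LL V → LL V} {r l : LL V} {m : X}
  (h : KX J i k j r l m)
include h
theorem KX.ap (hg : Fn g (vL V)) : (app (j g) r)◜ = app (j g)◜ r◜ := (teL V).app (h.jfn hg) h.full
theorem KX.wf0 (A : X) (hA : ∃ f, f ~ A) (hf : ∀ f, f ~ A → Fn f (k (vL V)) ∧ ∀ z, z ~ k (vL V) → Od (app f z)) :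
    ∃ f, f ~ A ∧ ∀ g, g ~ A → ¬ sep (k (vL V)) (fun z ↦ app g z ~ app f z) ~ m := by
  have := fun s t [DT s] [DT t] ↦ @df2 M _ J h.hJ s t
  have ts : ∀ {f : X} {g : LL V}, Fn f (k (vL V)) → Fn g (vL V) →
      (sep V (fun z ↦ app (i f) z = app g◜ z) ~ i m ↔ sep (k (vL V)) (fun z ↦ app f z = app (k g) z) ~ m) := fun {f g} hf hg ↦ by
    rw [← h.ti.mem, h.ti.sep (Q₀ := fun z ↦ app (i f) z = app g◜ z) fun z hz ↦ ⬚, h.ik]; rfl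
    rw [← h.ik g, ← h.ti.app hf hz, ← h.ti.app (h.tk.fn◝ hg) hz, h.ti.inj]
  have hW : ∀ f, f ~ A → ∃ g, Fn g (vL V) ∧ sep (k (vL V)) (fun z ↦ app f z = app (k g) z) ~ m ∧ Od (app (j g) r) := fun f hfA ↦ by
    rcases hf f hfA with ⟨h1, h2⟩
    obtain ⟨g, h3, h4⟩ := h.tg f h1 fun z hz ↦ by
      rcases h.ho _ (h.ti.od◝ (h2 z hz)) with ⟨c, e⟩
      rw [← h.ik, h.ti.inj] at e; exact ⟨c, e⟩
    exact ⟨g, h3, h4, h.od h3 (h.mo h4 h4 fun z hz e _ ↦ by rw [← e]; exact h2 z hz)⟩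
  have hQ : ∀ {f : X} {g : LL V}, f ~ A → Fn g (vL V) → sep (k (vL V)) (fun z ↦ app f z = app (k g) z) ~ m →
      ∃ f, f ~ i A ∧ ∃ g G, J g G ∧ Fn g V ∧ sep V (fun z ↦ app f z = app g z) ~ i m ∧ (app (j (‹LL V›)) r)◜ = app G r◜ := by
    intro f g h1 h2 h3
    exact ⟨i f, h.ti.mem◝ h1, g◜, (j g)◜, (h.jJ _ _)◝ ⟨g, rfl, rfl⟩, (teL V).fn◝ h2, (ts (hf f h1)◜ h2)◝ h3, h.ap h2⟩
  rcases hA with ⟨f0, hf0⟩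
  rcases hW f0 hf0 with ⟨g0, h1, h2, h3⟩
  obtain ⟨a, ha, ⟨f, hfA, g, G, hJ, hg, hs, e⟩, hmin⟩ := oleast (X := M) (fun a ↦ ∃ f, f ~ i A ∧ ∃ g G, J g G ∧ Fn g V ∧ sep V (fun z ↦ app f z = app g z) ~ i m ∧ a = app G r◜)
    ⟨_, (teL V).od◝ h3, hQ hf0 h1 h2⟩
  rcases h.ti.tr hfA with ⟨f, rfl⟩
  rw [h.ti.mem] at hfA
  rcases (h.jJ _ _)◜ hJ with ⟨g, rfl, rfl⟩
  have hg₀ : Fn g (vL V) := (teL V).fn◜ hg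
  rw [ts (hf f hfA)◜ hg₀] at hs
  rw [← h.ap hg₀] at e
  refine ⟨f, hfA, fun f₀ hf₀ hlt ↦ ⬚⟩
  rcases hW f₀ hf₀ with ⟨g₀, h4, h5, h6⟩
  refine hmin _ ⬚ (hQ hf₀ h4 h5)
  rw [e]; refine (h.lt h4 hg₀)◜ ⬚
  have := h.mo hs h5 (R := fun z ↦ app f z = app (k g) z ∧ app f₀ z = app (k g₀) z) fun z _ a b ↦ ⟨a, b⟩
  exact h.mo this hlt fun z _ a b ↦ by rw [← a◜, ← a◝]; exact b
theorem KX.wf (A : X) (hA : ∃ f, f ~ A) (hf : ∀ f, f ~ A → Fn f (k (vL V))) :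
    ∃ f, f ~ A ∧ ∀ g, g ~ A → ¬ sep (k (vL V)) (fun z ↦ app g z ~ app f z) ~ m := by
  rcases hA with ⟨f0, hf0⟩
  obtain ⟨_, h1, h2⟩ := h.wf0 (img A fun f ↦ lam (k (vL V)) fun z ↦ rk (app f z)) ⟨_, mem_img◝ ⟨f0, hf0, rfl⟩⟩ fun f hf ↦ by
    rcases mem_img◜ hf with ⟨f, _, rfl⟩
    exact ⟨fn_lam, fun z hz ↦ by rw [app_lam hz]; exact rk_od _⟩
  rcases mem_img◜ h1 with ⟨f, hfA, rfl⟩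
  refine ⟨f, hfA, fun g hg hlt ↦ h2 _ (mem_img◝ ⟨g, hg, rfl⟩) (h.mo hlt hlt fun z hz a _ ↦ ⬚)⟩
  rw [app_lam hz, app_lam hz]; exact rk_lt a
end
section
variable {i : X → M} (h : TE i) {v m : X} (hlos : LosOK ∊ (fun x ↦ ∃ y, x = i y) (i v) fun S ↦ S ~ i m)
include h
theorem TE.me [DF fun σ ↦ Q σ⁰] (e : ∀ z, z ~ v → (Q₀ (i z) ↔ Q z)) :
    MeasOne ∊ (fun S ↦ S ~ i m) (i v) Q₀ ↔ ZFI0.sep v Q ~ m := by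
  have : ∀ z, z ~ i (ZFI0.sep v Q) ↔ z ~ i v ∧ Q₀ z := fun z ↦ by
    constructor
    · intro hz; obtain ⟨z, rfl⟩ := h.tr hz
      rw [h.mem, mem_sep] at hz; exact ⟨h.mem◝ hz◜, (e z hz◜)◝ hz◝⟩
    · rintro ⟨h1, h2⟩; obtain ⟨z, rfl⟩ := h.tr h1
      rw [h.mem] at *; exact mem_sep◝ ⟨h1, (e z h1)◜ h2⟩
  constructor
  · rintro ⟨S, h1, h2⟩
    rwa [show S = i (ZFI0.sep v Q) from zext fun z ↦ (h1 z).trans (this z).symm, h.mem] at h2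
  · exact fun hs ↦ ⟨_, this, h.mem◝ hs⟩
theorem TE.into : FnInto ∊ (fun x ↦ ∃ y, x = i y) (i v) f ↔ ∃ g, f = i g ∧ Fn g v := by
  unfold FnInto; rw [fn_iff]; simp only [pin]
  constructor
  · rintro ⟨⟨g, rfl⟩, h1, _⟩; exact ⟨g, rfl, h.fn◜ h1⟩
  · rintro ⟨g, rfl, h1⟩
    exact ⟨⟨g, rfl⟩, h.fn◝ h1, fun x y hp ↦ let ⟨_, b, _, e, _⟩ := h.prtr hp; ⟨b, e⟩⟩
include hlos
theorem TE.lo (φ : Fml n) (fs : Fin n → X) (hf : ∀ j, Fn (fs j) v) :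
    UltSat ∊ (fun x ↦ ∃ y, x = i y) (i v) (fun S ↦ S ~ i m) φ (fun j ↦ i (fs j)) ↔
      ZFI0.sep v (fun z ↦ Eval ∊ NoAux AllSets φ fun j ↦ ZFI0.app (fs j) z) ~ m := by
  rw [hlos φ _ fun j ↦ h.into◝ ⟨_, rfl, hf j⟩]
  have : DF fun σ : ⊙X ↦ Eval ∊ NoAux AllSets φ fun j ↦ ZFI0.app (fs j) σ⁰ :=
    dfEval φ (fun σ ↦ AllSets) (DF.prop (p := True)) (fun j σ ↦ ZFI0.app (fs j) σ⁰) inferInstance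
  refine h.me fun z hz ↦ ⬚
  rw [← h.evr (C := fun x ↦ ∃ y, x = i y) ℸ Iff.rfl]
  simp only [pin]
  have e : ∀ j y, ZFI0.pr (i z) y ~ i (fs j) ↔ y = i (ZFI0.app (fs j) z) := fun j y ↦ by
    rw [(h.fn◝ (hf j)).mem, h.app (hf j) hz, h.mem]; simp [hz]
  simp only [e]
  exact ⟨fun ⟨ys, h1, h2⟩ ↦ by rwa [show ys = _ from funext h1] at h2, fun H ↦ ⟨_, ℸ rfl, H⟩⟩
theorem TE.m2 (hf : Fn f v) (hg : Fn g v) : MeasOne ∊ (fun S ↦ S ~ i m) (i v) (fun k ↦ ∃ y z, PairIn ∊ (i f) k y ∧ PairIn ∊ (i g) k z ∧ y ~ z) ↔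
    ZFI0.sep v (fun z ↦ ZFI0.app f z ~ ZFI0.app g z) ~ m := h.me fun z hz ↦ by
  simp only [pin, (h.fn◝ hf).mem, (h.fn◝ hg).mem, ← h.app hf hz, ← h.app hg hz]
  rw [← h.mem]
  exact ⟨fun ⟨x, y, e, e₀, H⟩ ↦ by rwa [e◝, e₀◝] at H, fun H ↦ ⟨_, _, ⟨h.mem◝ hz, rfl⟩, ⟨h.mem◝ hz, rfl⟩, H⟩⟩
theorem TE.lu : v ~ m ∧ (∀ Y, (∀ z, z ~ Y → z ~ v) → (ZFI0.sep v (fun z ↦ ¬ z ~ Y) ~ m ↔ ¬ Y ~ m)) ∧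
   (∀ Y Z, (∀ z, z ~ Y → z ~ v) → (∀ z, z ~ Z → z ~ v) → (ZFI0.sep v (fun z ↦ z ~ Y ∧ z ~ Z) ~ m ↔ Y ~ m ∧ Z ~ m)) ∧
   ∀ F, Fn F v → ZFI0.sep v (fun k ↦ ∃ y, y ~ ZFI0.app F k) ~ m → ∃ g, Fn g v ∧ ZFI0.sep v (fun k ↦ ZFI0.app g k ~ ZFI0.app F k) ~ m := by
  have hi : ∀ Y, Fn (lam v ℸ Y) v := fun Y ↦ fn_lam
  have hid : Fn (lam v fun z ↦ z) v := fn_lam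
  have e1 : ∀ Y, (∀ z, z ~ Y → z ~ v) → (ZFI0.sep v (fun z ↦ ZFI0.app (lam v fun z ↦ z) z ~ ZFI0.app (lam v ℸ Y) z) ~ m ↔ Y ~ m) := fun Y hY ↦ by
    rw [sep_congr (R := fun z ↦ z ~ Y) fun z hz ↦ by rw [app_lam hz, app_lam hz], sep_eta hY]
  have fs : ∀ Y Z (j : Fin 3), Fn (![lam v fun z ↦ z, lam v ℸ Y, lam v ℸ Z] j) v := fun Y Z j ↦ by
    fin_cases j <;> simp [hid, hi]
  refine ⟨⬚, fun Y hY ↦ ⬚, fun Y Z hY hZ ↦ ⬚, fun F hF hs ↦ ⬚⟩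
  · have := (h.lo hlos (.impl (.mem 0 0) (.mem 0 0)) _ (fs v v))◜ id
    rwa [sep_congr (R := fun z ↦ z ~ v) fun z hz ↦ by simp [Eval, hz], sep_eta fun z hz ↦ hz] at this
  · have := h.lo hlos (.neg (.mem 0 1)) _ (fs Y Y)
    rw [sep_congr (R := fun z ↦ ¬ z ~ Y) fun z hz ↦ by simp [Eval, app_lam hz]] at this
    rw [← this, ← e1 Y hY, ← h.m2 hlos hid (hi Y)]; rfl
  · have := h.lo hlos (.neg (.impl (.mem 0 1) (.neg (.mem 0 2)))) _ (fs Y Z)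
    rw [sep_congr (R := fun z ↦ z ~ Y ∧ z ~ Z) fun z hz ↦ by simp [Eval, app_lam hz]] at this
    rw [← this, ← e1 Y hY, ← e1 Z hZ, ← h.m2 hlos hid (hi Y), ← h.m2 hlos hid (hi Z)]
    exact Classical.not_imp.trans (and_congr Iff.rfl not_not)
  · have := h.lo hlos (.ex (.mem 0 1)) ![F] fun j ↦ by fin_cases j; exact hF
    rw [sep_congr (R := fun k ↦ ∃ y, y ~ ZFI0.app F k) fun z hz ↦ by simp [Eval, AllSets]] at this
    rcases this◝ hs with ⟨g0, hg, hs₀⟩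
    rcases h.into◜ hg with ⟨g, rfl, hg₀⟩
    exact ⟨g, hg₀, (h.m2 hlos hg₀ hF)◜ hs₀⟩
end
end
end
section
section
variable {X M : Type} [ZFM X] [ZFM M]
def PP (w z x : X) : Prop := ∀ u, u ~ w ↔ ∃ y, y ~ x ∧ pr u y ~ z
instance : F3 X PP := fi3 PP (by unfold PP; infer_instance)
theorem TE.PP {i : X → M} (h : TE i) {w z x : X} : PP (i w) (i z) (i x) ↔ PP w z x := by
  unfold ZFI0.PP
  have e : ∀ u, (∃ y, y ~ i x ∧ ZFI0.pr (i u) y ~ i z) ↔ ∃ y, y ~ x ∧ ZFI0.pr u y ~ z := fun u ↦ by rw [h.ex]; simp only [h.prin]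
  refine ⟨fun H u ↦ by rw [← h.mem, H, e], fun H u ↦ ⟨fun hu ↦ ⬚, fun ⟨y, h1, h2⟩ ↦ ⬚⟩⟩
  · rcases h.tr hu with ⟨u, rfl⟩
    rw [e, ← H, ← h.mem]; exact hu
  · rcases h.prtr h2 with ⟨u, y₀, rfl, rfl, h3⟩
    rw [h.mem, H]; exact ⟨_, h.mem◜ h1, h3⟩
def PreP : Pd := fun X E σ ↦ ∀ u, E u σ⁰ ↔ ∃ y, E y σ³ ∧ PairIn E σ² u y
instance : UD PreP := by unfold PreP; infer_instance
theorem PreP_iff : PreP X ∊ p ↔ PP (p 0) (p 2) (p 3) := by unfold PreP PP; simp only [pin]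
variable {V : M} {J : M → M → Prop} {i : X → M} {k : LL V → X} {j : LL V → LL V} {r l : LL V} {m : X}
  (h : KX J i k j r l m)
include h
theorem KX.jm : j x ~ j y ↔ x ~ y := h.el (R := fun X E σ ↦ E σ⁰ σ¹) inferInstance (cs x ℸ y)
theorem KX.trV : TransSet ∊ (vL V) := fun x hx y hy ↦ by
  rw [h.hV] at *; exact Vs_tr h.hl.sucO hx hy
theorem KX.il (x : LL V) : InL ∊ (vL V) x := by
  rcases ((teL V).inL h.ho h.trV)◜ x◝ with ⟨y, e, hy⟩
  rwa [Subtype.ext e]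
theorem KX.hk (a : X) (ha : Od a) : ∃ c, a = k c := by
  rcases h.ho _ (h.ti.od◝ ha) with ⟨c, e⟩
  rw [← h.ik, h.ti.inj] at e; exact ⟨c, e⟩
theorem KX.ix (hb : TransSet ∊ b) (hi : ∀ x, InL ∊ b x) (x : X) : InL ∊ (k b) x ↔ ∃ y, x = k y := by
  rw [h.tk.inL h.hk hb]; simp [hi]
theorem KX.ga : ∃ g : LL V, Od g ∧ (g ~ l ∨ g = l) ∧ (∀ x, InL ∊ (Vs (suc g)) x) ∧ j (Vs g) = Vs g ∧ j (Vs (suc g)) = Vs (suc g) := by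
  have : DF fun σ : ℕ → LL V ↦ ∃ s b, IsSuccOf ∊ σ⁰ s ∧ IsVStage ∊ s b ∧ ∀ x, InL ∊ b x := by
    simp only [vst, succ_iff]; infer_instance
  obtain ⟨g, h1, h2, h3⟩ := oleast (X := LL V) (fun g ↦ ∃ s b, IsSuccOf ∊ g s ∧ IsVStage ∊ s b ∧ ∀ x, InL ∊ b x)
    ⟨l, h.hl, _, _, succ_iff◝ rfl, vst◝ ⟨h.hl.sucO, h.hV⟩, h.il⟩
  have hg : j g = g := by
    obtain ⟨h1₀, h2₀, h3₀⟩ := (h.el (R := fun X E σ ↦ IsOrd E σ⁰ ∧ (∃ s b, IsSuccOf E σ⁰ s ∧ IsVStage E s b ∧ ∀ x, InL E b x) ∧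
      ∀ g, E g σ⁰ → ¬ ∃ s b, IsSuccOf E g s ∧ IsVStage E s b ∧ ∀ x, InL E b x) inferInstance ℸ g)◝ ⟨h1, h2, h3⟩
    have h1₀ : Od (j g) := h1₀
    rcases h1₀.tri h1 with h | h | h
    exacts [(h3 _ h h2₀).elim, h, (h3₀ _ h h2).elim]
  have hs : ∀ {x y : LL V}, IsVStage ∊ x y → IsVStage ∊ (j x) (j y) := fun {x y} H ↦
    (h.el (R := fun X E σ ↦ IsVStage E σ⁰ σ¹) inferInstance (cs x ℸ y))◝ H
  have hs₀ : j (suc g) = suc (j g) :=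
    succ_iff◜ ((h.el (R := fun X E σ ↦ IsSuccOf E σ⁰ σ¹) inferInstance (cs g ℸ suc g))◝ (succ_iff◝ rfl))
  rw [hg] at hs₀
  refine ⟨g, h1, ⬚, ⬚, ⬚, ⬚⟩
  · rcases h1.tri h.hl with h₀ | h₀ | h₀
    exacts [◁ h₀, ▷ h₀, (h3 _ h₀ ⟨_, _, succ_iff◝ rfl, vst◝ ⟨h.hl.sucO, h.hV⟩, h.il⟩).elim]
  · rcases h2 with ⟨s, b, h4, h5, h6⟩
    rw [succ_iff] at h4; subst h4; rw [(vst◜ h5)◝] at h6; exact h6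
  · have := (vst◜ (hs (vst◝ ⟨h1, rfl⟩)))◝; rwa [hg] at this
  · have := (vst◜ (hs (vst◝ ⟨h1.sucO, rfl⟩)))◝; rwa [hs₀] at this
theorem KX.pp (hx : ∀ u, u ~ x → u ~ Vs l) : PP w r (j x) ↔ w = x := by
  have e : ∀ u, (∃ y, y ~ j x ∧ pr u y ~ r) ↔ u ~ x := fun u ↦ by
    simp only [h.hr]
    exact ⟨fun ⟨y, h1, h2, e⟩ ↦ h.jm◜ (e ▸ h1), fun hu ↦ ⟨_, h.jm◝ hu, hx u hu, rfl⟩⟩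
  unfold PP; simp only [e]
  exact ⟨zext, fun e u ↦ by rw [e]⟩
theorem KX.lh : LH (k (vL V)) m (k (pow (vL V))) := by
  rcases h.ga with ⟨g, hg, hgl, hgL, jg, jb⟩
  have hv := h.ix h.trV h.il
  have tb : TransSet ∊ (Vs (suc g)) := fun x hx y hy ↦ Vs_tr hg.sucO hx hy
  have hsub : ∀ {u : LL V}, u ~ Vs g → u ~ Vs l := fun {u} hu ↦ by
    rcases hgl with h₀ | rfl
    · exact Vs_mono hg h.hl (fun z hz ↦ h.hl.tr h₀ hz) hu
    · exact hu
  have hx0 : ∀ {x : LL V}, x ~ Vs (suc g) → ∀ u, u ~ x → u ~ Vs l := fun {x} hx u hu ↦ hsub ((Vs_suc hg)◜ hx u hu)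
  have hfull : ∀ {R : X → Prop} [DF fun σ ↦ R σ⁰], (∀ z, z ~ k (vL V) → R z) → sep (k (vL V)) R ~ m := fun {R} _ H ↦ by
    have : k (vL V) ~ m := (h.hm _)◝ ⟨_, rfl, fun _ h ↦ h, h.full⟩
    exact h.up _ _ _ this this (fun z hz ↦ (mem_sep◜ hz)◜) fun z hz _ ↦ mem_sep◝ ⟨hz, H z hz⟩
  have A : ∀ {f : X}, f ~ fns (k (vL V)) (k (Vs (suc g))) → ∃ g₀, Fn g₀ (vL V) ∧ sep (k (vL V)) (fun z ↦ app f z = app (k g₀) z) ~ m ∧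
      app (j g₀) r ~ Vs (suc g) ∧ ∀ x, x ~ Vs (suc g) → (sep (k (vL V)) (fun z ↦ PP (app f z) z (k x)) ~ m ↔ app (j g₀) r = x) := fun {f} hf ↦ by
    rcases mem_fns◜ hf with ⟨h1, h2⟩
    obtain ⟨g₀, h3, h4⟩ := h.tg f h1 fun z hz ↦ let ⟨y, e⟩ := h.tk.tr (h2 z hz); ⟨y, e⟩
    refine ⟨g₀, h3, h4, ⬚, fun x hx ↦ ⬚⟩
    · have := (h.k2 (R := fun X E σ ↦ E σ⁰ σ³) inferInstance (Vs (suc g)) r h3 h3 (Q := fun z ↦ app (k g₀) z ~ k (Vs (suc g))) fun z hz ↦ by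
        rw [← h.tk.app h3 hz]; exact h.tk.mem)◜ (h.mo h4 h4 fun z hz e _ ↦ by rw [← e]; exact h2 z hz)
      rw [jb] at this; exact this
    · rw [← h.pp (hx0 hx)]
      have := h.k2 (R := PreP) inferInstance x r h3 h3 (Q := fun z ↦ PP (app (k g₀) z) z (k x)) fun z hz ↦ by
        rw [← h.tk.app h3 hz, h.tk.PP, PreP_iff]; rfl
      rw [PreP_iff] at this
      refine Iff.trans ⟨fun H ↦ ⬚, fun H ↦ ⬚⟩ this
      · exact h.mo h4 H fun z hz e H ↦ by rwa [← e]
      · exact h.mo h4 H fun z hz e H ↦ by rwa [e]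
  have hρ : ∀ {f x : X}, PairIn ∊ (sep (gpr (fns (k (vL V)) (k (Vs (suc g)))) (k (Vs (suc g)))) fun p ↦ ∃ f x, p = pr f x ∧ sep (k (vL V)) (fun z ↦ PP (app f z) z x) ~ m) f x ↔
      f ~ fns (k (vL V)) (k (Vs (suc g))) ∧ x ~ k (Vs (suc g)) ∧ sep (k (vL V)) (fun z ↦ PP (app f z) z x) ~ m := fun {f x} ↦ by
    rw [pin, mem_sep, mem_gpr]
    constructor
    · rintro ⟨⟨u, v, h1, h2, e⟩, f₀, x₀, e₀, h3⟩
      rcases pr_inj◜ e with ⟨rfl, rfl⟩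
      rcases pr_inj◜ e₀ with ⟨rfl, rfl⟩
      exact ⟨h1, h2, h3⟩
    · rintro ⟨h1, h2, h3⟩; exact ⟨⟨_, _, h1, h2, rfl⟩, _, _, rfl, h3⟩
  have hmt : ∀ {f : X}, MapsTo ∊ f (k (vL V)) (k (Vs (suc g))) ↔ f ~ fns (k (vL V)) (k (Vs (suc g))) := fun {f} ↦ by
    unfold MapsTo; rw [fn_iff, mem_fns]; simp only [pin]
    refine and_congr_right fun hf ↦ ⟨fun H x hx ↦ H x _ (hf.mem◝ ⟨hx, rfl⟩), fun H x y hp ↦ ⬚⟩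
    rw [hf.mem] at hp; rw [hp◝]; exact H x hp◜
  refine ⟨h.tk.trs◝ h.trV, fun x hx ↦ (hv x)◝ (h.sb x hx), (h.hm _)◝ ⟨_, rfl, fun _ h ↦ h, h.full⟩, fun x hx ↦ ⬚, h.up, fun f hf hy ↦ ⬚, fun x ↦ ⬚, (hv _)◝ ⟨_, rfl⟩,
    k (Vs (suc g)), _, h.tk.trs◝ tb, fun x ↦ (h.ix tb hgL x).trans (hv x).symm, fun f x hp ↦ hmt◝ (hρ◜ hp)◜, fun f hf ↦ ⬚, fun x hx ↦ ⬚, fun f f₀ x y hf hf₀ ↦ ⬚⟩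
  · rcases (h.hm x)◜ hx with ⟨x, rfl, h1, _⟩
    exact h.tk.sub◝ h1
  · rw [fn_iff] at hf
    rcases h.tg f hf fun x hx ↦ (hv _)◜ (hy x _ (pin◝ (hf.mem◝ ⟨hx, rfl⟩))) with ⟨g₀, h1, h2⟩
    have h1₀ := h.tk.fn◝ h1
    refine ⟨k g₀, (hv _)◝ ⟨_, rfl⟩, fn_iff◝ h1₀, _, h2, fun z hz ↦ ⟨app f z, ⬚⟩⟩
    rcases mem_sep◜ hz with ⟨h3, h4⟩
    rw [pin, pin, hf.mem, h1₀.mem]; exact ⟨⟨h3, rfl⟩, h3, h4⟩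
  · constructor
    · intro hx
      rcases h.tk.tr hx with ⟨x, rfl⟩
      exact ⟨(hv _)◝ ⟨_, rfl⟩, h.tk.sub◝ (mem_pow◜ (h.tk.mem◜ hx))⟩
    · rintro ⟨hx, hs⟩
      rcases (hv _)◜ hx with ⟨x, rfl⟩
      exact h.tk.mem◝ (mem_pow◝ (h.tk.sub◜ hs))
  · rw [hmt] at hf
    rcases A hf with ⟨g₀, h1, h2, h3, h4⟩
    have := h.tk.mem◝ h3
    exact ⟨_, this, hρ◝ ⟨hf, this, (h4 _ h3)◝ rfl⟩⟩
  · rcases h.tk.tr hx with ⟨x, rfl⟩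
    have hx₀ := h.tk.mem◜ hx
    let t : X → X := fun z ↦ sep (k (Vs g)) fun u ↦ ∃ y, y ~ k x ∧ pr u y ~ z
    have : DT fun σ : ⊙X ↦ t σ⁰ := inferInstanceAs (DT fun σ : ⊙X ↦ sep (k (Vs g)) fun u ↦ ∃ y, y ~ k x ∧ pr u y ~ σ 0)
    have gV : ∀ {u : LL V}, u ~ Vs g → u ~ vL V := fun {u} hu ↦ by
      rw [h.hV, Vs_suc h.hl]; exact fun w hw ↦ Vs_tr h.hl (hsub hu) hw
    refine ⟨lam (k (vL V)) t, hρ◝ ⟨mem_fns◝ ⟨fn_lam, fun z hz ↦ ⬚⟩, hx, ⬚⟩⟩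
    · rw [app_lam hz]
      rcases h.sb (t z) fun w hw ↦ h.tk.sub◝ (fun u ↦ gV) w (mem_sep◜ hw)◜ with ⟨y, hy⟩
      rw [hy, h.tk.mem, Vs_suc hg]; intro w hw
      rw [← h.tk.mem, ← hy] at hw; exact h.tk.mem◜ (mem_sep◜ hw)◜
    · have := (h.kk (R := fun X E σ ↦ ∀ u y, E y σ¹ → PairIn E σ⁰ u y → E u σ²) inferInstance (cs x ℸ Vs g)
        (Q := fun z ↦ ∀ u y, y ~ k x → pr u y ~ z → u ~ k (Vs g)) fun z hz ↦ ⬚)◝ ⬚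
      · refine h.mo this this fun z hz H _ u ↦ ⬚
        rw [app_lam hz, mem_sep]
        exact ⟨fun H ↦ H◝, fun ⟨y, h1, h2⟩ ↦ ⟨H u y h1 h2, y, h1, h2⟩⟩
      · constructor
        · intro H u y hy hp; rw [← h.tk.mem]
          exact H _ _ (h.tk.mem◝ hy) (h.tk.prin◝ (pin◜ hp))
        · intro H u y hy hp
          rcases h.tk.prtr hp with ⟨u, y₀, rfl, rfl, hp₀⟩
          exact h.tk.mem◝ (H _ _ (h.tk.mem◜ hy) (pin◝ hp₀))
      · intro u y hy hp
        rcases (h.hr _ _)◜ (pin◜ hp) with ⟨_, rfl⟩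
        show u ~ j (Vs g)
        rw [jg]; exact (Vs_suc hg)◜ hx₀ u (h.jm◜ hy)
  · rcases hρ◜ hf with ⟨h1, h2, h3⟩
    rcases hρ◜ hf₀ with ⟨h1₀, h2₀, h3₀⟩
    rcases h.tk.tr h2 with ⟨x, rfl⟩
    rcases h.tk.tr h2₀ with ⟨y, rfl⟩
    rcases A h1 with ⟨a, a1, a2, a3, a4⟩
    rcases A h1₀ with ⟨b, b1, b2, b3, b4⟩
    rw [a4 _ (h.tk.mem◜ h2)] at h3
    rw [b4 _ (h.tk.mem◜ h2₀)] at h3₀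
    subst h3; subst h3₀
    rw [h.tk.mem, ← h.lt a1 b1]
    have hf1 := (mem_fns◜ h1)◜
    have hf2 := (mem_fns◜ h1₀)◜
    have ab := h.mo a2 b2 (R := fun z ↦ app f z = app (k a) z ∧ app f₀ z = app (k b) z) fun z _ a b ↦ ⟨a, b⟩
    simp only [pin, hf1.mem, hf2.mem]
    constructor
    · intro H
      refine ⟨_, h.mo ab H (R := fun z ↦ app f z ~ app f₀ z) fun z _ e H ↦ by rwa [e◜, e◝], fun z hz ↦ ⬚⟩
      rcases mem_sep◜ hz with ⟨h5, h6⟩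
      exact ⟨_, _, ⟨h5, rfl⟩, ⟨h5, rfl⟩, h6⟩
    · rintro ⟨s, hs, H⟩
      refine h.mo ab (h.up s s (sep (k (vL V)) fun z ↦ app f z ~ app f₀ z) hs hs (fun z hz ↦ (mem_sep◜ hz)◜) fun z hz _ ↦ ⬚) fun z _ e H ↦ by rwa [← e◜, ← e◝]
      rcases H z hz with ⟨u, u₀, e, e₀, H⟩
      exact mem_sep◝ ⟨e◜, by rwa [e◝, e₀◝] at H⟩
end
end
section
theorem fin10 {M X : Type} [ZFM M] [ZFM X] [NA X] {i : X → M} (te : TE i) {J : M → M → Prop} (hP : ∀ p : M, ZFM.P p ↔ JPred ∊ J p)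
    {l vl V w : M} {m : X} (hvl : VAt ∊ l 0 vl) (hv1 : VAt ∊ l 1 V) (hw : IsV2L ∊ V w) (hI : ElemOn ∊ (InL ∊ V) J)
    (hm : IsMuSet ∊ J vl V (i m)) (hNL : ∀ x, InL ∊ V x → ∃ y, x = i y)
    (hNV : ∀ x, SubsetE ∊ (i x) V → InL ∊ V (i x))
    (ht : ∀ f, IsFuncOn ∊ (i f) V → (∀ x y, PairIn ∊ (i f) x y → InL ∊ V y) →
      ∃ g, InL ∊ V g ∧ IsFuncOn ∊ g V ∧
        MeasOne ∊ (fun S ↦ S ~ i m) V fun k ↦ ∃ y, PairIn ∊ (i f) k y ∧ PairIn ∊ g k y)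
    (hlos : LosOK ∊ (fun x ↦ ∃ y, x = i y) V fun S ↦ S ~ i m) (d : M) (hd : Od d) :
    ∃ SL SN : IterData M,
      IsIterSys ∊ (InL ∊ V) (fun S ↦ S ~ i m) emp V w d SL ∧
      IsLinIterSys ∊ (fun x ↦ ∃ y, x = i y) emp V (i m) d SN ∧
      (∀ a, IsOrd ∊ a → (a ~ d ∨ a = d) →
        (∀ x, SL.cls a x ↔ ∃ v1a, SN.imap emp a V v1a ∧ InL ∊ v1a x) ∧
        (∀ S, SL.meas a S ↔ ∃ ma, SN.imap emp a (i m) ma ∧ S ~ ma)) ∧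
      (∀ a c, IsOrd ∊ a → IsOrd ∊ c → (a ~ c ∨ a = c) → (c ~ d ∨ c = d) →
        (∀ x y, SL.imap a c x y → SN.imap a c x y) ∧
        ElemBetween ∊ (SL.cls a) (SL.cls c) (SL.imap a c) ∧
        ElemBetween ∊ (SN.cls a) (SN.cls c) (SN.imap a c)) := by
  rcases hvl with ⟨s, hs, hvs⟩
  rcases hv1 with ⟨s₀, ⟨s1, hs1, hs2⟩, hvs₀⟩
  cases hs; cases hs2
  rw [succ_iff] at hs1; subst hs1
  rcases vst◜ hvs with ⟨hl, rfl⟩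
  have hVe := (vst◜ hvs₀)◝
  clear hvs hvs₀
  have hk : ∀ x : LL V, ∃ y, i y = x◜ := fun x ↦ let ⟨y, e⟩ := hNL _ x◝; ⟨y, e.symm⟩
  choose k ik using hk
  have hj : ∀ x : LL V, ∃ y : LL V, J x◜ y◜ := fun x ↦ let ⟨y, hy⟩ := hI◜◜ _ x◝; ⟨⟨y, (hI◜◝◜ _ _ hy)◝⟩, hy⟩
  choose j hj using hj
  have jJ : ∀ x y, J x y ↔ ∃ z : LL V, x = z◜ ∧ y = (j z)◜ := fun x y ↦ by
    constructor
    · intro h; exact ⟨⟨x, (hI◜◝◜ _ _ h)◜⟩, rfl, hI◜◝◝ _ _ _ h (hj ⟨x, _⟩)⟩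
    · rintro ⟨z, rfl, rfl⟩; exact hj z
  have jj : ∀ {x : LL V} {y : M}, J x◜ y ↔ y = (j x)◜ := fun {x y} ↦ ⟨fun h ↦ hI◜◝◝ _ _ _ h (hj x), fun e ↦ e ▸ hj x⟩
  have hV : i (k (vL V)) = V := ik _
  have tk : TE k := ⟨by intros; rw [← te.mem, ik, ik]; rfl, fun {x b} hx ↦ by
    have := te.mem◝ hx
    rw [ik] at this
    refine ⟨⟨i x, L_tr b◝ this⟩, te.inj◜ ⬚⟩; rw [ik]⟩
  have hlos₀ : LosOK ∊ (fun x ↦ ∃ y, x = i y) (i (k (vL V))) fun S ↦ S ~ i m := by rw [hV]; exact hlos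
  rcases te.lu hlos₀ with ⟨u1, u2, u3, u4⟩
  have hVm : V ~ i m := by rw [← hV]; exact te.mem◝ u1
  rcases (hm V)◜ hVm with ⟨-, -, r0, Y, ⟨hr1, hr2⟩, hY, hrY⟩
  rw [fn_iff] at hr1; simp only [pin] at hr2
  have hYL : Y = (j (vL V))◜ := (jj (x := vL V))◜ hY
  have hrL : InL ∊ V r0 := L_tr (j (vL V))◝ (hYL ▸ hrY)
  have hlL : InL ∊ V l := (L_jc V).ord l hl
  have hro : ∀ {r₀ : M}, CodesRestr ∊ J (Vs l) r₀ → r₀ = r0 := fun {r₀} hr ↦ by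
    have h1 := fn_iff◜ hr◜
    refine h1.ext hr1 fun x hx ↦ ⬚
    exact hI◜◝◝ _ _ _ (hr◝ x _ (pin◝ (h1.mem◝ ⟨hx, rfl⟩))) (hr2 x _ (hr1.mem◝ ⟨hx, rfl⟩))
  have K : KX J i k j (⟨r0, hrL⟩ : LL V) ⟨l, hlL⟩ m := {
    ti := te
    tk := tk
    ik := ik
    ho := fun a ha ↦ ⟨⟨a, (L_jc V).ord a ha⟩, rfl⟩
    el := fun {R} hR σ ↦ by
      rcases hR with ⟨n, f, c, e⟩
      rw [e, e, evL, evL]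
      exact (hI◝ f _ _ ℸ hj _).symm
    hm := fun S ↦ by
      rw [← te.mem, hm]
      constructor
      · rintro ⟨h1, h2, r, Y, h3, h4, h5⟩
        rw [hro h3] at h5
        refine ⟨⟨i S, h1⟩, te.inj◜ (ik ⟨i S, h1⟩).symm, fun z hz ↦ h2 _ hz, ⬚⟩
        show r0 ~ (j _)◜
        rw [← (jj (x := ⟨i S, h1⟩))◜ h4]; exact h5
      · rintro ⟨S₀, rfl, h1, h2⟩
        rw [ik]
        exact ⟨S₀◝, (teL V).sub◝ h1, r0, _, ⟨fn_iff◝ hr1, fun x y h ↦ hr2 x y (pin◜ h)⟩, hj _, h2⟩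
    full := by show r0 ~ (j (vL V))◜; rw [← hYL]; exact hrY
    sb := fun x hx ↦ by
      have := te.sub◝ hx; rw [hV] at this
      exact ⟨⟨_, hNV x this⟩, te.inj◜ (ik ⟨_, hNV x this⟩).symm⟩
    hr := fun z y ↦ by
      rw [← (teL V).prin, ← (teL V).Vs ((teL V).od◜ hl)]
      show pr z◜ y◜ ~ r0 ↔ z◜ ~ Vs l ∧ _
      rw [hr1.mem]
      refine and_congr_right fun hz ↦ ⬚
      rw [(jj (x := z))◜ (hr2 _ _ (hr1.mem◝ ⟨hz, rfl⟩))]; exact Subtype.ext_iff.symm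
    hl := (teL V).od◜ hl
    hV := zext fun z ↦ by
      rw [← (teL V).Vs ((teL V).od◜ (by rw [(teL V).suc]; exact Od.sucO hl)), (teL V).suc, ← hVe]; rfl
    tg := fun f hf hy ↦ by
      have hf₀ := te.fn◝ hf
      obtain ⟨g, h1, h2, h3⟩ := ht f (by rw [fn_iff, ← hV]; exact hf₀) fun x y hp ↦ by
        rw [pin] at hp
        rcases te.prtr hp with ⟨x, y, rfl, rfl, hp₀⟩
        rw [hf.mem] at hp₀
        rcases hy x hp₀◜ with ⟨z, e⟩
        rw [hp₀◝, e, ik]; exact z◝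
      have hg : Fn (⟨g, h1⟩ : LL V) (vL V) := (teL V).fn◜ (fn_iff◜ h2)
      refine ⟨⟨g, h1⟩, hg, ⬚⟩
      rw [← hV] at h3
      refine (te.me fun z hz ↦ ⬚)◜ h3
      have hz₀ := te.mem◝ hz
      have hg₀ := tk.fn◝ hg
      have hgm := fun y ↦ (te.fn◝ hg₀).mem (x := i z) (y := y)
      simp only [pin, hf₀.mem, hz₀, true_and, exists_eq_left, ← te.app hf hz]
      simp only [ik] at hgm hz₀
      rw [hgm, ← te.inj, te.app hg₀ hz, ik ⟨g, h1⟩]; exact and_iff_right hz₀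
    hJ := (inferInstance : DF fun σ : ℕ → M ↦ ZFM.P (pr σ⁰ σ¹)).congr fun σ ↦ by
      rw [hP]; unfold JPred; simp only [kp]
      exact ⟨fun h ↦ ⟨_, _, rfl, h⟩, fun ⟨x, y, e, h⟩ ↦ by rcases pr_inj◜ e with ⟨e1, e2⟩; rwa [e1, e2]⟩
    jJ := jJ }
  rcases hNL _ ((L_jc V).ord d hd) with ⟨d, rfl⟩
  have hd₀ := te.od◜ hd
  let U : UC X := ⟨k (vL V), m, suc d, hd₀.sucO, u1, u2, u3, u4, K.wf⟩
  have sy : SY i (k (pow (vL V))) d := ⟨te, fun a ha ↦ hNL _ ((L_jc V).ord a ha), K.lh, rfl⟩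
  have hm₀ := sy.main
  have ew : w = i (k (pow (vL V))) := by
    rw [ik]; refine zext fun z ↦ ⬚
    rw [hw z]
    constructor
    · rintro ⟨h1, h2⟩; exact (teL V).mem (a := ⟨z, h1⟩) |>.2 (mem_pow◝ fun w hw ↦ h2 _ hw)
    · intro hz
      rcases (teL V).tr hz with ⟨z, rfl⟩
      exact ⟨z◝, (teL V).sub◝ (mem_pow◜ ((teL V).mem◜ hz))⟩
  rw [← ew, show i (UC.v : X) = V from hV] at hm₀
  exact hm₀
end
theorem stmt_10 {M : Type} (E J : M → M → Prop) (N : M → Prop)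
    (l vl v1 v2L m z0 : M)
    (hZF : SatZF E (JPred E J)) (hev : IsEvenOrd E l)
    (hvl : VAt E l 0 vl) (hv1 : VAt E l 1 v1) (hv2L : IsV2L E v1 v2L)
    (hI0 : I0Emb E l v1 J) (hprop : ProperEmb E (JPred E J) l v1 J)
    (hm : IsMuSet E J vl v1 m) (hz0 : IsZero E z0)
    (hNtrans : TransClass E N) (hNzf : ClassSatZF E NoAux N)
    (hNL : ∀ x, InL E v1 x → N x)
    (hNV2 : ∀ x, N x → SubsetE E x v1 → InL E v1 x)
    (hNm : N m)
    (htight : ∀ f, N f → IsFuncOn E f v1 → (∀ x y, PairIn E f x y → InL E v1 y) →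
      ∃ g, InL E v1 g ∧ IsFuncOn E g v1 ∧
        MeasOne E (fun X ↦ E X m) v1 (fun k ↦ ∃ y, PairIn E f k y ∧ PairIn E g k y))
    (hlos : LosOK E N v1 (fun X ↦ E X m)) :
    (∀ d, IsOrd E d → ∃ S : IterData M,
      IsIterSys E (InL E v1) (fun X ↦ E X m) z0 v1 v2L d S) ∧
    (∀ d, IsOrd E d → ∃ SL SN : IterData M,
      IsIterSys E (InL E v1) (fun X ↦ E X m) z0 v1 v2L d SL ∧
      IsLinIterSys E N z0 v1 m d SN ∧
      (∀ a, IsOrd E a → (E a d ∨ a = d) →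
        (∀ x, SL.cls a x ↔ ∃ v1a, SN.imap z0 a v1 v1a ∧ InL E v1a x) ∧
        (∀ X, SL.meas a X ↔ ∃ ma, SN.imap z0 a m ma ∧ E X ma)) ∧
      (∀ a c, IsOrd E a → IsOrd E c → (E a c ∨ a = c) → (E c d ∨ c = d) →
        (∀ x y, SL.imap a c x y → SN.imap a c x y) ∧
        ElemBetween E (SL.cls a) (SL.cls c) (SL.imap a c) ∧
        ElemBetween E (SN.cls a) (SN.cls c) (SN.imap a c))) := by
  let : ZFM M := ⟨E, JPred E J, hZF⟩
  let : ZFM {x // N x} := ⟨fun a b ↦ E a.1 b.1, NoAux, hNzf⟩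
  have : NA {x // N x} := ⟨hNzf⟩
  have te : TE (fun x : {x // N x} ↦ x.1) := ⟨Iff.rfl, fun {_ b} h ↦ ⟨⟨_, hNtrans _ _ b.2 h⟩, rfl⟩⟩
  have eN : N = fun x ↦ ∃ y : {x // N x}, x = y.1 := funext fun x ↦ propext ⟨fun h ↦ ⟨⟨x, h⟩, rfl⟩, fun ⟨y, e⟩ ↦ e ▸ y.2⟩
  have hl2 : LosOK E (fun x ↦ ∃ y : {x // N x}, x = y.1) v1 (fun X ↦ E X m) := by rw [← eN]; exact hlos
  have ez : z0 = emp := zero_iff.1 hz0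
  have key := fin10 te (J := J) (m := ⟨m, hNm⟩) (fun p ↦ Iff.rfl) hvl hv1 hv2L hI0.1 hm (fun x h ↦ ⟨⟨x, hNL x h⟩, rfl⟩)
    (fun x ↦ hNV2 _ x.2) (fun f ↦ htight f.1 f.2) hl2
  rw [← ez, ← eN] at key
  exact ⟨fun d hd ↦ let ⟨S, _, h, _⟩ := key d hd; ⟨S, h⟩, key⟩
end
end ZFI0
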